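/- Let k ≥ 1, α₁,…,α_k : Fˣ → ℂˣ characters, n = ab, x ∈ GL_a(F) regular elliptic, E a degree-a extension of F, ξ ∈ E a root of the characteristic polynomial of x, and μ a partition of b. Suppose ω₁,…,ω_k ∈ ℂ are roots of the twisted Kloosterman sheaf at ξ, i.e., Σ_{i=1}^k ω_i^m = (-1)^{k-1} K_{E_m}(α,ψ,ξ_m) for every m ≥ 1. Then K(α,ψ,J_μ(x)) = (-1)^{(k-1)n} · q^{(k-1)·n(n-1)/2} · Σ over functions d : {1,…,k} → ℕ with d₁+⋯+d_k = b of N_d(J_μ(ξ)) · ω₁^{d₁}⋯ω_k^{d_k}. -/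

import Mathlib

open scoped BigOperators

/-- The twisted matrix Kloosterman sum
`K(α,ψ,x) = Σ_{g₁⋯g_k = x} (∏ αᵢ(det gᵢ)) ψ(tr(g₁+⋯+g_k))`. -/
noncomputable def matrixKloosterman {F : Type} [Field F] [Fintype F] [DecidableEq F]
    {ι : Type} [Fintype ι] [DecidableEq ι] {k : ℕ}
    (α : Fin k → Fˣ →* ℂˣ) (ψ : AddChar F ℂ) (x : Matrix ι ι F) : ℂ :=
  ∑ g : Fin k → (Matrix ι ι F)ˣ,
    if ((List.ofFn g).prod : Matrix ι ι F) = x then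
      (∏ i, (α i (Units.map (Matrix.detMonoidHom) (g i)) : ℂ)) *
        ψ (Matrix.trace (∑ i, ((g i : Matrix ι ι F))))
    else 0

/-- The twisted Kloosterman sum over a finite extension `E` of `F`:
`K_E(α,ψ,ξ) = Σ_{t₁⋯t_k = ξ} (∏ αᵢ(N_{E/F}(tᵢ))) ψ(Tr_{E/F}(t₁+⋯+t_k))`. -/
noncomputable def fieldKloosterman {F : Type} [Field F] [Fintype F] {k : ℕ}
    (α : Fin k → Fˣ →* ℂˣ) (ψ : AddChar F ℂ)
    (E : Type) [Field E] [Fintype E] [DecidableEq E] [Algebra F E] (ξ : E) : ℂ :=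
  ∑ t : Fin k → Eˣ,
    if ((∏ i, t i : Eˣ) : E) = ξ then
      (∏ i, (α i (Units.map (Algebra.norm F : E →* F) (t i)) : ℂ)) *
        ψ (Algebra.trace F E (∑ i, (t i : E)))
    else 0

/-- `J_{(m)}(y)`: block matrix with `m` copies of the `a×a` matrix `y` on the block diagonal
and identity blocks on the block superdiagonal. -/
def jordanBlock {F : Type} [Zero F] [One F] {a : ℕ}
    (y : Matrix (Fin a) (Fin a) F) (m : ℕ) :
    Matrix (Fin m × Fin a) (Fin m × Fin a) F :=
  fun p q =>
    if p.1 = q.1 then y p.2 q.2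
    else if (p.1 : ℕ) + 1 = (q.1 : ℕ) then (if p.2 = q.2 then 1 else 0) else 0

/-- `J_μ(y)`: block diagonal of `J_{(m₁)}(y), …, J_{(m_r)}(y)` for `μ = (m₁,…,m_r)`. -/
def jordanPartition {F : Type} [Zero F] [One F] {a r : ℕ}
    (y : Matrix (Fin a) (Fin a) F) (μ : Fin r → ℕ) :
    Matrix (Σ j : Fin r, Fin (μ j) × Fin a) (Σ j : Fin r, Fin (μ j) × Fin a) F :=
  Matrix.blockDiagonal' (fun j => jordanBlock y (μ j))

/-- The scalar Jordan block of size `m` with eigenvalue `ξ`. -/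
def jordanBlockScalar {E : Type} [Zero E] [One E] (ξ : E) (m : ℕ) :
    Matrix (Fin m) (Fin m) E :=
  fun p q => if p = q then ξ else if (p : ℕ) + 1 = (q : ℕ) then 1 else 0

/-- `J_μ(ξ)`: block diagonal of scalar Jordan blocks of sizes `μ` with eigenvalue `ξ`. -/
def jordanPartitionScalar {E : Type} [Zero E] [One E] {r : ℕ} (ξ : E) (μ : Fin r → ℕ) :
    Matrix (Σ j : Fin r, Fin (μ j)) (Σ j : Fin r, Fin (μ j)) E :=
  Matrix.blockDiagonal' (fun j => jordanBlockScalar ξ (μ j))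

/-- `N_d(T)`: the number of chains of subspaces `0 ⊆ W₁ ⊆ ⋯ ⊆ W_k = V` with
`dim W_j = d₁ + ⋯ + d_j` and `T(W_j) ⊆ W_j` for all `j`. -/
noncomputable def flagCount {E : Type} [Field E] {V : Type} [AddCommGroup V] [Module E V]
    (T : V →ₗ[E] V) {k : ℕ} (d : Fin k → ℕ) : ℕ :=
  Nat.card {W : Fin k → Submodule E V //
    Monotone W ∧ (∀ j, Module.finrank E (W j) = ∑ i ∈ Finset.Iic j, d i) ∧
    (∀ j, Submodule.map T (W j) ≤ W j) ∧ (∀ j : Fin k, (j : ℕ) + 1 = k → W j = ⊤)}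

set_option linter.all false
namespace MK
attribute [local instance] Fintype.ofFinite
attribute [local instance] Classical.propDecidable

instance finiteHom {F V W : Type} [Field F] [AddCommGroup V] [Module F V] [Finite V]
    [AddCommGroup W] [Module F W] [Finite W] : Finite (V →ₗ[F] W) := DFunLike.finite _

instance finiteEnd {F V : Type} [Field F] [AddCommGroup V] [Module F V] [Finite V] :
    Finite (Module.End F V) := DFunLike.finite _

instance finiteUnits {M : Type} [Monoid M] [Finite M] : Finite Mˣ :=
  Finite.of_injective _ Units.val_injective

/-- functions of pairs (V, g) -/
abbrev PFun (F : Type) [Field F] : Type 1 :=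
  ∀ (V : Type) [AddCommGroup V] [Module F V] [Finite V], Module.End F V → ℂ

section
variable {F : Type} [Field F]

/-- isomorphism invariance -/
def PInv (G : PFun F) : Prop :=
  ∀ (V V' : Type) [AddCommGroup V] [Module F V] [Finite V] [AddCommGroup V'] [Module F V']
    [Finite V'] (e : V ≃ₗ[F] V') (g : Module.End F V) (g' : Module.End F V'),
    (∀ x, e (g x) = g' (e x)) → G V g = G V' g'

variable {V V' X Y : Type} [AddCommGroup V] [Module F V] [Finite V]
  [AddCommGroup V'] [Module F V'] [Finite V']
  [AddCommGroup X] [Module F X] [Finite X] [AddCommGroup Y] [Module F Y] [Finite Y]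

/-- stability of a subspace -/
abbrev Stab (g : Module.End F V) (U : Submodule F V) : Prop := ∀ x ∈ U, g x ∈ U

noncomputable def term (G1 G2 : PFun F) (g : Module.End F V) (U : Submodule F V) : ℂ :=
  if h : Stab g U then G1 U (g.restrict h) * G2 (V ⧸ U) (U.mapQ U g h) else 0

noncomputable def star (G1 G2 : PFun F) : PFun F := fun V _ _ _ g =>
  ∑ U : Submodule F V, term G1 G2 g U

theorem term_conj {G1 G2 : PFun F} (h1 : PInv G1) (h2 : PInv G2) (e : V ≃ₗ[F] V')
    (g : Module.End F V) (g' : Module.End F V') (hg : ∀ x, e (g x) = g' (e x))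
    (U : Submodule F V) (U' : Submodule F V') (hU : U' = U.map (e : V →ₗ[F] V')) :
    term G1 G2 g U = term G1 G2 g' U' := by
  subst hU
  have hs : Stab g U ↔ Stab g' (U.map (e : V →ₗ[F] V')) := by
    constructor
    · rintro h _ ⟨y, hy, rfl⟩
      exact ⟨g y, h y hy, hg y⟩
    · intro h x hx
      obtain ⟨y, hy, hy2⟩ := h (e x) ⟨x, hx, rfl⟩
      rw [← hg x] at hy2
      rwa [← e.injective hy2]
  unfold term
  by_cases h : Stab g U
  · have h' := hs.1 h
    rw [dif_pos h, dif_pos h']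
    congr 1
    · refine h1 _ _ (e.submoduleMap U) _ _ ?_
      intro x
      apply Subtype.ext
      exact hg x
    · refine h2 _ _ (Submodule.Quotient.equiv U _ e rfl) _ _ ?_
      intro x
      obtain ⟨x, rfl⟩ := Submodule.Quotient.mk_surjective _ x
      exact congrArg Submodule.Quotient.mk (hg x)
  · rw [dif_neg h, dif_neg (fun h' => h (hs.2 h'))]

theorem star_inv {G1 G2 : PFun F} (h1 : PInv G1) (h2 : PInv G2) : PInv (star G1 G2) := by
  intro V V' _ _ _ _ _ _ e g g' hg
  unfold star
  exact Fintype.sum_equiv (Submodule.orderIsoMapComap e).toEquiv _ _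
    (fun U => term_conj h1 h2 e g g' hg U _ rfl)

/-- block upper triangular endomorphism -/
def ext (gX : Module.End F X) (gY : Module.End F Y) (u : Y →ₗ[F] X) : Module.End F (X × Y) :=
  (gX.comp (LinearMap.fst F X Y) + u.comp (LinearMap.snd F X Y)).prod
    (gY.comp (LinearMap.snd F X Y))

@[simp] theorem ext_apply (gX : Module.End F X) (gY : Module.End F Y) (u : Y →ₗ[F] X) (v : X × Y) :
    ext gX gY u v = (gX v.1 + u v.2, gY v.2) := rfl

noncomputable def CC (G : PFun F) (gX : Module.End F X) (gY : Module.End F Y) : ℂ :=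
  ∑ u : Y →ₗ[F] X, G (X × Y) (ext gX gY u)

noncomputable def cc (G : PFun F) (gX : Module.End F X) (gY : Module.End F Y) : ℂ :=
  CC G gX gY / Nat.card (Y →ₗ[F] X)

/-- shear -/
def shear (t : Y →ₗ[F] X) : (X × Y) ≃ₗ[F] (X × Y) where
  toFun v := (v.1 + t v.2, v.2)
  invFun v := (v.1 - t v.2, v.2)
  map_add' v w := by ext <;> simp; abel
  map_smul' c v := by ext <;> simp
  left_inv v := by simp
  right_inv v := by simp

@[simp] theorem shear_apply (t : Y →ₗ[F] X) (v : X × Y) : shear t v = (v.1 + t v.2, v.2) := rfl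

theorem sum_hom_fiber {A B : Type} [AddCommGroup A] [AddCommGroup B] [Finite A] [Finite B]
    (φ : A →+ B) (hφ : Function.Surjective φ) (f : B → ℂ) :
    (Nat.card B : ℂ) * ∑ a, f (φ a) = Nat.card A * ∑ b, f b := by
  have key : ∀ b : B, ((Finset.univ.filter (fun a => φ a = b)).card)
      = (Finset.univ.filter (fun a => φ a = 0)).card := by
    intro b
    exact AddMonoidHom.card_fiber_eq_of_mem_range φ (hφ b) (hφ 0)
  have h1 : ∀ h : B → ℂ, ∑ a, h (φ a) = ((Finset.univ.filter (fun a => φ a = 0)).card : ℂ) * ∑ b, h b := by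
    intro h
    rw [← Finset.sum_fiberwise (s := Finset.univ) (g := fun a => φ a), Finset.mul_sum]
    refine Finset.sum_congr rfl fun b _ => ?_
    rw [← key b, ← nsmul_eq_mul, ← Finset.sum_const]
    refine Finset.sum_congr rfl fun a ha => ?_
    rw [(Finset.mem_filter.1 ha).2]
  have h2 := h1 (fun _ => 1)
  rw [h1 f]
  simp only [Finset.sum_const, Finset.card_univ, nsmul_eq_mul, mul_one] at h2
  rw [Nat.card_eq_fintype_card, Nat.card_eq_fintype_card, h2]
  ring

/-- maps sending B into A -/
def HH (A : Submodule F X) (B : Submodule F Y) : Submodule F (Y →ₗ[F] X) where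
  carrier := {u | ∀ b ∈ B, u b ∈ A}
  add_mem' hu hv b hb := A.add_mem (hu b hb) (hv b hb)
  zero_mem' b hb := A.zero_mem
  smul_mem' c u hu b hb := A.smul_mem c (hu b hb)

/-- pieces of a map in HH -/
def HHmap (A : Submodule F X) (B : Submodule F Y) :
    HH A B →+ (B →ₗ[F] A) × ((Y ⧸ B) →ₗ[F] (X ⧸ A)) where
  toFun u := (u.1.restrict u.2, B.mapQ A u.1 u.2)
  map_zero' := by
    ext x
    · rfl
    · rfl
  map_add' u v := by
    ext x
    · rfl
    · rfl

theorem HHmap_surj (A : Submodule F X) (B : Submodule F Y) :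
    Function.Surjective (HHmap A B) := by
  rintro ⟨v, w⟩
  obtain ⟨u2, hu2⟩ := Module.projective_lifting_property A.mkQ (w.comp B.mkQ) A.mkQ_surjective
  have hu2' : ∀ y, A.mkQ (u2 y) = w (B.mkQ y) := fun y => LinearMap.congr_fun hu2 y
  have h2A : ∀ b ∈ B, u2 b ∈ A := by
    intro b hb
    have := hu2' b
    rw [show B.mkQ b = 0 from (Submodule.Quotient.mk_eq_zero B).2 hb, map_zero] at this
    exact (Submodule.Quotient.mk_eq_zero A).1 this
  obtain ⟨d, hd⟩ := LinearMap.exists_extend (v - u2.restrict h2A)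
  have hd' : ∀ b : B, d b = v b - u2.restrict h2A b := fun b => LinearMap.congr_fun hd b
  refine ⟨⟨u2 + A.subtype.comp d, fun b hb => A.add_mem (h2A b hb) (d b).2⟩, ?_⟩
  refine Prod.ext ?_ ?_
  · ext b
    have := congrArg (fun z : A => (z : X)) (hd' b)
    change u2 b + (d b : X) = v b
    rw [this]
    change u2 b + ((v b : X) - u2 b) = v b
    abel
  · ext y
    have h0 : A.mkQ (d y : X) = 0 := (Submodule.Quotient.mk_eq_zero A).2 (d y).2
    have := hu2' y
    change A.mkQ (u2 y + (d y : X)) = w (B.mkQ y)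
    rw [map_add, h0, this, add_zero]

/-- product of submodules as a product -/
def prodEqv (A : Submodule F X) (B : Submodule F Y) : (A.prod B) ≃ₗ[F] A × B where
  toFun v := (⟨v.1.1, v.2.1⟩, ⟨v.1.2, v.2.2⟩)
  invFun v := ⟨(v.1.1, v.2.1), v.1.2, v.2.2⟩
  map_add' _ _ := rfl
  map_smul' _ _ := rfl
  left_inv _ := rfl
  right_inv _ := rfl

noncomputable def quotEqv (A : Submodule F X) (B : Submodule F Y) :
    ((X × Y) ⧸ (A.prod B)) ≃ₗ[F] (X ⧸ A) × (Y ⧸ B) :=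
  LinearEquiv.ofBijective ((A.prod B).liftQ (A.mkQ.prodMap B.mkQ) (by
      rintro ⟨x, y⟩ ⟨h1, h2⟩
      simp at h1 h2
      simp [h1, h2])) (by
    constructor
    · rw [← LinearMap.ker_eq_bot, Submodule.ker_liftQ_eq_bot]
      rintro ⟨x, y⟩ h
      simpa using h
    · rintro ⟨x, y⟩
      obtain ⟨x, rfl⟩ := A.mkQ_surjective x
      obtain ⟨y, rfl⟩ := B.mkQ_surjective y
      exact ⟨(A.prod B).mkQ (x, y), rfl⟩)

theorem stab_prod (gX : Module.End F X) (gY : Module.End F Y) (u : Y →ₗ[F] X)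
    (A : Submodule F X) (B : Submodule F Y) :
    Stab (ext gX gY u) (A.prod B) ↔ (Stab gX A ∧ Stab gY B) ∧ u ∈ HH A B := by
  constructor
  · intro h
    refine ⟨⟨fun x hx => ?_, fun y hy => ?_⟩, fun y hy => ?_⟩
    · have := h (x, 0) ⟨hx, B.zero_mem⟩
      simpa using this.1
    · exact (h (0, y) ⟨A.zero_mem, hy⟩).2
    · simpa using (h (0, y) ⟨A.zero_mem, hy⟩).1
  · rintro ⟨⟨h1, h2⟩, h3⟩ ⟨x, y⟩ ⟨hx, hy⟩
    exact ⟨A.add_mem (h1 x hx) (h3 y hy), h2 y hy⟩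

theorem term_prod {G1 G2 : PFun F} (h1 : PInv G1) (h2 : PInv G2)
    (gX : Module.End F X) (gY : Module.End F Y) (u : Y →ₗ[F] X)
    (A : Submodule F X) (B : Submodule F Y) (hA : Stab gX A) (hB : Stab gY B) (hu : u ∈ HH A B) :
    term G1 G2 (ext gX gY u) (A.prod B) =
      G1 (A × B) (ext (gX.restrict hA) (gY.restrict hB) (HHmap A B ⟨u, hu⟩).1) *
      G2 ((X ⧸ A) × (Y ⧸ B)) (ext (A.mapQ A gX hA) (B.mapQ B gY hB) (HHmap A B ⟨u, hu⟩).2) := by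
  unfold term
  rw [dif_pos ((stab_prod gX gY u A B).2 ⟨⟨hA, hB⟩, hu⟩)]
  congr 1
  · exact h1 _ _ (prodEqv A B) _ _ (fun _ => rfl)
  · refine h2 _ _ (quotEqv A B) _ _ (fun v => ?_)
    obtain ⟨v, rfl⟩ := Submodule.Quotient.mk_surjective _ v
    rfl

theorem sum_term_prod {G1 G2 : PFun F} (h1 : PInv G1) (h2 : PInv G2)
    (gX : Module.End F X) (gY : Module.End F Y) (A : Submodule F X) (B : Submodule F Y) :
    ∑ u, term G1 G2 (ext gX gY u) (A.prod B) = Nat.card (HH A B) *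
      if h : Stab gX A ∧ Stab gY B then
        cc G1 (gX.restrict h.1) (gY.restrict h.2) * cc G2 (A.mapQ A gX h.1) (B.mapQ B gY h.2)
      else 0 := by
  by_cases h : Stab gX A ∧ Stab gY B
  · rw [dif_pos h]
    have e1 : ∑ u, term G1 G2 (ext gX gY u) (A.prod B) =
        ∑ u : HH A B, term G1 G2 (ext gX gY u) (A.prod B) := by
      rw [← Finset.sum_subset (Finset.subset_univ (Finset.univ.filter (fun u => u ∈ HH A B)))]
      · exact (Finset.sum_subtype _ (by simp) _)
      · intro u _ hu
        unfold term
        rw [dif_neg]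
        intro hs
        exact hu (Finset.mem_filter.2 ⟨Finset.mem_univ _, ((stab_prod gX gY u A B).1 hs).2⟩)
    rw [e1]
    have e2 := sum_hom_fiber (HHmap A B) (HHmap_surj A B) (fun p =>
      G1 (A × B) (ext (gX.restrict h.1) (gY.restrict h.2) p.1) *
      G2 ((X ⧸ A) × (Y ⧸ B)) (ext (A.mapQ A gX h.1) (B.mapQ B gY h.2) p.2))
    have e3 : ∑ u : HH A B, term G1 G2 (ext gX gY u) (A.prod B) = ∑ u : HH A B,
      G1 (A × B) (ext (gX.restrict h.1) (gY.restrict h.2) (HHmap A B u).1) *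
      G2 ((X ⧸ A) × (Y ⧸ B)) (ext (A.mapQ A gX h.1) (B.mapQ B gY h.2) (HHmap A B u).2) :=
      Finset.sum_congr rfl fun u _ => term_prod h1 h2 gX gY u A B h.1 h.2 u.2
    have n1 : (Nat.card (B →ₗ[F] A) : ℂ) ≠ 0 := Nat.cast_ne_zero.2 Nat.card_pos.ne'
    have n2 : (Nat.card ((Y ⧸ B) →ₗ[F] (X ⧸ A)) : ℂ) ≠ 0 := Nat.cast_ne_zero.2 Nat.card_pos.ne'
    have e4 : ∑ p : (B →ₗ[F] A) × ((Y ⧸ B) →ₗ[F] (X ⧸ A)),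
        G1 (A × B) (ext (gX.restrict h.1) (gY.restrict h.2) p.1) *
        G2 ((X ⧸ A) × (Y ⧸ B)) (ext (A.mapQ A gX h.1) (B.mapQ B gY h.2) p.2) =
        CC G1 (gX.restrict h.1) (gY.restrict h.2) * CC G2 (A.mapQ A gX h.1) (B.mapQ B gY h.2) := by
      unfold CC
      rw [Finset.sum_mul_sum, ← Finset.sum_product']
      refine Finset.sum_congr ?_ fun _ _ => rfl
      ext; simp
    replace e2 := e2.trans (congrArg _ ((Finset.sum_congr (by ext; simp) fun _ _ => rfl).trans e4))
    rw [Nat.card_prod] at e2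
    push_cast at e2
    replace e2 := (congrArg (fun z => (Nat.card (B →ₗ[F] A) : ℂ) * Nat.card ((Y ⧸ B) →ₗ[F] (X ⧸ A)) * z)
      (e3.trans (Finset.sum_congr (by ext; simp) fun _ _ => rfl))).trans e2
    revert e2
    generalize (∑ u : HH A B, term G1 G2 (ext gX gY u) (A.prod B)) = S
    intro e2
    unfold cc
    field_simp
    linear_combination e2
  · rw [dif_neg h, mul_zero]
    refine Finset.sum_eq_zero fun u _ => ?_
    unfold term
    rw [dif_neg]
    exact fun hs => h ((stab_prod gX gY u A B).1 hs).1

theorem shear_map_comap (t : Y →ₗ[F] X) (A : Submodule F X) (B : Submodule F Y) :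
    ((A.prod B).map (shear t : (X × Y) →ₗ[F] (X × Y))).comap (LinearMap.inl F X Y) = A := by
  ext x
  constructor
  · rintro ⟨⟨a, b⟩, ⟨ha, hb⟩, h⟩
    simp at h
    obtain ⟨h, rfl⟩ := h
    simp at h
    rwa [← h]
  · intro hx
    exact ⟨(x, 0), ⟨hx, B.zero_mem⟩, by simp⟩

theorem shear_map_snd (t : Y →ₗ[F] X) (A : Submodule F X) (B : Submodule F Y) :
    ((A.prod B).map (shear t : (X × Y) →ₗ[F] (X × Y))).map (LinearMap.snd F X Y) = B := by
  ext y
  constructor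
  · rintro ⟨_, ⟨⟨a, b⟩, ⟨ha, hb⟩, rfl⟩, rfl⟩
    exact hb
  · intro hy
    exact ⟨_, ⟨(0, y), ⟨A.zero_mem, hy⟩, rfl⟩, rfl⟩

theorem exists_shear (U : Submodule F (X × Y)) (A : Submodule F X) (B : Submodule F Y)
    (hA : U.comap (LinearMap.inl F X Y) = A) (hB : U.map (LinearMap.snd F X Y) = B) :
    ∃ t : Y →ₗ[F] X, (A.prod B).map (shear t : (X × Y) →ₗ[F] (X × Y)) = U := by
  let π : U →ₗ[F] B := (LinearMap.snd F X Y).restrict (fun x hx => by rw [← hB]; exact ⟨x, hx, rfl⟩)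
  have hπ : Function.Surjective π := by
    rintro ⟨y, hy⟩
    rw [← hB] at hy
    obtain ⟨v, hv, rfl⟩ := hy
    exact ⟨⟨v, hv⟩, rfl⟩
  obtain ⟨s, hs⟩ := Module.projective_lifting_property π LinearMap.id hπ
  have hs' : ∀ b : B, (s b).1.2 = b := fun b => congrArg (fun z : B => (z : Y)) (LinearMap.congr_fun hs b)
  obtain ⟨t, ht⟩ := LinearMap.exists_extend ((LinearMap.fst F X Y).comp (U.subtype.comp s))
  have ht' : ∀ b : B, t b = (s b).1.1 := fun b => LinearMap.congr_fun ht b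
  have hmem : ∀ b ∈ B, (t b, b) ∈ U := by
    intro b hb
    have := (s ⟨b, hb⟩).2
    have e : ((s ⟨b, hb⟩ : U) : X × Y) = (t b, b) := Prod.ext (ht' ⟨b, hb⟩).symm (hs' ⟨b, hb⟩)
    rwa [e] at this
  refine ⟨t, le_antisymm ?_ ?_⟩
  · rintro _ ⟨⟨a, b⟩, ⟨ha, hb⟩, rfl⟩
    rw [SetLike.mem_coe, ← hA] at ha
    have := U.add_mem (show (a, (0:Y)) ∈ U from ha) (hmem b hb)
    simpa using this
  · rintro ⟨x, y⟩ hv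
    have hy : y ∈ B := by rw [← hB]; exact ⟨_, hv, rfl⟩
    refine ⟨(x - t y, y), ⟨?_, hy⟩, by simp⟩
    rw [SetLike.mem_coe, ← hA]
    have := U.sub_mem hv (hmem y hy)
    simpa using this

theorem shear_eq_iff (t t0 : Y →ₗ[F] X) (A : Submodule F X) (B : Submodule F Y) :
    (A.prod B).map (shear t : (X × Y) →ₗ[F] (X × Y)) =
      (A.prod B).map (shear t0 : (X × Y) →ₗ[F] (X × Y)) ↔ t - t0 ∈ HH A B := by
  have main : ∀ t t0 : Y →ₗ[F] X, t - t0 ∈ HH A B → (A.prod B).map (shear t : (X × Y) →ₗ[F] (X × Y)) ≤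
      (A.prod B).map (shear t0 : (X × Y) →ₗ[F] (X × Y)) := by
    rintro t t0 h _ ⟨⟨a, b⟩, ⟨ha, hb⟩, rfl⟩
    refine ⟨(a + (t - t0) b, b), ⟨A.add_mem ha (h b hb), hb⟩, ?_⟩
    refine Prod.ext ?_ rfl
    change a + (t b - t0 b) + t0 b = a + t b
    abel
  constructor
  · intro h b hb
    have : shear t (0, b) ∈ (A.prod B).map (shear t0 : (X × Y) →ₗ[F] (X × Y)) := by
      rw [← h]; exact ⟨(0, b), ⟨A.zero_mem, hb⟩, rfl⟩
    obtain ⟨⟨a, b'⟩, ⟨ha, hb'⟩, h2⟩ := this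
    simp at h2
    obtain ⟨h2, rfl⟩ := h2
    have : (t - t0) b' = a := by simp [← h2]
    rw [this]; exact ha
  · intro h
    refine le_antisymm (main _ _ h) (main _ _ ?_)
    have := (HH A B).neg_mem h
    rwa [neg_sub] at this

theorem sum_term_shear {G1 G2 : PFun F} (h1 : PInv G1) (h2 : PInv G2)
    (gX : Module.End F X) (gY : Module.End F Y) (U : Submodule F (X × Y)) (t : Y →ₗ[F] X) :
    ∑ u, term G1 G2 (ext gX gY u) (U.map (shear t : (X × Y) →ₗ[F] (X × Y))) =
    ∑ u, term G1 G2 (ext gX gY u) U := by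
  symm
  refine Fintype.sum_equiv (Equiv.addRight (t.comp gY - gX.comp t)) _ _ fun u => ?_
  refine term_conj h1 h2 (shear t) _ _ ?_ _ _ rfl
  rintro ⟨x, y⟩
  simp
  abel

theorem PL {G1 G2 : PFun F} (h1 : PInv G1) (h2 : PInv G2)
    (gX : Module.End F X) (gY : Module.End F Y) :
    cc (star G1 G2) gX gY = ∑ A : Submodule F X, ∑ B : Submodule F Y,
      if h : Stab gX A ∧ Stab gY B then
        cc G1 (gX.restrict h.1) (gY.restrict h.2) * cc G2 (A.mapQ A gX h.1) (B.mapQ B gY h.2)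
      else 0 := by
  set f : Submodule F (X × Y) → ℂ := fun U => ∑ u, term G1 G2 (ext gX gY u) U with hf
  have n1 : (Nat.card (Y →ₗ[F] X) : ℂ) ≠ 0 := Nat.cast_ne_zero.2 Nat.card_pos.ne'
  have key : ∀ (A : Submodule F X) (B : Submodule F Y),
      ∑ U ∈ Finset.univ.filter (fun U : Submodule F (X × Y) =>
        (U.comap (LinearMap.inl F X Y), U.map (LinearMap.snd F X Y)) = (A, B)), f U =
      Nat.card (Y →ₗ[F] X) * if h : Stab gX A ∧ Stab gY B then
        cc G1 (gX.restrict h.1) (gY.restrict h.2) * cc G2 (A.mapQ A gX h.1) (B.mapQ B gY h.2)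
      else 0 := by
    intro A B
    have nH : (Nat.card (HH A B) : ℂ) ≠ 0 := Nat.cast_ne_zero.2 Nat.card_pos.ne'
    have s1 : ∑ t : Y →ₗ[F] X, f ((A.prod B).map (shear t : (X × Y) →ₗ[F] (X × Y))) =
        Nat.card (Y →ₗ[F] X) * f (A.prod B) := by
      rw [Finset.sum_congr rfl (fun t _ => sum_term_shear h1 h2 gX gY (A.prod B) t)]
      rw [Finset.sum_const, nsmul_eq_mul, Finset.card_univ, Nat.card_eq_fintype_card]
    have s2 : ∑ t : Y →ₗ[F] X, f ((A.prod B).map (shear t : (X × Y) →ₗ[F] (X × Y))) =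
        Nat.card (HH A B) * ∑ U ∈ Finset.univ.filter (fun U : Submodule F (X × Y) =>
        (U.comap (LinearMap.inl F X Y), U.map (LinearMap.snd F X Y)) = (A, B)), f U := by
      rw [← Finset.sum_fiberwise_of_maps_to (t := Finset.univ.filter (fun U : Submodule F (X × Y) =>
        (U.comap (LinearMap.inl F X Y), U.map (LinearMap.snd F X Y)) = (A, B)))
        (g := fun t : Y →ₗ[F] X => (A.prod B).map (shear t : (X × Y) →ₗ[F] (X × Y)))]
      · rw [Finset.mul_sum]
        refine Finset.sum_congr rfl fun U hU => ?_
        have hU' := (Finset.mem_filter.1 hU).2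
        obtain ⟨t0, rfl⟩ := exists_shear U A B (congrArg Prod.fst hU') (congrArg Prod.snd hU')
        rw [Finset.sum_congr rfl (g := fun _ => f ((A.prod B).map (shear t0 : (X × Y) →ₗ[F] (X × Y))))
          (fun t ht => by rw [(Finset.mem_filter.1 ht).2])]
        rw [Finset.sum_const, nsmul_eq_mul]
        congr 2
        rw [← Fintype.card_subtype, ← Nat.card_eq_fintype_card]
        refine Nat.card_congr ?_
        refine (Equiv.subRight t0).subtypeEquiv ?_
        intro t
        exact shear_eq_iff t t0 A B
      · intro t _
        refine Finset.mem_filter.2 ⟨Finset.mem_univ _, ?_⟩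
        rw [shear_map_comap, shear_map_snd]
    have s3 := sum_term_prod h1 h2 gX gY A B
    rw [s1] at s2
    change f (A.prod B) = _ at s3
    rw [s3] at s2
    refine mul_left_cancel₀ nH ?_
    rw [← s2]; ring
  have s0 : CC (star G1 G2) gX gY = ∑ U, f U := by
    unfold CC star
    rw [Finset.sum_comm]
  unfold cc
  rw [s0, div_eq_iff n1]
  rw [← Finset.sum_fiberwise (s := Finset.univ) (g := fun U : Submodule F (X × Y) =>
        (U.comap (LinearMap.inl F X Y), U.map (LinearMap.snd F X Y)))]
  rw [show (Finset.univ : Finset (Submodule F X × Submodule F Y)) = Finset.univ ×ˢ Finset.univ by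
    ext; simp, Finset.sum_product, Finset.sum_mul]
  refine Finset.sum_congr rfl fun A _ => ?_
  rw [Finset.sum_mul]
  refine Finset.sum_congr rfl fun B _ => ?_
  rw [key A B]
  unfold cc
  ring

end
end MK

namespace MK
attribute [local instance] Fintype.ofFinite
attribute [local instance] Classical.propDecidable

section
variable {F : Type} [Field F]

noncomputable def mobAux (β : PFun F) : ℕ → PFun F
  | 0 => β
  | (m+1) => fun V _ _ _ g => β V g - ∑ U : Submodule F V,
      if h : Stab g U ∧ U ≠ ⊤ then mobAux β m U (g.restrict h.1) else 0

noncomputable def mob (β : PFun F) : PFun F := fun V _ _ _ g => mobAux β (Module.finrank F V) V g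

variable {V V' X Y : Type} [AddCommGroup V] [Module F V] [Finite V]
  [AddCommGroup V'] [Module F V'] [Finite V']
  [AddCommGroup X] [Module F X] [Finite X] [AddCommGroup Y] [Module F Y] [Finite Y]

/-- sum over stable subspaces -/
theorem dite_stab_conj (P : ∀ (V : Type) [AddCommGroup V] [Module F V], Submodule F V → Prop)
    (e : V ≃ₗ[F] V') (g : Module.End F V) (g' : Module.End F V') (hg : ∀ x, e (g x) = g' (e x))
    (U : Submodule F V) :
    Stab g U ↔ Stab g' (U.map (e : V →ₗ[F] V')) := by
  constructor
  · rintro h _ ⟨y, hy, rfl⟩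
    exact ⟨g y, h y hy, hg y⟩
  · intro h x hx
    obtain ⟨y, hy, hy2⟩ := h (e x) ⟨x, hx, rfl⟩
    rw [← hg x] at hy2
    rwa [← e.injective hy2]

theorem mobAux_inv {β : PFun F} (hβ : PInv β) (m : ℕ) : PInv (mobAux β m) := by
  induction m with
  | zero => exact hβ
  | succ m ih =>
    intro V V' _ _ _ _ _ _ e g g' hg
    unfold mobAux
    congr 1
    · exact hβ _ _ e g g' hg
    · suffices H : ∀ (U : Submodule F V) (U' : Submodule F V'), U' = U.map (e : V →ₗ[F] V') →
        (if h : Stab g U ∧ U ≠ ⊤ then mobAux β m U (g.restrict h.1) else 0) =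
        (if h : Stab g' U' ∧ U' ≠ ⊤ then mobAux β m U' (g'.restrict h.1) else 0) from
        Fintype.sum_equiv (Submodule.orderIsoMapComap e).toEquiv _ _ (fun U => H U _ rfl)
      rintro U _ rfl
      have hs := dite_stab_conj (fun _ _ _ _ => True) e g g' hg U
      have ht : (U ≠ ⊤) ↔ U.map (e : V →ₗ[F] V') ≠ ⊤ := by
        rw [not_iff_not]
        exact (map_eq_top_iff (Submodule.orderIsoMapComap e) (a := U)).symm
      by_cases h : Stab g U ∧ U ≠ ⊤
      · rw [dif_pos h, dif_pos ⟨hs.1 h.1, ht.1 h.2⟩]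
        refine ih _ _ (e.submoduleMap U) _ _ ?_
        intro x
        apply Subtype.ext
        exact hg x
      · rw [dif_neg h, dif_neg (fun h' => h ⟨hs.2 h'.1, ht.2 h'.2⟩)]

theorem mobAux_eq (β : PFun F) (m : ℕ) : ∀ (V : Type) [AddCommGroup V] [Module F V] [Finite V]
    (g : Module.End F V), Module.finrank F V ≤ m →
    mobAux β m V g = mob β V g ∧ mob β V g = β V g - ∑ U : Submodule F V,
      if h : Stab g U ∧ U ≠ ⊤ then mob β U (g.restrict h.1) else 0 := by
  induction m with
  | zero =>
    intro V _ _ _ g hV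
    have h0 : Module.finrank F V = 0 := by omega
    have : Subsingleton V := Module.finrank_zero_iff.1 h0
    have e : mob β V g = β V g := by unfold mob; rw [h0]; rfl
    refine ⟨e.symm, ?_⟩
    rw [e, Finset.sum_eq_zero, sub_zero]
    intro U _
    rw [dif_neg]
    rintro ⟨_, h⟩
    exact h (Subsingleton.elim _ _)
  | succ m ih =>
    intro V _ _ _ g hV
    have hlt : ∀ U : Submodule F V, U ≠ ⊤ → Module.finrank F U < Module.finrank F V :=
      fun U hU => Submodule.finrank_lt hU
    have a1 : mobAux β (m+1) V g = β V g - ∑ U : Submodule F V,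
        if h : Stab g U ∧ U ≠ ⊤ then mob β U (g.restrict h.1) else 0 := by
      change β V g - _ = _
      congr 1
      refine Finset.sum_congr rfl fun U _ => ?_
      by_cases h : Stab g U ∧ U ≠ ⊤
      · rw [dif_pos h, dif_pos h]
        exact (ih U _ (by have := hlt U h.2; omega)).1
      · rw [dif_neg h, dif_neg h]
    by_cases hle : Module.finrank F V ≤ m
    · have := (ih V g hle).2
      exact ⟨a1.trans this.symm, this⟩
    · have he : Module.finrank F V = m + 1 := by omega
      have : mob β V g = mobAux β (m+1) V g := by unfold mob; rw [he]
      exact ⟨this.symm, this.trans a1⟩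

theorem mob_inv {β : PFun F} (hβ : PInv β) : PInv (mob β) := by
  intro V V' _ _ _ _ _ _ e g g' hg
  rw [← (mobAux_eq β _ V g le_rfl).1, ← (mobAux_eq β _ V' g' le_rfl).1, e.finrank_eq]
  exact mobAux_inv hβ _ V V' e g g' hg

theorem mob_rec (β : PFun F) (g : Module.End F V) :
    mob β V g = β V g - ∑ U : Submodule F V,
      if h : Stab g U ∧ U ≠ ⊤ then mob β U (g.restrict h.1) else 0 :=
  (mobAux_eq β _ V g le_rfl).2

theorem mob_sum {β : PFun F} (hβ : PInv β) (g : Module.End F V) :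
    ∑ U : Submodule F V, (if h : Stab g U then mob β U (g.restrict h) else 0) = β V g := by
  have h1 := mob_rec β g
  have h2 : ∀ U : Submodule F V, (if h : Stab g U then mob β U (g.restrict h) else 0) =
     (if h : Stab g U ∧ U ≠ ⊤ then mob β U (g.restrict h.1) else 0) +
      if U = ⊤ then mob β V g else 0 := by
    intro U
    by_cases hU : U = ⊤
    · subst hU
      rw [dif_pos (show Stab g ⊤ from fun _ _ => trivial), if_pos rfl, dif_neg (fun h => h.2 rfl), zero_add]
      exact mob_inv hβ _ _ Submodule.topEquiv _ _ (fun _ => rfl)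
    · rw [if_neg hU, add_zero]
      by_cases h : Stab g U
      · rw [dif_pos h, dif_pos ⟨h, hU⟩]
      · rw [dif_neg h, dif_neg (fun h' => h h'.1)]
  rw [Finset.sum_congr rfl fun U _ => h2 U, Finset.sum_add_distrib, Finset.sum_ite_eq' Finset.univ ⊤]
  rw [h1]
  simp

def one : PFun F := fun _ _ _ _ _ => 1

theorem one_inv : PInv (one : PFun F) := fun _ _ _ _ _ _ _ _ _ _ _ _ => rfl

theorem star_mob {β : PFun F} (hβ : PInv β) (V : Type) [AddCommGroup V] [Module F V] [Finite V]
   (g : Module.End F V) : star (mob β) one V g = β V g := by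
  rw [← mob_sum hβ g]
  unfold star
  refine Finset.sum_congr rfl fun U _ => ?_
  unfold term
  by_cases h : Stab g U
  · rw [dif_pos h, dif_pos h]; exact mul_one _
  · rw [dif_neg h, dif_neg h]

theorem CC_congr {G : PFun F} (hG : PInv G) {X' Y' : Type} [AddCommGroup X'] [Module F X'] [Finite X']
    [AddCommGroup Y'] [Module F Y'] [Finite Y'] (eX : X ≃ₗ[F] X') (eY : Y ≃ₗ[F] Y')
    (gX : Module.End F X) (gY : Module.End F Y) (gX' : Module.End F X') (gY' : Module.End F Y')
    (hX : ∀ x, eX (gX x) = gX' (eX x)) (hY : ∀ x, eY (gY x) = gY' (eY x)) :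
    CC G gX gY = CC G gX' gY' := by
  unfold CC
  refine Fintype.sum_equiv (LinearEquiv.arrowCongr eY eX).toEquiv _ _ (fun u => ?_)
  refine hG _ _ (eX.prodCongr eY) _ _ ?_
  rintro ⟨x, y⟩
  simp [hX, hY, LinearEquiv.arrowCongr_apply]

theorem cc_congr {G : PFun F} (hG : PInv G) {X' Y' : Type} [AddCommGroup X'] [Module F X'] [Finite X']
    [AddCommGroup Y'] [Module F Y'] [Finite Y'] (eX : X ≃ₗ[F] X') (eY : Y ≃ₗ[F] Y')
    (gX : Module.End F X) (gY : Module.End F Y) (gX' : Module.End F X') (gY' : Module.End F Y')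
    (hX : ∀ x, eX (gX x) = gX' (eX x)) (hY : ∀ x, eY (gY x) = gY' (eY x)) :
    cc G gX gY = cc G gX' gY' := by
  unfold cc
  rw [CC_congr hG eX eY gX gY gX' gY' hX hY,
    Nat.card_congr (LinearEquiv.arrowCongr eY eX).toEquiv]

theorem cc_subL {G : PFun F} (hG : PInv G) [Subsingleton X] (gX : Module.End F X)
    (gY : Module.End F Y) : cc G gX gY = G Y gY := by
  have : Unique (Y →ₗ[F] X) := ⟨⟨0⟩, fun u => by ext; exact Subsingleton.elim _ _⟩
  unfold cc CC
  rw [Nat.card_unique, Nat.cast_one, div_one]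
  rw [Finset.sum_eq_single 0 (fun b _ hb => absurd (Subsingleton.elim b 0) hb) (fun h => absurd (Finset.mem_univ _) h)]
  refine hG _ _ (LinearEquiv.ofBijective (LinearMap.snd F X Y) ⟨?_, LinearMap.snd_surjective⟩) _ _ ?_
  · rintro ⟨a, b⟩ ⟨c, d⟩ h
    exact Prod.ext (Subsingleton.elim _ _) h
  · rintro ⟨x, y⟩; rfl

theorem cc_subR {G : PFun F} (hG : PInv G) [Subsingleton Y] (gX : Module.End F X)
    (gY : Module.End F Y) : cc G gX gY = G X gX := by
  have : Unique (Y →ₗ[F] X) := ⟨⟨0⟩, fun u => by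
    ext y; rw [Subsingleton.elim y 0, map_zero, map_zero]⟩
  unfold cc CC
  rw [Nat.card_unique, Nat.cast_one, div_one]
  rw [Finset.sum_eq_single 0 (fun b _ hb => absurd (Subsingleton.elim b 0) hb) (fun h => absurd (Finset.mem_univ _) h)]
  refine hG _ _ (LinearEquiv.ofBijective (LinearMap.fst F X Y) ⟨?_, LinearMap.fst_surjective⟩) _ _ ?_
  · rintro ⟨a, b⟩ ⟨c, d⟩ h
    exact Prod.ext h (Subsingleton.elim _ _)
  · rintro ⟨x, y⟩
    change gX x + (0 : Y →ₗ[F] X) y = gX x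
    simp

/-- additive functions -/
def PAdd (β : PFun F) : Prop :=
  ∀ (X Y : Type) [AddCommGroup X] [Module F X] [Finite X] [AddCommGroup Y] [Module F Y]
    [Finite Y] (gX : Module.End F X) (gY : Module.End F Y) (u : Y →ₗ[F] X),
    β (X × Y) (ext gX gY u) = β X gX + β Y gY

def PPrim (R : PFun F) : Prop :=
  ∀ (X Y : Type) [AddCommGroup X] [Module F X] [Finite X] [AddCommGroup Y] [Module F Y]
    [Finite Y] [Nontrivial X] [Nontrivial Y] (gX : Module.End F X) (gY : Module.End F Y),
    cc R gX gY = 0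

theorem padd_zero {β : PFun F} (hβ : PInv β) (ha : PAdd β) [Subsingleton V] (g : Module.End F V) :
    β V g = 0 := by
  have h1 := ha V V g g 0
  have h2 := hβ _ _ (LinearEquiv.ofBijective (LinearMap.fst F V V) ⟨fun _ _ _ => Subsingleton.elim _ _, LinearMap.fst_surjective⟩)
    (ext g g 0) g (fun _ => Subsingleton.elim _ _)
  rw [h2] at h1
  linear_combination -h1

theorem mob_zero {β : PFun F} (hβ : PInv β) (ha : PAdd β) [Subsingleton V] (g : Module.End F V) :
    mob β V g = 0 := by
  have h0 : Module.finrank F V = 0 := Module.finrank_zero_iff.2 inferInstance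
  have e : mob β V g = β V g := by unfold mob; rw [h0]; rfl
  rw [e, padd_zero hβ ha]

theorem mob_prim {β : PFun F} (hβ : PInv β) (ha : PAdd β) : PPrim (mob β) := by
  suffices H : ∀ (n : ℕ) (X Y : Type) [AddCommGroup X] [Module F X] [Finite X] [AddCommGroup Y] [Module F Y]
    [Finite Y] [Nontrivial X] [Nontrivial Y] (gX : Module.End F X) (gY : Module.End F Y),
    Module.finrank F X + Module.finrank F Y = n → cc (mob β) gX gY = 0 by
    intro X Y _ _ _ _ _ _ _ _ gX gY
    exact H _ X Y gX gY rfl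
  intro n
  induction n using Nat.strong_induction_on with
  | _ n ih =>
  intro X Y _ _ _ _ _ _ _ _ gX gY hn
  have hm := mob_inv hβ
  have p := PL hm one_inv gX gY
  have l : cc (star (mob β) one) gX gY = β X gX + β Y gY := by
    unfold cc CC
    rw [Finset.sum_congr rfl fun u _ => (star_mob hβ _ _).trans (ha X Y gX gY u)]
    rw [Finset.sum_const, nsmul_eq_mul, Finset.card_univ, Nat.card_eq_fintype_card]
    have n1 : (Fintype.card (Y →ₗ[F] X) : ℂ) ≠ 0 := Nat.cast_ne_zero.2 Fintype.card_ne_zero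
    field_simp
  rw [l] at p
  have one1 : ∀ (X Y : Type) [AddCommGroup X] [Module F X] [Finite X] [AddCommGroup Y] [Module F Y]
    [Finite Y] (gX : Module.End F X) (gY : Module.End F Y), cc (one : PFun F) gX gY = 1 := by
    intro X Y _ _ _ _ _ _ gX gY
    unfold cc CC one
    rw [Finset.sum_const, nsmul_eq_mul, mul_one, Finset.card_univ, Nat.card_eq_fintype_card]
    exact div_self (Nat.cast_ne_zero.2 Fintype.card_ne_zero)
  have key : ∀ (A : Submodule F X) (B : Submodule F Y), (if h : Stab gX A ∧ Stab gY B then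
        cc (mob β) (gX.restrict h.1) (gY.restrict h.2) * cc one (A.mapQ A gX h.1) (B.mapQ B gY h.2)
      else 0) = (if A = ⊥ then (if h : Stab gY B then mob β B (gY.restrict h) else 0) else 0)
      + (if B = ⊥ then (if h : Stab gX A then mob β A (gX.restrict h) else 0) else 0)
      + (if A = ⊤ then (if B = ⊤ then cc (mob β) gX gY else 0) else 0) := by
    intro A B
    have hbot : Stab gX ⊥ := by
      intro x hx; rw [Submodule.mem_bot] at hx ⊢; rw [hx, map_zero]
    have hbotY : Stab gY ⊥ := by
      intro x hx; rw [Submodule.mem_bot] at hx ⊢; rw [hx, map_zero]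
    by_cases hA : A = ⊥
    · subst hA
      rw [if_pos rfl, if_neg bot_ne_top, add_zero]
      by_cases hB : Stab gY B
      · rw [dif_pos ⟨hbot, hB⟩, dif_pos hB, one1, mul_one, cc_subL hm, dif_pos hbot]
        rw [mob_zero hβ ha (gX.restrict hbot)]
        simp
      · rw [dif_neg (fun h => hB h.2), dif_neg hB, dif_pos hbot, mob_zero hβ ha]; simp
    · rw [if_neg hA, zero_add]
      by_cases hB : B = ⊥
      · subst hB
        rw [if_pos rfl, if_neg (bot_ne_top (α := Submodule F Y)), ite_self, add_zero]
        by_cases h : Stab gX A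
        · rw [dif_pos ⟨h, hbotY⟩, dif_pos h, one1, mul_one, cc_subR hm]
        · rw [dif_neg (fun h' => h h'.1), dif_neg h]
      · rw [if_neg hB, zero_add]
        by_cases hT : A = ⊤ ∧ B = ⊤
        · obtain ⟨rfl, rfl⟩ := hT
          rw [if_pos rfl, if_pos rfl, dif_pos ⟨fun _ _ => trivial, fun _ _ => trivial⟩, one1, mul_one]
          exact cc_congr hm Submodule.topEquiv Submodule.topEquiv _ _ _ _ (fun _ => rfl) (fun _ => rfl)
        · have : (if A = ⊤ then (if B = ⊤ then cc (mob β) gX gY else 0) else 0) = 0 := by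
            by_cases h1 : A = ⊤
            · rw [if_pos h1, if_neg (fun h2 => hT ⟨h1, h2⟩)]
            · rw [if_neg h1]
          rw [this]
          by_cases h : Stab gX A ∧ Stab gY B
          · rw [dif_pos h, one1, mul_one]
            have : Nontrivial A := Submodule.nontrivial_iff_ne_bot.2 hA
            have : Nontrivial B := Submodule.nontrivial_iff_ne_bot.2 hB
            refine ih (Module.finrank F A + Module.finrank F B) ?_ A B _ _ rfl
            have a1 := Submodule.finrank_le A
            have a2 := Submodule.finrank_le B
            rcases not_and_or.1 hT with h3 | h3
            · have := Submodule.finrank_lt h3; omega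
            · have := Submodule.finrank_lt h3; omega
          · rw [dif_neg h]
  rw [Finset.sum_congr rfl fun A _ => Finset.sum_congr rfl fun B _ => key A B] at p
  simp only [Finset.sum_add_distrib, Finset.sum_ite_eq', Finset.mem_univ, if_true] at p
  rw [Finset.sum_comm] at p
  simp only [Finset.sum_ite_eq', Finset.mem_univ, if_true] at p
  have e1 : ∀ A : Submodule F X, (∑ B : Submodule F Y, if A = ⊤ then (if B = ⊤ then cc (mob β) gX gY else 0) else 0)
     = if A = ⊤ then cc (mob β) gX gY else 0 := by
    intro A
    by_cases h : A = ⊤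
    · simp [h]
    · simp [h]
  rw [Finset.sum_congr rfl fun A _ => e1 A, mob_sum hβ gX, mob_sum hβ gY, Finset.sum_ite_eq' Finset.univ ⊤] at p
  simp at p
  linear_combination -p

end
end MK

namespace MK
attribute [local instance] Fintype.ofFinite
attribute [local instance] Classical.propDecidable
section
variable {F : Type} [Field F]
variable {V V' X Y : Type} [AddCommGroup V] [Module F V] [Finite V]
  [AddCommGroup V'] [Module F V'] [Finite V']
  [AddCommGroup X] [Module F X] [Finite X] [AddCommGroup Y] [Module F Y] [Finite Y]

/-- nilpotent endomorphism V → V/W → W → V -/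
def nil (W : Submodule F V) (u : (V ⧸ W) →ₗ[F] W) : Module.End F V :=
  W.subtype ∘ₗ u ∘ₗ W.mkQ

@[simp] theorem nil_apply (W : Submodule F V) (u : (V ⧸ W) →ₗ[F] W) (v : V) :
    nil W u v = (u (W.mkQ v) : V) := rfl

theorem nil_mem (W : Submodule F V) (u : (V ⧸ W) →ₗ[F] W) (v : V) : nil W u v ∈ W := (u _).2

theorem nil_zero (W : Submodule F V) (u : (V ⧸ W) →ₗ[F] W) {v : V} (hv : v ∈ W) : nil W u v = 0 := by
  have : W.mkQ v = 0 := by simpa using hv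
  rw [nil_apply, this, map_zero]; rfl

theorem nil_add (W : Submodule F V) (u u' : (V ⧸ W) →ₗ[F] W) : nil W (u + u') = nil W u + nil W u' := by
  ext v; simp

theorem stab_nil (W : Submodule F V) (u : (V ⧸ W) →ₗ[F] W) (g : Module.End F V) :
    Stab (g + nil W u) W ↔ Stab g W := by
  constructor
  · intro h x hx
    have := h x hx
    rwa [LinearMap.add_apply, nil_zero W u hx, add_zero] at this
  · intro h x hx
    rw [LinearMap.add_apply, nil_zero W u hx, add_zero]
    exact h x hx

/-- decomposition V ≃ W × V/W with a shift -/
theorem exists_split' (W : Submodule F V) (g : Module.End F V) (h : Stab g W) :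
    ∃ (e : V ≃ₗ[F] W × (V ⧸ W)) (u0 : (V ⧸ W) →ₗ[F] W), (∀ x, (e x).2 = W.mkQ x) ∧ ∀ u x,
      e ((g + nil W u) x) = ext (g.restrict h) (W.mapQ W g h) (u + u0) (e x) := by
  obtain ⟨p, hp⟩ := LinearMap.exists_leftInverse_of_injective W.subtype (by simp)
  have hp' : ∀ w : W, p (w : V) = w := fun w => LinearMap.congr_fun hp w
  let e0 : V →ₗ[F] W × (V ⧸ W) := p.prod W.mkQ
  have inj : Function.Injective e0 := by
    rw [← LinearMap.ker_eq_bot, LinearMap.ker_eq_bot']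
    intro v hv
    have h2 : W.mkQ v = 0 := congrArg Prod.snd hv
    have h1 : p v = 0 := congrArg Prod.fst hv
    have : v ∈ W := by simpa using h2
    have h3 := hp' ⟨v, this⟩
    rw [show ((⟨v, this⟩ : W) : V) = v from rfl, h1] at h3
    exact (congrArg Subtype.val h3).symm
  have surj : Function.Surjective e0 := by
    rintro ⟨w, y⟩
    obtain ⟨v, rfl⟩ := W.mkQ_surjective y
    refine ⟨v + ((w - p v : W) : V), ?_⟩
    have hz : W.mkQ ((w - p v : W) : V) = 0 := by
      rw [Submodule.mkQ_apply, Submodule.Quotient.mk_eq_zero]; exact (w - p v).2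
    refine Prod.ext ?_ ?_
    · change p (v + ((w - p v : W) : V)) = w
      rw [map_add, hp']; abel
    · change W.mkQ (v + ((w - p v : W) : V)) = W.mkQ v
      rw [map_add, hz, add_zero]
  let d : V →ₗ[F] W := p.comp g - (g.restrict h).comp p
  have hd : W ≤ LinearMap.ker d := by
    intro w hw
    change p (g w) - (g.restrict h) (p w) = 0
    have h1 := hp' ⟨w, hw⟩
    have h2 := hp' ⟨g w, h w hw⟩
    simp only at h1 h2
    rw [h1, h2, sub_eq_zero]; rfl
  refine ⟨LinearEquiv.ofBijective e0 ⟨inj, surj⟩, W.liftQ d hd, fun x => rfl, ?_⟩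
  intro u x
  change (p _, W.mkQ _) = _
  change _ = ext _ _ _ (p x, W.mkQ x)
  rw [ext_apply]
  refine Prod.ext ?_ ?_
  · change p ((g + nil W u) x) = (g.restrict h) (p x) + (u (W.mkQ x) + W.liftQ d hd (W.mkQ x))
    rw [Submodule.mkQ_apply, Submodule.liftQ_apply]
    change p (g x + (u _ : V)) = _ + (_ + (p (g x) - (g.restrict h) (p x)))
    rw [map_add, hp', Submodule.mkQ_apply]; abel
  · change W.mkQ (g x + (u _ : V)) = W.mkQ (g x)
    rw [map_add]
    have : W.mkQ ((u (W.mkQ x) : W) : V) = 0 := by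
      rw [Submodule.mkQ_apply, Submodule.Quotient.mk_eq_zero]; exact (u _).2
    rw [this, add_zero]

theorem exists_split (W : Submodule F V) (g : Module.End F V) (h : Stab g W) :
    ∃ (e : V ≃ₗ[F] W × (V ⧸ W)) (u0 : (V ⧸ W) →ₗ[F] W), ∀ u x,
      e ((g + nil W u) x) = ext (g.restrict h) (W.mapQ W g h) (u + u0) (e x) := by
  obtain ⟨e, u0, -, he⟩ := exists_split' W g h
  exact ⟨e, u0, he⟩

theorem sum_nil {G : PFun F} (hG : PInv G) (W : Submodule F V) (g : Module.End F V) (h : Stab g W) :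
    ∑ u, G V (g + nil W u) = CC G (g.restrict h) (W.mapQ W g h) := by
  obtain ⟨e, u0, he⟩ := exists_split W g h
  unfold CC
  exact Fintype.sum_equiv (Equiv.addRight u0) _ _ fun u => hG _ _ e _ _ (he u)

/-- class function on End V -/
def ClassFn (χ : Module.End F V → ℂ) : Prop :=
  ∀ (e : V ≃ₗ[F] V) (g g' : Module.End F V), (∀ x, e (g x) = g' (e x)) → χ g = χ g'

/-- primitive (cuspidal) functions on End V -/
structure Prim (χ : Module.End F V → ℂ) : Prop where
  cls : ClassFn χ
  cusp : ∀ (W : Submodule F V), W ≠ ⊥ → W ≠ ⊤ → ∀ g, Stab g W → ∑ u, χ (g + nil W u) = 0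

theorem prim_of {G : PFun F} (hG : PInv G) (hp : PPrim G) : Prim (G V) := by
  refine ⟨fun e g g' h => hG _ _ e _ _ h, fun W h1 h2 g hg => ?_⟩
  rw [sum_nil hG W g hg]
  haveI : Nontrivial W := Submodule.nontrivial_iff_ne_bot.2 h1
  haveI : Nontrivial (V ⧸ W) := Submodule.Quotient.nontrivial_iff.2 h2
  have := hp W (V ⧸ W) (g.restrict hg) (W.mapQ W g hg)
  unfold cc at this
  rcases div_eq_zero_iff.1 this with h | h
  · exact h
  · exact absurd h (Nat.cast_ne_zero.2 Nat.card_pos.ne')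

/-- unipotent-invariant weights -/
def UInv (W : Submodule F V) (w : Module.End F V → ℂ) : Prop :=
  ∀ g, Stab g W → ∀ u, w (g + nil W u) = w g

theorem prim_group {χ : Module.End F V → ℂ} (hχ : Prim χ) (W : Submodule F V) (h1 : W ≠ ⊥) (h2 : W ≠ ⊤)
    {w : Module.End F V → ℂ} (hw : UInv W w) :
    ∑ g, (if Stab g W then χ g * w g else 0) = 0 := by
  have n1 : (Nat.card ((V ⧸ W) →ₗ[F] W) : ℂ) ≠ 0 := Nat.cast_ne_zero.2 Nat.card_pos.ne'
  refine (mul_eq_zero.1 (?_ : (Nat.card ((V ⧸ W) →ₗ[F] W) : ℂ) * _ = 0)).resolve_left n1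
  have : ∀ u : (V ⧸ W) →ₗ[F] W, ∑ g, (if Stab g W then χ g * w g else 0) =
      ∑ g, (if Stab g W then χ (g + nil W u) * w g else 0) := by
    intro u
    symm
    refine Fintype.sum_equiv (Equiv.addRight (nil W u)) _ _ fun g => ?_
    rw [Equiv.coe_addRight]
    by_cases h : Stab g W
    · rw [if_pos h, if_pos ((stab_nil W u g).2 h), hw g h u]
    · rw [if_neg h, if_neg (fun h' => h ((stab_nil W u g).1 h'))]
  rw [Nat.card_eq_fintype_card, ← Finset.card_univ, ← nsmul_eq_mul, ← Finset.sum_const]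
  rw [Finset.sum_congr rfl fun u _ => this u, Finset.sum_comm]
  refine Finset.sum_eq_zero fun g _ => ?_
  by_cases h : Stab g W
  · simp only [if_pos h]
    rw [← Finset.sum_mul, hχ.cusp W h1 h2 g h, zero_mul]
  · simp only [if_neg h, Finset.sum_const_zero]

theorem restrict_nil (W : Submodule F V) (u : (V ⧸ W) →ₗ[F] W) (g : Module.End F V) (h : Stab g W)
    (h' : Stab (g + nil W u) W) : (g + nil W u).restrict h' = g.restrict h := by
  ext x
  change g x + nil W u x = g x
  rw [nil_zero W u x.2, add_zero]

theorem mapQ_nil (W : Submodule F V) (u : (V ⧸ W) →ₗ[F] W) (g : Module.End F V) (h : Stab g W)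
    (h' : Stab (g + nil W u) W) : W.mapQ W (g + nil W u) h' = W.mapQ W g h := by
  ext x
  change W.mkQ (g x + nil W u x) = W.mkQ (g x)
  have : W.mkQ (nil W u x) = 0 := by
    rw [Submodule.mkQ_apply, Submodule.Quotient.mk_eq_zero]; exact nil_mem W u x
  rw [map_add, this, add_zero]

theorem term_uinv (G1 G2 : PFun F) (W : Submodule F V) : UInv W (fun g => term G1 G2 g W) := by
  intro g h u
  unfold term
  have h' := (stab_nil W u g).2 h
  beta_reduce
  rw [dif_pos h, dif_pos h', restrict_nil W u g h h', mapQ_nil W u g h h']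

theorem term_bot {G1 G2 : PFun F} (h1 : PInv G1) (h2 : PInv G2) (g : Module.End F V) :
    term G1 G2 g ⊥ = G1 (⊥ : Submodule F V) 0 * G2 V g := by
  unfold term
  have hs : Stab g ⊥ := by intro x hx; rw [Submodule.mem_bot] at hx ⊢; rw [hx, map_zero]
  rw [dif_pos hs]
  congr 1
  · congr 1; exact Subsingleton.elim _ _
  · refine h2 _ _ (Submodule.quotEquivOfEqBot ⊥ rfl) _ _ ?_
    intro x
    obtain ⟨x, rfl⟩ := Submodule.Quotient.mk_surjective _ x
    rfl

theorem term_top {G1 G2 : PFun F} (h1 : PInv G1) (h2 : PInv G2) (g : Module.End F V) :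
    term G1 G2 g ⊤ = G1 V g * G2 (V ⧸ (⊤ : Submodule F V)) 0 := by
  unfold term
  have hs : Stab g ⊤ := fun _ _ => trivial
  rw [dif_pos hs]
  congr 1
  · refine h1 _ _ (LinearEquiv.ofTop ⊤ rfl) _ _ ?_
    intro x; rfl
  · congr 1; exact Subsingleton.elim _ _

theorem prim_star {χ : Module.End F V → ℂ} (hχ : Prim χ) [Nontrivial V] {G1 G2 : PFun F} (h1 : PInv G1) (h2 : PInv G2)
    {m : Module.End F V → ℂ} (hm : ∀ W, UInv W m) :
    ∑ g, χ g * m g * star G1 G2 V g =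
    ∑ g, χ g * m g * (G1 (⊥ : Submodule F V) 0 * G2 V g + G1 V g * G2 (V ⧸ (⊤ : Submodule F V)) 0) := by
  have : ∀ W : Submodule F V, W ≠ ⊥ → W ≠ ⊤ → ∑ g, χ g * m g * term G1 G2 g W = 0 := by
    intro W hb ht
    rw [← prim_group hχ W hb ht (w := fun g => m g * term G1 G2 g W) (by
      intro g hg u
      beta_reduce
      rw [hm W g hg u]; exact congrArg _ (term_uinv G1 G2 W g hg u))]
    refine Finset.sum_congr rfl fun g _ => ?_
    by_cases h : Stab g W
    · rw [if_pos h]; ring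
    · rw [if_neg h]; unfold term; rw [dif_neg h, mul_zero]
  unfold star
  simp only [Finset.mul_sum]
  rw [Finset.sum_comm]
  rw [← Finset.sum_subset (Finset.subset_univ {⊥, ⊤})]
  · rw [Finset.sum_pair bot_ne_top, ← Finset.sum_add_distrib]
    refine Finset.sum_congr rfl fun g _ => ?_
    rw [term_bot h1 h2, term_top h1 h2, mul_add]
  · intro W _ hW
    simp only [Finset.mem_insert, Finset.mem_singleton, not_or] at hW
    exact this W hW.1 hW.2

theorem prim_mob {χ : Module.End F V → ℂ} (hχ : Prim χ) [Nontrivial V] {β : PFun F} (hβ : PInv β) (ha : PAdd β)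
    {m : Module.End F V → ℂ} (hm : ∀ W, UInv W m) :
    ∑ g, χ g * m g * mob β V g = ∑ g, χ g * m g * β V g := by
  have := prim_star hχ (mob_inv hβ) one_inv hm
  simp only [star_mob hβ] at this
  rw [this]
  refine Finset.sum_congr rfl fun g _ => ?_
  rw [mob_zero hβ ha (V := (⊥ : Submodule F V))]
  unfold one
  ring

/-! characteristic polynomials -/
theorem charpoly_ext (gX : Module.End F X) (gY : Module.End F Y) (u : Y →ₗ[F] X) :
    (ext gX gY u).charpoly = gX.charpoly * gY.charpoly := by
  let b₁ := Module.Free.chooseBasis F X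
  let b₂ := Module.Free.chooseBasis F Y
  rw [← LinearMap.charpoly_toMatrix gX b₁, ← LinearMap.charpoly_toMatrix gY b₂,
    ← LinearMap.charpoly_toMatrix (ext gX gY u) (b₁.prod b₂)]
  rw [← Matrix.charpoly_fromBlocks_zero₂₁ (M₁₁ := LinearMap.toMatrix b₁ b₁ gX)
    (M₁₂ := LinearMap.toMatrix b₂ b₁ u)]
  congr 1
  ext i j
  rcases i with i | i <;> rcases j with j | j <;> simp [LinearMap.toMatrix_apply]

theorem charpoly_conj' (e : V ≃ₗ[F] V') (g : Module.End F V) (g' : Module.End F V')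
    (h : ∀ x, e (g x) = g' (e x)) : g.charpoly = g'.charpoly := by
  have : g' = e.conj g := by
    ext x
    rw [LinearEquiv.conj_apply]
    simp [h]
  rw [this, LinearEquiv.charpoly_conj]

theorem charpoly_nil (W : Submodule F V) (g : Module.End F V) (h : Stab g W) (u) :
    (g + nil W u).charpoly = (g.restrict h).charpoly * (W.mapQ W g h).charpoly := by
  obtain ⟨e, u0, he⟩ := exists_split W g h
  rw [charpoly_conj' e _ _ (he u), charpoly_ext]

theorem charpoly_sub (W : Submodule F V) (g : Module.End F V) (h : Stab g W) :
    g.charpoly = (g.restrict h).charpoly * (W.mapQ W g h).charpoly := by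
  have := charpoly_nil W g h 0
  rwa [show nil W (0 : (V ⧸ W) →ₗ[F] W) = 0 by ext; simp, add_zero] at this

theorem uinv_charpoly (m : Polynomial F → ℂ) (W : Submodule F V) :
    UInv W (fun g => m g.charpoly) := by
  intro g h u
  beta_reduce
  rw [charpoly_nil W g h u, charpoly_sub W g h]

end
end MK

namespace MK
attribute [local instance] Fintype.ofFinite
attribute [local instance] Classical.propDecidable
section
open Polynomial
variable {F : Type} [Field F]
variable {V V' X Y : Type} [AddCommGroup V] [Module F V] [Finite V]
  [AddCommGroup V'] [Module F V'] [Finite V']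
  [AddCommGroup X] [Module F X] [Finite X] [AddCommGroup Y] [Module F Y] [Finite Y]

theorem aeval_intertwine (t : Y →ₗ[F] X) (gX : Module.End F X) (gY : Module.End F Y)
    (h : t ∘ₗ gY = gX ∘ₗ t) (p : F[X]) (y : Y) : t (aeval gY p y) = aeval gX p (t y) := by
  have h' : ∀ y, t (gY y) = gX (t y) := fun y => LinearMap.congr_fun h y
  induction p using Polynomial.induction_on' with
  | add p q hp hq => simp [hp, hq]
  | monomial n a =>
    rw [aeval_monomial, aeval_monomial]
    simp only [Module.End.mul_apply, Module.algebraMap_end_apply, map_smul]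
    congr 1
    induction n with
    | zero => simp
    | succ n ih => rw [pow_succ', pow_succ', Module.End.mul_apply, Module.End.mul_apply, h', ih]

theorem sylv (gX : Module.End F X) (gY : Module.End F Y) (pX pY : F[X]) (hX : aeval gX pX = 0)
    (hY : aeval gY pY = 0) (hc : IsCoprime pX pY) (u : Y →ₗ[F] X) :
    ∃ t : Y →ₗ[F] X, t ∘ₗ gY - gX ∘ₗ t = u := by
  let S : (Y →ₗ[F] X) →ₗ[F] (Y →ₗ[F] X) :=
    { toFun := fun t => t ∘ₗ gY - gX ∘ₗ t
      map_add' := by intro a b; ext; simp; abel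
      map_smul' := by intro a b; ext; simp [smul_sub] }
  have inj : Function.Injective S := by
    rw [← LinearMap.ker_eq_bot, LinearMap.ker_eq_bot']
    intro t ht
    have ht' : t ∘ₗ gY = gX ∘ₗ t := sub_eq_zero.1 ht
    obtain ⟨a, b, hab⟩ := hc
    ext y
    have h1 : aeval gY (a * pX + b * pY) y = y := by rw [hab]; simp
    have h2 : t y = t (aeval gY (a * pX) y) := by
      conv_lhs => rw [← h1]
      rw [map_add, LinearMap.add_apply, map_mul (aeval gY) b pY, hY]
      simp
    rw [h2, aeval_intertwine t gX gY ht', map_mul, hX]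
    simp
  exact LinearMap.surjective_of_injective inj u

theorem mapQ_aeval (W : Submodule F V) (g : Module.End F V) (h : Stab g W) (p : F[X]) (x : V) :
    aeval (W.mapQ W g h) p (W.mkQ x) = W.mkQ (aeval g p x) := by
  rw [aeval_intertwine W.mkQ (W.mapQ W g h) g (by ext; rfl)]

theorem restrict_aeval (W : Submodule F V) (g : Module.End F V) (h : Stab g W) (p : F[X]) (x : W) :
    ((aeval (g.restrict h) p x : W) : V) = aeval g p (x : V) :=
  aeval_intertwine W.subtype g (g.restrict h) (by ext; rfl) p x

theorem stab_aeval (W : Submodule F V) (g : Module.End F V) (h : Stab g W) (p : F[X]) : Stab (aeval g p) W := by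
  intro x hx
  rw [← restrict_aeval W g h p ⟨x, hx⟩]
  exact Subtype.coe_prop _

/-- 1 + nil as an automorphism -/
def uni (W : Submodule F V) (t : (V ⧸ W) →ₗ[F] W) : V ≃ₗ[F] V where
  toFun v := v + nil W t v
  invFun v := v - nil W t v
  map_add' a b := by simp; abel
  map_smul' c a := by simp
  left_inv v := by
    change v + nil W t v - nil W t (v + nil W t v) = v
    rw [map_add, nil_zero W t (nil_mem W t v)]; abel
  right_inv v := by
    change v - nil W t v + nil W t (v - nil W t v) = v
    rw [map_sub, nil_zero W t (nil_mem W t v)]; abel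

theorem prim_coprime {χ : Module.End F V → ℂ} (hχ : Prim χ) (g : Module.End F V) (p1 p2 : F[X])
    (hc : IsCoprime p1 p2) (h0 : aeval g (p1 * p2) = 0) (h1 : aeval g p1 ≠ 0) (h2 : aeval g p2 ≠ 0) :
    χ g = 0 := by
  set W := LinearMap.ker (aeval g p1) with hW
  have hs : Stab g W := by
    intro x hx
    rw [hW, LinearMap.mem_ker] at hx ⊢
    have : aeval g p1 (g x) = g (aeval g p1 x) := (aeval_intertwine g g g rfl p1 x).symm
    rw [this, hx, map_zero]
  have h12 : ∀ x, aeval g p1 (aeval g p2 x) = 0 := by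
    intro x
    rw [map_mul] at h0
    exact LinearMap.congr_fun h0 x
  have hb : W ≠ ⊥ := by
    intro hb
    apply h2
    ext x
    have : aeval g p2 x ∈ W := h12 x
    rw [hb, Submodule.mem_bot] at this
    exact this
  have ht : W ≠ ⊤ := fun ht => h1 (LinearMap.ker_eq_top.1 ht)
  have key : ∀ u, χ (g + nil W u) = χ g := by
    intro u
    obtain ⟨t, ht⟩ := sylv (g.restrict hs) (W.mapQ W g hs) p1 p2
      (by ext x; rw [restrict_aeval]; exact x.2)
      (by
        ext x
        change aeval (W.mapQ W g hs) p2 (W.mkQ x) = 0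
        rw [mapQ_aeval, Submodule.mkQ_apply, Submodule.Quotient.mk_eq_zero]
        exact h12 x) hc u
    symm
    refine hχ.cls (uni W t) _ _ fun x => ?_
    change g x + nil W t (g x) = g (x + nil W t x) + nil W u (x + nil W t x)
    rw [map_add, map_add, nil_zero W u (nil_mem W t x), add_zero]
    have e := congrArg (Subtype.val) (LinearMap.congr_fun ht (W.mkQ x))
    change (t (W.mkQ (g x)) : V) - g (t (W.mkQ x)) = u (W.mkQ x) at e
    rw [nil_apply, nil_apply, nil_apply, ← e]; abel
  have := hχ.cusp W hb ht g hs
  simp only [key] at this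
  rw [Finset.sum_const, nsmul_eq_mul] at this
  refine (mul_eq_zero.1 this).resolve_left ?_
  rw [Finset.card_univ, ← Nat.card_eq_fintype_card]
  exact Nat.cast_ne_zero.2 Nat.card_pos.ne'

theorem root_annih {K : Type} [Field K] [Algebra F K] (g : Module.End F V) (p : F[X]) (hp : aeval g p = 0)
    (r : K) (hr : aeval r g.charpoly = 0) : aeval r p = 0 := by
  let b := Module.Free.chooseBasis F V
  set A := LinearMap.toMatrix b b g
  have hA : aeval A p = 0 := by
    have := aeval_algHom_apply (LinearMap.toMatrixAlgEquiv b).toAlgHom g p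
    rw [hp, map_zero] at this
    exact this
  set B := A.map (algebraMap F K)
  have hB : aeval B (p.map (algebraMap F K)) = 0 := by
    rw [aeval_map_algebraMap]
    have := aeval_algHom_apply ((Algebra.ofId F K).mapMatrix (m := Module.Free.ChooseBasisIndex F V)) A p
    rw [hA, map_zero] at this
    exact this
  have hrB : r ∈ spectrum K B := by
    rw [Matrix.mem_spectrum_iff_isRoot_charpoly, Polynomial.IsRoot.def]
    have : B.charpoly = A.charpoly.map (algebraMap F K) := Matrix.charpoly_map _ _
    rw [this, LinearMap.charpoly_toMatrix, eval_map_algebraMap, hr]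
  have h := spectrum.subset_polynomial_aeval B (p.map (algebraMap F K)) ⟨r, hrB, rfl⟩
  rw [hB] at h
  by_contra hne
  apply h
  simp only [eval_map_algebraMap]
  rw [spectrum.mem_resolventSet_iff, sub_zero]
  exact (IsUnit.mk0 _ hne).map (algebraMap K (Matrix (Module.Free.ChooseBasisIndex F V) (Module.Free.ChooseBasisIndex F V) K))

theorem prim_supp {K : Type} [Field K] [Algebra F K] [Algebra.IsIntegral F K] {χ : Module.End F V → ℂ} (hχ : Prim χ)
    (g : Module.End F V) (hg : χ g ≠ 0) (r : K) (hr : aeval r g.charpoly = 0) :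
    ∃ b, g.charpoly = (minpoly F r) ^ b := by
  set f := minpoly F r
  have hIntg : IsIntegral F r := Algebra.IsIntegral.isIntegral r
  have hf : Irreducible f := minpoly.irreducible hIntg
  have hm := g.charpoly_monic
  obtain ⟨b, k, hk, hbk⟩ := WfDvdMonoid.max_power_factor (hm.ne_zero) hf
  refine ⟨b, ?_⟩
  have hc : IsCoprime (f ^ b) k := ((hf.coprime_iff_not_dvd).2 hk).pow_left
  have h0 : aeval g (f ^ b * k) = 0 := by rw [← hbk]; exact LinearMap.aeval_self_charpoly g
  by_cases h2 : aeval g k = 0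
  · exact absurd (minpoly.dvd F r (root_annih g k h2 r hr)) hk
  by_cases h1 : aeval g (f ^ b) = 0
  · have hu : IsUnit k := by
      by_contra hu
      have hk0 : k ≠ 0 := by
        rintro rfl; exact hk (dvd_zero _)
      obtain ⟨h, hh, hhk⟩ := WfDvdMonoid.exists_irreducible_factor hu hk0
      haveI := Fact.mk hh
      have e : aeval (AdjoinRoot.root h) g.charpoly = 0 := by
        rw [AdjoinRoot.aeval_eq, AdjoinRoot.mk_eq_zero, hbk]
        exact hhk.mul_left _
      have e2 := root_annih g _ h1 _ e
      rw [AdjoinRoot.aeval_eq, AdjoinRoot.mk_eq_zero] at e2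
      have e3 := hh.prime.dvd_of_dvd_pow e2
      exact hk ((hh.dvd_symm hf e3).trans hhk)
    have hfm : (f ^ b).Monic := (minpoly.monic hIntg).pow b
    have hkm : k.Monic := hfm.of_mul_monic_left (hbk ▸ hm)
    rw [hbk, hkm.eq_one_of_isUnit hu, mul_one]
  · exact absurd (prim_coprime hχ g _ _ hc h0 h1 h2) hg

end
end MK

namespace MK
attribute [local instance] Fintype.ofFinite
attribute [local instance] Classical.propDecidable
section
open Polynomial
variable {F : Type} [Field F]
variable {V V' X Y : Type} [AddCommGroup V] [Module F V] [Finite V]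
  [AddCommGroup V'] [Module F V'] [Finite V']
  [AddCommGroup X] [Module F X] [Finite X] [AddCommGroup Y] [Module F Y] [Finite Y]

/-- p ↦ p(g) v -/
noncomputable def cycMap (g : Module.End F V) (v : V) : F[X] →ₗ[F] V :=
  (LinearMap.applyₗ v).comp (aeval g).toLinearMap

@[simp] theorem cycMap_apply (g : Module.End F V) (v : V) (p : F[X]) : cycMap g v p = aeval g p v := rfl

def Cyc (g : Module.End F V) (v : V) : Prop := LinearMap.range (cycMap g v) = ⊤

theorem Cyc.ex {g : Module.End F V} {v : V} (h : Cyc g v) (w : V) : ∃ p : F[X], aeval g p v = w :=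
  LinearMap.range_eq_top.1 h w

theorem cyc_ker {g : Module.End F V} {v : V} (h : Cyc g v) (p : F[X]) :
    aeval g p v = 0 ↔ g.charpoly ∣ p := by
  have hm := g.charpoly_monic
  have hmod : ∀ p : F[X], aeval g (p %ₘ g.charpoly) v = aeval g p v := by
    intro p
    conv_rhs => rw [← modByMonic_add_div p g.charpoly]
    rw [map_add, map_mul, LinearMap.aeval_self_charpoly]
    simp
  constructor
  · intro hp
    let φ : degreeLT F (Module.finrank F V) →ₗ[F] V := (cycMap g v).comp (Submodule.subtype _)
    have hmem : ∀ p : F[X], p %ₘ g.charpoly ∈ degreeLT F (Module.finrank F V) := by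
      intro p
      rw [mem_degreeLT]
      have := degree_modByMonic_lt p hm
      rwa [degree_eq_natDegree hm.ne_zero, LinearMap.charpoly_natDegree] at this
    have hs : Function.Surjective φ := by
      intro w
      obtain ⟨p, hp⟩ := h.ex w
      exact ⟨⟨_, hmem p⟩, (hmod p).trans hp⟩
    have hfr : Module.finrank F (degreeLT F (Module.finrank F V)) = Module.finrank F V := by
      rw [(degreeLTEquiv F (Module.finrank F V)).finrank_eq]; simp
    haveI : FiniteDimensional F (degreeLT F (Module.finrank F V)) :=
      Module.Finite.equiv (degreeLTEquiv F (Module.finrank F V)).symm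
    have hi := (LinearMap.injective_iff_surjective_of_finrank_eq_finrank hfr).2 hs
    have h0 : (⟨_, hmem p⟩ : degreeLT F (Module.finrank F V)) = 0 := by
      apply hi
      rw [map_zero]
      exact (hmod p).trans hp
    rw [← modByMonic_eq_zero_iff_dvd hm]
    exact congrArg Subtype.val h0
  · rintro ⟨k, rfl⟩
    rw [map_mul, LinearMap.aeval_self_charpoly]; simp

theorem cyc_equiv {g : Module.End F V} {v : V} (h : Cyc g v) {g' : Module.End F V'} {v' : V'} (h' : Cyc g' v')
    (hP : g.charpoly = g'.charpoly) : ∃ e : V ≃ₗ[F] V', e v = v' ∧ ∀ x, e (g x) = g' (e x) := by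
  have hk : LinearMap.ker (cycMap g v) = LinearMap.ker (cycMap g' v') := by
    ext p
    rw [LinearMap.mem_ker, LinearMap.mem_ker, cycMap_apply, cycMap_apply, cyc_ker h, cyc_ker h', hP]
  let e := ((cycMap g v).quotKerEquivOfSurjective (LinearMap.range_eq_top.1 h)).symm ≪≫ₗ
    (Submodule.quotEquivOfEq _ _ hk) ≪≫ₗ ((cycMap g' v').quotKerEquivOfSurjective (LinearMap.range_eq_top.1 h'))
  have he : ∀ p : F[X], e (aeval g p v) = aeval g' p v' := by
    intro p
    have : ((cycMap g v).quotKerEquivOfSurjective (LinearMap.range_eq_top.1 h)).symm (aeval g p v) =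
        Submodule.Quotient.mk p := by
      rw [LinearEquiv.symm_apply_eq]; rfl
    simp only [e, LinearEquiv.trans_apply, this]
    rfl
  refine ⟨e, ?_, ?_⟩
  · have := he 1; simpa using this
  · intro x
    obtain ⟨p, rfl⟩ := h.ex x
    rw [he]
    have := he (Polynomial.X * p)
    rw [map_mul, map_mul] at this
    simpa using this

theorem cyc_conj {g : Module.End F V} {v : V} (h : Cyc g v) (e : V ≃ₗ[F] V') {g' : Module.End F V'}
    (he : ∀ x, e (g x) = g' (e x)) : Cyc g' (e v) := by
  unfold Cyc
  rw [LinearMap.range_eq_top]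
  intro w
  obtain ⟨p, hp⟩ := h.ex (e.symm w)
  refine ⟨p, ?_⟩
  have := aeval_intertwine (e : V →ₗ[F] V') g' g (by ext x; exact he x) p v
  rw [hp] at this
  simp only [LinearEquiv.coe_coe, LinearEquiv.apply_symm_apply] at this
  exact this.symm

theorem stab_cyc (g : Module.End F V) (v : V) : Stab g (LinearMap.range (cycMap g v)) := by
  rintro _ ⟨p, rfl⟩
  refine ⟨Polynomial.X * p, ?_⟩
  rw [cycMap_apply, map_mul]; simp

theorem mem_cyc (g : Module.End F V) (v : V) : v ∈ LinearMap.range (cycMap g v) := ⟨1, by simp⟩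

theorem range_cyc_nil (g : Module.End F V) (v : V) (W : Submodule F V) (h : Stab g W) (u) :
    LinearMap.range (cycMap (g + nil W u) v) = W ↔ LinearMap.range (cycMap g v) = W := by
  by_cases hv : v ∈ W
  · have : cycMap (g + nil W u) v = cycMap g v := by
      apply LinearMap.ext
      intro p
      have h' := (stab_nil W u g).2 h
      rw [cycMap_apply, cycMap_apply]
      rw [← restrict_aeval W g h p ⟨v, hv⟩, ← restrict_aeval W _ h' p ⟨v, hv⟩, restrict_nil W u g h h']
    rw [this]
  · constructor
    · intro e; exact absurd (e ▸ mem_cyc _ _) hv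
    · intro e; exact absurd (e ▸ mem_cyc _ _) hv

theorem vec_trick1 {χ : Module.End F V → ℂ} (hχ : Prim χ) (m : F[X] → ℂ) (v : V) (hv : v ≠ 0) :
    ∑ g : Module.End F V, χ g * m g.charpoly = ∑ g : Module.End F V, if Cyc g v then χ g * m g.charpoly else 0 := by
  have h1 : ∀ g : Module.End F V, χ g * m g.charpoly = ∑ W : Submodule F V,
      if LinearMap.range (cycMap g v) = W then χ g * m g.charpoly else 0 := by
    intro g; simp
  rw [Finset.sum_congr rfl fun g _ => h1 g, Finset.sum_comm,
    Finset.sum_eq_single (⊤ : Submodule F V)]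
  · rfl
  · intro W _ hW
    by_cases hb : W = ⊥
    · refine Finset.sum_eq_zero fun g _ => if_neg ?_
      rintro rfl
      have := mem_cyc g v
      rw [hb, Submodule.mem_bot] at this
      exact hv this
    refine Eq.trans ?_ (prim_group hχ W hb hW (w := fun g => if LinearMap.range (cycMap g v) = W then m g.charpoly else 0) ?_)
    · refine Finset.sum_congr rfl fun g _ => ?_
      by_cases h : LinearMap.range (cycMap g v) = W
      · rw [if_pos h, if_pos h, if_pos (h ▸ stab_cyc g v)]
      · rw [if_neg h, if_neg h, mul_zero, ite_self]
    · intro g hg u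
      beta_reduce
      rw [charpoly_nil W g hg u, charpoly_sub W g hg]
      simp only [range_cyc_nil g v W hg u]
  · intro h; exact absurd (Finset.mem_univ _) h


theorem vec_trick [Nontrivial V] {χ : Module.End F V → ℂ} (hχ : Prim χ) (m : F[X] → ℂ) (g0 : Module.End F V) (v0 : V) (h0 : Cyc g0 v0)
    (hm : ∀ p, p ≠ g0.charpoly → m p = 0) :
    ((Nat.card V : ℂ) - 1) * ∑ g : Module.End F V, χ g * m g.charpoly =
    Nat.card (V ≃ₗ[F] V) * (χ g0 * m g0.charpoly) := by
  haveI : Finite (V ≃ₗ[F] V) := DFunLike.finite _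
  have hc : ((Nat.card V : ℂ) - 1) = ((Finset.univ.filter (fun v : V => v ≠ 0)).card : ℂ) := by
    rw [Finset.filter_ne', Finset.card_erase_of_mem (Finset.mem_univ _), Finset.card_univ,
      Nat.card_eq_fintype_card, Nat.cast_sub Fintype.card_pos]; simp
  rw [hc, ← nsmul_eq_mul, ← Finset.sum_const,
    Finset.sum_congr rfl fun v hv => vec_trick1 hχ m v (Finset.mem_filter.1 hv).2]
  rw [Nat.card_eq_fintype_card, ← Finset.card_univ, ← nsmul_eq_mul, ← Finset.sum_const]
  rw [← Finset.sum_product', ← Finset.sum_filter_ne_zero]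
  symm
  by_cases hz : χ g0 * m g0.charpoly = 0
  · simp only [hz, Finset.sum_const_zero]
    symm
    refine Finset.sum_eq_zero ?_
    rintro ⟨v, g⟩ hx
    rw [Finset.mem_filter] at hx
    exfalso
    apply hx.2
    by_cases hcy : Cyc g v
    · rw [if_pos hcy]
      by_cases hp : g.charpoly = g0.charpoly
      · obtain ⟨e, -, he⟩ := cyc_equiv hcy h0 hp
        dsimp only
        rw [hp, hχ.cls e g g0 he, hz]
      · dsimp only
        rw [hm _ hp, mul_zero]
    · rw [if_neg hcy]
  have hconj : ∀ e : V ≃ₗ[F] V, ∀ x, e (g0 x) = (e.conj g0) (e x) := by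
    intro e x; simp [LinearEquiv.conj_apply]
  have hv0 : v0 ≠ 0 := by
    rintro rfl
    obtain ⟨w, hw⟩ := exists_ne (0 : V)
    obtain ⟨p, hp⟩ := h0.ex w
    rw [map_zero] at hp
    exact hw hp.symm
  refine Finset.sum_bij (fun e _ => (e v0, e.conj g0)) ?_ ?_ ?_ ?_
  · intro e _
    have hcy := cyc_conj h0 e (hconj e)
    rw [Finset.mem_filter]
    refine ⟨Finset.mem_product.2 ⟨Finset.mem_filter.2 ⟨Finset.mem_univ _, ?_⟩, Finset.mem_univ _⟩, ?_⟩
    · simpa using hv0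
    · dsimp only
      rw [if_pos hcy, LinearEquiv.charpoly_conj, ← hχ.cls e g0 _ (hconj e)]
      exact hz
  · intro e _ e' _ hee
    have h1 : e v0 = e' v0 := congrArg Prod.fst hee
    have h2 : e.conj g0 = e'.conj g0 := congrArg Prod.snd hee
    apply LinearEquiv.ext
    intro x
    obtain ⟨p, rfl⟩ := h0.ex x
    have i1 := aeval_intertwine (e : V →ₗ[F] V) (e.conj g0) g0 (by ext x; exact hconj e x) p v0
    have i2 := aeval_intertwine (e' : V →ₗ[F] V) (e'.conj g0) g0 (by ext x; exact hconj e' x) p v0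
    simp only [LinearEquiv.coe_coe] at i1 i2
    rw [i1, i2, h1, h2]
  · rintro ⟨v, g⟩ hx
    rw [Finset.mem_filter] at hx
    have hcy : Cyc g v := by
      by_contra hcy
      exact hx.2 (if_neg hcy)
    have hp : g.charpoly = g0.charpoly := by
      by_contra hp
      apply hx.2
      dsimp only
      rw [hm _ hp, mul_zero, ite_self]
    obtain ⟨e, he, he2⟩ := cyc_equiv h0 hcy hp.symm
    refine ⟨e, Finset.mem_univ _, ?_⟩
    refine Prod.ext he ?_
    apply LinearMap.ext
    intro x
    change (e.conj g0) x = g x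
    have := hconj e (e.symm x)
    have h3 := he2 (e.symm x)
    rw [LinearEquiv.apply_symm_apply] at this h3
    rw [← this, h3]
  · intro e _
    have hcy := cyc_conj h0 e (hconj e)
    dsimp only
    rw [if_pos hcy, LinearEquiv.charpoly_conj, ← hχ.cls e g0 _ (hconj e)]

/-- every monic polynomial of the right degree is the charpoly of a cyclic endomorphism -/
theorem exists_cyc (P : F[X]) (hP : P.Monic) (hd : P.natDegree = Module.finrank F V) :
    ∃ (g : Module.End F V) (v : V), Cyc g v ∧ g.charpoly = P := by
  let pb := AdjoinRoot.powerBasis' hP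
  haveI : FiniteDimensional F (AdjoinRoot P) := Module.Finite.of_basis pb.basis
  have hfr : Module.finrank F (AdjoinRoot P) = Module.finrank F V := by
    rw [pb.finrank, ← hd]; rfl
  let e := LinearEquiv.ofFinrankEq (AdjoinRoot P) V hfr
  haveI : Finite (AdjoinRoot P) := Finite.of_equiv V e.symm.toEquiv
  let g0 : Module.End F (AdjoinRoot P) := LinearMap.mulLeft F (AdjoinRoot.root P)
  have hev : ∀ p : F[X], aeval g0 p 1 = AdjoinRoot.mk P p := by
    intro p
    have := aeval_algHom_apply (Algebra.lmul F (AdjoinRoot P)) (AdjoinRoot.root P) p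
    rw [show g0 = Algebra.lmul F (AdjoinRoot P) (AdjoinRoot.root P) from rfl, this, AdjoinRoot.aeval_eq]
    simp
  have hc : Cyc g0 1 := by
    unfold Cyc
    rw [LinearMap.range_eq_top]
    intro w
    obtain ⟨p, rfl⟩ := AdjoinRoot.mk_surjective w
    exact ⟨p, hev p⟩
  have hch : g0.charpoly = P := by
    have h1 : P ∣ g0.charpoly := by
      have := hev g0.charpoly
      rw [LinearMap.aeval_self_charpoly] at this
      exact AdjoinRoot.mk_eq_zero.1 this.symm
    refine (eq_of_monic_of_dvd_of_natDegree_le hP g0.charpoly_monic h1 ?_)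
    rw [LinearMap.charpoly_natDegree, hfr, hd]
  refine ⟨e.conj g0, e 1, cyc_conj hc e ?_, ?_⟩
  · intro x; simp [LinearEquiv.conj_apply]
  · rw [LinearEquiv.charpoly_conj, hch]

end
end MK

namespace MK
attribute [local instance] Fintype.ofFinite
attribute [local instance] Classical.propDecidable
section
open Polynomial
variable {F : Type} [Field F]
variable {V V' X Y : Type} [AddCommGroup V] [Module F V] [Finite V]
  [AddCommGroup V'] [Module F V'] [Finite V']
  [AddCommGroup X] [Module F X] [Finite X] [AddCommGroup Y] [Module F Y] [Finite Y]
variable {K : Type} [Field K] [Finite K] [Algebra F K]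

/-- multiplicity of ξ as eigenvalue -/
noncomputable def bet (ξ : K) : PFun F := fun V _ _ _ g =>
  (((g.charpoly).map (algebraMap F K)).rootMultiplicity ξ : ℂ)

theorem bet_inv (ξ : K) : PInv (bet (F := F) ξ) := by
  intro V V' _ _ _ _ _ _ e g g' h
  unfold bet
  rw [charpoly_conj' e g g' h]

theorem map_charpoly_ne (g : Module.End F V) : (g.charpoly).map (algebraMap F K) ≠ 0 :=
  (g.charpoly_monic.map _).ne_zero

theorem bet_add (ξ : K) : PAdd (bet (F := F) ξ) := by
  intro X Y _ _ _ _ _ _ gX gY u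
  unfold bet
  rw [charpoly_ext, Polynomial.map_mul, rootMultiplicity_mul, Nat.cast_add]
  exact mul_ne_zero (map_charpoly_ne _) (map_charpoly_ne _)

theorem bet_sub (ξ : K) (W : Submodule F V) (g : Module.End F V) (h : Stab g W) :
    bet ξ V g = bet ξ W (g.restrict h) + bet ξ (V ⧸ W) (W.mapQ W g h) := by
  unfold bet
  rw [charpoly_sub W g h, Polynomial.map_mul, rootMultiplicity_mul, Nat.cast_add]
  exact mul_ne_zero (map_charpoly_ne _) (map_charpoly_ne _)

noncomputable def RR (ξ : K) : PFun F := mob (bet ξ)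

theorem RR_inv (ξ : K) : PInv (RR (F := F) ξ) := mob_inv (bet_inv ξ)

theorem RR_prim (ξ : K) : Prim (RR (F := F) ξ V) :=
  prim_of (RR_inv ξ) (mob_prim (bet_inv ξ) (bet_add ξ))

theorem bet_eq_zero (ξ : K) (g : Module.End F V) (h : aeval ξ g.charpoly ≠ 0) : bet ξ V g = 0 := by
  unfold bet
  rw [rootMultiplicity_eq_zero, Nat.cast_zero]
  rw [IsRoot.def, eval_map_algebraMap]; exact h

theorem RR_zero (ξ : K) (n : ℕ) : ∀ (V : Type) [AddCommGroup V] [Module F V] [Finite V] (g : Module.End F V),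
    Module.finrank F V = n → aeval ξ g.charpoly ≠ 0 → RR ξ V g = 0 := by
  induction n using Nat.strong_induction_on with
  | _ n ih =>
    intro V _ _ _ g hn h
    unfold RR
    rw [mob_rec, bet_eq_zero ξ g h, zero_sub, neg_eq_zero]
    refine Finset.sum_eq_zero fun U _ => ?_
    by_cases hU : Stab g U ∧ U ≠ ⊤
    · rw [dif_pos hU]
      refine ih (Module.finrank F U) ?_ U _ rfl ?_
      · rw [← hn]; exact Submodule.finrank_lt hU.2
      · intro h0
        apply h
        rw [charpoly_sub U g hU.1, map_mul, h0, zero_mul]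
    · rw [dif_neg hU]

theorem RR_ne (ξ : K) (g : Module.End F V) (h : RR ξ V g ≠ 0) : aeval ξ g.charpoly = 0 := by
  by_contra h0
  exact h (RR_zero ξ _ V g rfl h0)

theorem sum_sub_le {G : PFun F} (hG : PInv G) (W : Submodule F V) (g : Module.End F V) (hW : Stab g W) :
    ∑ U : Submodule F V, (if h : Stab g U ∧ U ≤ W then G U (g.restrict h.1) else 0) =
    ∑ U' : Submodule F W, (if h : Stab (g.restrict hW) U' then G U' ((g.restrict hW).restrict h) else 0) := by
  symm
  refine Finset.sum_of_injOn (fun U' => U'.map W.subtype) ?_ ?_ ?_ ?_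
  · intro A _ B _ h
    exact Submodule.map_injective_of_injective W.injective_subtype h
  · intro _ _; simp
  · intro U _ hU
    rw [dif_neg]
    rintro ⟨_, h⟩
    apply hU
    refine ⟨U.comap W.subtype, by simp, ?_⟩
    change Submodule.map W.subtype (Submodule.comap W.subtype U) = U
    rw [Submodule.map_comap_eq, Submodule.range_subtype, inf_eq_right.2 h]
  · intro U' _
    have hs : Stab (g.restrict hW) U' ↔ (Stab g (U'.map W.subtype) ∧ U'.map W.subtype ≤ W) := by
      constructor
      · intro h
        refine ⟨?_, Submodule.map_subtype_le W U'⟩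
        rintro _ ⟨x, hx, rfl⟩
        exact ⟨_, h x hx, rfl⟩
      · rintro ⟨h, _⟩ x hx
        obtain ⟨y, hy, hxy⟩ := h (x : V) ⟨x, hx, rfl⟩
        have : y = g.restrict hW x := Subtype.ext hxy
        rwa [← this]
    by_cases h : Stab (g.restrict hW) U'
    · rw [dif_pos h, dif_pos (hs.1 h)]
      refine hG _ _ (Submodule.equivSubtypeMap W U') _ _ ?_
      intro x
      rfl
    · rw [dif_neg h, dif_neg (fun h' => h (hs.2 h'))]

theorem mob_diff {β : PFun F} (hβ : PInv β) (W : Submodule F V) (g : Module.End F V) (hW : Stab g W) (hWt : W ≠ ⊤)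
    (hU : ∀ U : Submodule F V, Stab g U → U ≠ ⊤ → U ≤ W) :
    mob β V g = β V g - β W (g.restrict hW) := by
  rw [mob_rec]
  congr 1
  refine Eq.trans ?_ ((sum_sub_le (mob_inv hβ) W g hW).trans (Eq.trans
    (Finset.sum_congr rfl fun U _ => ?_) (mob_sum hβ (g.restrict hW))))
  swap
  · by_cases h : Stab (g.restrict hW) U
    · rw [dif_pos h, dif_pos h]
    · rw [dif_neg h, dif_neg h]
  refine Finset.sum_congr rfl fun U _ => ?_
  by_cases h : Stab g U ∧ U ≠ ⊤
  · rw [dif_pos h, dif_pos ⟨h.1, hU U h.1 h.2⟩]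
  · rw [dif_neg h, dif_neg]
    rintro ⟨ha, hb⟩
    exact h ⟨ha, fun ht => hWt (top_le_iff.1 (ht ▸ hb))⟩

theorem RR_reg [Finite F] (ξ : K) (g : Module.End F V) (v : V) (hc : Cyc g v) (b : ℕ) (hb : 1 ≤ b)
    (hg : g.charpoly = (minpoly F ξ) ^ b) : RR ξ V g = 1 := by
  set f := minpoly F ξ with hf0
  have hIntg : IsIntegral F ξ := Algebra.IsIntegral.isIntegral ξ
  have hf : Irreducible f := minpoly.irreducible hIntg
  have hfm : f.Monic := minpoly.monic hIntg
  set W := LinearMap.range (aeval g f) with hWdef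
  have hW : Stab g W := by
    rintro _ ⟨x, rfl⟩
    refine ⟨g x, ?_⟩
    have := aeval_intertwine g g g rfl f x
    exact this.symm
  have hnt : Nontrivial V := by
    rw [← Module.finrank_pos_iff (R := F), ← g.charpoly_natDegree, hg, hfm.natDegree_pow]
    exact Nat.mul_pos hb hf.natDegree_pos
  have hWt : W ≠ ⊤ := by
    intro h
    have hs : Function.Surjective (aeval g f) := LinearMap.range_eq_top.1 h
    have h0 : aeval g (f ^ b) = 0 := by rw [← hg]; exact g.aeval_self_charpoly
    rw [map_pow] at h0
    obtain ⟨w, hw⟩ := exists_ne (0 : V)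
    have hs' : Function.Surjective ((aeval g f) ^ b) := by
      rw [Module.End.coe_pow]; exact hs.iterate b
    obtain ⟨x, hx⟩ := hs' w
    rw [h0] at hx
    exact hw hx.symm
  have hU : ∀ U : Submodule F V, Stab g U → U ≠ ⊤ → U ≤ W := by
    intro U hUs hUt u hu
    obtain ⟨p, hp⟩ := hc.ex u
    by_cases hd : f ∣ p
    · obtain ⟨r, rfl⟩ := hd
      refine ⟨aeval g r v, ?_⟩
      rw [← hp, map_mul]; rfl
    · exfalso
      have hcop : IsCoprime (f ^ b) p := (hf.coprime_iff_not_dvd.2 hd).pow_left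
      obtain ⟨x, y, hxy⟩ := hcop
      apply hUt
      have hv : v ∈ U := by
        have h1 : aeval g (x * f ^ b + y * p) v = v := by rw [hxy]; simp
        rw [map_add, map_mul, ← hg, g.aeval_self_charpoly, mul_zero, zero_add, map_mul] at h1
        rw [← h1, Module.End.mul_apply, hp]
        exact stab_aeval U g hUs y u hu
      rw [eq_top_iff]
      intro w _
      obtain ⟨r, rfl⟩ := hc.ex w
      exact stab_aeval U g hUs r v hv
  have h1 : RR ξ V g = bet ξ V g - bet ξ W (g.restrict hW) :=
    mob_diff (bet_inv ξ) W g hW hWt hU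
  rw [h1, bet_sub ξ W g hW, add_sub_cancel_left]
  have hcQ : Cyc (W.mapQ W g hW) (W.mkQ v) := by
    unfold Cyc
    rw [LinearMap.range_eq_top]
    intro y
    obtain ⟨x, rfl⟩ := W.mkQ_surjective y
    obtain ⟨p, rfl⟩ := hc.ex x
    exact ⟨p, by rw [cycMap_apply, mapQ_aeval]⟩
  have hQ : (W.mapQ W g hW).charpoly ∣ f := by
    rw [← cyc_ker hcQ, mapQ_aeval]
    simp only [Submodule.mkQ_apply, Submodule.Quotient.mk_eq_zero]
    exact ⟨v, rfl⟩
  have hQf : (W.mapQ W g hW).charpoly = f := by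
    haveI : Nontrivial (V ⧸ W) := Submodule.Quotient.nontrivial_iff.2 hWt
    refine eq_of_monic_of_associated (LinearMap.charpoly_monic _) hfm ?_
    refine (hf.dvd_iff.1 hQ).resolve_left ?_ |>.symm
    intro hu
    have := natDegree_eq_zero_of_isUnit hu
    rw [LinearMap.charpoly_natDegree] at this
    exact (Module.finrank_pos (R := F) (M := V ⧸ W)).ne' this
  unfold bet
  rw [hQf]
  have hle : rootMultiplicity ξ (f.map (algebraMap F K)) ≤ 1 :=
    rootMultiplicity_le_one_of_separable ((PerfectField.separable_of_irreducible hf).map) ξ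
  have hge : 0 < rootMultiplicity ξ (f.map (algebraMap F K)) := by
    rw [rootMultiplicity_pos (hfm.map _).ne_zero, IsRoot.def, eval_map_algebraMap]
    exact minpoly.aeval F ξ
  rw [show rootMultiplicity ξ (f.map (algebraMap F K)) = 1 by omega]; simp

end
end MK

namespace MK
attribute [local instance] Fintype.ofFinite
attribute [local instance] Classical.propDecidable
section
open Polynomial
variable {F : Type} [Field F] [Finite F]
variable {K : Type} [Field K] [Finite K] [Algebra F K]

/-- iterated Frobenius -/
noncomputable def frob (F K : Type) [Field F] [Finite F] [Field K] [Algebra F K] (i : ℕ) : K →ₐ[F] K :=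
  (FiniteField.frobeniusAlgHom F K) ^ i

theorem frob_apply (i : ℕ) (x : K) : frob F K i x = x ^ (Nat.card F) ^ i := by
  unfold frob
  induction i generalizing x with
  | zero => simp
  | succ i ih =>
    rw [pow_succ, AlgHom.mul_apply, ih, FiniteField.frobeniusAlgHom_apply, Nat.card_eq_fintype_card, ← pow_mul,
      pow_succ']

theorem pow_card_mem (x : K) (h : x ^ Nat.card F = x) : x ∈ Set.range (algebraMap F K) := by
  rw [IsGalois.mem_range_algebraMap_iff_fixed]
  intro σ
  obtain ⟨n, hn⟩ := (FiniteField.bijective_frobeniusAlgEquivOfAlgebraic_pow F K).2 σ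
  rw [← hn]
  have h1 : FiniteField.frobeniusAlgEquivOfAlgebraic F K x = x := by
    rw [FiniteField.coe_frobeniusAlgEquivOfAlgebraic, ← Nat.card_eq_fintype_card]; exact h
  dsimp only
  generalize (n : ℕ) = m
  induction m with
  | zero => simp
  | succ m ih => rw [pow_succ, AlgEquiv.mul_apply, h1, ih]

theorem eq_pow_of_factors (f : F[X]) (hf : f.Monic) (hf1 : f.natDegree ≠ 0) (n : ℕ) : ∀ Q : F[X], Q.natDegree = n → Q.Monic →
    (∀ r : F[X], r.Monic → r.natDegree ≠ 0 → r ∣ Q → f ∣ r) → ∃ b, Q = f ^ b := by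
  induction n using Nat.strong_induction_on with
  | _ n ih =>
    intro Q hn hQ h
    by_cases h0 : Q.natDegree = 0
    · exact ⟨0, by rw [pow_zero]; exact (hQ.natDegree_eq_zero.1 h0)⟩
    · obtain ⟨Q1, rfl⟩ := h Q hQ h0 dvd_rfl
      have hQ1 : Q1.Monic := hf.of_mul_monic_left hQ
      obtain ⟨b, hb⟩ := ih Q1.natDegree (by rw [← hn, hf.natDegree_mul hQ1]; omega) Q1 rfl hQ1
        (fun r hr hr0 hd => h r hr hr0 (hd.mul_left f))
      exact ⟨b + 1, by rw [hb, pow_succ']⟩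

/-- minpoly to the power giving degree n -/
noncomputable def pol (F : Type) [Field F] {K : Type} [Field K] [Algebra F K] (n : ℕ) (η : K) : F[X] :=
  (minpoly F η) ^ (n / (minpoly F η).natDegree)

theorem minpoly_pos (η : K) : 0 < (minpoly F η).natDegree :=
  minpoly.natDegree_pos (Algebra.IsIntegral.isIntegral η)

theorem minpoly_mon (η : K) : (minpoly F η).Monic :=
  minpoly.monic (Algebra.IsIntegral.isIntegral η)

theorem eq_pol (n b : ℕ) (η : K) (Q : F[X]) (hn : Q.natDegree = n) (h : Q = (minpoly F η) ^ b) :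
    (minpoly F η).natDegree ∣ n ∧ Q = pol F n η ∧ b = n / (minpoly F η).natDegree := by
  have : n = b * (minpoly F η).natDegree := by rw [← hn, h, (minpoly_mon η).natDegree_pow]
  have h2 : b = n / (minpoly F η).natDegree := by
    rw [this, Nat.mul_div_cancel _ (minpoly_pos η)]
  exact ⟨⟨b, by rw [this, mul_comm]⟩, by rw [h, h2]; rfl, h2⟩

theorem pol_map (n : ℕ) (η : K) (h : η ^ (Nat.card F) ^ n = η) :
    (minpoly F η).natDegree ∣ n ∧
    (pol F n η).map (algebraMap F K) = ∏ i ∈ Finset.range n, (Polynomial.X - C (η ^ (Nat.card F) ^ i)) := by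
  set Q := ∏ i ∈ Finset.range n, (Polynomial.X - C (η ^ (Nat.card F) ^ i)) with hQdef
  have hQm : Q.Monic := monic_prod_of_monic _ _ fun i _ => monic_X_sub_C _
  have hQd : Q.natDegree = n := by
    rw [hQdef, natDegree_prod_of_monic _ _ fun i _ => monic_X_sub_C _]; simp only [natDegree_X_sub_C]; simp
  have hfix : Q.map (frob F K 1 : K →+* K) = Q := by
    rw [hQdef, Polynomial.map_prod]
    have h1 : ∀ i ∈ Finset.range n, Polynomial.map (frob F K 1 : K →+* K) (Polynomial.X - C (η ^ (Nat.card F) ^ i)) =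
        Polynomial.X - C (η ^ (Nat.card F) ^ (i+1)) := by
      intro i _
      rw [Polynomial.map_sub, map_X, map_C]
      congr 2
      rw [RingHom.coe_coe, frob_apply, pow_one, ← pow_mul, ← pow_succ]
    rw [Finset.prod_congr rfl h1]
    rcases n with _ | n
    · simp
    · rw [Finset.prod_range_succ, Finset.prod_range_succ', h]
      simp
  have hl : Q ∈ lifts (algebraMap F K) := by
    rw [lifts_iff_coeff_lifts]
    intro m
    apply pow_card_mem
    have := congrArg (fun p => coeff p m) hfix
    simp only [coeff_map, RingHom.coe_coe, frob_apply, pow_one] at this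
    exact this
  obtain ⟨Q0, hQ0, hd, hm⟩ := lifts_and_natDegree_eq_and_monic hl hQm
  obtain ⟨b, hb⟩ := eq_pow_of_factors (minpoly F η) (minpoly_mon η) (minpoly_pos η).ne' _ Q0 rfl hm (by
    intro r hr hr0 hrd
    have h1 : (r.map (algebraMap F K)) ∣ Q := by rw [← hQ0]; exact Polynomial.map_dvd _ hrd
    have h2 : Q.Splits := Splits.prod fun i _ => Splits.X_sub_C _
    have h3 := h2.of_dvd hQm.ne_zero h1
    obtain ⟨x, hx⟩ := h3.exists_eval_eq_zero (by
      rw [degree_map]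
      intro h0
      exact hr0 (natDegree_eq_of_degree_eq_some h0))
    have hxQ : Q.eval x = 0 := eval_eq_zero_of_dvd_of_eval_eq_zero h1 hx
    rw [hQdef, eval_prod, Finset.prod_eq_zero_iff] at hxQ
    obtain ⟨i, _, hi⟩ := hxQ
    rw [eval_sub, eval_X, eval_C, sub_eq_zero, ← frob_apply] at hi
    rw [eval_map_algebraMap, hi, aeval_algHom_apply] at hx
    apply minpoly.dvd
    exact (map_eq_zero_iff _ (frob F K i).toRingHom.injective).1 hx)
  obtain ⟨h1, h2, _⟩ := eq_pol n b η Q0 (by rw [hd, hQd]) hb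
  exact ⟨h1, by rw [← h2, hQ0]⟩

theorem frob_of_dvd (n : ℕ) (η : K) (h : (minpoly F η).natDegree ∣ n) : η ^ (Nat.card F) ^ n = η := by
  obtain ⟨c, rfl⟩ := h
  have h1 : η ^ (Nat.card F) ^ (minpoly F η).natDegree = η := by
    have hIntg : IsIntegral F η := Algebra.IsIntegral.isIntegral η
    have hfr := IntermediateField.adjoin.finrank hIntg
    have hc : Nat.card (IntermediateField.adjoin F {η}) = Nat.card F ^ (minpoly F η).natDegree := by
      rw [← hfr, Module.natCard_eq_pow_finrank (K := F)]
    rw [← hc]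
    have := FiniteField.pow_card (IntermediateField.AdjoinSimple.gen F η)
    have h2 := congrArg (fun x : IntermediateField.adjoin F {η} => (x : K)) this
    simp only [IntermediateField.coe_pow, IntermediateField.AdjoinSimple.coe_gen] at h2
    rwa [Nat.card_eq_fintype_card]
  rw [pow_mul]
  generalize (Nat.card F) ^ (minpoly F η).natDegree = Q at h1 ⊢
  induction c with
  | zero => simp
  | succ c ih => rw [pow_succ, pow_mul, ih, h1]

theorem mult_pow (η ξ : K) (hη : aeval η (minpoly F ξ) = 0) (b : ℕ) :
    (((minpoly F ξ) ^ b).map (algebraMap F K)).rootMultiplicity η = b := by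
  have hf : Irreducible (minpoly F ξ) := minpoly.irreducible (Algebra.IsIntegral.isIntegral ξ)
  have hne : (minpoly F ξ).map (algebraMap F K) ≠ 0 := ((minpoly_mon ξ).map _).ne_zero
  have hle : rootMultiplicity η ((minpoly F ξ).map (algebraMap F K)) ≤ 1 :=
    rootMultiplicity_le_one_of_separable ((PerfectField.separable_of_irreducible hf).map) η
  have hge : 0 < rootMultiplicity η ((minpoly F ξ).map (algebraMap F K)) := by
    rw [rootMultiplicity_pos hne, IsRoot.def, eval_map_algebraMap]
    exact hη
  rw [Polynomial.map_pow]
  induction b with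
  | zero => simp
  | succ b ih =>
    rw [pow_succ, rootMultiplicity_mul (mul_ne_zero (pow_ne_zero _ hne) hne), ih]; omega

theorem minpoly_conj (η ξ : K) (h : aeval η (minpoly F ξ) = 0) : minpoly F η = minpoly F ξ :=
  (minpoly.eq_of_irreducible_of_monic (minpoly.irreducible (Algebra.IsIntegral.isIntegral ξ)) h (minpoly_mon ξ)).symm

end
section
open Polynomial
variable {F : Type} [Field F] [Finite F]
variable {K : Type} [Field K] [Finite K] [Algebra F K]
variable {V V' X Y : Type} [AddCommGroup V] [Module F V] [Finite V] [Nontrivial V]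

/-- the total of χ against the multiplicity of ξ -/
noncomputable def BB (χ : Module.End F V → ℂ) (ξ : K) : ℂ := ∑ g, χ g * bet ξ V g

theorem prim_charpoly {χ : Module.End F V → ℂ} (hχ : Prim χ) (g : Module.End F V) (hg : χ g ≠ 0) (ξ : K)
    (h : aeval ξ g.charpoly = 0) : (minpoly F ξ).natDegree ∣ Module.finrank F V ∧
      g.charpoly = pol F (Module.finrank F V) ξ := by
  obtain ⟨b, hb⟩ := prim_supp hχ g hg ξ h
  obtain ⟨h1, h2, _⟩ := eq_pol _ b ξ g.charpoly g.charpoly_natDegree hb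
  exact ⟨h1, h2⟩

theorem BB_weight {χ : Module.End F V → ℂ} (hχ : Prim χ) (ξ : K) (h : F[X] → ℂ) :
    ∑ g, χ g * h g.charpoly * bet ξ V g = h (pol F (Module.finrank F V) ξ) * BB χ ξ := by
  unfold BB
  rw [Finset.mul_sum]
  refine Finset.sum_congr rfl fun g _ => ?_
  by_cases h0 : χ g = 0
  · rw [h0]; ring
  by_cases h1 : aeval ξ g.charpoly = 0
  · rw [(prim_charpoly hχ g h0 ξ h1).2]; ring
  · rw [bet_eq_zero ξ g h1]; ring

theorem BB_RR {χ : Module.End F V → ℂ} (hχ : Prim χ) (ξ : K) (h : F[X] → ℂ) :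
    ∑ g, χ g * h g.charpoly * RR ξ V g = h (pol F (Module.finrank F V) ξ) * BB χ ξ := by
  rw [← BB_weight hχ]
  exact prim_mob hχ (bet_inv ξ) (bet_add ξ) (m := fun g => h g.charpoly) (fun W => uinv_charpoly h W)

theorem BB_zero {χ : Module.End F V → ℂ} (hχ : Prim χ) (ξ : K)
    (h : ξ ^ (Nat.card F) ^ (Module.finrank F V) ≠ ξ) : BB χ ξ = 0 := by
  unfold BB
  refine Finset.sum_eq_zero fun g _ => ?_
  by_cases h0 : χ g = 0
  · rw [h0]; ring
  by_cases h1 : aeval ξ g.charpoly = 0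
  · exact absurd (frob_of_dvd _ ξ (prim_charpoly hχ g h0 ξ h1).1) h
  · rw [bet_eq_zero ξ g h1]; ring

/-- K splits all characteristic polynomials -/
def SplitsAll (F V K : Type) [Field F] [Field K] [Algebra F K] [AddCommGroup V] [Module F V] [Finite V] : Prop :=
  ∀ g : Module.End F V, ((g.charpoly).map (algebraMap F K)).Splits

theorem sum_rootMult (P : K[X]) (h : P.Splits) : ∑ ξ : K, P.rootMultiplicity ξ = P.natDegree := by
  rw [h.natDegree_eq_card_roots, ← Multiset.sum_count_eq_card (s := Finset.univ) (fun _ _ => Finset.mem_univ _)]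
  refine Finset.sum_congr rfl fun x _ => ?_
  convert (count_roots P).symm

theorem sum_bet (hK : SplitsAll F V K) (g : Module.End F V) : ∑ ξ : K, bet ξ V g = Module.finrank F V := by
  unfold bet
  rw [← Nat.cast_sum, sum_rootMult _ (hK g), natDegree_map, g.charpoly_natDegree]

theorem prim_expand (hK : SplitsAll F V K) {χ : Module.End F V → ℂ} (hχ : Prim χ) (h : F[X] → ℂ) :
    (Module.finrank F V : ℂ) * ∑ g, χ g * h g.charpoly =
      ∑ ξ : K, h (pol F (Module.finrank F V) ξ) * BB χ ξ := by
  simp only [← BB_weight hχ]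
  rw [Finset.sum_comm, Finset.mul_sum]
  refine Finset.sum_congr rfl fun g _ => ?_
  rw [← Finset.mul_sum, sum_bet hK]; ring

theorem BB_vec {χ : Module.End F V → ℂ} (hχ : Prim χ) (ξ : K) (g0 : Module.End F V) (v0 : V) (h0 : Cyc g0 v0)
    (hg : g0.charpoly = pol F (Module.finrank F V) ξ) :
    ((Nat.card V : ℂ) - 1) * BB χ ξ = Nat.card (V ≃ₗ[F] V) * (χ g0 * bet ξ V g0) := by
  have := vec_trick hχ (fun p => if p = g0.charpoly then (((p).map (algebraMap F K)).rootMultiplicity ξ : ℂ) else 0)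
    g0 v0 h0 (fun p hp => if_neg hp)
  rw [if_pos rfl] at this
  rw [show bet ξ V g0 = (((g0.charpoly).map (algebraMap F K)).rootMultiplicity ξ : ℂ) from rfl, ← this]
  congr 1
  unfold BB
  refine Finset.sum_congr rfl fun g _ => ?_
  by_cases h0 : χ g = 0
  · rw [h0]; ring
  by_cases h1 : aeval ξ g.charpoly = 0
  · rw [if_pos (by rw [hg, (prim_charpoly hχ g h0 ξ h1).2])]; rfl
  · rw [bet_eq_zero ξ g h1]
    have := bet_eq_zero ξ g h1
    unfold bet at this
    rw [this]; simp

theorem pol_monic (n : ℕ) (ξ : K) : (pol F n ξ).Monic := (minpoly_mon ξ).pow _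

theorem pol_natDegree (n : ℕ) (ξ : K) (h : ξ ^ (Nat.card F) ^ n = ξ) : (pol F n ξ).natDegree = n := by
  unfold pol
  rw [(minpoly_mon ξ).natDegree_pow, Nat.div_mul_cancel (pol_map n ξ h).1]

theorem exists_pol (ξ : K) (h : ξ ^ (Nat.card F) ^ (Module.finrank F V) = ξ) :
    ∃ (g : Module.End F V) (v : V), Cyc g v ∧ g.charpoly = pol F (Module.finrank F V) ξ :=
  exists_cyc _ (pol_monic _ ξ) (pol_natDegree _ ξ h)

theorem RR_pol (η ξ : K) (h : ξ ^ (Nat.card F) ^ (Module.finrank F V) = ξ) (g : Module.End F V) (v : V)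
    (hc : Cyc g v) (hg : g.charpoly = pol F (Module.finrank F V) ξ) :
    RR η V g = if aeval η (minpoly F ξ) = 0 then 1 else 0 := by
  split_ifs with h1
  · refine RR_reg η g v hc _ ?_ (by rw [minpoly_conj η ξ h1]; exact hg)
    exact Nat.div_pos (Nat.le_of_dvd Module.finrank_pos (pol_map _ ξ h).1) (minpoly_pos ξ)
  · apply RR_zero η _ V g rfl
    rw [hg]
    unfold pol
    rw [map_pow]
    exact pow_ne_zero _ h1

theorem BB_RR_RR (η ξ : K) (h : ξ ^ (Nat.card F) ^ (Module.finrank F V) = ξ) :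
    ((Nat.card V : ℂ) - 1) * BB (F := F) (RR η V) ξ = Nat.card (V ≃ₗ[F] V) *
      (((pol F (Module.finrank F V) ξ).map (algebraMap F K)).rootMultiplicity η : ℂ) := by
  obtain ⟨g, v, hc, hg⟩ := exists_pol (V := V) ξ h
  rw [BB_vec (RR_prim η) ξ g v hc hg, RR_pol η ξ h g v hc hg]
  congr 1
  split_ifs with h1
  · unfold bet
    rw [hg]
    unfold pol
    rw [mult_pow η ξ h1, mult_pow ξ ξ (minpoly.aeval F ξ)]; simp
  · rw [rootMultiplicity_eq_zero]
    · simp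
    · rw [IsRoot.def, eval_map_algebraMap]
      unfold pol
      rw [map_pow]
      exact pow_ne_zero _ h1

theorem sum_mult_prod (w : K → ℂ) (n : ℕ) (a : ℕ → K) :
    ∑ η : K, w η * ((∏ i ∈ Finset.range n, (Polynomial.X - C (a i))).rootMultiplicity η : ℂ) =
      ∑ i ∈ Finset.range n, w (a i) := by
  induction n with
  | zero => simp [← C_1, -map_one]
  | succ n ih =>
    rw [Finset.sum_range_succ, ← ih, ← Finset.sum_ite_eq' Finset.univ (a n) w |>.trans (if_pos (Finset.mem_univ _)),
      ← Finset.sum_add_distrib]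
    refine Finset.sum_congr rfl fun η _ => ?_
    rw [Finset.prod_range_succ, rootMultiplicity_mul, rootMultiplicity_X_sub_C]
    · push_cast; split_ifs <;> ring
    · exact mul_ne_zero (monic_prod_of_monic _ _ fun i _ => monic_X_sub_C _).ne_zero (X_sub_C_ne_zero _)

/-- R_w = ∑ w(η) R_η -/
noncomputable def Rw (w : K → ℂ) : PFun F := fun V _ _ _ g => ∑ η : K, w η * RR η V g

theorem prim_sum {ι : Type} (s : Finset ι) (c : ι → ℂ) (χ : ι → Module.End F V → ℂ) (h : ∀ i, Prim (χ i)) :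
    Prim (fun g => ∑ i ∈ s, c i * χ i g) := by
  refine ⟨fun e g g' hg => Finset.sum_congr rfl fun i _ => by rw [(h i).cls e g g' hg], fun W h1 h2 g hg => ?_⟩
  rw [Finset.sum_comm]
  refine Finset.sum_eq_zero fun i _ => ?_
  rw [← Finset.mul_sum, (h i).cusp W h1 h2 g hg, mul_zero]

theorem Rw_prim (w : K → ℂ) : Prim (Rw (F := F) w V) := prim_sum _ _ _ fun η => RR_prim η

theorem BB_Rw (w : K → ℂ) (ξ : K) (h : ξ ^ (Nat.card F) ^ (Module.finrank F V) = ξ) :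
    ((Nat.card V : ℂ) - 1) * BB (F := F) (Rw w V) ξ = Nat.card (V ≃ₗ[F] V) *
      ∑ i ∈ Finset.range (Module.finrank F V), w (ξ ^ (Nat.card F) ^ i) := by
  rw [← sum_mult_prod, ← (pol_map _ ξ h).2, Finset.mul_sum]
  have : BB (F := F) (Rw w V) ξ = ∑ η : K, w η * BB (F := F) (RR η V) ξ := by
    unfold BB Rw
    simp only [Finset.mul_sum, Finset.sum_mul]
    rw [Finset.sum_comm]
    refine Finset.sum_congr rfl fun η _ => Finset.sum_congr rfl fun g _ => by ring
  rw [this, Finset.mul_sum]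
  refine Finset.sum_congr rfl fun η _ => ?_
  have := BB_RR_RR (F := F) (V := V) η ξ h
  linear_combination w η * this

end
end MK

namespace MK
attribute [local instance] Fintype.ofFinite
attribute [local instance] Classical.propDecidable
section
open Polynomial
variable {F : Type} [Field F] [Finite F]
variable {V V' X Y : Type} [AddCommGroup V] [Module F V] [Finite V]
  [AddCommGroup V'] [Module F V'] [Finite V']
  [AddCommGroup X] [Module F X] [Finite X] [AddCommGroup Y] [Module F Y] [Finite Y]
variable {K : Type} [Field K] [Finite K] [Algebra F K]

theorem sum_fiber_AB (A : Submodule F X) (B : Submodule F Y) (f : Submodule F (X × Y) → ℂ) (c : ℂ)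
    (hf : ∀ t : Y →ₗ[F] X, f ((A.prod B).map (shear t : (X × Y) →ₗ[F] (X × Y))) = c) :
    (Nat.card (HH A B) : ℂ) * ∑ U ∈ Finset.univ.filter (fun U : Submodule F (X × Y) =>
        (U.comap (LinearMap.inl F X Y), U.map (LinearMap.snd F X Y)) = (A, B)), f U =
      Nat.card (Y →ₗ[F] X) * c := by
  have s1 : ∑ t : Y →ₗ[F] X, f ((A.prod B).map (shear t : (X × Y) →ₗ[F] (X × Y))) =
      Nat.card (Y →ₗ[F] X) * c := by
    rw [Finset.sum_congr rfl (fun t _ => hf t)]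
    rw [Finset.sum_const, nsmul_eq_mul, Finset.card_univ, Nat.card_eq_fintype_card]
  rw [← s1]
  rw [← Finset.sum_fiberwise_of_maps_to (t := Finset.univ.filter (fun U : Submodule F (X × Y) =>
        (U.comap (LinearMap.inl F X Y), U.map (LinearMap.snd F X Y)) = (A, B)))
        (g := fun t : Y →ₗ[F] X => (A.prod B).map (shear t : (X × Y) →ₗ[F] (X × Y)))]
  · rw [Finset.mul_sum]
    refine Finset.sum_congr rfl fun U hU => ?_
    have hU' := (Finset.mem_filter.1 hU).2
    obtain ⟨t0, rfl⟩ := exists_shear U A B (congrArg Prod.fst hU') (congrArg Prod.snd hU')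
    rw [Finset.sum_congr rfl (g := fun _ => f ((A.prod B).map (shear t0 : (X × Y) →ₗ[F] (X × Y))))
      (fun t ht => by rw [(Finset.mem_filter.1 ht).2])]
    rw [Finset.sum_const, nsmul_eq_mul]
    congr 2
    rw [← Fintype.card_subtype, ← Nat.card_eq_fintype_card]
    refine Nat.card_congr ?_
    refine ((Equiv.subRight t0).subtypeEquiv ?_).symm
    intro t
    exact shear_eq_iff t t0 A B
  · intro t _
    refine Finset.mem_filter.2 ⟨Finset.mem_univ _, ?_⟩
    rw [shear_map_comap, shear_map_snd]

theorem card_sub (S : Submodule F V) : Nat.card S = Nat.card F ^ (Module.finrank F S) :=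
  Module.natCard_eq_pow_finrank

/-- sum over subspaces of a function of the dimension, for F × Y -/
theorem sum_sub_line (φ : ℕ → ℂ) :
    ∑ U : Submodule F (F × Y), φ (Module.finrank F U) = ∑ B : Submodule F Y,
      (φ (Module.finrank F B + 1) + (Nat.card F : ℂ) ^ (Module.finrank F B) * φ (Module.finrank F B)) := by
  have hfr : ∀ (A : Submodule F F) (B : Submodule F Y) (t : Y →ₗ[F] F),
      Module.finrank F ((A.prod B).map (shear t : (F × Y) →ₗ[F] (F × Y))) =
        Module.finrank F A + Module.finrank F B := by
    intro A B t
    rw [LinearEquiv.finrank_map_eq, (prodEqv A B).finrank_eq, Module.finrank_prod]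
  have key := fun (A : Submodule F F) (B : Submodule F Y) =>
    sum_fiber_AB A B (fun U => φ (Module.finrank F U)) (φ (Module.finrank F A + Module.finrank F B))
      (fun t => by rw [hfr])
  have nH : ∀ (A : Submodule F F) (B : Submodule F Y), (Nat.card (HH A B) : ℂ) ≠ 0 :=
    fun A B => Nat.cast_ne_zero.2 Nat.card_pos.ne'
  rw [← Finset.sum_fiberwise (s := Finset.univ) (g := fun U : Submodule F (F × Y) =>
        (U.comap (LinearMap.inl F F Y), U.map (LinearMap.snd F F Y)))]
  rw [show (Finset.univ : Finset (Submodule F F × Submodule F Y)) = Finset.univ ×ˢ Finset.univ by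
    ext; simp, Finset.sum_product_right]
  refine Finset.sum_congr rfl fun B _ => ?_
  rw [show (Finset.univ : Finset (Submodule F F)) = {⊤, ⊥} by
    ext A
    simp only [Finset.mem_univ, Finset.mem_insert, Finset.mem_singleton, true_iff]
    by_cases hA : A = ⊥
    · exact Or.inr hA
    · left
      obtain ⟨a, ha, ha0⟩ := Submodule.exists_mem_ne_zero_of_ne_bot hA
      rw [eq_top_iff]
      intro x _
      have := A.smul_mem (x * a⁻¹) ha
      rwa [smul_eq_mul, mul_assoc, inv_mul_cancel₀ ha0, mul_one] at this]
  have htb : (⊤ : Submodule F F) ≠ ⊥ := by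
    intro h
    have h1 : (1 : F) ∈ (⊤ : Submodule F F) := Submodule.mem_top
    rw [h] at h1
    exact one_ne_zero ((Submodule.mem_bot F).1 h1)
  rw [Finset.sum_pair htb]
  congr 1
  · refine mul_left_cancel₀ (nH ⊤ B) ?_
    rw [key]
    have : HH (⊤ : Submodule F F) B = ⊤ := by
      ext u; simp [HH]
    rw [this, finrank_top, Module.finrank_self, add_comm 1]
    congr 2
    exact Nat.card_congr (LinearEquiv.toEquiv Submodule.topEquiv).symm
  · refine mul_left_cancel₀ (nH ⊥ B) ?_
    rw [key, finrank_bot F F, zero_add, ← mul_assoc]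
    congr 1
    have e : Nat.card (HH (⊥ : Submodule F F) B) = Nat.card B.dualAnnihilator :=
      Nat.card_congr (Equiv.subtypeEquivRight fun u => (by
        rw [Submodule.mem_dualAnnihilator]
        exact Iff.rfl))
    rw [e]
    have h1 : Nat.card B.dualAnnihilator = Nat.card F ^ (Module.finrank F B.dualAnnihilator) := by
      exact card_sub (V := Y →ₗ[F] F) B.dualAnnihilator
    have h2 : Nat.card (Y →ₗ[F] F) = Nat.card F ^ (Module.finrank F (Y →ₗ[F] F)) :=
      Module.natCard_eq_pow_finrank
    have h3 := Subspace.finrank_add_finrank_dualAnnihilator_eq B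
    have h4 : Module.finrank F (Y →ₗ[F] F) = Module.finrank F Y := Subspace.dual_finrank_eq
    rw [h1, h2, h4, ← h3]
    push_cast; ring

/-- inversion: a function of dimension with vanishing sums vanishes -/
theorem sub_inversion (φ : ℕ → ℂ) (h : ∀ n : ℕ, ∑ B : Submodule F (Fin n → F), φ (Module.finrank F B) = 0) (n : ℕ) :
    φ n = 0 := by
  induction n using Nat.strong_induction_on with
  | _ n ih =>
    have := h n
    rw [← Finset.add_sum_erase _ _ (Finset.mem_univ ⊤), Finset.sum_eq_zero, add_zero, finrank_top] at this
    · simpa using this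
    · intro U hU
      apply ih
      have := Submodule.finrank_lt (Finset.ne_of_mem_erase hU)
      simpa using this

noncomputable def aa (F : Type) [Field F] [Finite F] (K : Type) [Field K] [Finite K] [Algebra F K] (d : ℕ) : ℂ :=
  RR (F := F) (1 : K) (Fin d → F) 1

theorem RR_aa (V : Type) [AddCommGroup V] [Module F V] [Finite V] :
    RR (F := F) (1 : K) V 1 = aa F K (Module.finrank F V) := by
  unfold aa
  have e : V ≃ₗ[F] (Fin (Module.finrank F V) → F) :=
    LinearEquiv.ofFinrankEq _ _ (by simp)
  exact RR_inv 1 _ _ e 1 1 fun _ => rfl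

theorem sum_aa (V : Type) [AddCommGroup V] [Module F V] [Finite V] :
    ∑ U : Submodule F V, aa F K (Module.finrank F U) = Module.finrank F V := by
  have h := mob_sum (bet_inv (F := F) (1 : K)) (1 : Module.End F V)
  have h2 : bet (1 : K) V (1 : Module.End F V) = Module.finrank F V := by
    unfold bet
    rw [LinearMap.charpoly_one, Polynomial.map_pow, Polynomial.map_sub, map_X, Polynomial.map_one,
      ← C_1, rootMultiplicity_X_sub_C_pow]
  rw [← h2, ← h]
  refine Finset.sum_congr rfl fun U _ => ?_
  rw [dif_pos (show Stab (1 : Module.End F V) U from fun x hx => hx)]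
  rw [← RR_aa]
  rfl

theorem aa_rec (j : ℕ) : aa F K (j + 1) = (1 - (Nat.card F : ℂ) ^ j) * aa F K j + if j = 0 then 1 else 0 := by
  let φ : ℕ → ℂ := fun j => aa F K (j + 1) + (Nat.card F : ℂ) ^ j * aa F K j - aa F K j - (if j = 0 then 1 else 0)
  suffices H : φ j = 0 by
    simp only [φ] at H
    linear_combination H
  refine sub_inversion (F := F) φ (fun n => ?_) j
  simp only [φ]
  rw [Finset.sum_sub_distrib, Finset.sum_sub_distrib, ← sum_sub_line (fun d => aa F K d), sum_aa, sum_aa]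
  rw [Module.finrank_prod, Module.finrank_self]
  rw [Finset.sum_eq_single_of_mem ⊥ (Finset.mem_univ _)]
  · simp
  · intro B _ hB
    rw [if_neg]
    rwa [Submodule.finrank_eq_zero]

theorem aa_eq (j : ℕ) : aa F K (j + 1) = ∏ i ∈ Finset.range j, (1 - (Nat.card F : ℂ) ^ (i + 1)) := by
  induction j with
  | zero => rw [aa_rec]; simp
  | succ j ih => rw [aa_rec, ih, Finset.prod_range_succ]; simp [mul_comm]

theorem aa_ne (j : ℕ) : aa F K (j + 1) ≠ 0 := by
  rw [aa_eq, Finset.prod_ne_zero_iff]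
  intro i _ h
  have h1 : ((Nat.card F : ℂ)) ^ (i+1) = 1 := by linear_combination -h
  have h2 : (Nat.card F) ^ (i+1) = 1 := by exact_mod_cast h1
  have : 1 < Nat.card F := Finite.one_lt_card
  exact absurd h2 (Nat.one_lt_pow (by omega) this).ne'

theorem Rw_one [Nontrivial V] (w : K → ℂ) : Rw (F := F) w V 1 = w 1 * aa F K (Module.finrank F V) := by
  unfold Rw
  rw [Finset.sum_eq_single_of_mem 1 (Finset.mem_univ _), RR_aa]
  intro η _ h
  rw [RR_zero η _ V 1 rfl, mul_zero]
  rw [LinearMap.charpoly_one]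
  simp only [map_pow, map_sub, aeval_X, map_one]
  exact pow_ne_zero _ (sub_ne_zero.2 h)

end
end MK

namespace MK
attribute [local instance] Fintype.ofFinite
attribute [local instance] Classical.propDecidable
section
open scoped Kronecker

lemma trace_int {ι : Type} [Fintype ι] [DecidableEq ι] (M : Matrix ι ι ℂ) (N : ℕ) (hN : 0 < N)
    (h : M ^ (N + 1) = M) : IsIntegral ℤ M.trace := by
  rcases isEmpty_or_nonempty ι with hι | hι
  · simp [Matrix.trace]; exact isIntegral_zero
  rw [Matrix.trace_eq_sum_roots_charpoly]
  refine IsIntegral.multiset_sum fun r hr => ?_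
  have hr1 : r ∈ spectrum ℂ M := by
    rw [Matrix.mem_spectrum_iff_isRoot_charpoly]
    exact (Polynomial.mem_roots'.1 hr).2
  have h2 := spectrum.subset_polynomial_aeval M (Polynomial.X ^ (N + 1) - Polynomial.X)
    ⟨r, hr1, rfl⟩
  have h3 : Polynomial.aeval M (Polynomial.X ^ (N + 1) - Polynomial.X : Polynomial ℂ) = 0 := by
    simp [h]
  rw [h3, spectrum.zero_eq] at h2
  simp at h2
  refine ⟨Polynomial.X ^ (N + 1) - Polynomial.X, ?_, ?_⟩
  · exact Polynomial.monic_X_pow_sub (n := N + 1) (by rw [Polynomial.degree_X]; exact_mod_cast (by omega))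
  · simp [h2]

variable {Γ : Type} [Group Γ] [Finite Γ]

lemma avg_int {ι : Type} [Fintype ι] [DecidableEq ι] (ρ : Γ →* Matrix ι ι ℂ) (A : Matrix ι ι ℂ) (N : ℕ) (hN : 0 < N)
    (hA : A ^ N = 1) (hc : ∀ γ, A * ρ γ = ρ γ * A) :
    IsIntegral ℤ ((Nat.card Γ : ℂ)⁻¹ * ∑ γ, (A * ρ γ).trace) := by
  have hne : (Nat.card Γ : ℂ) ≠ 0 := by exact_mod_cast Nat.card_pos.ne'
  let P : Matrix ι ι ℂ := (Nat.card Γ : ℂ)⁻¹ • ∑ γ, ρ γ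
  have hP1 : ∀ γ, ρ γ * P = P := by
    intro γ
    simp only [P, Matrix.mul_smul, Finset.mul_sum, ← map_mul]
    congr 1
    exact Fintype.sum_equiv (Equiv.mulLeft γ) _ _ fun _ => rfl
  have hP : P * P = P := by
    conv_lhs => enter [1]; simp only [P]
    rw [Matrix.smul_mul, Finset.sum_mul]
    simp only [hP1]
    rw [Finset.sum_const, Finset.card_univ, ← Nat.card_eq_fintype_card, ← Nat.cast_smul_eq_nsmul ℂ, smul_smul,
      inv_mul_cancel₀ hne, one_smul]
  have hAP : A * P = P * A := by
    simp only [P, Matrix.mul_smul, Finset.mul_sum, Matrix.smul_mul, Finset.sum_mul, hc]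
  have hPp : ∀ n, P ^ (n + 1) = P := by
    intro n
    induction n with
    | zero => simp
    | succ n ih => rw [pow_succ, ih, hP]
  have h := trace_int (A * P) N hN (by
    have : Commute A P := hAP
    rw [this.mul_pow, hPp, pow_succ, hA, one_mul])
  convert h using 1
  simp only [P, Matrix.mul_smul, Finset.mul_sum, Matrix.trace_smul, Matrix.trace_sum, smul_eq_mul]

/-- permutation matrices -/
noncomputable def pm (Ω : Type) [Finite Ω] : Equiv.Perm Ω →* Matrix Ω Ω ℂ where
  toFun s := Matrix.of fun x y => if s y = x then 1 else 0
  map_one' := by ext x y; simp [Matrix.one_apply, eq_comm]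
  map_mul' s t := by
    ext x y
    simp only [Matrix.mul_apply, Matrix.of_apply, ite_mul, one_mul, zero_mul]
    rw [Finset.sum_eq_single (t y)]
    · by_cases h : s (t y) = x <;> simp [h]
    · intro b _ hb; simp [Ne.symm hb]
    · simp

lemma pm_trace {Ω : Type} [Finite Ω] (s : Equiv.Perm Ω) :
    (pm Ω s).trace = (Nat.card {x // s x = x} : ℂ) := by
  simp [pm, Matrix.trace, Nat.card_eq_fintype_card, Fintype.card_subtype]

lemma avg_perm {Ω ι : Type} [Finite Ω] [Finite ι] (a : Γ →* Equiv.Perm Ω) (s : Equiv.Perm Ω)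
    (hc : ∀ γ, s * a γ = a γ * s) (ρ : Γ →* Matrix ι ι ℂ) :
    IsIntegral ℤ ((Nat.card Γ : ℂ)⁻¹ *
      ∑ γ, (ρ γ).trace * (Nat.card {x // s (a γ x) = x} : ℂ)) := by
  let R : Γ →* Matrix (ι × Ω) (ι × Ω) ℂ :=
    { toFun := fun γ => ρ γ ⊗ₖ pm Ω (a γ)
      map_one' := by simp
      map_mul' := fun x y => by simp [Matrix.mul_kronecker_mul] }
  let A : Matrix (ι × Ω) (ι × Ω) ℂ := (1 : Matrix ι ι ℂ) ⊗ₖ pm Ω s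
  have hpow : ∀ n, A ^ n = (1 : Matrix ι ι ℂ) ⊗ₖ pm Ω (s ^ n) := by
    intro n
    induction n with
    | zero => simp
    | succ n ih => rw [pow_succ, ih, ← Matrix.mul_kronecker_mul, pow_succ s, map_mul, one_mul]
  have h := avg_int R A (orderOf s) (orderOf_pos s) (by rw [hpow, pow_orderOf_eq_one]; simp) (by
    intro γ
    change (1 : Matrix ι ι ℂ) ⊗ₖ pm Ω s * (ρ γ ⊗ₖ pm Ω (a γ)) = (ρ γ ⊗ₖ pm Ω (a γ)) * _ ⊗ₖ _
    rw [← Matrix.mul_kronecker_mul, ← Matrix.mul_kronecker_mul, ← map_mul, ← map_mul, hc]; simp)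
  convert h using 4 with γ
  change _ = ((1 : Matrix ι ι ℂ) ⊗ₖ pm Ω s * (ρ γ ⊗ₖ pm Ω (a γ))).trace
  rw [← Matrix.mul_kronecker_mul, ← map_mul, one_mul, Matrix.trace_kronecker, pm_trace]
  rfl

lemma avg_tr {ι : Type} [Finite ι] (ρ : Γ →* Matrix ι ι ℂ) :
    IsIntegral ℤ ((Nat.card Γ : ℂ)⁻¹ * ∑ γ, (ρ γ).trace) := by
  have := avg_int ρ 1 1 one_pos (by simp) (by simp)
  simpa using this

lemma tr_int {ι : Type} [Finite ι] (ρ : Γ →* Matrix ι ι ℂ) (γ : Γ) :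
    IsIntegral ℤ (ρ γ).trace := by
  refine trace_int _ (orderOf γ) (orderOf_pos γ) ?_
  rw [pow_succ, ← map_pow, pow_orderOf_eq_one]; simp

/-- orbit lemma -/
lemma orbit_int {Ω : Type} [Finite Ω] [MulAction Γ Ω] (Φ : Ω → Γ → ℂ)
    (hΦ : ∀ w δ γ, Φ (δ • w) (δ * γ * δ⁻¹) = Φ w γ)
    (hi : ∀ w : Ω, IsIntegral ℤ ((Nat.card (MulAction.stabilizer Γ w) : ℂ)⁻¹ *
      ∑ γ : MulAction.stabilizer Γ w, Φ w γ)) :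
    IsIntegral ℤ ((Nat.card Γ : ℂ)⁻¹ * ∑ γ, ∑ w, if γ • w = w then Φ w γ else 0) := by
  let S : Ω → ℂ := fun w => ∑ γ, if γ • w = w then Φ w γ else 0
  have hS1 : ∀ w, S w = ∑ γ : MulAction.stabilizer Γ w, Φ w γ := by
    intro w
    simp only [S]
    rw [← Finset.sum_filter]
    refine (Finset.sum_subtype _ (fun x => ?_) _)
    simp [MulAction.mem_stabilizer_iff]
  have hS2 : ∀ w (δ : Γ), S (δ • w) = S w := by
    intro w δ
    simp only [S]
    refine (Fintype.sum_equiv (MulAut.conj δ).toEquiv _ _ fun γ => ?_).symm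
    simp only [MulEquiv.toEquiv_eq_coe, MulEquiv.coe_toEquiv, MulAut.conj_apply, hΦ]
    congr 1
    simp [mul_smul]
  have hne : (Nat.card Γ : ℂ) ≠ 0 := by exact_mod_cast Nat.card_pos.ne'
  rw [Finset.sum_comm]
  change IsIntegral ℤ (_ * ∑ w, S w)
  rw [← Equiv.sum_comp (MulAction.selfEquivSigmaOrbits Γ Ω).symm, Fintype.sum_sigma, Finset.mul_sum]
  refine IsIntegral.sum _ fun o _ => ?_
  have h1 : ∀ x : MulAction.orbit Γ o.out, S ((MulAction.selfEquivSigmaOrbits Γ Ω).symm ⟨o, x⟩) = S o.out := by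
    rintro ⟨x, δ, rfl⟩
    exact hS2 _ δ
  simp only [h1]
  rw [Finset.sum_const, Finset.card_univ, ← Nat.card_eq_fintype_card, nsmul_eq_mul]
  have h2 := MulAction.card_orbit_mul_card_stabilizer_eq_card_group Γ o.out
  rw [← Nat.card_eq_fintype_card, ← Nat.card_eq_fintype_card, ← Nat.card_eq_fintype_card] at h2
  have h3 := hi o.out
  rw [← hS1] at h3
  refine cast (congrArg (IsIntegral ℤ) ?_) h3
  rw [← mul_assoc]
  congr 1
  have h4 : (Nat.card (MulAction.stabilizer Γ o.out) : ℂ) ≠ 0 := by exact_mod_cast Nat.card_pos.ne'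
  rw [← h2] at hne ⊢
  push_cast at hne ⊢
  have := left_ne_zero_of_mul hne
  field_simp
end
end MK

namespace MK
attribute [local instance] Fintype.ofFinite
attribute [local instance] Classical.propDecidable
section
open Polynomial
variable {K : Type} [Field K] [Finite K]
variable {W : Type} [AddCommGroup W] [Module K W] [Finite W]
variable {ι : Type} [Finite ι]

lemma int_nat (n : ℕ) : IsIntegral ℤ (n : ℂ) := by
  simpa using (isIntegral_algebraMap (R := ℤ) (A := ℂ) (x := (n : ℤ)))

lemma int_of_eq {a b : ℂ} (h : a = b) (hb : IsIntegral ℤ b) : IsIntegral ℤ a := h ▸ hb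

lemma bet_ker (l : K) (g : Module.End K W) :
    bet (F := K) l W g = (Module.finrank K (LinearMap.ker ((g - l • 1) ^ Module.finrank K W)) : ℂ) := by
  unfold bet
  rw [Algebra.algebraMap_self, Polynomial.map_id, ← LinearMap.finrank_maxGenEigenspace_eq,
    Module.End.maxGenEigenspace_eq_genEigenspace_finrank, Module.End.genEigenspace_nat]

lemma ker_smul_pow (l : Kˣ) (g : Module.End K W) (n : ℕ) :
    LinearMap.ker (((l⁻¹ : Kˣ) • g - 1) ^ n) = LinearMap.ker ((g - (l : K) • 1) ^ n) := by
  have : ((l⁻¹ : Kˣ) • g - 1) = (l⁻¹ : Kˣ) • (g - (l : K) • 1) := by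
    rw [smul_sub, ← Units.smul_def, smul_smul, inv_mul_cancel, one_smul]
  rw [this, _root_.smul_pow]
  ext x
  simp [Units.smul_def]

lemma bet_smul (l : Kˣ) (g : Module.End K W) :
    bet (F := K) (1 : K) W ((l⁻¹ : Kˣ) • g) = bet (F := K) (l : K) W g := by
  rw [bet_ker, bet_ker, one_smul, ker_smul_pow]

lemma bet_fix (g : Module.End K W) (x : W) (hx : x ≠ 0) (hg : g x = x) (h : Stab g (K ∙ x)) :
    bet (F := K) (1 : K) W g = 1 + bet (F := K) (1 : K) (W ⧸ (K ∙ x)) ((K ∙ x).mapQ (K ∙ x) g h) := by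
  rw [bet_sub (1 : K) (K ∙ x) g h]
  congr 1
  rw [bet_ker]
  have h1 : g.restrict h = 1 := by
    ext ⟨y, hy⟩
    obtain ⟨a, rfl⟩ := Submodule.mem_span_singleton.1 hy
    simp [hg]
  rw [h1, one_smul, sub_self, finrank_span_singleton hx, pow_one]
  rw [LinearMap.ker_zero, finrank_top, finrank_span_singleton hx, Nat.cast_one]

lemma ppart (n : ℕ) : ∀ (W : Type) [AddCommGroup W] [Module K W] [Finite W], Module.finrank K W = n →
    ∀ (Γ : Type) [Group Γ] [Finite Γ] (σ : Γ →* Module.End K W) (ρ : Γ →* Matrix ι ι ℂ) (M : ℕ),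
    Nat.card Γ ∣ Nat.card K * M →
    IsIntegral ℤ ((M : ℂ) * ((Nat.card Γ : ℂ)⁻¹ * ∑ γ, (ρ γ).trace * bet (F := K) (1 : K) W (σ γ))) := by
  induction n using Nat.strong_induction_on with
  | _ n ih =>
  intro W _ _ _ hW Γ _ _ σ ρ M hM
  have hne : (Nat.card Γ : ℂ) ≠ 0 := by exact_mod_cast Nat.card_pos.ne'
  letI act : MulAction Γ W :=
    { smul := fun γ x => σ γ x
      one_smul := fun x => by change σ 1 x = x; simp
      mul_smul := fun a b x => by change σ (a * b) x = σ a (σ b x); simp }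
  have act_def : ∀ (γ : Γ) (x : W), γ • x = σ γ x := fun _ _ => rfl
  let m : Γ → ℂ := fun γ => bet (F := K) (1 : K) W (σ γ)
  have hconj : ∀ δ γ : Γ, m (δ * γ * δ⁻¹) = m γ := by
    intro δ γ
    let e : W ≃ₗ[K] W := LinearEquiv.ofLinear (σ δ) (σ δ⁻¹)
      (by rw [← Module.End.mul_eq_comp, ← map_mul, mul_inv_cancel, map_one]; rfl)
      (by rw [← Module.End.mul_eq_comp, ← map_mul, inv_mul_cancel, map_one]; rfl)
    refine (bet_inv (F := K) (1 : K) W W e (σ γ) (σ (δ * γ * δ⁻¹)) ?_).symm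
    intro x
    change σ δ (σ γ x) = σ (δ * γ * δ⁻¹) (σ δ x)
    rw [← Module.End.mul_apply, ← Module.End.mul_apply, ← map_mul, ← map_mul]
    simp
  have htr : ∀ δ γ : Γ, (ρ (δ * γ * δ⁻¹)).trace = (ρ γ).trace := by
    intro δ γ
    rw [map_mul, Matrix.trace_mul_comm, ← map_mul, ← mul_assoc, inv_mul_cancel, one_mul]
  let Φ : W → Γ → ℂ := fun x γ => if x = 0 then 0 else (M : ℂ) * ((ρ γ).trace * m γ)
  have h1 := orbit_int (Γ := Γ) Φ (by
    intro w δ γ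
    have : (δ • w = 0) ↔ w = 0 := by
      constructor
      · intro h
        have : δ⁻¹ • δ • w = 0 := by rw [h, act_def, map_zero]
        simpa using this
      · rintro rfl; rw [act_def, map_zero]
    simp only [Φ, this, htr, hconj]) (by
    intro w
    by_cases hw : w = 0
    · simp only [Φ, if_pos hw]; simp; exact isIntegral_zero
    · simp only [Φ, if_neg hw]
      have hst : ∀ γ : MulAction.stabilizer Γ w, σ γ w = w := fun γ => γ.2
      have hS : ∀ γ : MulAction.stabilizer Γ w, Stab (σ γ) (K ∙ w) := by
        intro γ y hy
        obtain ⟨a, rfl⟩ := Submodule.mem_span_singleton.1 hy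
        rw [map_smul, hst]; exact hy
      let σ' : MulAction.stabilizer Γ w →* Module.End K (W ⧸ (K ∙ w)) :=
        { toFun := fun γ => (K ∙ w).mapQ (K ∙ w) (σ γ) (hS γ)
          map_one' := by ext x; simp
          map_mul' := fun a b => by ext x; simp }
      have hfr : Module.finrank K (W ⧸ (K ∙ w)) < n := by
        have := Submodule.finrank_quotient_add_finrank (K ∙ w)
        rw [finrank_span_singleton hw] at this
        omega
      have hdvd : Nat.card (MulAction.stabilizer Γ w) ∣ Nat.card K * M :=
        (Subgroup.card_subgroup_dvd_card _).trans hM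
      have i1 := ih _ hfr (W ⧸ (K ∙ w)) rfl (MulAction.stabilizer Γ w) σ'
        (ρ.comp (Subgroup.subtype _)) M hdvd
      have i2 := (int_nat M).mul (avg_tr (ρ.comp (Subgroup.subtype (MulAction.stabilizer Γ w))))
      refine int_of_eq ?_ (i1.add i2)
      rw [← mul_add, ← mul_add, ← Finset.sum_add_distrib, mul_left_comm]
      congr 1
      rw [Finset.mul_sum]
      refine Finset.sum_congr (by ext; simp) fun γ _ => ?_
      congr 1
      simp only [m]
      rw [bet_fix (σ γ) w hw (hst γ) (hS γ)]
      change _ = (ρ γ).trace * _ + (ρ γ).trace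
      simp only [σ']
      ring_nf
      rfl)
  -- fixed points
  have h2 : ∀ γ, ∃ z : ℕ, (Nat.card {x : W // σ γ x = x} : ℂ) * m γ = (Nat.card K : ℂ) * (z : ℂ) := by
    intro γ
    by_cases hm : m γ = 0
    · exact ⟨0, by rw [hm]; simp⟩
    · have hr : (σ γ).charpoly.IsRoot 1 := by
        by_contra hr
        apply hm
        refine bet_eq_zero _ _ ?_
        rwa [aeval_def, Algebra.algebraMap_self, eval₂_id]
      rw [← Module.End.hasEigenvalue_iff_isRoot_charpoly] at hr
      obtain ⟨v, hv⟩ := hr.exists_hasEigenvector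
      have e : Nat.card {x : W // σ γ x = x} = Nat.card ((σ γ).eigenspace 1) :=
        Nat.card_congr (Equiv.subtypeEquivRight fun x => by
          rw [Module.End.mem_eigenspace_iff, one_smul])
      have : Module.finrank K ((σ γ).eigenspace 1) ≠ 0 := by
        intro h0
        rw [Submodule.finrank_eq_zero] at h0
        exact hv.2 (by have : v ∈ (σ γ).eigenspace 1 := hv.1; rw [h0] at this; simpa using this)
      obtain ⟨c, hc⟩ := Nat.exists_eq_succ_of_ne_zero this
      have e2 : Nat.card ((σ γ).eigenspace 1) = Nat.card K ^ (c + 1) := by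
        rw [← Nat.succ_eq_add_one, ← hc]; exact card_sub _
      refine ⟨Nat.card K ^ c * ((σ γ).charpoly.map (algebraMap K K)).rootMultiplicity 1, ?_⟩
      rw [e, e2]; push_cast
      simp only [m, bet]; ring
  choose z hz using h2
  obtain ⟨t, ht⟩ := hM
  have i3 : IsIntegral ℤ (∑ γ, (t : ℂ) * ((ρ γ).trace * (z γ : ℂ))) :=
    IsIntegral.sum _ fun γ _ => (int_nat _).mul ((tr_int ρ γ).mul (int_nat _))
  refine int_of_eq ?_ (i3.sub h1)
  have ht' : (t : ℂ) = (Nat.card Γ : ℂ)⁻¹ * ((Nat.card K : ℂ) * M) := by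
    rw [eq_inv_mul_iff_mul_eq₀ hne]; exact_mod_cast ht.symm
  rw [ht', mul_left_comm, Finset.mul_sum, Finset.mul_sum, Finset.mul_sum, ← Finset.sum_sub_distrib]
  refine Finset.sum_congr rfl fun γ _ => ?_
  have i4 : (∑ w : W, if γ • w = w then Φ w γ else 0) =
      ((Nat.card {x : W // σ γ x = x} : ℂ) - 1) * ((M : ℂ) * ((ρ γ).trace * m γ)) := by
    have : ∀ w : W, (if γ • w = w then Φ w γ else 0) =
        (if σ γ w = w then ((M : ℂ) * ((ρ γ).trace * m γ)) else 0) -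
         (if w = 0 then ((M : ℂ) * ((ρ γ).trace * m γ)) else 0) := by
      intro w
      rw [act_def]
      by_cases hw : w = 0
      · simp [hw, Φ]
      · simp [hw, Φ]
    rw [Finset.sum_congr rfl fun w _ => this w, Finset.sum_sub_distrib, Finset.sum_ite_eq' Finset.univ (0 : W),
      ← Finset.sum_filter, Finset.sum_const, Nat.card_eq_fintype_card, Fintype.card_subtype]
    simp [sub_mul]
  rw [i4]
  have := hz γ
  calc _ = (Nat.card Γ : ℂ)⁻¹ * (M * ((ρ γ).trace * m γ)) := by ring
    _ = (Nat.card Γ : ℂ)⁻¹ * M * (ρ γ).trace * (Nat.card K * z γ) - (Nat.card Γ : ℂ)⁻¹ * M * (ρ γ).trace *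
        (Nat.card {x : W // σ γ x = x} * m γ) + (Nat.card Γ : ℂ)⁻¹ * (M * ((ρ γ).trace * m γ)) := by rw [this]; ring
    _ = _ := by ring
end
end MK

namespace MK
attribute [local instance] Fintype.ofFinite
attribute [local instance] Classical.propDecidable
section
open Polynomial
variable {K : Type} [Field K] [Finite K]
variable {W : Type} [AddCommGroup W] [Module K W] [Finite W]
variable {ι : Type} [Finite ι]
variable {Γ : Type} [Group Γ] [Finite Γ]

lemma card_ker (g : Module.End K W) :
    Nat.card (LinearMap.ker ((g - 1) ^ (Module.finrank K W + 1))) =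
      Nat.card K ^ (g.charpoly.rootMultiplicity 1) := by
  rw [card_sub]
  congr 1
  rw [← LinearMap.finrank_maxGenEigenspace_eq, Module.End.maxGenEigenspace_eq_genEigenspace_finrank,
    ← Module.End.genEigenspace_eq_genEigenspace_finrank_of_le g 1 (Nat.le_succ _),
    Module.End.genEigenspace_nat, one_smul]

/-- shift -/
def shiftN (J : ℕ) (x : Fin J → W) : Fin J → W := fun j => if h : (j : ℕ) + 1 < J then x ⟨j + 1, h⟩ else 0

lemma shift_inj (J : ℕ) : Function.Injective fun x : Fin J → W => x + shiftN J x := by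
  intro x y hxy
  have hj : ∀ j, x j + shiftN J x j = y j + shiftN J y j := fun j => congrFun hxy j
  have : ∀ t, ∀ j : Fin J, J ≤ j + t + 1 → x j = y j := by
    intro t
    induction t with
    | zero =>
      intro j h
      have := hj j
      simp only [shiftN] at this
      rw [dif_neg (by omega), dif_neg (by omega), add_zero, add_zero] at this
      exact this
    | succ t ih =>
      intro j h
      have := hj j
      simp only [shiftN] at this
      by_cases h1 : (j : ℕ) + 1 < J
      · rw [dif_pos h1, dif_pos h1, ih ⟨j + 1, h1⟩ (by simp; omega)] at this
        exact add_right_cancel this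
      · rw [dif_neg h1, dif_neg h1, add_zero, add_zero] at this
        exact this
  ext j
  exact this J j (by omega)

noncomputable def shiftP (W : Type) [AddCommGroup W] [Finite W] (J : ℕ) : Equiv.Perm (Fin J → W) :=
  Equiv.ofBijective _ (Finite.injective_iff_bijective.1 (shift_inj (W := W) J))

lemma count_shift (T : Module.End K W) (J : ℕ) :
    Nat.card {x : Fin (J + 1) → W // (fun j => T (x j)) = x + shiftN (J + 1) x} =
      Nat.card (LinearMap.ker ((T - 1) ^ (J + 1))) := by
  have key : ∀ x : Fin (J + 1) → W, (fun j => T (x j)) = x + shiftN (J + 1) x →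
      ∀ j, ∀ h : j < J + 1, x ⟨j, h⟩ = ((T - 1) ^ j) (x 0) := by
    intro x hx j
    induction j with
    | zero => intro h; simp
    | succ j ih =>
      intro h
      have h1 := congrFun hx ⟨j, by omega⟩
      simp only [Pi.add_apply, shiftN] at h1
      rw [dif_pos (show j + 1 < J + 1 from h)] at h1
      rw [pow_succ', Module.End.mul_apply, ← ih (by omega), LinearMap.sub_apply, Module.End.one_apply, h1]
      abel
  refine Nat.card_congr ⟨fun x => ⟨x.1 0, ?_⟩, fun y => ⟨fun j => ((T - 1) ^ (j : ℕ)) y.1, ?_⟩, ?_, ?_⟩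
  · rw [LinearMap.mem_ker, pow_succ', Module.End.mul_apply, ← key x.1 x.2 J (by omega)]
    have h1 := congrFun x.2 ⟨J, by omega⟩
    simp only [Pi.add_apply, shiftN] at h1
    rw [dif_neg (by simp), add_zero] at h1
    rw [LinearMap.sub_apply, h1]; simp
  · ext j
    have hT : ∀ w, T w = w + (T - 1) w := fun w => by simp
    simp only [Pi.add_apply, shiftN]
    rw [hT, ← Module.End.mul_apply, ← pow_succ']
    congr 1
    by_cases h1 : (j : ℕ) + 1 < J + 1
    · rw [dif_pos h1]
    · rw [dif_neg h1, show (j : ℕ) + 1 = J + 1 by omega]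
      exact y.2
  · intro x
    ext j
    exact (key x.1 x.2 j j.2).symm
  · intro y
    ext
    simp

def permOf (σ : Γ →* Module.End K W) (J : ℕ) : Γ →* Equiv.Perm (Fin J → W) where
  toFun γ :=
    { toFun := fun x j => σ γ (x j)
      invFun := fun x j => σ γ⁻¹ (x j)
      left_inv := fun x => by ext j; simp [← Module.End.mul_apply, ← map_mul]
      right_inv := fun x => by ext j; simp [← Module.End.mul_apply, ← map_mul] }
  map_one' := by ext x j; simp
  map_mul' a b := by ext x j; simp

lemma lpart0 (σ : Γ →* Module.End K W) (ρ : Γ →* Matrix ι ι ℂ) :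
    IsIntegral ℤ ((Nat.card Γ : ℂ)⁻¹ * ∑ γ, (ρ γ).trace *
      (Nat.card K : ℂ) ^ ((σ γ).charpoly.rootMultiplicity 1)) := by
  have h := avg_perm (permOf σ (Module.finrank K W + 1)) (shiftP W (Module.finrank K W + 1))⁻¹ (by
    intro γ
    rw [inv_mul_eq_iff_eq_mul, ← mul_assoc, eq_mul_inv_iff_mul_eq]
    ext x j
    change σ γ ((x + shiftN _ x) j) = (fun j => σ γ (x j)) j + shiftN _ (fun j => σ γ (x j)) j
    simp only [Pi.add_apply, map_add, shiftN]
    congr 1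
    by_cases h1 : (j : ℕ) + 1 < Module.finrank K W + 1
    · rw [dif_pos h1, dif_pos h1]
    · rw [dif_neg h1, dif_neg h1, map_zero]) ρ
  refine int_of_eq ?_ h
  congr 1
  refine Finset.sum_congr rfl fun γ _ => ?_
  congr 1
  rw [← Nat.cast_pow, ← card_ker, ← count_shift]
  congr 1
  refine Nat.card_congr (Equiv.subtypeEquivRight fun x => ?_)
  rw [Equiv.Perm.inv_eq_iff_eq]
  rfl

lemma pow_sub_one (Q m : ℕ) (hQ : 1 ≤ Q) : ∃ z : ℤ, (Q : ℂ) ^ m - 1 = (Q - 1) * (m + (Q - 1) * z) := by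
  induction m with
  | zero => exact ⟨0, by simp⟩
  | succ m ih =>
    obtain ⟨z, hz⟩ := ih
    refine ⟨z * Q + m, ?_⟩
    have : (Q : ℂ) ^ m = 1 + (Q - 1) * (m + (Q - 1) * z) := by rw [← hz]; ring
    rw [pow_succ, this]; push_cast; ring

lemma br_int (σ : Γ →* Module.End K W) (ρ : Γ →* Matrix ι ι ℂ) (θ : MulChar K ℂ)
    (hd : Nat.card Γ ∣ Nat.card K * (Nat.card K - 1)) :
    IsIntegral ℤ ((Nat.card Γ : ℂ)⁻¹ * ∑ γ, (ρ γ).trace * ∑ l : Kˣ, θ l * bet (F := K) (l : K) W (σ γ)) := by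
  have hne : (Nat.card Γ : ℂ) ≠ 0 := by exact_mod_cast Nat.card_pos.ne'
  letI ft : Fintype (Γ × Kˣ) := Fintype.ofFinite _
  have hQ1 : 1 < Nat.card K := Finite.one_lt_card
  have hKu : Nat.card Kˣ = Nat.card K - 1 := Nat.card_units K
  have hQne : (Nat.card K : ℂ) - 1 ≠ 0 := by
    rw [sub_ne_zero]; exact_mod_cast hQ1.ne'
  have hΓ' : (Nat.card (Γ × Kˣ) : ℂ) = Nat.card Γ * (Nat.card K - 1) := by
    rw [Nat.card_prod, hKu]; push_cast [hQ1.le]; ring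
  let σ' : Γ × Kˣ →* Module.End K W :=
    { toFun := fun x => (x.2⁻¹ : Kˣ) • σ x.1
      map_one' := by simp
      map_mul' := fun x y => by
        simp only [Prod.fst_mul, Prod.snd_mul, map_mul, mul_inv]
        rw [smul_mul_smul_comm] }
  let ρ' : Γ × Kˣ →* Matrix ι ι ℂ :=
    { toFun := fun x => θ x.2 • ρ x.1
      map_one' := by simp
      map_mul' := fun x y => by
        simp only [Prod.fst_mul, Prod.snd_mul, map_mul, Units.val_mul]
        rw [smul_mul_smul_comm] }
  have htr : ∀ x, (ρ' x).trace = θ x.2 * (ρ x.1).trace := fun x => by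
    simp [ρ', Matrix.trace_smul]
  let m : Γ × Kˣ → ℕ := fun x => (σ' x).charpoly.rootMultiplicity 1
  have hm : ∀ x, (m x : ℂ) = bet (F := K) (x.2 : K) W (σ x.1) := by
    intro x
    rw [← bet_smul]
    simp only [m, bet, Algebra.algebraMap_self, Polynomial.map_id]
    rfl
  -- the sum as a sum over the product
  have hsum : ∑ γ, (ρ γ).trace * ∑ l : Kˣ, θ l * bet (F := K) (l : K) W (σ γ) =
      ∑ x : Γ × Kˣ, (ρ' x).trace * m x := by
    refine Eq.trans ?_ (Finset.sum_congr (s₁ := Finset.univ ×ˢ Finset.univ) (by ext; simp) fun x _ => rfl)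
    rw [Finset.sum_product]
    refine Finset.sum_congr rfl fun γ _ => ?_
    rw [Finset.mul_sum]
    refine Finset.sum_congr rfl fun l _ => ?_
    rw [htr, hm]; ring
  set A : ℂ := ∑ x : Γ × Kˣ, (ρ' x).trace * m x with hA
  rw [hsum]
  -- p-part
  have hp : IsIntegral ℤ (((Nat.card K : ℂ) - 1) * ((Nat.card Γ : ℂ)⁻¹ * A)) := by
    have h := ppart (K := K) _ W rfl (Γ × Kˣ) σ' ρ' ((Nat.card K - 1) ^ 2) (by
      rw [Nat.card_prod, hKu, pow_two, ← mul_assoc]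
      exact Nat.mul_dvd_mul_right hd _)
    refine int_of_eq ?_ h
    rw [hΓ']
    have e : ∑ γ : Γ × Kˣ, (ρ' γ).trace * bet (F := K) (1 : K) W (σ' γ) = A := by
      refine Finset.sum_congr rfl fun x _ => ?_
      rw [hm, ← bet_smul]; rfl
    rw [e]
    push_cast [hQ1.le]
    field_simp
  -- l-part
  have hl : IsIntegral ℤ ((Nat.card K : ℂ) * ((Nat.card Γ : ℂ)⁻¹ * A)) := by
    have h := (lpart0 σ' ρ').sub (avg_tr ρ')
    choose z hz using fun x => pow_sub_one (Nat.card K) (m x) hQ1.le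
    obtain ⟨t, ht⟩ := hd
    have ht' : (t : ℂ) = (Nat.card Γ : ℂ)⁻¹ * ((Nat.card K : ℂ) * (Nat.card K - 1)) := by
      rw [eq_inv_mul_iff_mul_eq₀ hne]
      have : ((Nat.card K * (Nat.card K - 1) : ℕ) : ℂ) = ((Nat.card Γ * t : ℕ) : ℂ) := by rw [ht]
      push_cast [hQ1.le] at this
      exact this.symm
    have h2 : IsIntegral ℤ (∑ x : Γ × Kˣ, (t : ℂ) * ((ρ' x).trace * (z x : ℂ))) :=
      IsIntegral.sum _ fun x _ => (int_nat _).mul ((tr_int ρ' x).mul (by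
        simpa using (isIntegral_algebraMap (R := ℤ) (A := ℂ) (x := z x))))
    refine int_of_eq ?_ (((int_nat (Nat.card K)).mul h).sub h2)
    rw [← mul_sub, ← Finset.sum_sub_distrib, hΓ', ht', hA, Finset.mul_sum, Finset.mul_sum, Finset.mul_sum,
      Finset.mul_sum, ← Finset.sum_sub_distrib]
    refine Finset.sum_congr rfl fun x _ => ?_
    have := hz x
    have e2 : (Nat.card K : ℂ) ^ ((σ' x).charpoly.rootMultiplicity 1) =
      1 + (Nat.card K - 1) * (m x + (Nat.card K - 1) * z x) := by rw [← this]; simp [m]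
    rw [e2]
    field_simp
    ring
  exact int_of_eq (by ring) (hl.sub hp)
end
end MK

namespace MK
attribute [local instance] Fintype.ofFinite
attribute [local instance] Classical.propDecidable
section
open Polynomial
variable {F : Type} [Field F] [Finite F]
variable {K : Type} [Field K] [Finite K] [Algebra F K]
variable {ι : Type} [Finite ι]

lemma Rw_inv (w : K → ℂ) : PInv (Rw (F := F) w) := by
  intro V V' _ _ _ _ _ _ e g g' h
  unfold Rw
  refine Finset.sum_congr rfl fun η _ => ?_
  rw [RR_inv η V V' e g g' h]

lemma Rw_rec {V : Type} [AddCommGroup V] [Module F V] [Finite V] (w : K → ℂ) (g : Module.End F V) :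
    Rw w V g = ∑ η : K, w η * bet η V g - ∑ U : Submodule F V,
      if h : Stab g U ∧ U ≠ ⊤ then Rw w U (g.restrict h.1) else 0 := by
  unfold Rw RR
  rw [Finset.sum_congr rfl fun η _ => by rw [mob_rec, mul_sub], Finset.sum_sub_distrib]
  congr 1
  simp only [Finset.mul_sum]
  rw [Finset.sum_comm]
  refine Finset.sum_congr rfl fun U _ => ?_
  by_cases h : Stab g U ∧ U ≠ ⊤
  · simp only [dif_pos h]
  · simp only [dif_neg h, mul_zero, Finset.sum_const_zero]

lemma bet_baseChange {V : Type} [AddCommGroup V] [Module F V] [Finite V]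
    [Finite (TensorProduct F K V)] (l : K) (g : Module.End F V) :
    bet (F := K) l (TensorProduct F K V) (LinearMap.baseChange K g) = bet l V g := by
  unfold bet
  rw [LinearMap.charpoly_baseChange, Algebra.algebraMap_self, Polynomial.map_id]

lemma R_int (n : ℕ) : ∀ (V : Type) [AddCommGroup V] [Module F V] [Finite V], Module.finrank F V = n →
    ∀ (Γ : Type) [Group Γ] [Finite Γ] (σ : Γ →* Module.End F V) (ρ : Γ →* Matrix ι ι ℂ) (θ : MulChar K ℂ),
    Nat.card Γ ∣ Nat.card K * (Nat.card K - 1) →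
    IsIntegral ℤ ((Nat.card Γ : ℂ)⁻¹ * ∑ γ, (ρ γ).trace * Rw (fun η : K => θ η) V (σ γ)) := by
  induction n using Nat.strong_induction_on with
  | _ n ih =>
  intro V _ _ _ hV Γ _ _ σ ρ θ hM
  haveI : Finite (TensorProduct F K V) := Module.finite_of_finite K
  have hne : (Nat.card Γ : ℂ) ≠ 0 := by exact_mod_cast Nat.card_pos.ne'
  let eσ : Γ → (V ≃ₗ[F] V) := fun δ => LinearEquiv.ofLinear (σ δ) (σ δ⁻¹)
      (by rw [← Module.End.mul_eq_comp, ← map_mul, mul_inv_cancel, map_one]; rfl)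
      (by rw [← Module.End.mul_eq_comp, ← map_mul, inv_mul_cancel, map_one]; rfl)
  letI act : MulAction Γ (Submodule F V) :=
    { smul := fun γ U => U.map (σ γ)
      one_smul := fun U => by
        change U.map (σ 1) = U
        rw [map_one]; exact Submodule.map_id U
      mul_smul := fun a b U => by
        change U.map (σ (a * b)) = (U.map (σ b)).map (σ a)
        rw [map_mul, ← Submodule.map_comp]; rfl }
  have act_def : ∀ (γ : Γ) (U : Submodule F V), γ • U = U.map (σ γ) := fun _ _ => rfl
  have act_def' : ∀ (γ : Γ) (U : Submodule F V), γ • U = U.map (eσ γ : V →ₗ[F] V) := fun _ _ => rfl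
  have stab_iff : ∀ (γ : Γ) (U : Submodule F V), γ • U = U ↔ Stab (σ γ) U := by
    intro γ U
    rw [act_def]
    constructor
    · intro h x hx
      rw [← h]; exact ⟨x, hx, rfl⟩
    · intro h
      refine Submodule.eq_of_le_of_finrank_eq ?_ ?_
      · rintro _ ⟨x, hx, rfl⟩; exact h x hx
      · exact LinearEquiv.finrank_map_eq (eσ γ) U
  have htr : ∀ δ γ : Γ, (ρ (δ * γ * δ⁻¹)).trace = (ρ γ).trace := by
    intro δ γ
    rw [map_mul, Matrix.trace_mul_comm, ← map_mul, ← mul_assoc, inv_mul_cancel, one_mul]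
  let Φ : Submodule F V → Γ → ℂ := fun U γ =>
    if h : Stab (σ γ) U ∧ U ≠ ⊤ then (ρ γ).trace * Rw (fun η : K => θ η) U ((σ γ).restrict h.1) else 0
  have h1 := orbit_int (Γ := Γ) Φ (by
    intro U δ γ
    have hg : ∀ x, eσ δ (σ γ x) = σ (δ * γ * δ⁻¹) (eσ δ x) := by
      intro x
      change σ δ (σ γ x) = σ (δ * γ * δ⁻¹) (σ δ x)
      rw [← Module.End.mul_apply, ← Module.End.mul_apply, ← map_mul, ← map_mul]
      simp
    have hs := dite_stab_conj (fun _ _ _ _ => True) (eσ δ) (σ γ) (σ (δ * γ * δ⁻¹)) hg U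
    have ht : (U ≠ ⊤) ↔ U.map (eσ δ : V →ₗ[F] V) ≠ ⊤ := by
      rw [not_iff_not]
      exact (map_eq_top_iff (Submodule.orderIsoMapComap (eσ δ)) (a := U)).symm
    rw [act_def']
    simp only [Φ]
    by_cases h : Stab (σ γ) U ∧ U ≠ ⊤
    · rw [dif_pos h, dif_pos ⟨hs.1 h.1, ht.1 h.2⟩, htr]
      congr 1
      refine (Rw_inv _ _ _ ((eσ δ).submoduleMap U) _ _ ?_).symm
      intro x
      apply Subtype.ext
      exact hg x
    · rw [dif_neg h, dif_neg (fun h' => h ⟨hs.2 h'.1, ht.2 h'.2⟩)]) (by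
    intro U
    by_cases hU : U = ⊤
    · have : ∀ γ, Φ U γ = 0 := fun γ => by
        simp only [Φ]; rw [dif_neg (fun h => h.2 hU)]
      simp only [this]; simp; exact isIntegral_zero
    · have hS : ∀ γ : MulAction.stabilizer Γ U, Stab (σ γ) U := fun γ => (stab_iff γ U).1 γ.2
      let σ' : MulAction.stabilizer Γ U →* Module.End F U :=
        { toFun := fun γ => (σ γ).restrict (hS γ)
          map_one' := by ext x; simp
          map_mul' := fun a b => by ext x; simp }
      have i1 := ih _ (by rw [← hV]; exact Submodule.finrank_lt hU) U rfl (MulAction.stabilizer Γ U) σ'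
        (ρ.comp (Subgroup.subtype _)) θ ((Subgroup.card_subgroup_dvd_card _).trans hM)
      refine int_of_eq ?_ i1
      congr 1
      refine Finset.sum_congr (by ext; simp) fun γ _ => ?_
      simp only [Φ]
      rw [dif_pos ⟨hS γ, hU⟩]
      rfl)
  let σK : Γ →* Module.End K (TensorProduct F K V) :=
    { toFun := fun γ => LinearMap.baseChange K (σ γ)
      map_one' := by rw [map_one]; exact LinearMap.baseChange_id
      map_mul' := fun a b => by rw [map_mul]; exact LinearMap.baseChange_mul _ _ }
  have h2 := br_int σK ρ θ hM
  refine int_of_eq ?_ (h2.sub h1)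
  rw [← mul_sub, ← Finset.sum_sub_distrib]
  congr 1
  refine Finset.sum_congr rfl fun γ _ => ?_
  rw [Rw_rec, mul_sub]
  congr 1
  · congr 1
    have e : ∀ l : K, bet (F := K) l (TensorProduct F K V) (σK γ) = bet l V (σ γ) :=
      fun l => bet_baseChange l (σ γ)
    simp only [e]
    rw [← Finset.sum_subset (Finset.subset_univ (Finset.univ.image (fun u : Kˣ => (u : K))))]
    · rw [Finset.sum_image (fun a _ b _ h => Units.ext h)]
    · intro x _ hx
      have : ¬ IsUnit x := by
        rintro ⟨u, rfl⟩
        exact hx (by simp)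
      rw [MulChar.map_nonunit _ this, zero_mul]
  · rw [Finset.mul_sum]
    refine Finset.sum_congr rfl fun U _ => ?_
    rw [stab_iff]
    simp only [Φ]
    by_cases h : Stab (σ γ) U ∧ U ≠ ⊤
    · rw [dif_pos h, if_pos h.1, dif_pos h]
    · rw [dif_neg h, dif_neg h, ite_self, mul_zero]
end
end MK

namespace MK
attribute [local instance] Fintype.ofFinite
attribute [local instance] Classical.propDecidable
section
open Polynomial
open scoped ComplexConjugate
open scoped ComplexOrder

noncomputable abbrev LL (N : ℕ) : IntermediateField ℚ ℂ :=
  IntermediateField.adjoin ℚ {Complex.exp (2 * Real.pi * Complex.I / N)}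

def CP (N : ℕ) (z : ℂ) : Prop :=
  ∃ x y : LL N, (x : ℂ) = z ∧ ∀ τ : LL N →+* ℂ, τ y = conj (τ x)

lemma CP.add {N : ℕ} {z w : ℂ} (hz : CP N z) (hw : CP N w) : CP N (z + w) := by
  obtain ⟨x, y, rfl, h⟩ := hz
  obtain ⟨x', y', rfl, h'⟩ := hw
  exact ⟨x + x', y + y', by simp, fun τ => by simp [h, h']⟩

lemma CP.mul {N : ℕ} {z w : ℂ} (hz : CP N z) (hw : CP N w) : CP N (z * w) := by
  obtain ⟨x, y, rfl, h⟩ := hz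
  obtain ⟨x', y', rfl, h'⟩ := hw
  exact ⟨x * x', y * y', by simp, fun τ => by simp [h, h']⟩

lemma CP.rat {N : ℕ} (q : ℚ) : CP N (q : ℂ) :=
  ⟨(q : LL N), (q : LL N), by simp, fun τ => by simp⟩

lemma CP.zero {N : ℕ} : CP N 0 := by simpa using CP.rat (N := N) 0

lemma CP.sum {N : ℕ} {I : Type} (s : Finset I) (f : I → ℂ) (h : ∀ i ∈ s, CP N (f i)) :
    CP N (∑ i ∈ s, f i) := by
  induction s using Finset.induction_on with
  | empty => simpa using CP.zero
  | insert a s ha ih =>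
    rw [Finset.sum_insert ha]
    exact (h a (by simp)).add (ih fun i hi => h i (by simp [hi]))

lemma CP.msum {N : ℕ} (s : Multiset ℂ) (h : ∀ i ∈ s, CP N i) : CP N s.sum := by
  induction s using Multiset.induction_on with
  | empty => simpa using CP.zero
  | cons a s ih =>
    rw [Multiset.sum_cons]
    exact (h a (by simp)).add (ih fun i hi => h i (by simp [hi]))

lemma CP.root {N : ℕ} (hN : N ≠ 0) (z : ℂ) (hz : z ^ N = 1) : CP N z := by
  haveI : NeZero N := ⟨hN⟩
  have hp := Complex.isPrimitiveRoot_exp N hN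
  obtain ⟨i, -, rfl⟩ := hp.eq_pow_of_pow_eq_one hz
  have hmem : Complex.exp (2 * Real.pi * Complex.I / N) ∈ LL N :=
    IntermediateField.mem_adjoin_simple_self ℚ _
  let x : LL N := (⟨_, hmem⟩ : LL N) ^ i
  have hx : x ^ N = 1 := by
    apply Subtype.ext
    simpa [x] using hz
  refine ⟨x, x⁻¹, by simp [x], fun τ => ?_⟩
  have h1 : (τ x) ^ N = 1 := by rw [← map_pow, hx, map_one]
  rw [map_inv₀, Complex.inv_eq_conj (Complex.norm_eq_one_of_pow_eq_one h1 hN)]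

lemma CP.conj {N : ℕ} {z : ℂ} (h : CP N z) : CP N (conj z) := by
  obtain ⟨x, y, rfl, h⟩ := h
  refine ⟨y, x, ?_, fun τ => by rw [h]; simp⟩
  exact h (algebraMap (LL N) ℂ)

lemma kron {N : ℕ} (hN : N ≠ 0) {I : Type} [Fintype I] (a : I → ℂ) (h1 : ∀ i, CP N (a i))
    (h2 : ∀ i, IsIntegral ℤ (a i)) (h3 : ∑ i, a i * conj (a i) = 1) (i : I) : a i = 0 ∨ ‖a i‖ = 1 := by
  choose x y hx hy using h1
  haveI : FiniteDimensional ℚ (LL N) :=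
    IntermediateField.adjoin.finiteDimensional
      ((Complex.isPrimitiveRoot_exp N hN).isIntegral (Nat.pos_of_ne_zero hN)).tower_top
  haveI : NumberField (LL N) := {}
  have hsum : ∑ i, x i * y i = 1 := by
    apply Subtype.ext
    change _ = (1:ℂ)
    rw [← h3]
    push_cast
    refine Finset.sum_congr rfl fun j _ => ?_
    rw [hx]
    congr 1
    rw [← hx]
    exact hy j (algebraMap (LL N) ℂ)
  by_cases h0 : x i = 0
  · left; rw [← hx, h0]; simp
  right
  obtain ⟨n, hn, hxn⟩ := NumberField.Embeddings.pow_eq_one_of_norm_le_one (LL N) ℂ h0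
    ((isIntegral_algebraMap_iff (algebraMap (LL N) ℂ).injective).1 (by
      have := h2 i
      rw [← hx i] at this
      exact this)) (by
      intro τ
      have h4 := congrArg τ hsum
      simp only [map_sum, map_mul, map_one, hy, Complex.mul_conj] at h4
      have h5 : ∑ j, Complex.normSq (τ (x j)) = 1 := by exact_mod_cast h4
      have h6 : Complex.normSq (τ (x i)) ≤ 1 := by
        rw [← h5]
        exact Finset.single_le_sum (f := fun j => Complex.normSq (τ (x j)))
          (fun j _ => Complex.normSq_nonneg _) (Finset.mem_univ i)
      rw [Complex.normSq_eq_norm_sq] at h6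
      exact (sq_le_one_iff₀ (norm_nonneg _)).1 h6)
  refine Complex.norm_eq_one_of_pow_eq_one (n := n) ?_ hn.ne'
  rw [← hx i]
  exact_mod_cast congrArg (Subtype.val) hxn

lemma kron_one {N : ℕ} (hN : N ≠ 0) {I : Type} [Fintype I] (a : I → ℂ) (h1 : ∀ i, CP N (a i))
    (h2 : ∀ i, IsIntegral ℤ (a i)) (h3 : ∑ i, a i * conj (a i) = 1) :
    ∃ i0, ∀ i, i ≠ i0 → a i = 0 := by
  have h4 := kron hN a h1 h2 h3
  have h5 : ∃ i0, a i0 ≠ 0 := by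
    by_contra! h
    simp [h] at h3
  obtain ⟨i0, hi0⟩ := h5
  refine ⟨i0, fun i hi => ?_⟩
  by_contra h6
  simp only [Complex.mul_conj] at h3
  have h7 : ∑ j, Complex.normSq (a j) = 1 := by exact_mod_cast h3
  have h8 : Complex.normSq (a i) + Complex.normSq (a i0) ≤ ∑ j, Complex.normSq (a j) := by
    rw [← Finset.sum_pair (f := fun j => Complex.normSq (a j)) hi]
    exact Finset.sum_le_sum_of_subset_of_nonneg (Finset.subset_univ _) fun _ _ _ => Complex.normSq_nonneg _
  rw [h7, Complex.normSq_eq_norm_sq, Complex.normSq_eq_norm_sq, (h4 i).resolve_left h6,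
    (h4 i0).resolve_left hi0] at h8
  norm_num at h8

variable {G : Type} [Group G] [Finite G]

lemma CP.trace {N : ℕ} (hN : N ≠ 0) (hG : Nat.card G ∣ N) {ι : Type} [Fintype ι] [DecidableEq ι] (ρ : G →* Matrix ι ι ℂ)
    (g : G) : CP N (ρ g).trace := by
  rcases isEmpty_or_nonempty ι with hι | hι
  · simp [Matrix.trace]; exact CP.zero
  rw [Matrix.trace_eq_sum_roots_charpoly]
  refine CP.msum _ fun r hr => CP.root hN r ?_
  have hr1 : r ∈ spectrum ℂ (ρ g) := by
    rw [Matrix.mem_spectrum_iff_isRoot_charpoly]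
    exact (Polynomial.mem_roots'.1 hr).2
  have h2 := spectrum.subset_polynomial_aeval (ρ g) (Polynomial.X ^ N - 1) ⟨r, hr1, rfl⟩
  have h3 : Polynomial.aeval (ρ g) (Polynomial.X ^ N - 1 : Polynomial ℂ) = 0 := by
    obtain ⟨k, rfl⟩ := hG
    rw [map_sub, map_pow, aeval_X, map_one, ← map_pow, pow_mul, pow_card_eq_one', one_pow, map_one, sub_self]
  rw [h3, spectrum.zero_eq] at h2
  simpa [sub_eq_zero] using h2

lemma tr_inv {ι : Type} [Fintype ι] [DecidableEq ι] (ρ : G →* Matrix ι ι ℂ) (g : G) :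
    (ρ g⁻¹).trace = conj (ρ g).trace := by
  let H : Matrix ι ι ℂ := ∑ γ, (ρ γ).conjTranspose * ρ γ
  have hH : (ρ g).conjTranspose * H * ρ g = H := by
    simp only [H, Finset.mul_sum, Finset.sum_mul]
    refine Fintype.sum_equiv (Equiv.mulRight g) _ _ fun γ => ?_
    simp [map_mul, Matrix.conjTranspose_mul, mul_assoc]
  have hpd : H.PosDef := by
    have : H = ((ρ 1).conjTranspose * ρ 1) + ∑ γ ∈ Finset.univ.erase 1, (ρ γ).conjTranspose * ρ γ :=
      (Finset.add_sum_erase _ (fun γ => (ρ γ).conjTranspose * ρ γ) (Finset.mem_univ 1)).symm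
    rw [this]
    refine Matrix.PosDef.add_posSemidef ?_ ?_
    · rw [map_one]; simpa using Matrix.PosDef.one
    · exact Matrix.posSemidef_sum _ fun γ _ => Matrix.posSemidef_conjTranspose_mul_self _
  have hu := hpd.isUnit
  have h1 : (ρ g).conjTranspose * H = H * ρ g⁻¹ := by
    calc _ = ((ρ g).conjTranspose * H * ρ g) * ρ g⁻¹ := by
          rw [mul_assoc _ (ρ g), ← map_mul, mul_inv_cancel, map_one, mul_one]
      _ = _ := by rw [hH]
  obtain ⟨U, hU⟩ := hu
  have h2 : ρ g⁻¹ = (↑U⁻¹ : Matrix ι ι ℂ) * ((ρ g).conjTranspose * H) := by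
    rw [h1, ← hU, Units.inv_mul_cancel_left]
  rw [h2, Matrix.trace_mul_comm, ← hU, Units.mul_inv_cancel_right, Matrix.trace_conjTranspose]
  rfl
end
end MK

namespace MK
attribute [local instance] Fintype.ofFinite
attribute [local instance] Classical.propDecidable
section
open Polynomial
variable {G : Type} [Group G] [Finite G]

noncomputable def zz (φ : G → ℂ) : MonoidAlgebra ℂ G := ∑ g, MonoidAlgebra.single g (φ g)

lemma zz_coeff (φ : G → ℂ) (h : G) : (zz φ).coeff h = φ h := by
  simp [zz, MonoidAlgebra.coeff_sum, Finsupp.single_apply]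

lemma zz_mul_coeff (Φ φ : G → ℂ) (h : G) :
    (zz Φ * zz φ).coeff h = ∑ g, Φ (h * g⁻¹) * φ g := by
  unfold zz
  rw [Finset.sum_mul]
  simp_rw [Finset.mul_sum, MonoidAlgebra.single_mul_single]
  rw [Finset.sum_comm]
  simp only [MonoidAlgebra.coeff_sum, Finsupp.coe_finset_sum, Finset.sum_apply]
  refine Finset.sum_congr rfl fun g _ => ?_
  rw [Finset.sum_eq_single (h * g⁻¹)]
  · simp
  · intro b _ hb
    rw [MonoidAlgebra.coeff_single, Finsupp.single_apply, if_neg]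
    rintro rfl; simp at hb
  · simp

lemma zz_comm (φ : G → ℂ) (hφ : ∀ g h, φ (h * g * h⁻¹) = φ g) (y : MonoidAlgebra ℂ G) : zz φ * y = y * zz φ := by
  have hy : y = zz (fun g => y.coeff g) := by
    ext g; rw [zz_coeff]
  rw [hy]
  ext h
  rw [zz_mul_coeff, zz_mul_coeff]
  refine Fintype.sum_equiv ((Equiv.inv G).trans ((Equiv.mulRight h).trans (Equiv.refl _))) _ _ fun g => ?_
  simp only [Equiv.trans_apply, Equiv.inv_apply, Equiv.coe_mulRight, Equiv.refl_apply]
  rw [mul_comm]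
  congr 1
  · simp
  · rw [← hφ (h * g⁻¹) g⁻¹]; simp [mul_assoc]

noncomputable def bas : Module.Basis G ℂ (MonoidAlgebra ℂ G) :=
  Module.Basis.ofRepr (MonoidAlgebra.coeffLinearEquiv ℂ)

lemma trace_left (z : MonoidAlgebra ℂ G) :
    LinearMap.trace ℂ _ (LinearMap.mulLeft ℂ z) = Nat.card G * z.coeff 1 := by
  rw [LinearMap.trace_eq_matrix_trace ℂ bas, Matrix.trace]
  simp only [Matrix.diag, LinearMap.toMatrix_apply]
  have : ∀ g : G, (bas.repr ((LinearMap.mulLeft ℂ z) (bas g))) g = z.coeff 1 := by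
    intro g
    have h1 : (bas g : MonoidAlgebra ℂ G) = MonoidAlgebra.single g 1 := by
      simp [bas]
    rw [h1]
    change (z * MonoidAlgebra.single g 1).coeff g = _
    rw [MonoidAlgebra.coeff_mul_single_eq_coeff_mul (m₂ := 1) (H := by simp)]
    simp
  rw [Finset.sum_congr rfl fun g _ => this g]
  simp

lemma trace_left_pi {n : ℕ} (d : Fin n → ℕ) (M : Π i, Matrix (Fin (d i)) (Fin (d i)) ℂ) :
    LinearMap.trace ℂ _ (LinearMap.mulLeft ℂ M) = ∑ i, d i * (M i).trace := by
  rw [LinearMap.trace_eq_matrix_trace ℂ (Pi.basis fun i => Matrix.stdBasis ℂ (Fin (d i)) (Fin (d i))), Matrix.trace]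
  simp only [Matrix.diag, LinearMap.toMatrix_apply]
  rw [Fintype.sum_sigma]
  refine Finset.sum_congr rfl fun i _ => ?_
  rw [Fintype.sum_prod_type]
  have : ∀ x y, ((Pi.basis fun i => Matrix.stdBasis ℂ (Fin (d i)) (Fin (d i))).repr ((LinearMap.mulLeft ℂ M)
    ((Pi.basis fun i => Matrix.stdBasis ℂ (Fin (d i)) (Fin (d i))) ⟨i, (x, y)⟩))) ⟨i, (x, y)⟩ = M i x x := by
    intro x y
    rw [Pi.basis_repr, Pi.basis_apply]
    simp only [LinearMap.mulLeft_apply, Pi.mul_apply, Pi.single_eq_same, Matrix.stdBasis_eq_single]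
    have : ∀ N : Matrix (Fin (d i)) (Fin (d i)) ℂ, (Matrix.stdBasis ℂ (Fin (d i)) (Fin (d i))).repr N (x,y) = N x y := by
      intro N
      simp [Matrix.stdBasis]
    rw [this]
    simp
  rw [Finset.sum_congr rfl fun x _ => Finset.sum_congr rfl fun y _ => this x y]
  simp [Matrix.trace, Finset.mul_sum]

open ComplexConjugate in
theorem eigen_thm {N : ℕ} (hN : N ≠ 0) (hG : Nat.card G ∣ N) (φ : G → ℂ)
    (hφ : ∀ g h, φ (h * g * h⁻¹) = φ g)
    (h1 : ∀ (d : ℕ) (ρ : G →* Matrix (Fin d) (Fin d) ℂ), IsIntegral ℤ ((Nat.card G : ℂ)⁻¹ * ∑ g, (ρ g).trace * φ g))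
    (h2 : ∑ g, φ g * conj (φ g) = Nat.card G) (h3 : ∀ g, CP N (φ g))
    (Φ : G → ℂ) (hΦ : ∀ g h, Φ (h * g * h⁻¹) = Φ g) :
    ∃ γ : ℂ, ∀ h, ∑ g, Φ (h * g⁻¹) * φ g = γ * φ h := by
  haveI : NeZero (Nat.card G : ℂ) := ⟨by exact_mod_cast Nat.card_pos.ne'⟩
  haveI : Module.Finite ℂ (MonoidAlgebra ℂ G) := Module.Finite.of_basis bas
  obtain ⟨n, d, hd, ⟨e⟩⟩ := IsSemisimpleRing.exists_algEquiv_pi_matrix_of_isAlgClosed ℂ (MonoidAlgebra ℂ G)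
  let ρ : ∀ i, G →* Matrix (Fin (d i)) (Fin (d i)) ℂ := fun i =>
    ((Pi.evalMonoidHom (fun i => Matrix (Fin (d i)) (Fin (d i)) ℂ) i).comp (e : MonoidAlgebra ℂ G →* _)).comp
      (MonoidAlgebra.of ℂ G)
  have hG0 : (Nat.card G : ℂ) ≠ 0 := NeZero.ne _
  have htr : ∀ i (φ : G → ℂ), (e (zz φ) i).trace = ∑ g, (ρ i g).trace * φ g := by
    intro i φ
    unfold zz
    rw [map_sum, Finset.sum_apply, Matrix.trace_sum]
    refine Finset.sum_congr rfl fun g _ => ?_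
    have : MonoidAlgebra.single g (φ g) = φ g • MonoidAlgebra.single g (1:ℂ) := by simp
    rw [this, map_smul, Pi.smul_apply, Matrix.trace_smul, smul_eq_mul, mul_comm]
    rfl
  have hsc : ∀ φ : G → ℂ, (∀ g h, φ (h * g * h⁻¹) = φ g) → ∀ i, ∃ s : ℂ, e (zz φ) i = Matrix.scalar (Fin (d i)) s := by
    intro φ hφ i
    have := Matrix.mem_range_scalar_of_commute_single (M := e (zz φ) i) (by
      intro x y _
      have hc := zz_comm φ hφ (e.symm (Pi.single i (Matrix.single x y 1)))
      have := congrFun (congrArg e hc) i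
      simp only [map_mul, AlgEquiv.apply_symm_apply, Pi.mul_apply, Pi.single_eq_same] at this
      exact this.symm)
    obtain ⟨s, hs⟩ := this
    exact ⟨s, hs.symm⟩
  let φ' : G → ℂ := fun g => conj (φ g⁻¹)
  have hφ' : ∀ g h, φ' (h * g * h⁻¹) = φ' g := by
    intro g h
    simp only [φ']
    rw [← hφ g⁻¹ h]
    simp [mul_assoc]
  choose s hs using hsc φ hφ
  choose s' hs' using hsc φ' hφ'
  choose S hS using hsc Φ hΦ
  let a : Fin n → ℂ := fun i => (Nat.card G : ℂ)⁻¹ * ∑ g, (ρ i g).trace * φ g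
  have ha : ∀ i, (d i : ℂ) * s i = Nat.card G * a i := by
    intro i
    have h4 := htr i φ
    rw [hs, Matrix.scalar_apply, Matrix.trace_diagonal] at h4
    simp only [a]
    rw [mul_inv_cancel_left₀ hG0, ← h4]
    simp
  have ha' : ∀ i, (d i : ℂ) * s' i = Nat.card G * conj (a i) := by
    intro i
    have h4 := htr i φ'
    rw [hs', Matrix.scalar_apply, Matrix.trace_diagonal] at h4
    simp only [a, map_mul, map_inv₀, map_sum, Complex.conj_natCast]
    rw [mul_inv_cancel_left₀ hG0]
    trans ∑ g, (ρ i g).trace * φ' g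
    · rw [← h4]; simp
    refine Fintype.sum_equiv (Equiv.inv G) _ _ fun g => ?_
    simp only [φ', Equiv.inv_apply]
    rw [tr_inv]; simp
  have hdn : ∀ i, (d i : ℂ) ≠ 0 := fun i => by exact_mod_cast (hd i).out
  have h5 : ∑ i, a i * conj (a i) = 1 := by
    have h6 := trace_left (zz φ * zz φ')
    rw [zz_mul_coeff] at h6
    have h7 : ∑ g, φ (1 * g⁻¹) * φ' g = Nat.card G := by
      rw [← h2]
      refine Fintype.sum_equiv (Equiv.inv G) _ _ fun g => ?_
      simp [φ']
    rw [h7, ← LinearMap.trace_conj' _ e.toLinearEquiv] at h6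
    have h8 : e.toLinearEquiv.conj (LinearMap.mulLeft ℂ (zz φ * zz φ')) = LinearMap.mulLeft ℂ (e (zz φ * zz φ')) := by
      refine LinearMap.ext fun y => ?_
      simp [LinearEquiv.conj_apply]
    rw [h8, trace_left_pi] at h6
    have h9 : ∀ i, (d i : ℂ) * (e (zz φ * zz φ') i).trace = (Nat.card G * Nat.card G) * (a i * conj (a i)) := by
      intro i
      rw [map_mul, Pi.mul_apply, hs, hs', ← map_mul, Matrix.scalar_apply, Matrix.trace_diagonal]
      simp only [Finset.sum_const, Finset.card_univ, Fintype.card_fin, nsmul_eq_mul]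
      linear_combination (d i * s' i) * ha i + (Nat.card G * a i) * ha' i
    simp_rw [h9] at h6
    rw [← Finset.mul_sum] at h6
    have h10 : (Nat.card G * Nat.card G : ℂ) ≠ 0 := mul_ne_zero hG0 hG0
    exact mul_left_cancel₀ h10 (by rw [h6, mul_one])
  obtain ⟨i0, hi0⟩ := kron_one hN a (fun i => by
      refine CP.mul ?_ (CP.sum _ _ fun g _ => CP.mul (CP.trace hN hG _ _) (h3 g))
      have := CP.rat (N := N) ((Nat.card G : ℚ)⁻¹)
      push_cast at this
      exact this) (fun i => h1 _ _) h5
  refine ⟨S i0, fun h => ?_⟩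
  have h11 : zz Φ * zz φ = S i0 • zz φ := by
    apply e.injective
    funext i
    rw [map_mul, Pi.mul_apply, map_smul, Pi.smul_apply]
    by_cases hi : i = i0
    · subst hi
      rw [hS, Matrix.scalar_apply, ← Matrix.smul_one_eq_diagonal]; simp
    · have : s i = 0 := by
        have := ha i
        rw [hi0 i hi, mul_zero] at this
        exact (mul_eq_zero.1 this).resolve_left (hdn i)
      rw [hs, this]; simp
  rw [← zz_mul_coeff, h11, MonoidAlgebra.coeff_smul_apply, zz_coeff, smul_eq_mul]

end
end MK

namespace MK
attribute [local instance] Fintype.ofFinite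
attribute [local instance] Classical.propDecidable
section
open Polynomial
variable {F : Type} [Field F]
variable {X Y : Type} [AddCommGroup X] [Module F X] [Finite X] [AddCommGroup Y] [Module F Y] [Finite Y]

/-- a vector space with an endomorphism killed by an irreducible polynomial is a vector space over the residue field -/
noncomputable def EHom (f : F[X]) (g : Module.End F X) (h : aeval g f = 0) : AdjoinRoot f →ₐ[F] Module.End F X :=
  Ideal.Quotient.liftₐ (Ideal.span {f}) (aeval g) (by
    intro a ha
    obtain ⟨c, rfl⟩ := Ideal.mem_span_singleton'.1 ha
    rw [map_mul, h, mul_zero])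

lemma EHom_mk (f : F[X]) (g : Module.End F X) (h : aeval g f = 0) (p : F[X]) :
    EHom f g h (AdjoinRoot.mk f p) = aeval g p := rfl

lemma vs_aut {E : Type} [Field E] {K W : Type} [AddCommGroup K] [AddCommGroup W] [Module E K] [Module E W]
    [Finite W] (d1 d2 : K →ₗ[E] W) (h1 : Function.Injective d1) (h2 : Function.Injective d2) :
    ∃ A : W ≃ₗ[E] W, ∀ k, A (d1 k) = d2 k := by
  haveI : Module.Finite E W := inferInstance
  obtain ⟨C1, hC1⟩ := Submodule.exists_isCompl (LinearMap.range d1)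
  obtain ⟨C2, hC2⟩ := Submodule.exists_isCompl (LinearMap.range d2)
  have e1 := Submodule.finrank_add_eq_of_isCompl hC1
  have e2 := Submodule.finrank_add_eq_of_isCompl hC2
  rw [LinearMap.finrank_range_of_inj h1] at e1
  rw [LinearMap.finrank_range_of_inj h2] at e2
  let eC : C1 ≃ₗ[E] C2 := LinearEquiv.ofFinrankEq _ _ (by omega)
  let eR : LinearMap.range d1 ≃ₗ[E] LinearMap.range d2 :=
    (LinearEquiv.ofInjective d1 h1).symm.trans (LinearEquiv.ofInjective d2 h2)
  refine ⟨(Submodule.prodEquivOfIsCompl _ _ hC1).symm.trans ((eR.prodCongr eC).trans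
    (Submodule.prodEquivOfIsCompl _ _ hC2)), fun k => ?_⟩
  have : (Submodule.prodEquivOfIsCompl _ _ hC1).symm (d1 k) = (LinearEquiv.ofInjective d1 h1 k, 0) := by
    rw [LinearEquiv.symm_apply_eq]; simp
  simp [this, eR]

lemma mod_aut (f : F[X]) (hf : Irreducible f) (gX : Module.End F X) (gY : Module.End F Y)
    (hX : aeval gX f = 0) (hY : aeval gY f = 0) (d1 d2 : Y →ₗ[F] X)
    (c1 : d1 ∘ₗ gY = gX ∘ₗ d1) (c2 : d2 ∘ₗ gY = gX ∘ₗ d2)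
    (h1 : Function.Injective d1) (h2 : Function.Injective d2) :
    ∃ A : X ≃ₗ[F] X, (∀ x, A (gX x) = gX (A x)) ∧ ∀ k, A (d1 k) = d2 k := by
  haveI : Fact (Irreducible f) := ⟨hf⟩
  letI mX : Module (AdjoinRoot f) X := Module.compHom X (EHom f gX hX).toRingHom
  letI mY : Module (AdjoinRoot f) Y := Module.compHom Y (EHom f gY hY).toRingHom
  have sX : ∀ (p : F[X]) (x : X), AdjoinRoot.mk f p • x = aeval gX p x := fun p x => rfl
  have sY : ∀ (p : F[X]) (x : Y), AdjoinRoot.mk f p • x = aeval gY p x := fun p x => rfl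
  let lift : ∀ d : Y →ₗ[F] X, d ∘ₗ gY = gX ∘ₗ d → (Y →ₗ[AdjoinRoot f] X) := fun d hd =>
    { toFun := d
      map_add' := map_add d
      map_smul' := by
        intro m x
        obtain ⟨p, rfl⟩ := AdjoinRoot.mk_surjective m
        rw [sY, RingHom.id_apply, sX]
        exact aeval_intertwine d gX gY hd p x }
  obtain ⟨A, hA⟩ := vs_aut (lift d1 c1) (lift d2 c2) h1 h2
  refine ⟨{ A.toAddEquiv with
    map_smul' := ?_ }, ?_, hA⟩
  · intro c x
    have h3 := A.map_smul (AdjoinRoot.mk f (C c)) x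
    rw [sX, sX] at h3
    simpa using h3
  · intro x
    have h3 := A.map_smul (AdjoinRoot.mk f Polynomial.X) x
    rw [sX, sX] at h3
    simpa using h3

/-- upper right corner of `p (ext gX gY u)` -/
noncomputable def DD (gX : Module.End F X) (gY : Module.End F Y) (u : Y →ₗ[F] X) (p : F[X]) : Y →ₗ[F] X :=
  LinearMap.fst F X Y ∘ₗ aeval (ext gX gY u) p ∘ₗ LinearMap.inr F X Y

lemma aeval_ext (gX : Module.End F X) (gY : Module.End F Y) (u : Y →ₗ[F] X) (p : F[X]) (x : X) (y : Y) :
    aeval (ext gX gY u) p (x, y) = (aeval gX p x + DD gX gY u p y, aeval gY p y) := by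
  have h1 := aeval_intertwine (LinearMap.inl F X Y) (ext gX gY u) gX (by ext <;> simp) p x
  have h2 := aeval_intertwine (LinearMap.snd F X Y) gY (ext gX gY u) (by ext <;> simp) p (0, y)
  have : ((x, y) : X × Y) = LinearMap.inl F X Y x + LinearMap.inr F X Y y := by simp
  rw [this, map_add, ← h1]
  ext
  · simp [DD]
  · simpa using h2

lemma DD_X (gX : Module.End F X) (gY : Module.End F Y) (u : Y →ₗ[F] X) (p : F[X]) (y : Y) :
    DD gX gY u (Polynomial.X * p) y = gX (DD gX gY u p y) + u (aeval gY p y) := by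
  have h := aeval_ext gX gY u (Polynomial.X * p) 0 y
  rw [map_mul, aeval_X, Module.End.mul_apply, aeval_ext, ext_apply] at h
  simpa using (congrArg Prod.fst h).symm

lemma DD_lin (gX : Module.End F X) (gY : Module.End F Y) (u v : Y →ₗ[F] X) (A : Module.End F X)
    (hA : ∀ x, A (gX x) = gX (A x)) (p : F[X]) (y : Y) :
    DD gX gY (u - A ∘ₗ v) p y = DD gX gY u p y - A (DD gX gY v p y) := by
  induction p using Polynomial.induction_on' generalizing y with
  | add p q hp hq =>
    have : ∀ w, DD gX gY w (p + q) y = DD gX gY w p y + DD gX gY w q y := by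
      intro w; simp [DD]
    rw [this, this, this, hp, hq, map_add]; abel
  | monomial n a =>
    induction n with
    | zero =>
      have : ∀ w, DD gX gY w (monomial 0 a) y = 0 := by
        intro w
        simp [DD, Algebra.algebraMap_eq_smul_one]
      rw [this, this, this]; simp
    | succ n ih =>
      have : monomial (n+1) a = Polynomial.X * monomial n a := by
        rw [X_mul_monomial]
      rw [this, DD_X, DD_X, DD_X, ih]
      simp only [LinearMap.sub_apply, LinearMap.comp_apply, map_sub, map_add, hA]
      abel

lemma ext_conj (f : F[X]) (hf : Irreducible f) (gX : Module.End F X) (gY : Module.End F Y)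
    (hX : aeval gX f = 0) (u0 u1 : Y →ₗ[F] X)
    (h0 : ∀ y, aeval (ext gX gY u0) f (0, y) = 0 → y = 0)
    (h1 : ∀ y, aeval (ext gX gY u1) f (0, y) = 0 → y = 0) :
    ∃ e : (X × Y) ≃ₗ[F] (X × Y), ∀ v, e (ext gX gY u0 v) = ext gX gY u1 (e v) := by
  have hK : Stab gY (LinearMap.ker (aeval gY f)) := by
    intro y hy
    rw [LinearMap.mem_ker] at hy ⊢
    rw [← aeval_intertwine gY gY gY rfl, hy, map_zero]
  have comm : ∀ u, (DD gX gY u f).domRestrict (LinearMap.ker (aeval gY f)) ∘ₗ gY.restrict hK =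
      gX ∘ₗ (DD gX gY u f).domRestrict (LinearMap.ker (aeval gY f)) := by
    intro u
    ext ⟨y, hy⟩
    rw [LinearMap.mem_ker] at hy
    have h := aeval_intertwine (ext gX gY u) _ _ rfl f (0, y)
    rw [aeval_ext, ext_apply, ext_apply, aeval_ext, hX] at h
    simp [hy] at h
    simpa using h.1.symm
  have inj : ∀ u, (∀ y, aeval (ext gX gY u) f (0, y) = 0 → y = 0) →
      Function.Injective ((DD gX gY u f).domRestrict (LinearMap.ker (aeval gY f))) := by
    intro u hu
    rw [← LinearMap.ker_eq_bot, LinearMap.ker_eq_bot']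
    rintro ⟨y, hy⟩ h
    rw [LinearMap.mem_ker] at hy
    apply Subtype.ext
    refine hu y ?_
    rw [aeval_ext, hy, hX]
    simpa using h
  obtain ⟨A, hA, hA2⟩ := mod_aut f hf gX (gY.restrict hK) hX (by
    ext x
    rw [restrict_aeval]
    simpa using x.2) _ _ (comm u0) (comm u1) (inj u0 h0) (inj u1 h1)
  let w := u1 - (A : X →ₗ[F] X) ∘ₗ u0
  have hw : ∀ y, aeval gY f y = 0 → DD gX gY w f y = 0 := by
    intro y hy
    rw [DD_lin gX gY u1 u0 A hA, sub_eq_zero]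
    exact (hA2 ⟨y, hy⟩).symm
  -- the extension by w splits
  let H := ext gX gY w
  let R := LinearMap.range (aeval H f)
  have hR : Stab H R := by
    rintro _ ⟨v, rfl⟩
    exact ⟨H v, (aeval_intertwine H H H rfl f v).symm⟩
  have hss : Module.End.IsSemisimple (R.mapQ R H hR) := by
    refine Module.End.isSemisimple_of_squarefree_aeval_eq_zero hf.squarefree ?_
    refine LinearMap.ext fun z => ?_
    obtain ⟨x, rfl⟩ := R.mkQ_surjective z
    rw [mapQ_aeval]
    simp [R]
  rw [Module.End.isSemisimple_iff] at hss
  let W0 := LinearMap.range (LinearMap.inl F X Y)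
  obtain ⟨q, hq, hc⟩ := hss (W0.map R.mkQ) (by
    rintro _ ⟨_, ⟨x, rfl⟩, rfl⟩
    refine ⟨H (x, 0), ⟨gX x, by simp [H]⟩, rfl⟩)
  have hdis : ∀ x : X, ∀ y : Y, (x, (0:Y)) ∈ R → x = 0 := by
    rintro x - ⟨⟨x', y'⟩, h⟩
    rw [aeval_ext, hX] at h
    simp at h
    rw [← h.1]
    exact hw _ h.2
  have hex : ∀ y, ∃ x, R.mkQ (x, y) ∈ q := by
    intro y
    have : R.mkQ (0, y) ∈ W0.map R.mkQ ⊔ q := by rw [hc.sup_eq_top]; trivial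
    obtain ⟨_, ⟨_, ⟨x, rfl⟩, rfl⟩, b, hb, hab⟩ := Submodule.mem_sup.1 this
    refine ⟨-x, ?_⟩
    have : R.mkQ (-x, y) = b := by
      rw [← sub_eq_iff_eq_add'.2 hab.symm, ← map_sub]; simp
    rw [this]; exact hb
  have huq : ∀ x x' y, R.mkQ (x, y) ∈ q → R.mkQ (x', y) ∈ q → x = x' := by
    intro x x' y h1 h2
    have h3 := q.sub_mem h1 h2
    rw [← map_sub] at h3
    have h4 : R.mkQ ((x, y) - (x', y)) ∈ W0.map R.mkQ := ⟨_, ⟨x - x', by simp⟩, rfl⟩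
    have h5 := (Submodule.disjoint_def.1 hc.disjoint) _ h4 h3
    rw [Submodule.mkQ_apply, Submodule.Quotient.mk_eq_zero] at h5
    have := hdis (x - x') 0 (by simpa using h5)
    exact sub_eq_zero.1 this
  choose t ht using hex
  let T : Y →ₗ[F] X :=
    { toFun := t
      map_add' := fun y y' => huq _ _ (y + y') (ht _) (by
        have := q.add_mem (ht y) (ht y')
        rw [← map_add] at this
        exact this)
      map_smul' := fun c y => huq _ _ (c • y) (ht _) (by
        have := q.smul_mem c (ht y)
        rw [← map_smul] at this
        exact this) }
  have hT : ∀ y, gX (t y) + w y = t (gY y) := by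
    intro y
    refine huq _ _ (gY y) ?_ (ht _)
    have := hq (ht y)
    change R.mkQ (H (t y, y)) ∈ q at this
    simpa [H] using this
  refine ⟨(A.prodCongr (LinearEquiv.refl F Y)).trans (shear T), ?_⟩
  rintro ⟨x, y⟩
  have := hT y
  simp only [w, LinearMap.sub_apply, LinearMap.comp_apply] at this
  ext
  · simp [shear, T, hA]
    rw [← this]
    simp
    abel
  · simp [shear]

variable {V : Type} [AddCommGroup V] [Module F V] [Finite V]

theorem lemmaU (f : F[X]) (hf : Irreducible f) {χ : Module.End F V → ℂ} (hχ : Prim χ)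
    (h0 : ∀ g, aeval g f = 0 → χ g = 0) (g : Module.End F V) (b : ℕ) (hg : g.charpoly = f ^ b) : χ g = 0 := by
  suffices h : ∀ N, ∀ g : Module.End F V, g.charpoly = f ^ b →
      Module.finrank F V ≤ Module.finrank F (LinearMap.ker (aeval g f)) + N → χ g = 0 from
    h _ g hg (Nat.le_add_left _ _)
  intro N
  induction N with
  | zero =>
    intro g hg h
    refine h0 g ?_
    have h1 : LinearMap.ker (aeval g f) = ⊤ := Submodule.eq_top_of_finrank_eq
      (le_antisymm (Submodule.finrank_le _) (by simpa using h))
    exact LinearMap.ker_eq_top.1 h1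
  | succ N ih =>
    intro g hg h
    by_cases htop : LinearMap.ker (aeval g f) = ⊤
    · exact h0 g (LinearMap.ker_eq_top.1 htop)
    have hbot : LinearMap.ker (aeval g f) ≠ ⊥ := by
      intro hbot
      have hn : (aeval g f) ^ b = 0 := by
        rw [← map_pow, ← hg]; exact LinearMap.aeval_self_charpoly g
      have hinj := LinearMap.ker_eq_bot.1 hbot
      apply htop
      rw [Submodule.eq_top_iff']
      intro x
      have : ∀ n, Function.Injective ((aeval g f) ^ n : Module.End F V) := by
        intro n
        induction n with
        | zero => rw [pow_zero]; exact Function.injective_id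
        | succ n ih => rw [pow_succ]; exact ih.comp hinj
      have h3 : x = 0 := this b (by rw [hn]; simp)
      rw [h3]; simp
    obtain ⟨W, hW⟩ : ∃ W, W = LinearMap.ker (aeval g f) := ⟨_, rfl⟩
    have hs : Stab g W := by
      intro y hy
      rw [hW, LinearMap.mem_ker] at hy ⊢
      rw [← aeval_intertwine g g g rfl, hy, map_zero]
    have hcu := hχ.cusp W (hW ▸ hbot) (hW ▸ htop) g hs
    have hcp : ∀ u, (g + nil W u).charpoly = f ^ b := by
      intro u
      rw [charpoly_nil W g hs, ← charpoly_sub, hg]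
    have hle : ∀ u, W ≤ LinearMap.ker (aeval (g + nil W u) f) := by
      intro u x hx
      have hs' := (stab_nil W u g).2 hs
      rw [LinearMap.mem_ker, ← restrict_aeval W _ hs' f ⟨x, hx⟩]
      have := restrict_nil W u g hs hs'
      rw [this, restrict_aeval W _ hs f ⟨x, hx⟩]
      rw [hW] at hx
      exact hx
    have hkey : ∀ u, χ (g + nil W u) = if LinearMap.ker (aeval (g + nil W u) f) = W then χ g else 0 := by
      intro u
      split_ifs with hu
      · obtain ⟨e, u0, he2, he⟩ := exists_split' W g hs
        have hker : ∀ u, LinearMap.ker (aeval (g + nil W u) f) = W → ∀ y, aeval (ext (g.restrict hs) (W.mapQ W g hs) (u + u0)) f (0, y) = 0 → y = 0 := by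
          intro u hu y hy
          have h1 := aeval_intertwine (e : V →ₗ[F] _) (ext (g.restrict hs) (W.mapQ W g hs) (u + u0)) (g + nil W u)
            (LinearMap.ext (he u)) f (e.symm (0, y))
          simp only [LinearEquiv.coe_coe, LinearEquiv.apply_symm_apply] at h1
          rw [hy, LinearEquiv.map_eq_zero_iff] at h1
          have h2 : e.symm (0, y) ∈ W := hu.le (LinearMap.mem_ker.2 h1)
          have h3 := he2 (e.symm (0, y))
          rw [LinearEquiv.apply_symm_apply] at h3
          rw [show y = ((0, y) : W × (V ⧸ W)).2 from rfl, h3]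
          simpa using h2
        obtain ⟨e', he'⟩ := ext_conj f hf (g.restrict hs) (W.mapQ W g hs) (by
          ext x
          rw [restrict_aeval]
          have : (x : V) ∈ LinearMap.ker (aeval g f) := hW.le x.2
          simpa using this) (u + u0) (0 + u0) (hker u hu) (hker 0 (by
            rw [show nil W (0 : (V ⧸ W) →ₗ[F] W) = 0 by ext; simp, add_zero, hW]))
        refine hχ.cls ((e.trans e').trans e.symm) _ _ fun x => ?_
        simp only [LinearEquiv.trans_apply]
        rw [he, he', LinearEquiv.symm_apply_eq]
        have := he 0 (e.symm (e' (e x)))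
        rw [show nil W (0 : (V ⧸ W) →ₗ[F] W) = 0 by ext; simp, add_zero] at this
        rw [this]; simp
      · refine ih _ (hcp u) ?_
        have := Submodule.finrank_lt_finrank_of_lt (lt_of_le_of_ne (hle u) (Ne.symm hu))
        have h9 : Module.finrank F W = Module.finrank F (LinearMap.ker (aeval g f)) := by rw [← hW]
        omega
    rw [Finset.sum_congr rfl fun u _ => hkey u, ← Finset.sum_filter, Finset.sum_const, nsmul_eq_mul] at hcu
    refine (mul_eq_zero.1 hcu).resolve_left ?_
    refine Nat.cast_ne_zero.2 (Finset.card_ne_zero.2 ?_)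
    refine ⟨0, ?_⟩
    rw [Finset.mem_filter]
    refine ⟨Finset.mem_univ _, ?_⟩
    rw [show nil W (0 : (V ⧸ W) →ₗ[F] W) = 0 by ext; simp, add_zero, hW]

end
end MK

namespace MK
attribute [local instance] Fintype.ofFinite
attribute [local instance] Classical.propDecidable
section
open Polynomial
variable {F : Type} [Field F] [Finite F]
variable {K : Type} [Field K] [Finite K] [Algebra F K]

/-- Moebius transform only depends on the values along a relation compatible with restriction. -/
lemma mob_rel (β β' : PFun F)
    (R : ∀ (V : Type) [AddCommGroup V] [Module F V] [Finite V], Module.End F V → Module.End F V → Prop)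
    (hst : ∀ (V : Type) [AddCommGroup V] [Module F V] [Finite V] (g g' : Module.End F V), R V g g' →
      ∀ U, Stab g U ↔ Stab g' U)
    (hres : ∀ (V : Type) [AddCommGroup V] [Module F V] [Finite V] (g g' : Module.End F V), R V g g' →
      ∀ U (h : Stab g U) (h' : Stab g' U), R U (g.restrict h) (g'.restrict h'))
    (hβ : ∀ (V : Type) [AddCommGroup V] [Module F V] [Finite V] (g g' : Module.End F V), R V g g' →
      β V g = β' V g') (n : ℕ) :
    ∀ (V : Type) [AddCommGroup V] [Module F V] [Finite V] (g g' : Module.End F V),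
      Module.finrank F V = n → R V g g' → mob β V g = mob β' V g' := by
  induction n using Nat.strong_induction_on with
  | _ n ih =>
  intro V _ _ _ g g' hn hR
  rw [mob_rec, mob_rec, hβ V g g' hR]
  congr 1
  refine Finset.sum_congr rfl fun U _ => ?_
  by_cases h : Stab g U ∧ U ≠ ⊤
  · have h' : Stab g' U ∧ U ≠ ⊤ := ⟨(hst V g g' hR U).1 h.1, h.2⟩
    rw [dif_pos h, dif_pos h']
    exact ih _ (hn ▸ Submodule.finrank_lt (lt_top_iff_ne_top.2 h.2).ne) U _ _ rfl (hres V g g' hR U h.1 h'.1)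
  · have h' : ¬ (Stab g' U ∧ U ≠ ⊤) := fun h' => h ⟨(hst V g g' hR U).2 h'.1, h'.2⟩
    rw [dif_neg h, dif_neg h']

lemma bet_shift {V : Type} [AddCommGroup V] [Module F V] [Finite V] (ξ : K) (c : F) (g : Module.End F V) :
    bet (F := F) (ξ + algebraMap F K c) V (g + c • 1) = bet (F := F) ξ V g := by
  haveI : Finite (TensorProduct F K V) := Module.finite_of_finite K
  rw [← bet_baseChange (ξ + algebraMap F K c), ← bet_baseChange ξ, bet_ker, bet_ker]
  have : (LinearMap.baseChange K (g + c • 1) : Module.End K (TensorProduct F K V)) - (ξ + algebraMap F K c) • 1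
      = LinearMap.baseChange K g - ξ • 1 := by
    rw [LinearMap.baseChange_add, LinearMap.baseChange_smul, Module.End.one_eq_id, LinearMap.baseChange_id,
      add_smul, algebraMap_smul, Module.End.one_eq_id]
    abel
  rw [this]

lemma ker_inverse {W : Type} [AddCommGroup W] [Module K W] (ξ : K) (hξ : ξ ≠ 0) (G G' : Module.End K W)
    (e1 : G * G' = 1) (e2 : G' * G = 1) (N : ℕ) :
    LinearMap.ker ((G' - ξ⁻¹ • 1) ^ N) ≤ LinearMap.ker ((G - ξ • 1) ^ N) := by
  have key2 : G - ξ • 1 = ((-ξ) • G) * (G' - ξ⁻¹ • 1) := by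
    rw [mul_sub, smul_mul_assoc, e1]
    simp [smul_smul, hξ]
    abel
  have c2 : Commute ((-ξ) • G) (G' - ξ⁻¹ • 1) := by
    refine Commute.smul_left (Commute.sub_right (e1.trans e2.symm) ?_) _
    exact (Commute.one_right _).smul_right _
  intro x hx
  rw [LinearMap.mem_ker] at hx ⊢
  rw [key2, c2.mul_pow, Module.End.mul_apply, hx, map_zero]

lemma bet_inverse {V : Type} [AddCommGroup V] [Module F V] [Finite V] (ξ : K) (hξ : ξ ≠ 0)
    (g g' : Module.End F V) (h : g * g' = 1) :
    bet (F := F) ξ⁻¹ V g' = bet (F := F) ξ V g := by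
  haveI : Finite (TensorProduct F K V) := Module.finite_of_finite K
  rw [← bet_baseChange ξ⁻¹, ← bet_baseChange ξ g, bet_ker, bet_ker]
  have h2 : g' * g = 1 := mul_eq_one_comm.1 h
  have e1 : (LinearMap.baseChange K g : Module.End K (TensorProduct F K V)) * LinearMap.baseChange K g' = 1 := by
    rw [← LinearMap.baseChange_mul, h, LinearMap.baseChange_one]
  have e2 : (LinearMap.baseChange K g' : Module.End K (TensorProduct F K V)) * LinearMap.baseChange K g = 1 := by
    rw [← LinearMap.baseChange_mul, h2, LinearMap.baseChange_one]
  have := le_antisymm (ker_inverse ξ hξ _ _ e1 e2 (Module.finrank K (TensorProduct F K V)))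
    (by simpa using ker_inverse ξ⁻¹ (inv_ne_zero hξ) _ _ e2 e1 (Module.finrank K (TensorProduct F K V)))
  rw [this]

lemma RR_shift {V : Type} [AddCommGroup V] [Module F V] [Finite V] (ξ : K) (c : F) (g : Module.End F V) :
    RR (F := F) (ξ + algebraMap F K c) V (g + c • 1) = RR (F := F) ξ V g := by
  refine mob_rel (bet (ξ + algebraMap F K c)) (bet ξ) (fun V _ _ _ g g' => g = g' + c • 1) ?_ ?_ ?_ _ V _ _ rfl rfl
  · rintro V _ _ _ _ g rfl U
    constructor
    · intro h x hx
      have := U.sub_mem (h x hx) (U.smul_mem c hx)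
      simpa using this
    · intro h x hx
      have := U.add_mem (h x hx) (U.smul_mem c hx)
      simpa using this
  · rintro V _ _ _ _ g rfl U h h'
    ext x
    rfl
  · rintro V _ _ _ _ g rfl
    exact bet_shift ξ c g

lemma stab_inverse {V : Type} [AddCommGroup V] [Module F V] [Finite V] (g g' : Module.End F V)
    (h : g * g' = 1) (U : Submodule F V) (hU : Stab g U) : Stab g' U := by
  have inj : Function.Injective (g.restrict hU) := by
    intro x y hxy
    have := congrArg (fun z : U => g' z) hxy
    have h2 : g' * g = 1 := mul_eq_one_comm.1 h
    simp only [LinearMap.restrict_coe_apply, ← Module.End.mul_apply, h2, Module.End.one_apply] at this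
    exact Subtype.ext this
  have sur := (Finite.injective_iff_surjective).1 inj
  intro x hx
  obtain ⟨y, hy⟩ := sur ⟨x, hx⟩
  have h3 : g y = x := congrArg Subtype.val hy
  have h2 : g' * g = 1 := mul_eq_one_comm.1 h
  rw [← h3, ← Module.End.mul_apply, h2]
  exact y.2

lemma RR_inverse {V : Type} [AddCommGroup V] [Module F V] [Finite V] (ξ : K) (hξ : ξ ≠ 0)
    (g g' : Module.End F V) (h : g * g' = 1) :
    RR (F := F) ξ⁻¹ V g' = RR (F := F) ξ V g := by
  refine mob_rel (bet ξ⁻¹) (bet ξ) (fun V _ _ _ g g' => g' * g = 1) ?_ ?_ ?_ _ V _ _ rfl h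
  · intro V _ _ _ g g' h U
    exact ⟨stab_inverse g g' (mul_eq_one_comm.1 h) U, stab_inverse g' g h U⟩
  · intro V _ _ _ g g' h U h1 h2
    ext x
    exact LinearMap.congr_fun h x
  · intro V _ _ _ g g' h
    exact bet_inverse ξ hξ _ _ h

lemma RR_int (ξ : K) (n : ℕ) : ∀ (V : Type) [AddCommGroup V] [Module F V] [Finite V] (g : Module.End F V),
    Module.finrank F V = n → ∃ m : ℤ, RR (F := F) ξ V g = m := by
  induction n using Nat.strong_induction_on with
  | _ n ih =>
  intro V _ _ _ g hn
  have : ∀ U : Submodule F V, ∃ m : ℤ,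
      (if h : Stab g U ∧ U ≠ ⊤ then mob (bet ξ) U (g.restrict h.1) else 0) = (m : ℂ) := by
    intro U
    by_cases h : Stab g U ∧ U ≠ ⊤
    · rw [dif_pos h]
      exact ih _ (hn ▸ Submodule.finrank_lt (lt_top_iff_ne_top.2 h.2).ne) U _ rfl
    · rw [dif_neg h]
      exact ⟨0, by simp⟩
  choose m hm using this
  refine ⟨(Polynomial.rootMultiplicity ξ (Polynomial.map (algebraMap F K) (LinearMap.charpoly g)) : ℕ) - ∑ U, m U, ?_⟩
  unfold RR
  rw [mob_rec]
  push_cast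
  congr 1
  exact Finset.sum_congr rfl fun U _ => hm U
end
end MK

namespace MK
attribute [local instance] Fintype.ofFinite
attribute [local instance] Classical.propDecidable
section
open Polynomial
variable {F : Type} [Field F] [Finite F]
variable {K : Type} [Field K] [Finite K] [Algebra F K]

/-- trace of `η ∈ E_n`, as an element of `F` -/
noncomputable def tx (F : Type) [Field F] {K : Type} [Field K] [Algebra F K] (n : ℕ) (η : K) : F :=
  -(pol F n η).coeff (n - 1)

/-- norm of `η ∈ E_n`, as an element of `F` -/
noncomputable def nx (F : Type) [Field F] {K : Type} [Field K] [Algebra F K] (n : ℕ) (η : K) : F :=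
  (-1) ^ n * (pol F n η).coeff 0

/-- the subfield of `K` with `q^n` elements (as a finset) -/
noncomputable def En (F : Type) (K : Type) [Field K] [Finite K] (n : ℕ) : Finset K :=
  Finset.univ.filter fun x : K => x ^ Nat.card F ^ n = x

lemma mem_En {n : ℕ} {x : K} : x ∈ En F K n ↔ x ^ Nat.card F ^ n = x := by simp [En]

lemma tx_map {n : ℕ} (hn : 0 < n) {η : K} (h : η ∈ En F K n) :
    algebraMap F K (tx F n η) = ∑ i ∈ Finset.range n, η ^ Nat.card F ^ i := by
  have h1 := (pol_map (F := F) n η (mem_En.1 h)).2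
  have h2 := congrArg (fun p => Polynomial.coeff p (n - 1)) h1
  simp only [Polynomial.coeff_map] at h2
  have h3 := Polynomial.prod_X_sub_C_coeff_card_pred (Finset.range n) (fun i => η ^ Nat.card F ^ i)
    (by simpa using hn)
  rw [Finset.card_range] at h3
  rw [tx, map_neg, h2, h3, neg_neg]

lemma nx_map {n : ℕ} {η : K} (h : η ∈ En F K n) :
    algebraMap F K (nx F n η) = ∏ i ∈ Finset.range n, η ^ Nat.card F ^ i := by
  have h1 := (pol_map (F := F) n η (mem_En.1 h)).2
  have h2 := congrArg (fun p => Polynomial.eval 0 p) h1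
  simp only [Polynomial.eval_prod, Polynomial.eval_sub, Polynomial.eval_X, Polynomial.eval_C, zero_sub,
    ← Polynomial.coeff_zero_eq_eval_zero, Polynomial.coeff_map] at h2
  rw [nx, map_mul, h2, Finset.prod_neg, Finset.card_range, ← mul_assoc]
  simp [← mul_pow]

lemma frob_pow_add (n : ℕ) (x y : K) : (x + y) ^ Nat.card F ^ n = x ^ Nat.card F ^ n + y ^ Nat.card F ^ n := by
  rw [← frob_apply, ← frob_apply, ← frob_apply, map_add]

lemma frob_pow_alg (n : ℕ) (x : F) : (algebraMap F K x) ^ Nat.card F ^ n = algebraMap F K x := by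
  rw [← frob_apply, AlgHom.commutes]

lemma frob_inj (n : ℕ) : Function.Injective (fun x : K => x ^ Nat.card F ^ n) := by
  intro x y h
  simp only [← frob_apply] at h
  exact (frob F K n).injective h

lemma En_add {n : ℕ} {x y : K} (hx : x ∈ En F K n) (hy : y ∈ En F K n) : x + y ∈ En F K n := by
  rw [mem_En] at *
  rw [frob_pow_add, hx, hy]

lemma En_mul {n : ℕ} {x y : K} (hx : x ∈ En F K n) (hy : y ∈ En F K n) : x * y ∈ En F K n := by
  rw [mem_En] at *
  rw [mul_pow, hx, hy]

lemma En_inv {n : ℕ} {x : K} (hx : x ∈ En F K n) : x⁻¹ ∈ En F K n := by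
  rw [mem_En] at *
  rw [inv_pow, hx]

lemma En_alg {n : ℕ} (c : F) : algebraMap F K c ∈ En F K n := by
  rw [mem_En, frob_pow_alg]

lemma En_pow {n : ℕ} {x : K} (hx : x ∈ En F K n) (j : ℕ) : x ^ j ∈ En F K n := by
  rw [mem_En] at *
  rw [← pow_mul, mul_comm, pow_mul, hx]

lemma En_pow_iff {n : ℕ} {x : K} (j : ℕ) : x ^ Nat.card F ^ j ∈ En F K n ↔ x ∈ En F K n := by
  refine ⟨fun h => ?_, fun h => En_pow h _⟩
  rw [mem_En] at *
  apply frob_inj (F := F) j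
  simp only
  rw [← pow_mul, mul_comm, pow_mul, h]

lemma pol_frob (n j : ℕ) (η : K) : pol F n (η ^ Nat.card F ^ j) = pol F n η := by
  have : minpoly F (η ^ Nat.card F ^ j) = minpoly F η := by
    apply minpoly_conj
    rw [← frob_apply, Polynomial.aeval_algHom_apply, minpoly.aeval, map_zero]
  rw [pol, pol, this]

lemma tx_add {n : ℕ} (hn : 0 < n) {x y : K} (hx : x ∈ En F K n) (hy : y ∈ En F K n) :
    tx F n (x + y) = tx F n x + tx F n y := by
  apply (algebraMap F K).injective
  rw [map_add, tx_map hn hx, tx_map hn hy, tx_map hn (En_add hx hy), ← Finset.sum_add_distrib]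
  exact Finset.sum_congr rfl fun i _ => frob_pow_add i x y

lemma tx_smul {n : ℕ} (hn : 0 < n) {x : K} (hx : x ∈ En F K n) (c : F) :
    tx F n (algebraMap F K c * x) = c * tx F n x := by
  apply (algebraMap F K).injective
  rw [map_mul, tx_map hn hx, tx_map hn (En_mul (En_alg c) hx), Finset.mul_sum]
  exact Finset.sum_congr rfl fun i _ => by rw [mul_pow, frob_pow_alg]

lemma nx_mul {n : ℕ} {x y : K} (hx : x ∈ En F K n) (hy : y ∈ En F K n) :
    nx F n (x * y) = nx F n x * nx F n y := by
  apply (algebraMap F K).injective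
  rw [map_mul, nx_map hx, nx_map hy, nx_map (En_mul hx hy), ← Finset.prod_mul_distrib]
  exact Finset.prod_congr rfl fun i _ => by rw [mul_pow]

section V
variable {V : Type} [AddCommGroup V] [Module F V] [Finite V]

lemma trace_charpoly [Nontrivial V] (g : Module.End F V) :
    LinearMap.trace F V g = -g.charpoly.coeff (Module.finrank F V - 1) := by
  have b := Module.finBasis F V
  haveI : Nonempty (Fin (Module.finrank F V)) := ⟨⟨0, Module.finrank_pos⟩⟩
  rw [LinearMap.trace_eq_matrix_trace F b, Matrix.trace_eq_neg_charpoly_coeff, LinearMap.charpoly_toMatrix,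
    Fintype.card_fin]

lemma trace_tx [Nontrivial V] (g : Module.End F V) (ξ : K) (h : g.charpoly = pol F (Module.finrank F V) ξ) :
    LinearMap.trace F V g = tx F (Module.finrank F V) ξ := by
  rw [trace_charpoly, h, tx]

lemma det_nx (g : Module.End F V) (ξ : K) (h : g.charpoly = pol F (Module.finrank F V) ξ) :
    LinearMap.det g = nx F (Module.finrank F V) ξ := by
  rw [LinearMap.det_eq_sign_charpoly_coeff, h, nx]

lemma En_supp [Nontrivial V] (ξ : K) (g : Module.End F V) (h : RR ξ V g ≠ 0) :
    ξ ∈ En F K (Module.finrank F V) ∧ g.charpoly = pol F (Module.finrank F V) ξ := by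
  have := prim_charpoly (RR_prim (F := F) (V := V) ξ) g h ξ (RR_ne ξ g h)
  exact ⟨mem_En.2 (frob_of_dvd _ _ this.1), this.2⟩

lemma sum_frob (n j : ℕ) (f : K → ℂ) : ∑ ξ ∈ En F K n, f (ξ ^ Nat.card F ^ j) = ∑ ξ ∈ En F K n, f ξ := by
  have hb : Function.Bijective (fun x : K => x ^ Nat.card F ^ j) :=
    Finite.injective_iff_bijective.1 (frob_inj (F := F) j)
  refine Finset.sum_bij (fun x _ => x ^ Nat.card F ^ j) (fun x hx => (En_pow_iff j).2 hx)
    (fun x _ y _ h => hb.1 h) (fun y hy => ?_) (fun _ _ => rfl)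
  obtain ⟨x, rfl⟩ := hb.2 y
  exact ⟨x, (En_pow_iff j).1 hy, rfl⟩

lemma lemS [Nontrivial V] (hK : SplitsAll F V K) (w : K → ℂ) (h : Polynomial F → ℂ) :
    ((Nat.card V : ℂ) - 1) * ∑ g, Rw w V g * h (LinearMap.charpoly g)
      = (Nat.card (V ≃ₗ[F] V) : ℂ) * ∑ η ∈ En F K (Module.finrank F V), h (pol F (Module.finrank F V) η) * w η := by
  have hn : (Module.finrank F V : ℂ) ≠ 0 := Nat.cast_ne_zero.2 Module.finrank_pos.ne'
  apply mul_left_cancel₀ hn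
  have h1 := prim_expand hK (Rw_prim (F := F) (V := V) w) h
  rw [mul_left_comm, h1]
  rw [← Finset.sum_subset (Finset.subset_univ (En F K (Module.finrank F V)))]
  · rw [Finset.mul_sum]
    rw [Finset.sum_congr rfl (g := fun ξ => ∑ i ∈ Finset.range (Module.finrank F V),
      (Nat.card (V ≃ₗ[F] V) : ℂ) * (h (pol F (Module.finrank F V) (ξ ^ Nat.card F ^ i)) * w (ξ ^ Nat.card F ^ i)))]
    · rw [Finset.sum_comm]
      rw [Finset.sum_congr rfl (fun i _ => sum_frob (F := F) (Module.finrank F V) i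
        (fun ξ => (Nat.card (V ≃ₗ[F] V) : ℂ) * (h (pol F (Module.finrank F V) ξ) * w ξ)))]
      rw [Finset.sum_const, Finset.card_range, nsmul_eq_mul, ← Finset.mul_sum]
    · intro ξ hξ
      rw [mul_left_comm, BB_Rw w ξ (mem_En.1 hξ), mul_left_comm, Finset.mul_sum, Finset.mul_sum]
      exact Finset.sum_congr rfl fun i _ => by rw [pol_frob]
  · intro ξ _ hξ
    rw [BB_zero (Rw_prim (F := F) (V := V) w) ξ (fun h => hξ (mem_En.2 h)), mul_zero]

lemma lemS2 [Nontrivial V] (w w' : K → ℂ) (h : Polynomial F → ℂ) :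
    ((Nat.card V : ℂ) - 1) * ∑ g, Rw w V g * Rw w' V g * h (LinearMap.charpoly g)
      = (Nat.card (V ≃ₗ[F] V) : ℂ) * ∑ ξ ∈ En F K (Module.finrank F V), w' ξ * h (pol F (Module.finrank F V) ξ) *
        ∑ i ∈ Finset.range (Module.finrank F V), w (ξ ^ Nat.card F ^ i) := by
  have e : ∑ g, Rw w V g * Rw w' V g * h (LinearMap.charpoly g)
      = ∑ ξ, w' ξ * (h (pol F (Module.finrank F V) ξ) * BB (F := F) (Rw w V) ξ) := by
    rw [Finset.sum_congr rfl (g := fun g => ∑ ξ, w' ξ * (Rw w V g * h (LinearMap.charpoly g) * RR ξ V g))]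
    · rw [Finset.sum_comm]
      refine Finset.sum_congr rfl fun ξ _ => ?_
      rw [← Finset.mul_sum, BB_RR (Rw_prim (F := F) (V := V) w) ξ h]
    · intro g _
      conv_lhs => rw [mul_assoc, mul_comm (Rw w' V g), ← mul_assoc]
      conv_lhs => rw [show Rw w' V g = ∑ ξ, w' ξ * RR ξ V g from rfl]
      rw [Finset.mul_sum]
      exact Finset.sum_congr rfl fun ξ _ => by ring
  rw [e, ← Finset.sum_subset (Finset.subset_univ (En F K (Module.finrank F V)))]
  · rw [Finset.mul_sum, Finset.mul_sum]
    refine Finset.sum_congr rfl fun ξ hξ => ?_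
    have := BB_Rw (F := F) (V := V) w ξ (mem_En.1 hξ)
    linear_combination (w' ξ * h (pol F (Module.finrank F V) ξ)) * this
  · intro ξ _ hξ
    rw [BB_zero (Rw_prim (F := F) (V := V) w) ξ (fun h => hξ (mem_En.2 h)), mul_zero, mul_zero]

lemma trace_nil (W : Submodule F V) (u : V ⧸ W →ₗ[F] W) (g : Module.End F V) :
    LinearMap.trace F V (g * nil W u) = LinearMap.trace F W (u ∘ₗ (W.mkQ ∘ₗ g ∘ₗ W.subtype)) := by
  have : g * nil W u = (g ∘ₗ W.subtype) ∘ₗ (u ∘ₗ W.mkQ) := rfl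
  rw [this, LinearMap.trace_comp_comm']
  rfl

lemma trace_nil' (W : Submodule F V) (u : V ⧸ W →ₗ[F] W) (g : Module.End F V) (h : Stab g W) :
    LinearMap.trace F V (g * nil W u) = 0 := by
  rw [trace_nil]
  have : W.mkQ ∘ₗ g ∘ₗ W.subtype = 0 := by
    ext x
    simpa using h x x.2
  rw [this, LinearMap.comp_zero, map_zero]

lemma sum_psi_nil (ψ : AddChar F ℂ) (hψ : ∃ a : F, ψ a ≠ 1) (W : Submodule F V) (g : Module.End F V) :
    ∑ u : V ⧸ W →ₗ[F] W, ψ (LinearMap.trace F V (g * nil W u))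
      = if Stab g W then (Nat.card (V ⧸ W →ₗ[F] W) : ℂ) else 0 := by
  split_ifs with h
  · rw [Finset.sum_congr rfl (g := fun _ => 1) (fun u _ => by rw [trace_nil' W u g h, AddChar.map_zero_eq_one])]
    simp
  · obtain ⟨c, hc⟩ := hψ
    obtain ⟨w, hw, hgw⟩ : ∃ w ∈ W, g w ∉ W := by
      unfold Stab at h
      push Not at h
      exact h
    let Λ : (V ⧸ W →ₗ[F] W) →+ F :=
      { toFun := fun u => LinearMap.trace F V (g * nil W u)
        map_zero' := by rw [show nil W 0 = 0 by ext; simp [nil], mul_zero, map_zero]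
        map_add' := fun u v => by rw [nil_add, mul_add, map_add] }
    have hne : W.mkQ (g w) ≠ 0 := by simpa using hgw
    obtain ⟨φ, hφ⟩ : ∃ φ : Module.Dual F (V ⧸ W), φ (W.mkQ (g w)) ≠ 0 := by
      by_contra hcon
      push Not at hcon
      exact hne ((Module.forall_dual_apply_eq_zero_iff F _).1 hcon)
    have h0 : (ψ.compAddMonoidHom Λ) ≠ 0 := by
      intro h0
      have h1 := DFunLike.congr_fun h0 ((LinearMap.toSpanSingleton F W ⟨w, hw⟩) ∘ₗ ((c / φ (W.mkQ (g w))) • φ))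
      rw [AddChar.compAddMonoidHom_apply, AddChar.zero_apply] at h1
      apply hc
      rw [← h1]
      congr 1
      change c = LinearMap.trace F V (g * nil W _)
      rw [trace_nil, LinearMap.comp_assoc, LinearMap.trace_comp_comm']
      have : (((c / φ (W.mkQ (g w))) • φ) ∘ₗ W.mkQ ∘ₗ g ∘ₗ W.subtype) ∘ₗ LinearMap.toSpanSingleton F W ⟨w, hw⟩
          = c • LinearMap.id := by
        ext
        simp at hφ ⊢
        field_simp
      rw [this, map_smul, LinearMap.trace_id]
      simp
    have := (AddChar.sum_eq_zero_iff_ne_zero (ψ := ψ.compAddMonoidHom Λ)).2 h0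
    exact this

/-- additive Fourier transform on `End V` -/
noncomputable def Fou (ψ : AddChar F ℂ) (χ : Module.End F V → ℂ) (h : Module.End F V) : ℂ :=
  ∑ g, χ g * ψ (LinearMap.trace F V (g * h))

lemma fou_prim (ψ : AddChar F ℂ) (hψ : ∃ a : F, ψ a ≠ 1) {χ : Module.End F V → ℂ} (hχ : Prim χ) :
    Prim (Fou ψ χ) := by
  constructor
  · intro e h h' he
    unfold Fou
    refine Finset.sum_bijective (fun g => e.conj g) e.conj.bijective (by simp) fun g _ => ?_
    have h1 : h' = e.conj h := by
      ext x
      have := he (e.symm x)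
      simp at this
      simp [this]
    rw [hχ.cls e g (e.conj g) (fun x => by simp [LinearEquiv.conj_apply_apply]), h1]
    congr 2
    rw [← LinearMap.trace_conj' (g * h) e]
    congr 1
    exact LinearEquiv.conj_comp e h g
  · intro W h1 h2 h hW
    unfold Fou
    rw [Finset.sum_comm]
    have e : ∀ g : Module.End F V, ∑ u : V ⧸ W →ₗ[F] W, χ g * ψ (LinearMap.trace F V (g * (h + nil W u)))
        = (Nat.card (V ⧸ W →ₗ[F] W) : ℂ) * if Stab g W then χ g * ψ (LinearMap.trace F V (g * h)) else 0 := by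
      intro g
      simp only [mul_add, map_add, AddChar.map_add_eq_mul, ← mul_assoc]
      rw [← Finset.mul_sum, sum_psi_nil ψ hψ]
      split_ifs
      · ring
      · simp
    rw [Finset.sum_congr rfl fun g _ => e g, ← Finset.mul_sum,
      prim_group hχ W h1 h2 (w := fun g => ψ (LinearMap.trace F V (g * h))), mul_zero]
    intro g hg u
    simp only
    rw [add_mul, map_add, LinearMap.trace_mul_comm F (nil W u), trace_nil' W u h hW, add_zero]
end V
end
end MK

namespace MK
attribute [local instance] Fintype.ofFinite
attribute [local instance] Classical.propDecidable
section
open Polynomial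
variable {F : Type} [Field F] [Finite F]
variable {K : Type} [Field K] [Finite K] [Algebra F K]
variable {V : Type} [AddCommGroup V] [Module F V] [Finite V]

lemma prim_lin {χ χ' : Module.End F V → ℂ} (h : Prim χ) (h' : Prim χ') (c : ℂ) :
    Prim fun g => χ g - c * χ' g := by
  constructor
  · intro e g g' he
    beta_reduce
    rw [h.cls e g g' he, h'.cls e g g' he]
  · intro W h1 h2 g hg
    rw [Finset.sum_sub_distrib, ← Finset.mul_sum, h.cusp W h1 h2 g hg, h'.cusp W h1 h2 g hg, mul_zero, sub_zero]

/-- kernel of the Fourier transform -/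
noncomputable def wf (ψ : AddChar F ℂ) (n : ℕ) (ξ η : K) : ℂ :=
  if ξ ∈ En F K n ∧ η ∈ En F K n then ψ (tx F n (ξ * η)) else 0

/-- the constant -/
noncomputable def cst (F K V : Type) [Field F] [Finite F] [Field K] [Finite K] [Algebra F K]
    [AddCommGroup V] [Module F V] [Finite V] : ℂ :=
  (Nat.card (V ≃ₗ[F] V) : ℂ) / (((Nat.card V : ℂ) - 1) * aa F K (Module.finrank F V))

/-- the defect in identity (*) -/
noncomputable def PP (ψ : AddChar F ℂ) (ξ : K) (h : Module.End F V) : ℂ :=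
  Fou ψ (RR ξ V) h - cst F K V * Rw (wf ψ (Module.finrank F V) ξ) V h

lemma card_sub_one_ne [Nontrivial V] : ((Nat.card V : ℂ) - 1) ≠ 0 := by
  have : 1 < Nat.card V := Finite.one_lt_card
  have h2 : (Nat.card V : ℂ) ≠ 1 := by
    exact_mod_cast this.ne'
  exact sub_ne_zero.2 h2

lemma aa_ne' [Nontrivial V] : aa F K (Module.finrank F V) ≠ 0 := by
  obtain ⟨j, hj⟩ : ∃ j, Module.finrank F V = j + 1 :=
    ⟨Module.finrank F V - 1, (Nat.sub_add_cancel Module.finrank_pos).symm⟩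
  rw [hj]
  exact aa_ne j

lemma PP_prim [Nontrivial V] (ψ : AddChar F ℂ) (hψ : ∃ a : F, ψ a ≠ 1) (ξ : K) :
    Prim (PP (V := V) ψ ξ) :=
  prim_lin (fou_prim ψ hψ (RR_prim ξ)) (Rw_prim _) _

lemma RR_eq_Rw (ξ : K) (g : Module.End F V) : RR ξ V g = Rw (Pi.single ξ 1) V g := by
  unfold Rw
  rw [Finset.sum_eq_single ξ]
  · simp
  · intro b _ hb
    simp [hb]
  · simp

lemma sum_RR [Nontrivial V] (hK : SplitsAll F V K) (ξ : K) :
    ((Nat.card V : ℂ) - 1) * ∑ g : Module.End F V, RR ξ V g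
      = if ξ ∈ En F K (Module.finrank F V) then (Nat.card (V ≃ₗ[F] V) : ℂ) else 0 := by
  have := lemS (V := V) hK (Pi.single ξ 1) (fun _ => 1)
  simp only [mul_one, ← RR_eq_Rw, one_mul] at this
  rw [this]
  simp [Pi.single_apply]

lemma PP_zero [Nontrivial V] (hK : SplitsAll F V K) (ψ : AddChar F ℂ) (ξ : K) :
    PP (V := V) ψ ξ 0 = 0 := by
  have h1 : Fou (V := V) ψ (RR ξ V) 0 = ∑ g : Module.End F V, RR ξ V g := by
    simp [Fou]
  have h2 : Rw (wf ψ (Module.finrank F V) ξ) V (0 : Module.End F V) = wf ψ (Module.finrank F V) ξ 0 * aa F K (Module.finrank F V) := by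
    unfold Rw
    rw [Finset.sum_eq_single 0]
    · congr 1
      rw [← RR_aa (F := F) (K := K) V, ← RR_shift (F := F) (0 : K) 1 (0 : Module.End F V)]
      simp
    · intro η _ hη
      have : RR (F := F) η V 0 = 0 := by
        by_contra hne
        have := RR_ne η _ hne
        rw [LinearMap.charpoly_zero, map_pow, Polynomial.aeval_X] at this
        exact hη (eq_zero_of_pow_eq_zero this)
      rw [this, mul_zero]
    · simp
  have h3 := sum_RR (V := V) hK ξ
  have h0 : (0 : K) ∈ En F K (Module.finrank F V) := by
    have := En_alg (F := F) (K := K) (n := Module.finrank F V) 0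
    rwa [map_zero] at this
  have h4 : tx F (Module.finrank F V) (0 : K) = 0 := by
    have := tx_smul (F := F) Module.finrank_pos h0 0 (n := Module.finrank F V)
    simpa using this
  have h5 := card_sub_one_ne (V := V)
  have h6 := aa_ne' (F := F) (K := K) (V := V)
  have h7 : wf ψ (Module.finrank F V) ξ 0 = if ξ ∈ En F K (Module.finrank F V) then 1 else 0 := by
    simp [wf, h0, h4]
  rw [PP, h1, h2, h7, cst]
  apply mul_left_cancel₀ h5
  rw [mul_zero, mul_sub, h3]
  split_ifs
  · field_simp
    ring
  · simp

lemma PP_notin [Nontrivial V] (ψ : AddChar F ℂ) (ξ : K) (h : ξ ∉ En F K (Module.finrank F V)) (g : Module.End F V) :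
    PP (V := V) ψ ξ g = 0 := by
  have h1 : ∀ g, RR ξ V g = 0 := fun g => by
    by_contra hne
    exact h (En_supp ξ g hne).1
  simp [PP, Fou, Rw, wf, h1, h]

lemma PP_shift1 [Nontrivial V] (ψ : AddChar F ℂ) (ξ : K) (c : F) (h : Module.End F V) :
    PP (V := V) ψ ξ (h + c • 1) = ψ (c * tx F (Module.finrank F V) ξ) * PP (V := V) ψ ξ h := by
  have hn : 0 < Module.finrank F V := Module.finrank_pos
  have h1 : Fou (V := V) ψ (RR ξ V) (h + c • 1) = ψ (c * tx F (Module.finrank F V) ξ) * Fou (V := V) ψ (RR ξ V) h := by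
    unfold Fou
    rw [Finset.mul_sum]
    refine Finset.sum_congr rfl fun g _ => ?_
    by_cases hg : RR ξ V g = 0
    · simp [hg]
    · rw [mul_add, map_add, AddChar.map_add_eq_mul, mul_smul_comm, mul_one, map_smul, smul_eq_mul,
        trace_tx g ξ (En_supp ξ g hg).2]
      ring
  have h2 : Rw (wf ψ (Module.finrank F V) ξ) V (h + c • 1)
      = ψ (c * tx F (Module.finrank F V) ξ) * Rw (wf ψ (Module.finrank F V) ξ) V h := by
    unfold Rw
    rw [Finset.mul_sum]
    refine (Finset.sum_bijective (fun η : K => η + algebraMap F K c) (AddGroup.addRight_bijective _) (by simp)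
      fun η _ => ?_).symm
    rw [RR_shift]
    have : (η + algebraMap F K c ∈ En F K (Module.finrank F V)) ↔ η ∈ En F K (Module.finrank F V) := by
      constructor
      · intro h
        have := En_add h (En_alg (F := F) (K := K) (n := Module.finrank F V) (-c))
        simpa using this
      · intro h
        exact En_add h (En_alg c)
    unfold wf
    by_cases hc : ξ ∈ En F K (Module.finrank F V) ∧ η ∈ En F K (Module.finrank F V)
    · rw [if_pos hc, if_pos ⟨hc.1, this.2 hc.2⟩, mul_add, tx_add hn (En_mul hc.1 hc.2) (En_mul hc.1 (En_alg c)),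
        mul_comm ξ (algebraMap F K c), tx_smul hn hc.1, AddChar.map_add_eq_mul]
      ring
    · rw [if_neg hc, if_neg (fun h => hc ⟨h.1, this.1 h.2⟩)]
      ring
  rw [PP, PP, h1, h2]
  ring

lemma PP_shift2 [Nontrivial V] (ψ : AddChar F ℂ) (ξ : K) (c : F) (h : Module.End F V) :
    PP (V := V) ψ (ξ + algebraMap F K c) h = ψ (c * LinearMap.trace F V h) * PP (V := V) ψ ξ h := by
  have hn : 0 < Module.finrank F V := Module.finrank_pos
  have h1 : Fou (V := V) ψ (RR (ξ + algebraMap F K c) V) h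
      = ψ (c * LinearMap.trace F V h) * Fou (V := V) ψ (RR ξ V) h := by
    unfold Fou
    rw [Finset.mul_sum]
    refine (Finset.sum_bijective (fun g : Module.End F V => g + c • 1) (AddGroup.addRight_bijective _) (by simp)
      fun g _ => ?_).symm
    rw [RR_shift, add_mul, map_add, AddChar.map_add_eq_mul, smul_mul_assoc, one_mul, map_smul, smul_eq_mul]
    ring
  have h2 : Rw (wf ψ (Module.finrank F V) (ξ + algebraMap F K c)) V h
      = ψ (c * LinearMap.trace F V h) * Rw (wf ψ (Module.finrank F V) ξ) V h := by
    unfold Rw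
    rw [Finset.mul_sum]
    refine Finset.sum_congr rfl fun η _ => ?_
    by_cases hg : RR η V h = 0
    · simp [hg]
    obtain ⟨hη, hh⟩ := En_supp η h hg
    rw [trace_tx h η hh]
    have : (ξ + algebraMap F K c ∈ En F K (Module.finrank F V)) ↔ ξ ∈ En F K (Module.finrank F V) := by
      constructor
      · intro h
        have := En_add h (En_alg (F := F) (K := K) (n := Module.finrank F V) (-c))
        simpa using this
      · intro h
        exact En_add h (En_alg c)
    unfold wf
    by_cases hc : ξ ∈ En F K (Module.finrank F V)
    · rw [if_pos ⟨this.2 hc, hη⟩, if_pos ⟨hc, hη⟩, add_mul, tx_add hn (En_mul hc hη) (En_mul (En_alg c) hη),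
        tx_smul hn hη, AddChar.map_add_eq_mul]
      ring
    · rw [if_neg (fun h => hc (this.1 h.1)), if_neg (fun h => hc h.1)]
      ring
  rw [PP, PP, h1, h2]
  ring

lemma psi_ne (ψ : AddChar F ℂ) (a : F) : ψ a ≠ 0 := by
  intro h
  have := AddChar.map_add_eq_mul ψ a (-a)
  rw [h, zero_mul, add_neg_cancel, AddChar.map_zero_eq_one] at this
  exact one_ne_zero this

lemma PP_nonunit [Nontrivial V] (hK : SplitsAll F V K) (ψ : AddChar F ℂ) (hψ : ∃ a : F, ψ a ≠ 1) (ξ : K)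
    (h : Module.End F V) (hh : ¬ IsUnit h) : PP (V := V) ψ ξ h = 0 := by
  by_contra hne
  have h0 : LinearMap.det h = 0 := by
    by_contra h0
    exact hh ((LinearMap.isUnit_iff_isUnit_det h).2 (Ne.isUnit h0))
  rw [LinearMap.det_eq_sign_charpoly_coeff] at h0
  have h1 : (Polynomial.aeval (0 : F)) h.charpoly = 0 := by
    have : h.charpoly.coeff 0 = 0 := by simpa using h0
    rw [Polynomial.coe_aeval_eq_eval, ← Polynomial.coeff_zero_eq_eval_zero, this]
  obtain ⟨b, hb⟩ := prim_supp (PP_prim ψ hψ ξ) h hne (0 : F) h1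
  rw [minpoly.zero] at hb
  refine hne (lemmaU Polynomial.X Polynomial.irreducible_X (PP_prim ψ hψ ξ) (fun g hg => ?_) h b hb)
  rw [Polynomial.aeval_X] at hg
  rw [hg, PP_zero hK]

lemma PP_unit [Nontrivial V] (hK : SplitsAll F V K) (ψ : AddChar F ℂ) (hψ : ∃ a : F, ψ a ≠ 1) (ξ : K)
    (h : Module.End F V) (hh : PP (V := V) ψ ξ h ≠ 0) (c : F) : IsUnit (h + c • 1) := by
  by_contra hcon
  have := PP_nonunit hK ψ hψ ξ _ hcon
  rw [PP_shift1] at this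
  exact (mul_ne_zero (psi_ne ψ _) hh) this

end
end MK

namespace MK
attribute [local instance] Fintype.ofFinite
attribute [local instance] Classical.propDecidable
section
open Polynomial
open ComplexConjugate
variable {F : Type} [Field F] [Finite F]
variable {K : Type} [Field K] [Finite K] [Algebra F K]

lemma exists_gen (n : ℕ) (hn : 0 < n) (hd : Nat.card F ^ n - 1 ∣ Nat.card K - 1) :
    ∃ g : K, IsPrimitiveRoot g (Nat.card F ^ n - 1) := by
  obtain ⟨z, hz⟩ := IsCyclic.exists_ofOrder_eq_natCard (α := Kˣ)
  have hq : 1 < Nat.card F := Finite.one_lt_card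
  have hK : 1 < Nat.card K := Finite.one_lt_card
  have h1 : Nat.card Kˣ = Nat.card K - 1 := Nat.card_units K
  obtain ⟨m, hm⟩ := hd
  have hpos : 0 < Nat.card F ^ n - 1 := Nat.sub_pos_of_lt (Nat.one_lt_pow hn.ne' hq)
  have hmpos : 0 < m := by
    rcases Nat.eq_zero_or_pos m with h | h
    · rw [h] at hm
      omega
    · exact h
  refine ⟨((z ^ m : Kˣ) : K), ?_⟩
  rw [IsPrimitiveRoot.coe_units_iff]
  have h2 : orderOf (z ^ m) = Nat.card F ^ n - 1 := by
    rw [orderOf_pow_of_dvd hmpos.ne', hz, h1, hm, Nat.mul_div_cancel _ hmpos]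
    rw [hz, h1, hm]
    exact Dvd.intro_left _ rfl
  rw [← h2]
  exact IsPrimitiveRoot.orderOf _

lemma En_unit_iff {n : ℕ} {x : K} (hx : x ≠ 0) : x ∈ En F K n ↔ x ^ (Nat.card F ^ n - 1) = 1 := by
  have hq : 0 < Nat.card F ^ n := pow_pos Finite.card_pos n
  rw [mem_En]
  obtain ⟨m, hm⟩ : ∃ m, Nat.card F ^ n = m + 1 := ⟨Nat.card F ^ n - 1, by omega⟩
  rw [hm, pow_succ, Nat.add_sub_cancel]
  constructor
  · intro h
    exact mul_right_cancel₀ hx (by rw [h, one_mul])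
  · intro h
    rw [h, one_mul]

lemma zero_En {n : ℕ} : (0 : K) ∈ En F K n := by
  rw [mem_En]
  exact zero_pow (pow_pos Finite.card_pos n).ne'

lemma card_En (n : ℕ) (hn : 0 < n) (hd : Nat.card F ^ n - 1 ∣ Nat.card K - 1) :
    (En F K n).card = Nat.card F ^ n := by
  obtain ⟨g, hg⟩ := exists_gen (F := F) (K := K) n hn hd
  have hq : 1 < Nat.card F := Finite.one_lt_card
  have hpos : 0 < Nat.card F ^ n - 1 := Nat.sub_pos_of_lt (Nat.one_lt_pow hn.ne' hq)
  have h1 : (En F K n).erase 0 = Polynomial.nthRootsFinset (Nat.card F ^ n - 1) (1 : K) := by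
    ext x
    rw [Finset.mem_erase, Polynomial.mem_nthRootsFinset hpos]
    constructor
    · rintro ⟨h0, h1⟩
      exact (En_unit_iff h0).1 h1
    · intro h
      have h0 : x ≠ 0 := by
        rintro rfl
        rw [zero_pow hpos.ne'] at h
        exact zero_ne_one h
      exact ⟨h0, (En_unit_iff h0).2 h⟩
  have h2 := hg.card_nthRootsFinset
  rw [← h1, Finset.card_erase_of_mem zero_En] at h2
  have h3 : 0 < (En F K n).card := Finset.card_pos.2 ⟨0, zero_En⟩
  omega

/-- A primitive prime divisor package. -/
lemma exists_t0 (n : ℕ) (hn : 1 < n) (hd : Nat.card F ^ n - 1 ∣ Nat.card K - 1) :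
    ∃ (l : ℕ) (t : K), l.Prime ∧ IsPrimitiveRoot t l ∧ t ∈ En F K n ∧
      (∀ d, d ∣ n → d < n → l * (Nat.card F ^ d - 1) ∣ Nat.card F ^ n - 1) ∧
      ∀ i, 0 < i → i < n → ∃ x ∈ En F K n, x ≠ 0 ∧ x ^ Nat.card F ^ i = t * x := by
  obtain ⟨q, hqdef⟩ : ∃ q, q = Nat.card F := ⟨_, rfl⟩
  have hq : 1 < Nat.card F := Finite.one_lt_card
  obtain ⟨g, hg⟩ := exists_gen (F := F) (K := K) n (by omega) hd
  rw [← hqdef] at hq hg ⊢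
  have hbig := Polynomial.sub_one_lt_natAbs_cyclotomic_eval hn (q := q) hq.ne'
  obtain ⟨l, hl, hld⟩ := Nat.exists_prime_and_dvd (n := ((Polynomial.cyclotomic n ℤ).eval (q : ℤ)).natAbs) (by omega)
  have hldz : (l : ℤ) ∣ (Polynomial.cyclotomic n ℤ).eval (q : ℤ) := Int.natCast_dvd.2 hld
  have hcast : ∀ d, ((q ^ d - 1 : ℕ) : ℤ) = (q : ℤ) ^ d - 1 := fun d => by
    rw [Nat.cast_sub (Nat.one_le_pow _ _ (by omega))]
    simp
  have hdiv : ∀ d, d ∣ n → d < n → l * (q ^ d - 1) ∣ q ^ n - 1 := by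
    intro d hdn hlt
    have h1 := Polynomial.X_pow_sub_one_mul_cyclotomic_dvd_X_pow_sub_one_of_dvd ℤ
      (Nat.mem_properDivisors.2 ⟨hdn, hlt⟩)
    have h2 := Polynomial.eval_dvd (x := (q : ℤ)) h1
    simp only [Polynomial.eval_mul, Polynomial.eval_sub, Polynomial.eval_pow, Polynomial.eval_X,
      Polynomial.eval_one] at h2
    rw [← Int.natCast_dvd_natCast, Nat.cast_mul, hcast, hcast]
    refine dvd_trans ?_ h2
    rw [mul_comm]
    exact mul_dvd_mul_left _ hldz
  have hpos : ∀ d, 0 < d → 0 < q ^ d - 1 := fun d hd => Nat.sub_pos_of_lt (Nat.one_lt_pow hd.ne' hq)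
  have hl1 : l ∣ q ^ n - 1 := (Dvd.intro _ rfl).trans (hdiv 1 (one_dvd n) hn)
  have hlpos := hl.pos
  refine ⟨l, g ^ ((q ^ n - 1) / l), hl, ?_, ?_, hdiv, ?_⟩
  · exact hg.pow (hpos n (by omega)) (Nat.div_mul_cancel hl1).symm
  · have hg0 : g ≠ 0 := hg.ne_zero (hpos n (by omega)).ne'
    refine En_pow ((En_unit_iff hg0).2 ?_) _
    rw [← hqdef]
    exact hg.pow_eq_one
  · intro i hi hin
    have hg0 : g ≠ 0 := hg.ne_zero (hpos n (by omega)).ne'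
    have hgE : g ∈ En F K n := by
      rw [En_unit_iff hg0, ← hqdef]
      exact hg.pow_eq_one
    have hgcd : Nat.gcd (q ^ n - 1) (q ^ i - 1) = q ^ Nat.gcd n i - 1 := Nat.pow_sub_one_gcd_pow_sub_one q n i
    have hdlt : Nat.gcd n i < n := lt_of_le_of_lt (Nat.gcd_le_right _ hi) hin
    have hdpos : 0 < Nat.gcd n i := Nat.gcd_pos_of_pos_right _ hi
    obtain ⟨N', hN'⟩ := hdiv _ (Nat.gcd_dvd_left n i) hdlt
    have hN : q ^ n - 1 = (q ^ Nat.gcd n i - 1) * (l * N') := by rw [hN']; ring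
    have hlN : 0 < l * N' := by
      rcases Nat.eq_zero_or_pos (l * N') with h | h
      · rw [h, mul_zero] at hN
        have := hpos n (by omega)
        omega
      · exact h
    -- the power map image
    have hy : IsPrimitiveRoot (g ^ (q ^ i - 1)) (l * N') := by
      have h1 : orderOf g = q ^ n - 1 := hg.eq_orderOf.symm
      have h2 : orderOf (g ^ (q ^ i - 1)) = l * N' := by
        rw [orderOf_pow' g (hpos i hi).ne', h1, hgcd, hN, Nat.mul_div_cancel_left _ (hpos _ hdpos)]
      rw [← h2]
      exact IsPrimitiveRoot.orderOf _
    haveI : NeZero (l * N') := ⟨hlN.ne'⟩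
    have ht : (g ^ ((q ^ n - 1) / l)) ^ (l * N') = 1 := by
      rw [pow_mul, ← pow_mul g, Nat.div_mul_cancel hl1, hg.pow_eq_one, one_pow]
    obtain ⟨j, _, hj⟩ := hy.eq_pow_of_pow_eq_one ht
    refine ⟨g ^ j, En_pow hgE j, pow_ne_zero _ hg0, ?_⟩
    rw [← hj]
    obtain ⟨m, hm⟩ : ∃ m, q ^ i = m + 1 := ⟨q ^ i - 1, by have := hpos i hi; omega⟩
    rw [hm, Nat.add_sub_cancel]
    ring

lemma sum_mulChar (a : K) (ha : a ≠ 1) : ∑ χ : MulChar K ℂ, χ a = 0 := by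
  haveI : NeZero ((Monoid.exponent Kˣ : ℂ)) := ⟨Nat.cast_ne_zero.2 Monoid.exponent_ne_zero_of_finite⟩
  obtain ⟨χ, hχ⟩ := MulChar.exists_apply_ne_one_of_hasEnoughRootsOfUnity K ℂ ha
  refine eq_zero_of_mul_eq_self_left hχ ?_
  simp only [Finset.mul_sum, ← MulChar.mul_apply]
  exact Fintype.sum_bijective _ (Group.mulLeft_bijective χ) _ _ fun χ' => rfl

lemma mulChar_sep (f : K → ℂ) (h : ∀ θ : MulChar K ℂ, ∑ ξ, θ ξ * f ξ = 0) (x : K) (hx : x ≠ 0) : f x = 0 := by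
  have h1 : ∑ θ : MulChar K ℂ, θ x⁻¹ * ∑ ξ, θ ξ * f ξ = 0 :=
    Finset.sum_eq_zero fun θ _ => by rw [h θ, mul_zero]
  simp only [Finset.mul_sum] at h1
  rw [Finset.sum_comm, Finset.sum_eq_single x] at h1
  · have h2 : ∀ θ : MulChar K ℂ, θ x⁻¹ * (θ x * f x) = f x := fun θ => by
      rw [← mul_assoc, ← map_mul, inv_mul_cancel₀ hx, map_one, one_mul]
    rw [Finset.sum_congr rfl fun θ _ => h2 θ, Finset.sum_const, nsmul_eq_mul] at h1
    rcases mul_eq_zero.1 h1 with h3 | h3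
    · exfalso
      rw [Nat.cast_eq_zero, Finset.card_eq_zero] at h3
      exact Finset.univ_nonempty.ne_empty h3
    · exact h3
  · intro y _ hy
    rw [Finset.sum_congr rfl (g := fun θ : MulChar K ℂ => θ (x⁻¹ * y) * f y)
      (fun θ _ => by rw [map_mul, mul_assoc]), ← Finset.sum_mul, sum_mulChar, zero_mul]
    intro h
    exact hy ((inv_mul_eq_one₀ hx).1 h).symm
  · simp

lemma mulChar_norm (θ : MulChar K ℂ) (x : K) (hx : x ≠ 0) : conj (θ x) = θ x⁻¹ := by
  have h1 : θ x ^ (Nat.card K - 1) = 1 := by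
    rw [← map_pow, Nat.card_eq_fintype_card, FiniteField.pow_card_sub_one_eq_one x hx, map_one]
  have hK : 1 < Nat.card K := Finite.one_lt_card
  have h2 : ‖θ x‖ = 1 := Complex.norm_eq_one_of_pow_eq_one h1 (by omega)
  have h3 : θ x * θ x⁻¹ = 1 := by rw [← map_mul, mul_inv_cancel₀ hx, map_one]
  rw [← Complex.inv_eq_conj h2]
  exact inv_eq_of_mul_eq_one_right h3

end
end MK

namespace MK
attribute [local instance] Fintype.ofFinite
attribute [local instance] Classical.propDecidable
section
open Polynomial
open ComplexConjugate

variable {F : Type} [Field F] [Finite F]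
variable {K : Type} [Field K] [Finite K] [Algebra F K]
variable {V : Type} [AddCommGroup V] [Module F V] [Finite V]

lemma nx_zero_iff {n : ℕ} (hn : 0 < n) {η : K} (h : η ∈ En F K n) : nx F n η = 0 ↔ η = 0 := by
  rw [← map_eq_zero_iff (algebraMap F K) (algebraMap F K).injective, nx_map h, Finset.prod_eq_zero_iff]
  · constructor
    · rintro ⟨i, _, hi⟩
      exact pow_eq_zero_iff (pow_ne_zero _ (Nat.card_pos.ne')) |>.1 hi
    · rintro rfl
      exact ⟨0, Finset.mem_range.2 hn, by simp⟩

lemma RR_unit [Nontrivial V] (η : K) (g : Module.End F V) (h : RR η V g ≠ 0) : IsUnit g ↔ η ≠ 0 := by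
  obtain ⟨h1, h2⟩ := En_supp η g h
  rw [LinearMap.isUnit_iff_isUnit_det, det_nx g η h2, isUnit_iff_ne_zero, not_iff_not]
  exact nx_zero_iff Module.finrank_pos h1

lemma sum_units (f : Module.End F V → ℂ) (h : ∀ g, ¬ IsUnit g → f g = 0) :
    ∑ g, f g = ∑ u : (Module.End F V)ˣ, f u := by
  symm
  refine Finset.sum_bij_ne_zero (fun u _ _ => (u : Module.End F V)) (fun _ _ _ => Finset.mem_univ _)
    (fun _ _ _ _ _ _ h => Units.ext h) ?_ (fun _ _ _ => rfl)
  intro g _ hg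
  by_cases hu : IsUnit g
  · exact ⟨hu.unit, Finset.mem_univ _, hg, rfl⟩
  · exact absurd (h g hu) hg

lemma Rw_nonunit [Nontrivial V] (θ : MulChar K ℂ) (g : Module.End F V) (hg : ¬ IsUnit g) :
    Rw (F := F) (fun η : K => θ η) V g = 0 := by
  refine Finset.sum_eq_zero fun η _ => ?_
  by_cases h : RR (F := F) η V g = 0
  · rw [h, mul_zero]
  · have : η = 0 := by
      by_contra h0
      exact hg ((RR_unit η g h).2 h0)
    subst this
    have h0 : θ (0 : K) = 0 := θ.map_nonunit (by simp)
    beta_reduce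
    rw [h0, zero_mul]

lemma En_reindex {n : ℕ} {x : K} (hx : x ∈ En F K n) (h0 : x ≠ 0) (f : K → ℂ) :
    ∑ ξ ∈ En F K n, f (ξ * x) = ∑ ξ ∈ En F K n, f ξ := by
  refine Finset.sum_bij' (fun ξ _ => ξ * x) (fun ξ _ => ξ * x⁻¹) (fun ξ h => En_mul h hx)
    (fun ξ h => En_mul h (En_inv hx)) (fun ξ _ => ?_) (fun ξ _ => ?_) (fun _ _ => rfl)
  · field_simp
  · field_simp

lemma theta_orth {n : ℕ} (θ : MulChar K ℂ) (t : K) (ht : θ t ≠ 1) (i : ℕ)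
    (hx : ∃ x ∈ En F K n, x ≠ 0 ∧ x ^ Nat.card F ^ i = t * x) :
    ∑ ξ ∈ En F K n, conj (θ ξ) * θ (ξ ^ Nat.card F ^ i) = 0 := by
  obtain ⟨x, hx, h0, h1⟩ := hx
  have h2 := En_reindex hx h0 (fun ξ => conj (θ ξ) * θ (ξ ^ Nat.card F ^ i))
  have h3 : conj (θ x) * θ x = 1 := by
    rw [mulChar_norm θ x h0, ← map_mul, inv_mul_cancel₀ h0, map_one]
  have h4 : ∀ ξ : K, conj (θ (ξ * x)) * θ ((ξ * x) ^ Nat.card F ^ i)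
      = θ t * (conj (θ ξ) * θ (ξ ^ Nat.card F ^ i)) := by
    intro ξ
    rw [mul_pow, h1, map_mul, map_mul, map_mul, map_mul]
    linear_combination (θ t * conj (θ ξ) * θ (ξ ^ Nat.card F ^ i)) * h3
  beta_reduce at h2
  rw [Finset.sum_congr rfl fun ξ _ => h4 ξ, ← Finset.mul_sum] at h2
  by_contra hne
  exact ht (mul_right_cancel₀ hne (h2.trans (one_mul _).symm))

lemma theta_norm {n : ℕ} (hn : 0 < n) (hd : Nat.card F ^ n - 1 ∣ Nat.card K - 1) (θ : MulChar K ℂ) :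
    ∑ ξ ∈ En F K n, conj (θ ξ) * θ ξ = (Nat.card F : ℂ) ^ n - 1 := by
  have h0 : (0 : K) ∈ En F K n := zero_En
  rw [← Finset.sum_erase_add _ _ h0, Finset.sum_congr rfl (g := fun _ => (1 : ℂ))]
  · rw [Finset.sum_const, Finset.card_erase_of_mem h0, card_En n hn hd, nsmul_eq_mul,
      Nat.cast_sub (Nat.one_le_pow _ _ Nat.card_pos), θ.map_nonunit (by simp)]
    simp
  · intro x hx
    have hx0 := Finset.ne_of_mem_erase hx
    rw [mulChar_norm θ x hx0, ← map_mul, inv_mul_cancel₀ hx0, map_one]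

lemma conj_Rw (w : K → ℂ) (g : Module.End F V) :
    conj (Rw (F := F) w V g) = Rw (F := F) (fun η => conj (w η)) V g := by
  unfold Rw
  rw [map_sum]
  refine Finset.sum_congr rfl fun η _ => ?_
  obtain ⟨m, hm⟩ := RR_int (F := F) η _ V g rfl
  rw [map_mul, hm]
  simp

lemma norm_Rw [Nontrivial V] (hd : Nat.card F ^ (Module.finrank F V) - 1 ∣ Nat.card K - 1)
    (θ : MulChar K ℂ) (t : K) (ht : θ t ≠ 1)
    (hx : ∀ i, 0 < i → i < Module.finrank F V → ∃ x ∈ En F K (Module.finrank F V), x ≠ 0 ∧ x ^ Nat.card F ^ i = t * x) :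
    ∑ g, Rw (F := F) (fun η : K => θ η) V g * conj (Rw (F := F) (fun η : K => θ η) V g)
      = Nat.card (V ≃ₗ[F] V) := by
  have h := lemS2 (V := V) (F := F) (fun η : K => θ η) (fun η => conj (θ η)) (fun _ => 1)
  have hn : 0 < Module.finrank F V := Module.finrank_pos
  simp only [mul_one] at h
  have h1 : ∑ ξ ∈ En F K (Module.finrank F V), conj (θ ξ) *
        ∑ i ∈ Finset.range (Module.finrank F V), θ (ξ ^ Nat.card F ^ i) = (Nat.card V : ℂ) - 1 := by
    simp only [Finset.mul_sum]
    rw [Finset.sum_comm, Finset.sum_eq_single 0]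
    · simp only [pow_zero, pow_one]
      rw [theta_norm hn hd, Module.natCard_eq_pow_finrank (K := F) (V := V)]
      push_cast; rfl
    · intro i hi h0
      exact theta_orth θ t ht i (hx i (Nat.pos_of_ne_zero h0) (Finset.mem_range.1 hi))
    · intro h; exact absurd (Finset.mem_range.2 hn) h
  rw [h1, mul_comm] at h
  rw [← mul_right_cancel₀ card_sub_one_ne h]
  exact Finset.sum_congr rfl fun g _ => by rw [conj_Rw]

lemma card_units : Nat.card (Module.End F V)ˣ = Nat.card (V ≃ₗ[F] V) :=
  Nat.card_congr (LinearMap.GeneralLinearGroup.generalLinearEquiv F V).toEquiv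

lemma eig0 {N : ℕ} (hN : N ≠ 0) (hGN : Nat.card (V ≃ₗ[F] V) ∣ N) (ψ : AddChar F ℂ) (R : Module.End F V → ℂ)
    (hinv : ClassFn R) (hnorm : ∑ g, R g * conj (R g) = Nat.card (V ≃ₗ[F] V)) (hnon : ∀ g, ¬ IsUnit g → R g = 0)
    (hIntg : ∀ (d : ℕ) (ρ : (Module.End F V)ˣ →* Matrix (Fin d) (Fin d) ℂ), IsIntegral ℤ ((Nat.card (Module.End F V)ˣ : ℂ)⁻¹ *
      ∑ g, (ρ g).trace * R (g : Module.End F V)))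
    (hCP : ∀ g, CP N (R g)) : ∃ γ : ℂ, ∀ h : (Module.End F V)ˣ, Fou ψ R h
      = γ * R ((h⁻¹ : (Module.End F V)ˣ) : Module.End F V) := by
  have hcl : ∀ g h : (Module.End F V)ˣ, R ((h * g * h⁻¹ : (Module.End F V)ˣ) : Module.End F V)
      = R (g : Module.End F V) := by
    intro g h
    refine (hinv (LinearMap.GeneralLinearGroup.generalLinearEquiv F V h) g _ ?_).symm
    intro x
    have h1 : (h * g * h⁻¹ * h : (Module.End F V)ˣ) = h * g := by group
    have h2 := congrArg (fun u : (Module.End F V)ˣ => (u : Module.End F V) x) h1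
    exact h2.symm
  obtain ⟨γ, hγ⟩ := eigen_thm (G := (Module.End F V)ˣ) (N := N)
    hN (by rw [card_units]; exact hGN)
    (fun u => R u) hcl (fun d ρ => by convert hIntg d ρ)
    (by
      rw [card_units, ← hnorm]
      refine Eq.trans (Finset.sum_congr (by ext; simp) fun _ _ => rfl) (sum_units (fun g => R g * conj (R g)) ?_).symm
      intro g hg
      rw [hnon g hg, zero_mul])
    (fun g => hCP g)
    (fun u => ψ (LinearMap.trace F V ((u⁻¹ : (Module.End F V)ˣ) : Module.End F V)))
    (by
      intro g h
      beta_reduce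
      congr 1
      rw [mul_inv_rev, inv_inv, mul_inv_rev, Units.val_mul, LinearMap.trace_mul_comm, ← Units.val_mul]
      congr 2
      group)
  refine ⟨γ, fun h => ?_⟩
  rw [← hγ h⁻¹]
  unfold Fou
  rw [sum_units]
  · refine Finset.sum_congr (by ext; simp) fun g _ => ?_
    rw [mul_comm]
    congr 3
  · intro g hg
    rw [hnon g hg, zero_mul]


lemma R_int' {ι : Type} (i1 : Fintype ι) (i2 : DecidableEq ι) (Γ : Type) [Group Γ] [Finite Γ] (σ : Γ →* Module.End F V)
    (ρ : Γ →* Matrix ι ι ℂ) (θ : MulChar K ℂ) (h : Nat.card Γ ∣ Nat.card K * (Nat.card K - 1)) :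
    IsIntegral ℤ ((Nat.card Γ : ℂ)⁻¹ * ∑ γ, (ρ γ).trace * Rw (fun η : K => θ η) V (σ γ)) := by
  haveI : Finite ι := Finite.of_fintype ι
  have h1 : i1 = Fintype.ofFinite ι := Subsingleton.elim _ _
  have h2 : i2 = fun a b => Classical.propDecidable (a = b) := Subsingleton.elim _ _
  subst h1 h2
  exact R_int (F := F) _ V rfl _ σ ρ θ h

lemma eig [Nontrivial V] (hG : Nat.card (V ≃ₗ[F] V) ∣ Nat.card K * (Nat.card K - 1))
    (hd : Nat.card F ^ (Module.finrank F V) - 1 ∣ Nat.card K - 1)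
    (θ : MulChar K ℂ) (t : K) (ht : θ t ≠ 1)
    (hx : ∀ i, 0 < i → i < Module.finrank F V → ∃ x ∈ En F K (Module.finrank F V), x ≠ 0 ∧ x ^ Nat.card F ^ i = t * x)
    (ψ : AddChar F ℂ) :
    ∃ γ : ℂ, ∀ h : (Module.End F V)ˣ, Fou ψ (Rw (F := F) (fun η : K => θ η) V) h
      = γ * Rw (F := F) (fun η : K => θ η) V ((h⁻¹ : (Module.End F V)ˣ) : Module.End F V) := by
  have hK : 1 < Nat.card K := Finite.one_lt_card
  have hne : Nat.card (V ≃ₗ[F] V) ≠ 0 := by rw [← card_units]; exact Nat.card_pos.ne'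
  have hinv := (Rw_prim (F := F) (V := V) (fun η : K => θ η)).cls
  have hnorm := norm_Rw hd θ t ht hx
  have hnon := Rw_nonunit (F := F) (V := V) θ
  have hIntg : ∀ (d : ℕ) (ρ : (Module.End F V)ˣ →* Matrix (Fin d) (Fin d) ℂ), IsIntegral ℤ ((Nat.card (Module.End F V)ˣ : ℂ)⁻¹ *
      ∑ g, (ρ g).trace * Rw (F := F) (fun η : K => θ η) V (g : Module.End F V)) :=
    fun d ρ => by
      have := R_int' (F := F) (V := V) _ _ _ (Units.coeHom (Module.End F V)) ρ θ (by rw [card_units]; exact hG)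
      convert this using 1
      refine congrArg _ (Finset.sum_congr (by ext; simp) fun _ _ => rfl)
  have hCP : ∀ g : Module.End F V, CP (Nat.card (V ≃ₗ[F] V) * (Nat.card K - 1)) (Rw (F := F) (fun η : K => θ η) V g) := by
    intro g
    refine CP.sum _ _ fun η _ => CP.mul ?_ ?_
    · by_cases h0 : η = 0
      · subst h0
        beta_reduce
        rw [θ.map_nonunit (by simp)]
        exact CP.zero
      · refine CP.root (Nat.mul_ne_zero hne (by omega)) _ ?_
        rw [mul_comm, pow_mul, ← map_pow, Nat.card_eq_fintype_card (α := K), FiniteField.pow_card_sub_one_eq_one η h0, map_one, one_pow]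
    · obtain ⟨m, hm⟩ := RR_int (F := F) η _ V g rfl
      rw [hm]
      exact_mod_cast CP.rat (N := Nat.card (V ≃ₗ[F] V) * (Nat.card K - 1)) (m : ℚ)
  exact eig0 (Nat.mul_ne_zero hne (by omega)) (Dvd.intro _ rfl) ψ _ hinv hnorm hnon hIntg hCP

end
end MK

namespace MK
attribute [local instance] Fintype.ofFinite
attribute [local instance] Classical.propDecidable
section
open Polynomial
open ComplexConjugate

variable {F : Type} [Field F] [Finite F]
variable {K : Type} [Field K] [Finite K] [Algebra F K]
variable {V : Type} [AddCommGroup V] [Module F V] [Finite V]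

lemma fou_one [Nontrivial V] (hK : SplitsAll F V K) (ψ : AddChar F ℂ) (w : K → ℂ) :
    Fou (V := V) ψ (Rw (F := F) w V) 1 = cst F K V * aa F K (Module.finrank F V) *
      ∑ η ∈ En F K (Module.finrank F V), ψ (tx F (Module.finrank F V) η) * w η := by
  have h := lemS (V := V) hK w (fun p => ψ (-p.coeff (Module.finrank F V - 1)))
  have h1 : Fou (V := V) ψ (Rw (F := F) w V) 1 = ∑ g : Module.End F V, Rw (F := F) w V g *
      ψ (-(LinearMap.charpoly g).coeff (Module.finrank F V - 1)) := by
    unfold Fou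
    exact Finset.sum_congr rfl fun g _ => by rw [mul_one, trace_charpoly]
  have h2 : ∀ η : K, -(pol F (Module.finrank F V) η).coeff (Module.finrank F V - 1) = tx F (Module.finrank F V) η := fun η => rfl
  simp only [h2] at h
  have h5 := card_sub_one_ne (V := V)
  have h6 := aa_ne' (F := F) (K := K) (V := V)
  apply mul_left_cancel₀ h5
  rw [h1, h, cst]
  field_simp

lemma fou_Rw (ψ : AddChar F ℂ) (w : K → ℂ) (h : Module.End F V) :
    Fou (V := V) ψ (Rw (F := F) w V) h = ∑ ξ, w ξ * Fou (V := V) ψ (RR ξ V) h := by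
  unfold Fou Rw
  simp only [Finset.sum_mul, Finset.mul_sum]
  rw [Finset.sum_comm]
  exact Finset.sum_congr rfl fun ξ _ => Finset.sum_congr rfl fun g _ => by ring

lemma sum_PP_theta [Nontrivial V] (hK : SplitsAll F V K) (hG : Nat.card (V ≃ₗ[F] V) ∣ Nat.card K * (Nat.card K - 1))
    (hd : Nat.card F ^ (Module.finrank F V) - 1 ∣ Nat.card K - 1)
    (θ : MulChar K ℂ) (t : K) (ht : θ t ≠ 1)
    (hx : ∀ i, 0 < i → i < Module.finrank F V → ∃ x ∈ En F K (Module.finrank F V), x ≠ 0 ∧ x ^ Nat.card F ^ i = t * x)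
    (ψ : AddChar F ℂ) (h : (Module.End F V)ˣ) :
    ∑ ξ : K, θ ξ * PP ψ ξ (h : Module.End F V) = 0 := by
  obtain ⟨γ, hγ⟩ := eig hG hd θ t ht hx ψ
  have h6 := aa_ne' (F := F) (K := K) (V := V)
  have h1 := hγ 1
  rw [inv_one, Units.val_one, fou_one hK, Rw_one, map_one, one_mul] at h1
  obtain ⟨τ, hτ⟩ : ∃ τ, τ = ∑ η ∈ En F K (Module.finrank F V), ψ (tx F (Module.finrank F V) η) * θ η := ⟨_, rfl⟩
  rw [← hτ] at h1
  have h2 : γ = cst F K V * τ := by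
    apply mul_right_cancel₀ h6
    rw [← h1]; ring
  have h3 : ∀ η : K, (∑ ξ : K, θ ξ * wf ψ (Module.finrank F V) ξ η) * RR η V (h : Module.End F V)
      = τ * (θ η⁻¹ * RR η V (h : Module.End F V)) := by
    intro η
    by_cases hr : RR η V (h : Module.End F V) = 0
    · rw [hr]; simp
    have h0 : η ≠ 0 := (RR_unit η _ hr).1 h.isUnit
    have hE := (En_supp η _ hr).1
    rw [← mul_assoc]
    congr 1
    have e1 : ∑ ξ : K, θ ξ * wf ψ (Module.finrank F V) ξ η
        = ∑ ξ ∈ En F K (Module.finrank F V), θ ξ * ψ (tx F (Module.finrank F V) (ξ * η)) := by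
      rw [← Finset.sum_subset (Finset.subset_univ (En F K (Module.finrank F V)))]
      · exact Finset.sum_congr rfl fun ξ hξ => by rw [wf, if_pos ⟨hξ, hE⟩]
      · intro ξ _ hξ
        rw [wf, if_neg (fun h => hξ h.1), mul_zero]
    rw [e1, hτ, Finset.sum_mul]
    refine Eq.trans ?_ (En_reindex hE h0 (fun ξ => ψ (tx F (Module.finrank F V) ξ) * θ ξ * θ η⁻¹))
    refine Finset.sum_congr rfl fun ξ _ => ?_
    rw [map_mul]
    have : θ η * θ η⁻¹ = 1 := by rw [← map_mul, mul_inv_cancel₀ h0, map_one]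
    linear_combination (-ψ (tx F (Module.finrank F V) (ξ * η)) * θ ξ) * this
  have h4 : Rw (F := F) (fun η : K => θ η) V ((h⁻¹ : (Module.End F V)ˣ) : Module.End F V)
      = ∑ η : K, θ η⁻¹ * RR η V (h : Module.End F V) := by
    unfold Rw
    refine Finset.sum_bij' (fun η _ => η⁻¹) (fun η _ => η⁻¹) (fun _ _ => Finset.mem_univ _)
      (fun _ _ => Finset.mem_univ _) (fun η _ => inv_inv η) (fun η _ => inv_inv η) ?_
    intro η _
    by_cases h0 : η = 0
    · subst h0
      simp [θ.map_nonunit]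
    · rw [inv_inv, RR_inverse η h0 ((h⁻¹ : (Module.End F V)ˣ) : Module.End F V) (h : Module.End F V) (by simp)]
  unfold PP
  simp only [mul_sub, Finset.sum_sub_distrib]
  rw [← fou_Rw, hγ h, h4, h2, sub_eq_zero]
  have h7 : ∑ ξ : K, θ ξ * (cst F K V * Rw (wf ψ (Module.finrank F V) ξ) V (h : Module.End F V))
     = cst F K V * ∑ η : K, (∑ ξ : K, θ ξ * wf ψ (Module.finrank F V) ξ η) * RR η V (h : Module.End F V) := by
    unfold Rw
    simp only [Finset.sum_mul, Finset.mul_sum]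
    rw [Finset.sum_comm]
    exact Finset.sum_congr rfl fun ξ _ => Finset.sum_congr rfl fun g _ => by ring
  rw [h7, Finset.sum_congr rfl fun η _ => h3 η, ← Finset.mul_sum, mul_assoc]

lemma PP_t0 [Nontrivial V] (hK : SplitsAll F V K) (hG : Nat.card (V ≃ₗ[F] V) ∣ Nat.card K * (Nat.card K - 1))
    (hd : Nat.card F ^ (Module.finrank F V) - 1 ∣ Nat.card K - 1) (t : K) (ht : t ≠ 0)
    (hx : ∀ i, 0 < i → i < Module.finrank F V → ∃ x ∈ En F K (Module.finrank F V), x ≠ 0 ∧ x ^ Nat.card F ^ i = t * x)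
    (ψ : AddChar F ℂ) (h : Module.End F V) (hh : IsUnit h) (ξ : K) : PP ψ (ξ * t) h = PP ψ ξ h := by
  by_cases h0 : ξ = 0
  · rw [h0, zero_mul]
  refine sub_eq_zero.1 (mulChar_sep (fun ξ => PP ψ (ξ * t) h - PP ψ ξ h) (fun θ => ?_) ξ h0)
  simp only [mul_sub, Finset.sum_sub_distrib]
  have e1 : θ t * ∑ ξ : K, θ ξ * PP ψ (ξ * t) h = ∑ ξ : K, θ ξ * PP ψ ξ h := by
    rw [Finset.mul_sum]
    refine Finset.sum_bij' (fun ξ _ => ξ * t) (fun ξ _ => ξ * t⁻¹) (fun _ _ => Finset.mem_univ _)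
      (fun _ _ => Finset.mem_univ _) (fun ξ _ => ?_) (fun ξ _ => ?_) (fun ξ _ => ?_)
    · field_simp
    · field_simp
    · rw [map_mul]; ring
  by_cases h1 : θ t = 1
  · rw [h1, one_mul] at e1
    rw [e1, sub_self]
  · have h2 := sum_PP_theta hK hG hd θ t h1 hx ψ hh.unit
    rw [IsUnit.unit_spec] at h2
    rw [h2] at e1 ⊢
    have h3 : θ t ≠ 0 := by
      intro h
      have : θ t * θ t⁻¹ = 1 := by rw [← map_mul, mul_inv_cancel₀ ht, map_one]
      rw [h, zero_mul] at this
      exact zero_ne_one this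
    rw [(mul_eq_zero.1 e1).resolve_left h3, sub_zero]

end
end MK

namespace MK
attribute [local instance] Fintype.ofFinite
attribute [local instance] Classical.propDecidable
section
open Polynomial

variable {F : Type} [Field F] [Finite F]
variable {K : Type} [Field K] [Finite K] [Algebra F K]
variable {V : Type} [AddCommGroup V] [Module F V] [Finite V]

lemma psi_sep (ψ : AddChar F ℂ) (hψ : ∃ a : F, ψ a ≠ 1) (x y : F) (h : ∀ c, ψ (c * x) = ψ (c * y)) : x = y := by
  by_contra hne
  obtain ⟨a, ha⟩ := hψ
  have h1 := h (a / (x - y))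
  apply ha
  have h2 : a = a / (x - y) * x - a / (x - y) * y := by
    rw [← mul_sub, div_mul_cancel₀ _ (sub_ne_zero.2 hne)]
  rw [h2, AddChar.map_sub_eq_div, h1, div_self (psi_ne ψ _)]

lemma tx_inv [Nontrivial V] (hK : SplitsAll F V K) (hG : Nat.card (V ≃ₗ[F] V) ∣ Nat.card K * (Nat.card K - 1))
    (hd : Nat.card F ^ (Module.finrank F V) - 1 ∣ Nat.card K - 1) (t : K) (ht : t ≠ 0)
    (hx : ∀ i, 0 < i → i < Module.finrank F V → ∃ x ∈ En F K (Module.finrank F V), x ≠ 0 ∧ x ^ Nat.card F ^ i = t * x)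
    (ψ : AddChar F ℂ) (hψ : ∃ a : F, ψ a ≠ 1) (h : Module.End F V) (ξ : K) (hP : PP ψ ξ h ≠ 0) (j : ℕ) :
    PP ψ (ξ * t ^ j) h ≠ 0 ∧ tx F (Module.finrank F V) (ξ * t ^ j) = tx F (Module.finrank F V) ξ := by
  have hu := PP_unit hK ψ hψ ξ h hP
  have hu0 : IsUnit h := by simpa using hu 0
  induction j with
  | zero => rw [pow_zero, mul_one]; exact ⟨hP, rfl⟩
  | succ j ih =>
    rw [pow_succ, ← mul_assoc]
    refine ⟨by rw [PP_t0 hK hG hd t ht hx ψ h hu0]; exact ih.1, ?_⟩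
    rw [← ih.2]
    refine psi_sep ψ hψ _ _ fun c => ?_
    have h1 := PP_t0 hK hG hd t ht hx ψ _ (hu c) (ξ * t ^ j)
    rw [PP_shift1, PP_shift1, PP_t0 hK hG hd t ht hx ψ h hu0] at h1
    exact mul_right_cancel₀ ih.1 h1

lemma S_zero {n : ℕ} (hn : 0 < n) (ξ t : K) (l : ℕ) (hl : l.Prime) (ht : IsPrimitiveRoot t l) (htE : t ∈ En F K n)
    (hξ : ξ ∈ En F K n) (h : ∀ j, tx F n (ξ * t ^ j) = tx F n ξ) :
    ∑ i ∈ (Finset.range n).filter (fun i => t ^ Nat.card F ^ i = t), ξ ^ Nat.card F ^ i = 0 := by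
  have ht0 : t ≠ 0 := ht.ne_zero hl.ne_zero
  haveI : NeZero l := ⟨hl.ne_zero⟩
  have hl0 : (l : K) ≠ 0 := ht.neZero'.out
  have h1 : ∀ j, ∑ i ∈ Finset.range n, ξ ^ Nat.card F ^ i * (t ^ Nat.card F ^ i) ^ j = algebraMap F K (tx F n ξ) := by
    intro j
    rw [← h j, tx_map hn (En_mul hξ (En_pow htE j))]
    exact Finset.sum_congr rfl fun i _ => by rw [mul_pow, ← pow_mul, ← pow_mul, mul_comm j]
  have h2 : ∑ j ∈ Finset.range l, (t⁻¹) ^ j * ∑ i ∈ Finset.range n, ξ ^ Nat.card F ^ i * (t ^ Nat.card F ^ i) ^ j = 0 := by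
    rw [Finset.sum_congr rfl fun j _ => by rw [h1 j], ← Finset.sum_mul, ht.inv.geom_sum_eq_zero hl.one_lt, zero_mul]
  have h3 : ∀ i, ∑ j ∈ Finset.range l, (t⁻¹ * t ^ Nat.card F ^ i) ^ j = if t ^ Nat.card F ^ i = t then (l : K) else 0 := by
    intro i
    split_ifs with hi
    · rw [hi, inv_mul_cancel₀ ht0]; simp
    · have h4 : t⁻¹ * t ^ Nat.card F ^ i ≠ 1 := fun h => hi ((inv_mul_eq_one₀ ht0).1 h).symm
      rw [geom_sum_eq h4, mul_pow, inv_pow, ht.pow_eq_one, pow_right_comm, ht.pow_eq_one]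
      simp
  simp only [Finset.mul_sum] at h2
  rw [Finset.sum_comm] at h2
  have h5 : ∀ i, ∑ j ∈ Finset.range l, (t⁻¹) ^ j * (ξ ^ Nat.card F ^ i * (t ^ Nat.card F ^ i) ^ j)
     = l * (if t ^ Nat.card F ^ i = t then ξ ^ Nat.card F ^ i else 0) := by
    intro i
    have : ∀ j, (t⁻¹) ^ j * (ξ ^ Nat.card F ^ i * (t ^ Nat.card F ^ i) ^ j) = ξ ^ Nat.card F ^ i * (t⁻¹ * t ^ Nat.card F ^ i) ^ j := by
      intro j; rw [mul_pow]; ring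
    rw [Finset.sum_congr rfl fun j _ => this j, ← Finset.mul_sum, h3]
    split_ifs
    · ring
    · simp
  rw [Finset.sum_congr rfl fun i _ => h5 i, ← Finset.mul_sum] at h2
  rw [Finset.sum_filter]
  exact (mul_eq_zero.1 h2).resolve_left hl0

lemma card_I (n e : ℕ) (he : 0 < e) (m : ℕ) (h : n = e * m) : ((Finset.range n).filter (fun i => e ∣ i)).card = m := by
  subst h
  have : (Finset.range (e * m)).filter (fun i => e ∣ i) = (Finset.range m).image (fun i => e * i) := by
    ext i
    simp only [Finset.mem_filter, Finset.mem_range, Finset.mem_image]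
    constructor
    · rintro ⟨h1, ⟨c, rfl⟩⟩
      exact ⟨c, lt_of_mul_lt_mul_left h1 (Nat.zero_le _), rfl⟩
    · rintro ⟨c, h1, rfl⟩
      exact ⟨Nat.mul_lt_mul_of_pos_left h1 he, Dvd.intro _ rfl⟩
  rw [this, Finset.card_image_of_injective _ (fun a b h => Nat.eq_of_mul_eq_mul_left he h), Finset.card_range]

lemma I_ne {n : ℕ} (hn : 0 < n) (t : K) (l : ℕ) (hl : l.Prime) (ht : IsPrimitiveRoot t l) (htE : t ∈ En F K n)
    (hdv : ∀ d, d ∣ n → d < n → l * (Nat.card F ^ d - 1) ∣ Nat.card F ^ n - 1) :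
    (((Finset.range n).filter (fun i => t ^ Nat.card F ^ i = t)).card : K) ≠ 0 := by
  have hq : 1 < Nat.card F := Finite.one_lt_card
  have ht0 : t ≠ 0 := ht.ne_zero hl.ne_zero
  haveI : Fact l.Prime := ⟨hl⟩
  have hcop : ∀ i, t ^ Nat.card F ^ i = t ↔ ((Nat.card F : ZMod l)) ^ i = 1 := by
    intro i
    have h1 : t ^ Nat.card F ^ i = t ↔ t ^ (Nat.card F ^ i - 1) = 1 := by
      obtain ⟨c, hc⟩ : ∃ c, Nat.card F ^ i = c + 1 := ⟨Nat.card F ^ i - 1, by have := Nat.one_le_pow i _ (by omega : 0 < Nat.card F); omega⟩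
      rw [hc, pow_succ, Nat.add_sub_cancel]
      constructor
      · intro h; exact mul_right_cancel₀ ht0 (h.trans (one_mul t).symm)
      · intro h; rw [h, one_mul]
    rw [h1, ht.pow_eq_one_iff_dvd, ← ZMod.natCast_eq_zero_iff, Nat.cast_sub (Nat.one_le_pow _ _ (by omega)), sub_eq_zero]
    push_cast; rfl
  simp only [hcop, ← orderOf_dvd_iff_pow_eq_one]
  have hen : orderOf (Nat.card F : ZMod l) ∣ n := orderOf_dvd_iff_pow_eq_one.2 ((hcop n).1 (mem_En.1 htE))
  have he : 0 < orderOf (Nat.card F : ZMod l) := Nat.pos_of_dvd_of_pos hen hn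
  obtain ⟨m, hm⟩ := hen
  rw [card_I n _ he m hm]
  obtain ⟨p, hp⟩ := CharP.exists K
  have hpp : p.Prime := CharP.char_is_prime K p
  rw [Ne, CharP.cast_eq_zero_iff K p]
  rintro ⟨m', rfl⟩
  have hm0 : 0 < m' := by
    rcases Nat.eq_zero_or_pos m' with h | h
    · subst h; simp at hm; omega
    · exact h
  obtain ⟨d, hd⟩ : ∃ d, d = orderOf (Nat.card F : ZMod l) * m' := ⟨_, rfl⟩
  have hnd : n = d * p := by rw [hm, hd]; ring
  have hd0 : 0 < d := by rw [hd]; positivity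
  have h1 := hdv d ⟨p, hnd⟩ (by rw [hnd]; exact lt_mul_of_one_lt_right hd0 hpp.one_lt)
  have h2 : (Nat.card F : ZMod l) ^ d = 1 := orderOf_dvd_iff_pow_eq_one.1 ⟨m', hd⟩
  have h3 : (∑ i ∈ Finset.range p, (Nat.card F ^ d) ^ i) * (Nat.card F ^ d - 1) = Nat.card F ^ n - 1 := by
    rw [hnd, pow_mul]
    exact Nat.geomSum_eq (by exact Nat.one_lt_pow hd0.ne' hq) p ▸ Nat.div_mul_cancel (by simpa using Nat.sub_dvd_pow_sub_pow (Nat.card F ^ d) 1 p)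
  rw [← h3] at h1
  have h4 := Nat.dvd_of_mul_dvd_mul_right (by have := Nat.one_lt_pow hd0.ne' hq; omega) h1
  rw [← ZMod.natCast_eq_zero_iff] at h4
  push_cast at h4
  rw [h2] at h4
  simp only [one_pow, Finset.sum_const, Finset.card_range, nsmul_eq_mul, mul_one] at h4
  rw [ZMod.natCast_eq_zero_iff, Nat.prime_dvd_prime_iff_eq hl hpp] at h4
  haveI : NeZero l := ⟨hl.ne_zero⟩
  have hl0 : (l : K) ≠ 0 := ht.neZero'.out
  rw [h4] at hl0
  exact hl0 (CharP.cast_eq_zero K p)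

theorem PP_eq_zero [Nontrivial V] (hK : SplitsAll F V K) (hG : Nat.card (V ≃ₗ[F] V) ∣ Nat.card K * (Nat.card K - 1))
    (hd : Nat.card F ^ (Module.finrank F V) - 1 ∣ Nat.card K - 1)
    (ψ : AddChar F ℂ) (hψ : ∃ a : F, ψ a ≠ 1) (ξ : K) (h : Module.End F V) : PP ψ ξ h = 0 := by
  by_contra hP
  have hn : 0 < Module.finrank F V := Module.finrank_pos
  by_cases h1 : Module.finrank F V = 1
  · obtain ⟨c, hc⟩ : ∃ c : F, h = c • 1 := by
      obtain ⟨v, hv, hs⟩ := finrank_eq_one_iff'.1 h1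
      obtain ⟨c, hc⟩ := hs (h v)
      refine ⟨c, LinearMap.ext fun w => ?_⟩
      obtain ⟨a, rfl⟩ := hs w
      simp only [map_smul, LinearMap.smul_apply, Module.End.one_apply]
      rw [← hc, smul_comm]
    have := PP_unit hK ψ hψ ξ h hP (-c)
    rw [hc, ← add_smul, add_neg_cancel, zero_smul] at this
    exact not_isUnit_zero this
  · obtain ⟨l, t, hl, ht, htE, hdv, hx⟩ := exists_t0 (F := F) (K := K) (Module.finrank F V) (by omega) hd
    have ht0 : t ≠ 0 := ht.ne_zero hl.ne_zero
    have key : ∀ ξ : K, PP ψ ξ h ≠ 0 →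
        ∑ i ∈ (Finset.range (Module.finrank F V)).filter (fun i => t ^ Nat.card F ^ i = t), ξ ^ Nat.card F ^ i = 0 := by
      intro ξ hξ
      refine S_zero hn ξ t l hl ht htE ?_ (fun j => (tx_inv hK hG hd t ht0 hx ψ hψ h ξ hξ j).2)
      by_contra hc
      exact hξ (PP_notin ψ ξ hc h)
    have k1 := key ξ hP
    have k2 := key (ξ + algebraMap F K 1) (by
      rw [PP_shift2]; exact mul_ne_zero (psi_ne ψ _) hP)
    rw [Finset.sum_congr rfl fun i _ => frob_pow_add (F := F) i ξ _, Finset.sum_add_distrib, k1, zero_add] at k2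
    apply I_ne (F := F) hn t l hl ht htE hdv
    simpa using k2

end
end MK

namespace MK
attribute [local instance] Fintype.ofFinite
attribute [local instance] Classical.propDecidable
section
open Polynomial

variable {F : Type} [Field F] [Finite F]
variable {K : Type} [Field K] [Finite K] [Algebra F K]
variable {V : Type} [AddCommGroup V] [Module F V] [Finite V]

/-- one factor of the Kloosterman sum -/
noncomputable def Phi (ψ : AddChar F ℂ) (χ : MulChar F ℂ) (g : Module.End F V) : ℂ :=
  χ (LinearMap.det g) * ψ (LinearMap.trace F V g)

/-- coordinate free matrix Kloosterman sums, by recursion -/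
noncomputable def KK (ψ : AddChar F ℂ) : List (MulChar F ℂ) → PFun F
  | [] => fun V _ _ _ x => if x = 1 then 1 else 0
  | (χ :: L) => fun V _ _ _ x => ∑ g : Module.End F V, ∑ h : Module.End F V,
      if g * h = x then Phi ψ χ g * KK ψ L V h else 0

/-- Kloosterman sums on the subfield `E_n` of `K` -/
noncomputable def Kf (ψ : AddChar F ℂ) (K : Type) [Field K] [Finite K] [Algebra F K] (n : ℕ) :
    List (MulChar F ℂ) → K → ℂ
  | [] => fun ξ => if ξ = 1 then 1 else 0
  | (χ :: L) => fun ξ => ∑ t ∈ En F K n, χ (nx F n t) * ψ (tx F n t) * Kf ψ K n L (t⁻¹ * ξ)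

lemma Phi_nonunit (ψ : AddChar F ℂ) (χ : MulChar F ℂ) (g : Module.End F V) (h : ¬ IsUnit g) : Phi ψ χ g = 0 := by
  unfold Phi
  rw [LinearMap.isUnit_iff_isUnit_det] at h
  rw [χ.map_nonunit h, zero_mul]

lemma KK_nonunit (ψ : AddChar F ℂ) (L : List (MulChar F ℂ)) (x : Module.End F V) (h : ¬ IsUnit x) :
    KK ψ L V x = 0 := by
  induction L generalizing x with
  | nil =>
    rw [KK]
    beta_reduce
    rw [if_neg]
    rintro rfl
    exact h isUnit_one
  | cons χ L ih =>
    rw [KK]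
    refine Finset.sum_eq_zero fun g _ => Finset.sum_eq_zero fun y _ => ?_
    split_ifs with hg
    · by_cases h1 : IsUnit g
      · by_cases h2 : IsUnit y
        · exact absurd (hg ▸ h1.mul h2) h
        · rw [ih y h2, mul_zero]
      · rw [Phi_nonunit _ _ _ h1, zero_mul]
    · rfl

lemma ext_step [Nontrivial V] (hK : SplitsAll F V K) (hG : Nat.card (V ≃ₗ[F] V) ∣ Nat.card K * (Nat.card K - 1))
    (hd : Nat.card F ^ (Module.finrank F V) - 1 ∣ Nat.card K - 1)
    (ψ : AddChar F ℂ) (hψ : ∃ a : F, ψ a ≠ 1) (χ : MulChar F ℂ) (ξ : K) (h1 : ξ ∈ En F K (Module.finrank F V))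
    (h0 : ξ ≠ 0) (y : Module.End F V) (hy : IsUnit y) :
    ∑ g : Module.End F V, Phi ψ χ g * RR ξ V (g * y) = cst F K V *
      ∑ t ∈ En F K (Module.finrank F V), χ (nx F (Module.finrank F V) t) * ψ (tx F (Module.finrank F V) t) *
        RR (t⁻¹ * ξ) V y := by
  obtain ⟨n, hn⟩ : ∃ n, n = Module.finrank F V := ⟨_, rfl⟩
  have hn0 : 0 < Module.finrank F V := Module.finrank_pos
  obtain ⟨u, rfl⟩ := hy
  obtain ⟨y, hyy⟩ : ∃ y : Module.End F V, y = (u⁻¹ : (Module.End F V)ˣ) := ⟨_, rfl⟩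
  have e1 : (u : Module.End F V) * y = 1 := by rw [hyy]; exact u.mul_inv
  have e2 : y * (u : Module.End F V) = 1 := by rw [hyy]; exact u.inv_mul
  have hχ0 : χ 0 = 0 := χ.map_nonunit (by simp)
  have s1 : ∑ g : Module.End F V, Phi ψ χ g * RR ξ V (g * (u : Module.End F V)) = ∑ z : Module.End F V, Phi ψ χ (z * y) * RR ξ V z := by
    refine Finset.sum_bij' (fun g _ => g * (u : Module.End F V)) (fun g _ => g * y) (by simp) (by simp) ?_ ?_ ?_
    · intro g _; rw [mul_assoc, e1, mul_one]
    · intro g _; rw [mul_assoc, e2, mul_one]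
    · intro g _; rw [mul_assoc, e1, mul_one]
  have s2 : ∑ z : Module.End F V, Phi ψ χ (z * y) * RR ξ V z
      = χ (nx F (Module.finrank F V) ξ) * χ (LinearMap.det y) * Fou ψ (RR ξ V) y := by
    unfold Fou
    rw [Finset.mul_sum]
    refine Finset.sum_congr rfl fun z _ => ?_
    by_cases hz : RR ξ V z = 0
    · rw [hz]; ring
    · rw [Phi, map_mul, map_mul, det_nx z ξ (En_supp ξ z hz).2]; ring
  have s3 := PP_eq_zero hK hG hd ψ hψ ξ y
  rw [PP, sub_eq_zero] at s3
  rw [s1, s2, s3, ← En_reindex h1 h0, Finset.mul_sum]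
  unfold Rw
  rw [Finset.mul_sum, Finset.mul_sum]
  symm
  rw [← Finset.sum_subset (Finset.subset_univ (En F K (Module.finrank F V)))]
  · refine Finset.sum_congr rfl fun η hη => ?_
    rw [wf, if_pos ⟨h1, hη⟩]
    by_cases h3 : η = 0
    · subst h3
      rw [zero_mul, (nx_zero_iff hn0 hη).2 rfl, hχ0]
      by_cases h4 : RR (0 : K) V y = 0
      · rw [h4]; ring
      · exfalso
        refine (RR_unit 0 y h4).1 ⟨u⁻¹, hyy.symm⟩ rfl
    · have e3 : (η * ξ)⁻¹ * ξ = η⁻¹ := by field_simp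
      rw [e3, RR_inverse η h3 y u e2, nx_mul hη h1, map_mul, mul_comm ξ η]
      by_cases h4 : RR η V y = 0
      · rw [h4]; ring
      · rw [det_nx y η (En_supp η y h4).2]; ring
  · intro η _ hη
    rw [wf, if_neg (fun h => hη h.2)]; ring

lemma sum_conv {M : Type} [Fintype M] [DecidableEq M] [Mul M] (f : M → M → ℂ) (R : M → ℂ) (f' : M → M → ℂ)
    (h : ∀ a b, f b a * R (b * a) = f' a b) :
    ∑ x : M, (∑ a : M, ∑ b : M, if a * b = x then f a b else 0) * R x = ∑ b : M, ∑ a : M, f' b a := by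
  simp only [Finset.sum_mul, ite_mul, zero_mul]
  rw [Finset.sum_comm]
  rw [Finset.sum_comm (γ := M) (f := fun b a => f' b a)]
  refine Finset.sum_congr rfl fun a _ => ?_
  rw [Finset.sum_comm]
  refine Finset.sum_congr rfl fun b _ => ?_
  rw [Finset.sum_ite_eq, if_pos (Finset.mem_univ _), h]

theorem extraction [Nontrivial V] (hK : SplitsAll F V K) (hG : Nat.card (V ≃ₗ[F] V) ∣ Nat.card K * (Nat.card K - 1))
    (hd : Nat.card F ^ (Module.finrank F V) - 1 ∣ Nat.card K - 1)
    (ψ : AddChar F ℂ) (hψ : ∃ a : F, ψ a ≠ 1) (L : List (MulChar F ℂ)) (ξ : K)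
    (h1 : ξ ∈ En F K (Module.finrank F V)) (h0 : ξ ≠ 0) :
    ∑ x : Module.End F V, KK ψ L V x * RR ξ V x =
      (cst F K V) ^ L.length * aa F K (Module.finrank F V) * Kf ψ K (Module.finrank F V) L ξ := by
  induction L generalizing ξ with
  | nil =>
    simp only [KK, Kf, ite_mul, one_mul, zero_mul, List.length_nil, pow_zero]
    rw [Finset.sum_ite_eq' Finset.univ (1 : Module.End F V), if_pos (Finset.mem_univ _)]
    split_ifs with h
    · rw [h, RR_aa, mul_one]
    · rw [mul_zero, RR_zero ξ _ V 1 rfl]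
      rw [LinearMap.charpoly_one]
      simp only [map_pow, map_sub, aeval_X, map_one]
      exact pow_ne_zero _ (sub_ne_zero.2 h)
  | cons χ L ih =>
    have hχ0 : χ 0 = 0 := χ.map_nonunit (by simp)
    have s1 : ∑ x : Module.End F V, KK ψ (χ :: L) V x * RR ξ V x =
        ∑ h : Module.End F V, KK ψ L V h * ∑ g : Module.End F V, Phi ψ χ g * RR ξ V (g * h) := by
      simp only [KK, Finset.mul_sum]
      exact sum_conv (fun g h => Phi ψ χ g * KK ψ L V h) (RR ξ V) _ (fun h g => by ring)
    rw [s1]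
    have s2 : ∀ h : Module.End F V, KK ψ L V h * ∑ g : Module.End F V, Phi ψ χ g * RR ξ V (g * h) =
      KK ψ L V h * (cst F K V *
      ∑ t ∈ En F K (Module.finrank F V), χ (nx F (Module.finrank F V) t) * ψ (tx F (Module.finrank F V) t) *
        RR (t⁻¹ * ξ) V h) := by
      intro h
      by_cases hu : IsUnit h
      · rw [ext_step hK hG hd ψ hψ χ ξ h1 h0 h hu]
      · rw [KK_nonunit _ _ _ hu, zero_mul, zero_mul]
    rw [Finset.sum_congr rfl fun h _ => s2 h]
    simp only [Kf, Finset.mul_sum]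
    rw [Finset.sum_comm]
    refine Finset.sum_congr rfl fun t ht => ?_
    by_cases h3 : t = 0
    · subst h3
      rw [(nx_zero_iff Module.finrank_pos ht).2 rfl, hχ0]
      simp
    · have := ih (t⁻¹ * ξ) (En_mul (En_inv ht) h1) (mul_ne_zero (inv_ne_zero h3) h0)
      rw [List.length_cons, pow_succ]
      have e : ∀ a b c d e : ℂ, a * b * c * (d * e) = b * d * (a * c * e) := by intros; ring
      rw [e, ← this, Finset.mul_sum]
      refine Finset.sum_congr rfl fun h _ => ?_
      ring

end
end MK

namespace MK
attribute [local instance] Fintype.ofFinite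
attribute [local instance] Classical.propDecidable
section
open Polynomial

variable {F : Type} [Field F] [Finite F]
variable {V X Y : Type} [AddCommGroup V] [Module F V] [Finite V]
variable [AddCommGroup X] [Module F X] [Finite X] [AddCommGroup Y] [Module F Y] [Finite Y]

lemma Phi_conj {V' : Type} [AddCommGroup V'] [Module F V'] (ψ : AddChar F ℂ) (χ : MulChar F ℂ) (e : V ≃ₗ[F] V') (g : Module.End F V) :
    Phi ψ χ (e.conj g) = Phi ψ χ g := by
  unfold Phi
  rw [LinearMap.trace_conj', LinearEquiv.conj_apply, LinearMap.comp_assoc, LinearMap.det_conj]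

lemma KK_inv (ψ : AddChar F ℂ) (L : List (MulChar F ℂ)) : PInv (KK ψ L) := by
  induction L with
  | nil =>
    intro V V' _ _ _ _ _ _ e g g' h
    have : g' = e.conj g := by
      ext x
      rw [LinearEquiv.conj_apply_apply, h, e.apply_symm_apply]
    subst this
    have : e.conj g = 1 ↔ g = 1 := by
      rw [show (1 : Module.End F V') = e.conj 1 from (LinearEquiv.conj_id e).symm]
      exact e.conj.injective.eq_iff
    simp only [KK, this]
  | cons χ L ih =>
    intro V V' _ _ _ _ _ _ e g g' h
    have : g' = e.conj g := by
      ext x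
      rw [LinearEquiv.conj_apply_apply, h, e.apply_symm_apply]
    subst this
    simp only [KK]
    refine Fintype.sum_equiv e.conj.toEquiv _ _ fun a => Fintype.sum_equiv e.conj.toEquiv _ _ fun b => ?_
    have h1 : (e.conj a) * (e.conj b) = e.conj (a * b) := (LinearEquiv.conj_comp e b a).symm
    have h2 : KK ψ L V b = KK ψ L V' (e.conj b) := ih _ _ e _ _ (fun x => by
      rw [LinearEquiv.conj_apply_apply, e.symm_apply_apply])
    change _ = if (e.conj a) * (e.conj b) = e.conj g then Phi ψ χ (e.conj a) * KK ψ L V' (e.conj b) else 0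
    rw [h1, Phi_conj, h2]
    simp only [e.conj.injective.eq_iff]

lemma det_ext (a : Module.End F X) (d : Module.End F Y) (v : Y →ₗ[F] X) :
    LinearMap.det (ext a d v) = LinearMap.det a * LinearMap.det d := by
  rw [LinearMap.det_eq_sign_charpoly_coeff, LinearMap.det_eq_sign_charpoly_coeff, LinearMap.det_eq_sign_charpoly_coeff,
    charpoly_ext, Module.finrank_prod, pow_add, Polynomial.mul_coeff_zero]
  ring

lemma trace_low (w : Y →ₗ[F] X) (g : Module.End F (X × Y)) :
    LinearMap.trace F (X × Y) (ext 0 0 w * g) =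
      LinearMap.trace F X (w ∘ₗ (LinearMap.snd F X Y ∘ₗ g ∘ₗ LinearMap.inl F X Y)) := by
  have : ext (0 : Module.End F X) (0 : Module.End F Y) w = LinearMap.inl F X Y ∘ₗ w ∘ₗ LinearMap.snd F X Y := by
    ext x <;> simp
  rw [this, Module.End.mul_eq_comp, LinearMap.comp_assoc, LinearMap.trace_comp_comm']
  rfl

lemma trace_ext (a : Module.End F X) (d : Module.End F Y) (v : Y →ₗ[F] X) :
    LinearMap.trace F (X × Y) (ext a d v) = LinearMap.trace F X a + LinearMap.trace F Y d := by
  have : ext a d v = LinearMap.prodMap a d + ext 0 0 v * 1 := by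
    ext x <;> simp
  rw [this, map_add, LinearMap.trace_prodMap', trace_low]
  have : v ∘ₗ (LinearMap.snd F X Y ∘ₗ (1 : Module.End F (X × Y)) ∘ₗ LinearMap.inl F X Y) = 0 := by
    ext x; simp
  rw [this, map_zero, add_zero]

lemma Phi_ext (ψ : AddChar F ℂ) (χ : MulChar F ℂ) (a : Module.End F X) (d : Module.End F Y) (v : Y →ₗ[F] X) :
    Phi ψ χ (ext a d v) = Phi ψ χ a * Phi ψ χ d := by
  unfold Phi
  rw [det_ext, trace_ext, map_mul, AddChar.map_add_eq_mul]
  ring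

lemma ext_mul (a a' : Module.End F X) (d d' : Module.End F Y) (v v' : Y →ₗ[F] X) :
    ext a d v * ext a' d' v' = ext (a * a') (d * d') (a ∘ₗ v' + v ∘ₗ d') := by
  ext x <;> simp

lemma ext_inj (a a' : Module.End F X) (d d' : Module.End F Y) (v v' : Y →ₗ[F] X) :
    ext a d v = ext a' d' v' ↔ a = a' ∧ d = d' ∧ v = v' := by
  constructor
  · intro h
    refine ⟨LinearMap.ext fun x => ?_, LinearMap.ext fun y => ?_, LinearMap.ext fun y => ?_⟩
    · have := congrArg Prod.fst (LinearMap.congr_fun h (x, 0)); simpa using this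
    · have := congrArg Prod.snd (LinearMap.congr_fun h (0, y)); simpa using this
    · have := congrArg Prod.fst (LinearMap.congr_fun h (0, y)); simpa using this
  · rintro ⟨rfl, rfl, rfl⟩; rfl

/-- lower left corner -/
def low (g : Module.End F (X × Y)) : X →ₗ[F] Y := LinearMap.snd F X Y ∘ₗ g ∘ₗ LinearMap.inl F X Y

lemma low_zero (g : Module.End F (X × Y)) (h : low g = 0) : ∃ a d v, g = ext a d v := by
  refine ⟨LinearMap.fst F X Y ∘ₗ g ∘ₗ LinearMap.inl F X Y, LinearMap.snd F X Y ∘ₗ g ∘ₗ LinearMap.inr F X Y,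
    LinearMap.fst F X Y ∘ₗ g ∘ₗ LinearMap.inr F X Y, ?_⟩
  have h2 : ∀ x, (g (x, 0)).2 = 0 := fun x => LinearMap.congr_fun h x
  have h3 : g (0, 0) = 0 := map_zero g
  ext x
  · simp [h3]
  · simp [h2]
  · simp [h3]
  · simp

lemma low_ext (a : Module.End F X) (d : Module.End F Y) (v : Y →ₗ[F] X) : low (ext a d v) = 0 := by
  ext x; simp [low]

lemma sum_low (f : Module.End F (X × Y) → ℂ) (h : ∀ g, low g ≠ 0 → f g = 0) :
    ∑ g, f g = ∑ a : Module.End F X, ∑ d : Module.End F Y, ∑ v : Y →ₗ[F] X, f (ext a d v) := by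
  have e : ∀ a : Module.End F X, ∑ d : Module.End F Y, ∑ v : Y →ₗ[F] X, f (ext a d v) = ∑ p : Module.End F Y × (Y →ₗ[F] X), f (ext a p.1 p.2) :=
    fun a => by
      rw [← Fintype.sum_prod_type' (f := fun d v => f (ext a d v))]
  simp only [e]
  have e2 : ∑ a : Module.End F X, ∑ p : Module.End F Y × (Y →ₗ[F] X), f (ext a p.1 p.2) =
    ∑ p : Module.End F X × (Module.End F Y × (Y →ₗ[F] X)), f (ext p.1 p.2.1 p.2.2) := by
    rw [← Fintype.sum_prod_type' (f := fun a (p : Module.End F Y × (Y →ₗ[F] X)) => f (ext a p.1 p.2))]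
  rw [e2]
  symm
  refine Fintype.sum_of_injective (fun p : Module.End F X × (Module.End F Y × (Y →ₗ[F] X)) => ext p.1 p.2.1 p.2.2) ?_ _ _ ?_ (fun _ => rfl)
  · rintro ⟨a, d, v⟩ ⟨a', d', v'⟩ hh
    obtain ⟨rfl, rfl, rfl⟩ := (ext_inj _ _ _ _ _ _).1 hh
    rfl
  · intro g hg
    refine h g fun h0 => hg ?_
    obtain ⟨a, d, v, rfl⟩ := low_zero g h0
    exact ⟨(a, d, v), rfl⟩

lemma sum_psi_hom (ψ : AddChar F ℂ) (hψ : ∃ a : F, ψ a ≠ 1) (c : X →ₗ[F] Y) :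
    ∑ w : Y →ₗ[F] X, ψ (LinearMap.trace F X (w ∘ₗ c)) = if c = 0 then (Nat.card (Y →ₗ[F] X) : ℂ) else 0 := by
  split_ifs with h
  · subst h
    simp
  · obtain ⟨t, ht⟩ := hψ
    obtain ⟨x, hx⟩ : ∃ x, c x ≠ 0 := by
      by_contra hcon
      push Not at hcon
      exact h (LinearMap.ext hcon)
    let Λ : (Y →ₗ[F] X) →+ F :=
      { toFun := fun u => LinearMap.trace F X (u ∘ₗ c)
        map_zero' := by simp
        map_add' := fun u v => by rw [LinearMap.add_comp, map_add] }
    obtain ⟨φ, hφ⟩ : ∃ φ : Module.Dual F Y, φ (c x) ≠ 0 := by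
      by_contra hcon
      push Not at hcon
      exact hx ((Module.forall_dual_apply_eq_zero_iff F _).1 hcon)
    have h0 : (ψ.compAddMonoidHom Λ) ≠ 0 := by
      intro h0
      have h1 := DFunLike.congr_fun h0 ((LinearMap.toSpanSingleton F X x) ∘ₗ ((t / φ (c x)) • φ))
      rw [AddChar.compAddMonoidHom_apply, AddChar.zero_apply] at h1
      apply ht
      rw [← h1]
      congr 1
      change t = LinearMap.trace F X _
      rw [LinearMap.comp_assoc, LinearMap.trace_comp_comm']
      have : (((t / φ (c x)) • φ) ∘ₗ c) ∘ₗ LinearMap.toSpanSingleton F X x = t • LinearMap.id := by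
        ext
        simp
        field_simp
      rw [this, map_smul, LinearMap.trace_id]
      simp
    exact (AddChar.sum_eq_zero_iff_ne_zero (ψ := ψ.compAddMonoidHom Λ)).2 h0

/-- partial sum -/
noncomputable def AA (H : Module.End F (X × Y) → ℂ) (gX : Module.End F X) (gY : Module.End F Y)
    (g : Module.End F (X × Y)) : ℂ := ∑ h, if ∃ u, g * h = ext gX gY u then H h else 0

lemma AA_inv (H : Module.End F (X × Y) → ℂ) (gX : Module.End F X) (gY : Module.End F Y)
    (g : Module.End F (X × Y)) (w : Y →ₗ[F] X) : AA H gX gY (ext 1 1 w * g) = AA H gX gY g := by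
  unfold AA
  have e1 : ∀ w : Y →ₗ[F] X, ext 1 1 (-w) * ext 1 1 w = (1 : Module.End F (X × Y)) := by
    intro w; ext x <;> simp
  refine Finset.sum_congr rfl fun h _ => ?_
  have : (∃ u, ext 1 1 w * g * h = ext gX gY u) ↔ ∃ u, g * h = ext gX gY u := by
    constructor
    · rintro ⟨u, hu⟩
      have : g * h = ext 1 1 (-w) * (ext 1 1 w * g * h) := by
        rw [← mul_assoc, ← mul_assoc, e1, one_mul]
      rw [this, hu, ext_mul, one_mul, one_mul]
      exact ⟨_, rfl⟩
    · rintro ⟨u, hu⟩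
      rw [mul_assoc, hu, ext_mul, one_mul, one_mul]
      exact ⟨_, rfl⟩
  simp only [this]

lemma sum_AA_low (ψ : AddChar F ℂ) (hψ : ∃ a : F, ψ a ≠ 1) (χ : MulChar F ℂ) (H : Module.End F (X × Y) → ℂ)
    (gX : Module.End F X) (gY : Module.End F Y) :
    ∑ g, Phi ψ χ g * AA H gX gY g = ∑ g, if low g = 0 then Phi ψ χ g * AA H gX gY g else 0 := by
  have e1 : ∀ w : Y →ₗ[F] X, ext 1 1 (-w) * ext 1 1 w = (1 : Module.End F (X × Y)) := by
    intro w; ext x <;> simp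
  have e2 : ∀ w : Y →ₗ[F] X, ext 1 1 w * ext 1 1 (-w) = (1 : Module.End F (X × Y)) := by
    intro w; ext x <;> simp
  have hN : (Nat.card (Y →ₗ[F] X) : ℂ) ≠ 0 := Nat.cast_ne_zero.2 Nat.card_pos.ne'
  have e3 : ∀ w : Y →ₗ[F] X, ∑ g, Phi ψ χ g * AA H gX gY g = ∑ g, Phi ψ χ g * AA H gX gY g * ψ (LinearMap.trace F X (w ∘ₗ low g)) := by
    intro w
    have : ∑ g, Phi ψ χ g * AA H gX gY g = ∑ g, Phi ψ χ (ext 1 1 w * g) * AA H gX gY (ext 1 1 w * g) := by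
      symm
      refine Finset.sum_bij' (fun g _ => ext 1 1 w * g) (fun g _ => ext 1 1 (-w) * g) (by simp) (by simp) ?_ ?_ (fun _ _ => rfl)
      · intro g _; rw [← mul_assoc, e1, one_mul]
      · intro g _; rw [← mul_assoc, e2, one_mul]
    rw [this]
    refine Finset.sum_congr rfl fun g _ => ?_
    rw [AA_inv]
    unfold Phi
    have h1 : ext 1 1 w * g = g + ext 0 0 w * g := by
      ext x <;> simp
    rw [map_mul (LinearMap.det), det_ext, h1, map_add, trace_low, AddChar.map_add_eq_mul]
    simp only [map_one, one_mul, low]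
    ring
  apply mul_left_cancel₀ hN
  have e4 : (Nat.card (Y →ₗ[F] X) : ℂ) * ∑ g, Phi ψ χ g * AA H gX gY g =
      ∑ w : Y →ₗ[F] X, ∑ g, Phi ψ χ g * AA H gX gY g * ψ (LinearMap.trace F X (w ∘ₗ low g)) := by
    rw [← Finset.sum_congr rfl fun w _ => e3 w]
    simp
  rw [e4, Finset.sum_comm, Finset.mul_sum]
  refine Finset.sum_congr rfl fun g _ => ?_
  rw [← Finset.mul_sum, sum_psi_hom ψ hψ]
  split_ifs <;> ring

lemma AA_ext (H : Module.End F (X × Y) → ℂ) (gX : Module.End F X) (gY : Module.End F Y)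
    (a : Module.End F X) (d : Module.End F Y) (v : Y →ₗ[F] X) (hd : IsUnit d) :
    AA H gX gY (ext a d v) = ∑ a', ∑ d', if a * a' = gX ∧ d * d' = gY then ∑ v', H (ext a' d' v') else 0 := by
  unfold AA
  rw [sum_low]
  · refine Finset.sum_congr rfl fun a' _ => Finset.sum_congr rfl fun d' _ => ?_
    have : ∀ v' : Y →ₗ[F] X, (∃ u, ext a d v * ext a' d' v' = ext gX gY u) ↔ a * a' = gX ∧ d * d' = gY := by
      intro v'
      constructor
      · rintro ⟨u, hu⟩
        rw [ext_mul] at hu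
        have := (ext_inj _ _ _ _ _ _).1 hu
        exact ⟨this.1, this.2.1⟩
      · rintro ⟨rfl, rfl⟩
        exact ⟨_, ext_mul _ _ _ _ _ _⟩
    simp only [this]
    split_ifs <;> simp
  · intro h hl
    rw [if_neg]
    rintro ⟨u, hu⟩
    apply hl
    have hinj : Function.Injective d := ((Module.End.isUnit_iff d).1 hd).1
    ext x
    apply hinj
    have := congrArg Prod.snd (LinearMap.congr_fun hu (x, 0))
    simpa [low] using this

lemma CC_step (ψ : AddChar F ℂ) (hψ : ∃ a : F, ψ a ≠ 1) (χ : MulChar F ℂ) (L : List (MulChar F ℂ))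
    (gX : Module.End F X) (gY : Module.End F Y) :
    CC (KK ψ (χ :: L)) gX gY = (Nat.card (Y →ₗ[F] X) : ℂ) * ∑ a : Module.End F X, ∑ d : Module.End F Y,
      ∑ a' : Module.End F X, ∑ d' : Module.End F Y,
      if a * a' = gX ∧ d * d' = gY then Phi ψ χ a * Phi ψ χ d * CC (KK ψ L) a' d' else 0 := by
  have s1 : CC (KK ψ (χ :: L)) gX gY = ∑ g, Phi ψ χ g * AA (KK ψ L (X × Y)) gX gY g := by
    unfold CC AA
    simp only [KK, Finset.mul_sum]
    rw [Finset.sum_comm]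
    refine Finset.sum_congr rfl fun g _ => ?_
    rw [Finset.sum_comm]
    refine Finset.sum_congr rfl fun h _ => ?_
    split_ifs with hh
    · obtain ⟨u, hu⟩ := hh
      rw [hu, Finset.sum_eq_single u]
      · rw [if_pos rfl]
      · intro u' _ hne
        rw [if_neg]
        intro h3
        exact hne ((ext_inj _ _ _ _ _ _).1 h3).2.2.symm
      · simp
    · rw [mul_zero]
      refine Finset.sum_eq_zero fun u _ => ?_
      rw [if_neg fun h3 => hh ⟨u, h3⟩]
  rw [s1, sum_AA_low ψ hψ, sum_low]
  swap
  · intro g hg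
    rw [if_neg hg]
  rw [Finset.mul_sum]
  refine Finset.sum_congr rfl fun a _ => ?_
  rw [Finset.mul_sum]
  refine Finset.sum_congr rfl fun d _ => ?_
  simp only [low_ext, if_true, Phi_ext]
  by_cases hd : IsUnit d
  · simp only [AA_ext _ _ _ a d _ hd]
    rw [Finset.sum_const, nsmul_eq_mul]
    simp only [Finset.mul_sum, mul_ite, mul_zero, CC]
    simp
  · simp [Phi_nonunit ψ χ d hd]

theorem CC_KK (ψ : AddChar F ℂ) (hψ : ∃ a : F, ψ a ≠ 1) (L : List (MulChar F ℂ))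
    (gX : Module.End F X) (gY : Module.End F Y) :
    CC (KK ψ L) gX gY = (Nat.card (Y →ₗ[F] X) : ℂ) ^ L.length * KK ψ L X gX * KK ψ L Y gY := by
  induction L generalizing gX gY with
  | nil =>
    unfold CC
    simp only [KK, List.length_nil, pow_zero, one_mul]
    have h1 : (1 : Module.End F (X × Y)) = ext 1 1 0 := by ext <;> simp
    simp only [h1, ext_inj]
    by_cases ha : gX = 1
    · by_cases hb : gY = 1
      · simp [ha, hb]
      · simp [ha, hb]
    · simp [ha]
  | cons χ L ih =>
    rw [CC_step ψ hψ]
    simp only [ih, KK, List.length_cons]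
    rw [pow_succ, mul_comm _ (Nat.card (Y →ₗ[F] X) : ℂ), mul_assoc, mul_assoc]
    congr 1
    rw [Finset.sum_mul_sum, Finset.mul_sum]
    refine Finset.sum_congr rfl fun a _ => ?_
    rw [Finset.mul_sum]
    refine Finset.sum_congr rfl fun d _ => ?_
    rw [Finset.sum_mul_sum, Finset.mul_sum]
    refine Finset.sum_congr rfl fun a' _ => ?_
    rw [Finset.mul_sum]
    refine Finset.sum_congr rfl fun d' _ => ?_
    by_cases h1 : a * a' = gX
    · by_cases h2 : d * d' = gY
      · rw [if_pos ⟨h1, h2⟩, if_pos h1, if_pos h2]; ring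
      · rw [if_neg (fun h => h2 h.2), if_neg h2, mul_zero, mul_zero]
    · rw [if_neg (fun h => h1 h.1), if_neg h1, zero_mul, mul_zero]

end
end MK

namespace MK
attribute [local instance] Fintype.ofFinite
attribute [local instance] Classical.propDecidable
section
open Polynomial

variable {F : Type} [Field F] [Finite F]
variable {K : Type} [Field K] [Finite K] [Algebra F K]
variable {V X Y : Type} [AddCommGroup V] [Module F V] [Finite V]
variable [AddCommGroup X] [Module F X] [Finite X] [AddCommGroup Y] [Module F Y] [Finite Y]

/-- group-like functions -/
def GLk (G : PFun F) : Prop :=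
  ∀ (X Y : Type) [AddCommGroup X] [Module F X] [Finite X] [AddCommGroup Y] [Module F Y]
    [Finite Y] (gX : Module.End F X) (gY : Module.End F Y), cc G gX gY = G X gX * G Y gY

lemma star_GL {G1 G2 : PFun F} (h1 : PInv G1) (h2 : PInv G2) (k1 : GLk G1) (k2 : GLk G2) : GLk (star G1 G2) := by
  intro X Y _ _ _ _ _ _ gX gY
  rw [PL h1 h2]
  unfold star
  rw [Finset.sum_mul_sum]
  refine Finset.sum_congr rfl fun A _ => Finset.sum_congr rfl fun B _ => ?_
  unfold term
  by_cases hA : Stab gX A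
  · by_cases hB : Stab gY B
    · rw [dif_pos ⟨hA, hB⟩, dif_pos hA, dif_pos hB, k1, k2]; ring
    · rw [dif_neg (fun h => hB h.2), dif_neg hB, mul_zero]
  · rw [dif_neg (fun h => hA h.1), dif_neg hA, zero_mul]

/-- `c ^ dim V` -/
noncomputable def pw (c : ℂ) : PFun F := fun V _ _ _ _ => c ^ Module.finrank F V

/-- indicator of the zero space -/
noncomputable def triv : PFun F := fun V _ _ _ _ => if Module.finrank F V = 0 then 1 else 0

lemma pw_inv (c : ℂ) : PInv (pw c : PFun F) := by
  intro V V' _ _ _ _ _ _ e g g' h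
  unfold pw
  rw [e.finrank_eq]

lemma triv_inv : PInv (triv : PFun F) := by
  intro V V' _ _ _ _ _ _ e g g' h
  unfold triv
  rw [e.finrank_eq]

lemma cc_const (G : PFun F) (gX : Module.End F X) (gY : Module.End F Y) (z : ℂ)
    (h : ∀ u, G (X × Y) (ext gX gY u) = z) : cc G gX gY = z := by
  unfold cc CC
  have hN : (Nat.card (Y →ₗ[F] X) : ℂ) ≠ 0 := Nat.cast_ne_zero.2 Nat.card_pos.ne'
  rw [Finset.sum_congr rfl fun u _ => h u, Finset.sum_const, nsmul_eq_mul, Finset.card_univ, ← Nat.card_eq_fintype_card]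
  field_simp

lemma pw_GL (c : ℂ) : GLk (pw c : PFun F) := by
  intro X Y _ _ _ _ _ _ gX gY
  refine cc_const _ _ _ _ fun u => ?_
  unfold pw
  rw [Module.finrank_prod, pow_add]

lemma triv_GL : GLk (triv : PFun F) := by
  intro X Y _ _ _ _ _ _ gX gY
  refine cc_const _ _ _ _ fun u => ?_
  unfold triv
  rw [Module.finrank_prod]
  by_cases h1 : Module.finrank F X = 0
  · by_cases h2 : Module.finrank F Y = 0
    · rw [if_pos (by omega), if_pos h1, if_pos h2, mul_one]
    · rw [if_neg (by omega), if_neg h2, mul_zero]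
  · rw [if_neg (by omega), if_neg h1, zero_mul]

/-- all entries of a tuple but the last one -/
abbrev headPart {k : ℕ} (ν : Fin (k + 1) → ℂ) : Fin k → ℂ := fun i => ν i.castSucc

/-- weighted count of stable flags -/
noncomputable def VF : (k : ℕ) → (Fin k → ℂ) → PFun F
  | 0, _ => triv
  | (k + 1), ν => star (VF k (headPart ν)) (pw (ν (Fin.last k)))

lemma VF_inv (k : ℕ) (ν : Fin k → ℂ) : PInv (VF k ν : PFun F) := by
  induction k with
  | zero => exact triv_inv
  | succ k ih => exact star_inv (ih _) (pw_inv _)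

lemma VF_GL (k : ℕ) (ν : Fin k → ℂ) : GLk (VF k ν : PFun F) := by
  induction k with
  | zero => exact triv_GL
  | succ k ih => exact star_GL (VF_inv _ _) (pw_inv _) (ih _) (pw_GL _)

lemma VF_sub (k : ℕ) (ν : Fin k → ℂ) [Subsingleton V] (g : Module.End F V) : VF k ν V g = 1 := by
  have h0 : ∀ (V : Type) [AddCommGroup V] [Module F V] [Subsingleton V], Module.finrank F V = 0 :=
    fun V _ _ _ => Module.finrank_zero_of_subsingleton
  induction k generalizing V with
  | zero => simp [VF, triv, h0]
  | succ k ih =>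
    unfold VF star
    have hs : ∀ U : Submodule F V, U = ⊥ := fun U => Subsingleton.elim _ _
    rw [Finset.sum_eq_single (⊥ : Submodule F V) (fun b _ hb => absurd (hs b) hb) (fun h => absurd (Finset.mem_univ _) h)]
    unfold term
    rw [dif_pos (fun x hx => by rw [Subsingleton.elim (g x) x]; exact hx), ih, pw, h0, pow_zero, one_mul]

lemma uinv_one (W : Submodule F V) : UInv W (fun _ : Module.End F V => (1 : ℂ)) := by
  unfold UInv
  intros
  rfl

lemma sum_VF [Nontrivial V] {χ : Module.End F V → ℂ} (hχ : Prim χ) (k : ℕ) (ν : Fin k → ℂ) :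
    ∑ g, χ g * VF k ν V g = (∑ i, ν i ^ Module.finrank F V) * ∑ g, χ g := by
  induction k with
  | zero =>
    have : Module.finrank F V ≠ 0 := Module.finrank_pos.ne'
    simp [VF, triv, this]
  | succ k ih =>
    have := prim_star hχ (VF_inv k (headPart ν)) (pw_inv (ν (Fin.last k))) (m := fun _ => 1) uinv_one
    simp only [mul_one] at this
    unfold VF
    rw [this]
    have h1 : VF k (headPart ν) (⊥ : Submodule F V) (0 : Module.End F (⊥ : Submodule F V)) = 1 := VF_sub _ _ _
    have h2 : pw (ν (Fin.last k)) (V ⧸ (⊤ : Submodule F V)) (0 : Module.End F _) = 1 := by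
      unfold pw
      rw [Module.finrank_zero_of_subsingleton, pow_zero]
    rw [h1, h2]
    simp only [one_mul, mul_one, mul_add, Finset.sum_add_distrib]
    rw [ih, Fin.sum_univ_castSucc, add_mul, add_comm]
    congr 1
    rw [Finset.mul_sum]
    exact Finset.sum_congr rfl fun g _ => by rw [pw, mul_comm]

/-- normalising factor -/
noncomputable def nrm (F : Type) (n : ℕ) : ℂ := (-1) ^ n / (Nat.card F : ℂ) ^ (n.choose 2)

/-- normalised Kloosterman sums -/
noncomputable def kap (ψ : AddChar F ℂ) (L : List (MulChar F ℂ)) : PFun F :=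
  fun V _ _ _ g => nrm F (Module.finrank F V) ^ (L.length - 1) * KK ψ L V g

lemma kap_inv (ψ : AddChar F ℂ) (L : List (MulChar F ℂ)) : PInv (kap ψ L) := by
  intro V V' _ _ _ _ _ _ e g g' h
  unfold kap
  rw [e.finrank_eq, KK_inv ψ L _ _ e g g' h]

lemma card_ne : (Nat.card F : ℂ) ≠ 0 := Nat.cast_ne_zero.2 Nat.card_pos.ne'

lemma choose_add (n m : ℕ) : (n + m).choose 2 = n.choose 2 + m.choose 2 + n * m := by
  induction m with
  | zero => simp
  | succ m ih =>
    rw [← add_assoc, Nat.choose_succ_succ' (n + m) 1, Nat.choose_succ_succ' m 1, ih]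
    simp only [Nat.choose_one_right]
    ring

lemma nrm_add (n m : ℕ) : nrm F (n + m) * (Nat.card F : ℂ) ^ (n * m) = nrm F n * nrm F m := by
  unfold nrm
  have := card_ne (F := F)
  rw [choose_add, pow_add, pow_add, pow_add]
  field_simp

lemma kap_GL (ψ : AddChar F ℂ) (hψ : ∃ a : F, ψ a ≠ 1) (L : List (MulChar F ℂ)) (hL : 1 ≤ L.length) : GLk (kap ψ L) := by
  intro X Y _ _ _ _ _ _ gX gY
  have h1 := CC_KK ψ hψ L gX gY
  have hN : (Nat.card (Y →ₗ[F] X) : ℂ) = (Nat.card F : ℂ) ^ (Module.finrank F X * Module.finrank F Y) := by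
    rw [Module.natCard_eq_pow_finrank (K := F), Module.finrank_linearMap, Nat.cast_pow, mul_comm]
  have h2 : CC (kap ψ L) gX gY = nrm F (Module.finrank F X + Module.finrank F Y) ^ (L.length - 1) * CC (KK ψ L) gX gY := by
    unfold CC kap
    rw [Finset.mul_sum, Module.finrank_prod]
  unfold cc
  obtain ⟨k, hk⟩ : ∃ k, L.length = k + 1 := ⟨L.length - 1, by omega⟩
  rw [h2, h1, hN]
  unfold kap
  rw [hk, Nat.add_sub_cancel]
  have h3 := nrm_add (F := F) (Module.finrank F X) (Module.finrank F Y)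
  have h4 : (Nat.card F : ℂ) ^ (Module.finrank F X * Module.finrank F Y) ≠ 0 := pow_ne_zero _ card_ne
  rw [pow_succ, div_eq_iff h4]
  have h5 := congrArg (· ^ k) h3
  simp only [mul_pow] at h5
  linear_combination (KK ψ L X gX * KK ψ L Y gY * (Nat.card F : ℂ) ^ (Module.finrank F X * Module.finrank F Y)) * h5

end
end MK

namespace MK
attribute [local instance] Fintype.ofFinite
attribute [local instance] Classical.propDecidable
section
open Polynomial

variable {F : Type} [Field F] [Finite F]
variable {K : Type} [Field K] [Finite K] [Algebra F K]
variable {V X Y : Type} [AddCommGroup V] [Module F V] [Finite V]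
variable [AddCommGroup X] [Module F X] [Finite X] [AddCommGroup Y] [Module F Y] [Finite Y]

lemma card_aut : Nat.card (V ≃ₗ[F] V) =
    Nat.card F ^ (Module.finrank F V).choose 2 * ∏ i ∈ Finset.range (Module.finrank F V), (Nat.card F ^ (i + 1) - 1) := by
  obtain ⟨n, hn⟩ : ∃ n, n = Module.finrank F V := ⟨_, rfl⟩
  rw [← hn]
  have h1 : Nat.card (V ≃ₗ[F] V) = Nat.card (Matrix.GeneralLinearGroup (Fin n) F) := by
    have b : Module.Basis (Fin n) F V := Module.finBasisOfFinrankEq F V hn.symm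
    rw [← card_units]
    exact Nat.card_congr (Matrix.GeneralLinearGroup.toLin' b).symm.toEquiv
  rw [h1, Matrix.card_GL_field, ← Nat.card_eq_fintype_card, Fin.prod_univ_eq_prod_range (fun i => Nat.card F ^ n - Nat.card F ^ i) n]
  have h2 : ∀ i ∈ Finset.range n, Nat.card F ^ n - Nat.card F ^ i = Nat.card F ^ i * (Nat.card F ^ (n - 1 - i + 1) - 1) := by
    intro i hi
    rw [Finset.mem_range] at hi
    rw [Nat.mul_sub, ← pow_add, mul_one]
    congr 2
    omega
  rw [Finset.prod_congr rfl h2, Finset.prod_mul_distrib, Finset.prod_pow_eq_pow_sum, Finset.sum_range_id,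
    ← Nat.choose_two_right, Finset.prod_range_reflect (fun i => Nat.card F ^ (i + 1) - 1) n]

lemma nrm_cst [Nontrivial V] : nrm F (Module.finrank F V) * cst F K V = -1 := by
  unfold nrm cst
  rw [card_aut, Module.natCard_eq_pow_finrank (K := F) (V := V)]
  have h0 := card_sub_one_ne (V := V)
  have h1 := aa_ne' (F := F) (K := K) (V := V)
  have h2 := card_ne (F := F)
  have hq : 1 ≤ Nat.card F := Nat.card_pos
  rw [Module.natCard_eq_pow_finrank (K := F) (V := V)] at h0
  obtain ⟨j, hj⟩ : ∃ j, Module.finrank F V = j + 1 :=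
    ⟨Module.finrank F V - 1, (Nat.sub_add_cancel Module.finrank_pos).symm⟩
  rw [hj] at h0 h1 ⊢
  have h3 : ∏ i ∈ Finset.range j, ((Nat.card F : ℂ) ^ (i + 1) - 1) = (-1) ^ j * aa F K (j + 1) := by
    rw [aa_eq]
    have := Finset.prod_const (s := Finset.range j) (-1 : ℂ)
    rw [Finset.card_range] at this
    rw [← this, ← Finset.prod_mul_distrib]
    exact Finset.prod_congr rfl fun i _ => by ring
  rw [Finset.prod_range_succ]
  push_cast [Nat.one_le_pow]
  have h4 : ∀ i, ((Nat.card F ^ i - 1 : ℕ) : ℂ) = (Nat.card F : ℂ) ^ i - 1 := by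
    intro i
    rw [Nat.cast_sub (Nat.one_le_pow _ _ hq)]
    push_cast
    rfl
  simp only [h4]
  rw [h3]
  push_cast at h0
  have h5 : ((-1 : ℂ) ^ j) * (-1) ^ j = 1 := by rw [← mul_pow]; simp
  field_simp
  rw [pow_succ]
  linear_combination -h5

lemma conj_of_annih (f : F[X]) (hf : Irreducible f) (gX : Module.End F X) (gY : Module.End F Y)
    (hX : aeval gX f = 0) (hY : aeval gY f = 0) (hd : Module.finrank F X = Module.finrank F Y) :
    ∃ A : X ≃ₗ[F] Y, ∀ x, A (gX x) = gY (A x) := by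
  haveI : Fact (Irreducible f) := ⟨hf⟩
  letI mX : Module (AdjoinRoot f) X := Module.compHom X (EHom f gX hX).toRingHom
  letI mY : Module (AdjoinRoot f) Y := Module.compHom Y (EHom f gY hY).toRingHom
  have sX : ∀ (p : F[X]) (x : X), AdjoinRoot.mk f p • x = aeval gX p x := fun p x => rfl
  have sY : ∀ (p : F[X]) (x : Y), AdjoinRoot.mk f p • x = aeval gY p x := fun p x => rfl
  haveI tX : IsScalarTower F (AdjoinRoot f) X := ⟨fun c m x => by
    obtain ⟨p, rfl⟩ := AdjoinRoot.mk_surjective m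
    have e1 : c • AdjoinRoot.mk f p = AdjoinRoot.mk f (c • p) := rfl
    rw [e1, sX, sX, map_smul]; rfl⟩
  haveI tY : IsScalarTower F (AdjoinRoot f) Y := ⟨fun c m x => by
    obtain ⟨p, rfl⟩ := AdjoinRoot.mk_surjective m
    have e1 : c • AdjoinRoot.mk f p = AdjoinRoot.mk f (c • p) := rfl
    rw [e1, sY, sY, map_smul]; rfl⟩
  haveI fX : Module.Finite (AdjoinRoot f) X := inferInstance
  haveI fY : Module.Finite (AdjoinRoot f) Y := inferInstance
  have hr : Module.finrank (AdjoinRoot f) X = Module.finrank (AdjoinRoot f) Y := by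
    have e1 := Module.finrank_mul_finrank F (AdjoinRoot f) X
    have e2 := Module.finrank_mul_finrank F (AdjoinRoot f) Y
    have : 0 < Module.finrank F (AdjoinRoot f) := by
      haveI := (AdjoinRoot.powerBasis hf.ne_zero).finite
      exact Module.finrank_pos
    exact Nat.eq_of_mul_eq_mul_left this (by rw [e1, e2, hd])
  let A : X ≃ₗ[AdjoinRoot f] Y := LinearEquiv.ofFinrankEq _ _ hr
  refine ⟨A.restrictScalars F, fun x => ?_⟩
  have h3 := A.map_smul (AdjoinRoot.mk f Polynomial.X) x
  rw [sX, sY] at h3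
  simpa using h3

end
end MK

namespace MK
attribute [local instance] Fintype.ofFinite
attribute [local instance] Classical.propDecidable
section
open Polynomial

variable {F : Type} [Field F] [Finite F]
variable {K : Type} [Field K] [Finite K] [Algebra F K]
variable {V X Y : Type} [AddCommGroup V] [Module F V] [Finite V]
variable [AddCommGroup X] [Module F X] [Finite X] [AddCommGroup Y] [Module F Y] [Finite Y]

lemma prim_ind {G1 G2 : PFun F} (i1 : PInv G1) (i2 : PInv G2) (k1 : GLk G1) (k2 : GLk G2)
    (f : F[X]) (hf : Irreducible f) (hm : f.Monic)
    (ih : ∀ (W : Type) [AddCommGroup W] [Module F W] [Finite W], Module.finrank F W < Module.finrank F V →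
      ∀ (g : Module.End F W) (b : ℕ), g.charpoly = f ^ b → G1 W g = G2 W g) :
    Prim (fun g : Module.End F V => if ∃ b : ℕ, g.charpoly = f ^ b then G1 V g - G2 V g else 0) := by
  constructor
  · intro e g g' h
    simp only [charpoly_conj' e g g' h, i1 _ _ e g g' h, i2 _ _ e g g' h]
  · intro W hb ht g hs
    simp only [charpoly_nil W g hs]
    by_cases hc : ∃ b : ℕ, (g.restrict hs).charpoly * (W.mapQ W g hs).charpoly = f ^ b
    · simp only [if_pos hc, Finset.sum_sub_distrib]
      rw [sum_nil i1 W g hs, sum_nil i2 W g hs]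
      have hne : (Nat.card ((V ⧸ W) →ₗ[F] W) : ℂ) ≠ 0 := Nat.cast_ne_zero.2 Nat.card_pos.ne'
      have e1 := k1 W (V ⧸ W) (g.restrict hs) (W.mapQ W g hs)
      have e2 := k2 W (V ⧸ W) (g.restrict hs) (W.mapQ W g hs)
      unfold cc at e1 e2
      rw [div_eq_iff hne] at e1 e2
      obtain ⟨b, hb'⟩ := hc
      have pw : ∀ p : F[X], p.Monic → p ∣ f ^ b → ∃ c : ℕ, p = f ^ c := by
        intro p hp hd
        obtain ⟨c, _, hc⟩ := (dvd_prime_pow hf.prime b).1 hd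
        exact ⟨c, eq_of_monic_of_associated hp (hm.pow c) hc⟩
      obtain ⟨c1, hc1⟩ := pw _ (LinearMap.charpoly_monic (g.restrict hs)) (hb' ▸ dvd_mul_right _ _)
      obtain ⟨c2, hc2⟩ := pw _ (LinearMap.charpoly_monic (W.mapQ W g hs)) (hb' ▸ dvd_mul_left _ _)
      have d1 : Module.finrank F W < Module.finrank F V := Submodule.finrank_lt ht
      have d2 : Module.finrank F (V ⧸ W) < Module.finrank F V := by
        have := W.finrank_quotient_add_finrank
        have h3 : 0 < Module.finrank F W := by
          rw [Nat.pos_iff_ne_zero]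
          intro h
          exact hb (Submodule.finrank_eq_zero.1 h)
        omega
      rw [e1, e2, ih W d1 _ c1 hc1, ih (V ⧸ W) d2 _ c2 hc2, sub_self]
    · simp only [if_neg hc, Finset.sum_const_zero]

/-- `K` is large enough for everything up to dimension `N` -/
def Good (F K : Type) [Field F] [Field K] [Algebra F K] (N : ℕ) : Prop :=
  ∀ (V : Type) [AddCommGroup V] [Module F V] [Finite V], Nontrivial V → Module.finrank F V ≤ N →
    SplitsAll F V K ∧ Nat.card (V ≃ₗ[F] V) ∣ Nat.card K * (Nat.card K - 1) ∧
      Nat.card F ^ Module.finrank F V - 1 ∣ Nat.card K - 1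

lemma KK_sub (ψ : AddChar F ℂ) (L : List (MulChar F ℂ)) [Subsingleton V] (g : Module.End F V) : KK ψ L V g = 1 := by
  haveI : Subsingleton (Module.End F V) := ⟨fun a b => LinearMap.ext fun x => Subsingleton.elim _ _⟩
  induction L generalizing g with
  | nil => simp [KK, Subsingleton.elim g 1]
  | cons χ L ih =>
    unfold KK
    rw [Fintype.sum_subsingleton _ (1 : Module.End F V), Fintype.sum_subsingleton _ (1 : Module.End F V),
      if_pos (Subsingleton.elim _ _), ih, mul_one, Phi]
    have : LinearMap.trace F V 1 = 0 := by
      rw [Subsingleton.elim (1 : Module.End F V) 0, map_zero]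
    rw [this]
    simp

lemma kap_sub (ψ : AddChar F ℂ) (L : List (MulChar F ℂ)) [Subsingleton V] (g : Module.End F V) : kap ψ L V g = 1 := by
  unfold kap
  rw [KK_sub, Module.finrank_zero_of_subsingleton]
  simp [nrm]

lemma RR_g0 (ξ : K) (hV : 1 ≤ Module.finrank F V) (g0 : Module.End F V) (h0 : aeval g0 (minpoly F ξ) = 0)
    (g : Module.End F V) (b : ℕ) (hg : g.charpoly = minpoly F ξ ^ b) : RR ξ V g0 ≠ 0 := by
  intro hz
  have hirr : Irreducible (minpoly F ξ) := minpoly.irreducible (Algebra.IsIntegral.isIntegral ξ)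
  have hmon : (minpoly F ξ).Monic := minpoly.monic (Algebra.IsIntegral.isIntegral ξ)
  have hall : ∀ g : Module.End F V, aeval g (minpoly F ξ) = 0 → RR ξ V g = 0 := by
    intro g hg
    obtain ⟨A, hA⟩ := conj_of_annih _ hirr g g0 hg h0 rfl
    rw [RR_inv ξ _ _ A g g0 hA, hz]
  have hdeg : (minpoly F ξ ^ b).natDegree = Module.finrank F V := by
    rw [← hg, LinearMap.charpoly_natDegree]
  obtain ⟨g', v, hc, hg'⟩ := exists_cyc (V := V) _ (hmon.pow b) hdeg
  have hb : 1 ≤ b := by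
    rw [Polynomial.natDegree_pow] at hdeg
    rcases b with _ | b
    · omega
    · omega
  have h1 := RR_reg ξ g' v hc b hb hg'
  rw [lemmaU _ hirr (RR_prim ξ) hall g' b hg'] at h1
  exact zero_ne_one h1

lemma sum_RR_sq (ξ : K) (g0 : Module.End F V) (h0 : RR ξ V g0 ≠ 0) : ∑ g : Module.End F V, RR ξ V g * RR ξ V g ≠ 0 := by
  choose m hm using fun g : Module.End F V => RR_int ξ _ V g rfl
  simp only [hm]
  have h1 : m g0 ≠ 0 := by
    intro h
    rw [hm, h] at h0
    simp at h0
  have h2 : 0 < ∑ g, m g * m g :=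
    Finset.sum_pos' (fun g _ => mul_self_nonneg _) ⟨g0, Finset.mem_univ _, mul_self_pos.2 h1⟩
  exact_mod_cast h2.ne'

lemma sum_RR' [Nontrivial V] (hK : SplitsAll F V K) (ξ : K) (h : ξ ∈ En F K (Module.finrank F V)) :
    ∑ g : Module.End F V, RR ξ V g = cst F K V * aa F K (Module.finrank F V) := by
  have h1 := sum_RR hK ξ
  rw [if_pos h] at h1
  have h2 := card_sub_one_ne (V := V)
  have h3 := aa_ne' (F := F) (K := K) (V := V)
  unfold cst
  rw [← h1]
  field_simp

lemma main_abs (ξ : K) (h0 : ξ ≠ 0) (N : ℕ) (hK : Good F K N) (ψ : AddChar F ℂ) (hψ : ∃ a : F, ψ a ≠ 1)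
    (L : List (MulChar F ℂ)) (k : ℕ) (hk : 1 ≤ k) (hL : L.length = k) (ν : Fin k → ℂ)
    (hν : ∀ b, 1 ≤ b → (minpoly F ξ).natDegree * b ≤ N → (∑ i, ν i ^ ((minpoly F ξ).natDegree * b)) =
      (-1) ^ (k - 1) * Kf ψ K ((minpoly F ξ).natDegree * b) L ξ)
    (n : ℕ) : ∀ (V : Type) [AddCommGroup V] [Module F V] [Finite V], Module.finrank F V = n → n ≤ N →
      ∀ (g : Module.End F V) (b : ℕ), g.charpoly = minpoly F ξ ^ b → kap ψ L V g = VF k ν V g := by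
  induction n using Nat.strong_induction_on with
  | _ n ih =>
  intro V _ _ _ hn hN g b hg
  rcases subsingleton_or_nontrivial V with hs | hnt
  · rw [kap_sub, VF_sub]
  have hirr : Irreducible (minpoly F ξ) := minpoly.irreducible (Algebra.IsIntegral.isIntegral ξ)
  have hmon : (minpoly F ξ).Monic := minpoly.monic (Algebra.IsIntegral.isIntegral ξ)
  have hpos : 1 ≤ Module.finrank F V := Module.finrank_pos
  have hdeg : (minpoly F ξ).natDegree * b = Module.finrank F V := by
    rw [← LinearMap.charpoly_natDegree g, hg, Polynomial.natDegree_pow, mul_comm]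
  have hb : 1 ≤ b := by
    rcases b with _ | b
    · omega
    · omega
  have hP := prim_ind (V := V) (kap_inv ψ L) (VF_inv k ν) (kap_GL ψ hψ L (by omega)) (VF_GL k ν) (minpoly F ξ) hirr hmon
    (fun W _ _ _ hW g b hg => ih _ (hn ▸ hW) W rfl (by omega) g b hg)
  obtain ⟨Δ, hΔ⟩ : ∃ Δ : Module.End F V → ℂ, Δ = fun g : Module.End F V =>
    if ∃ b : ℕ, g.charpoly = minpoly F ξ ^ b then kap ψ L V g - VF k ν V g else 0 := ⟨_, rfl⟩
  rw [← hΔ] at hP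
  have hgΔ : Δ g = kap ψ L V g - VF k ν V g := by
    rw [hΔ]
    exact if_pos ⟨b, hg⟩
  rw [← sub_eq_zero, ← hgΔ]
  by_cases hex : ∃ g0 : Module.End F V, aeval g0 (minpoly F ξ) = 0
  swap
  · push Not at hex
    exact lemmaU _ hirr hP (fun g h => absurd h (hex g)) g b hg
  obtain ⟨g0, hg0⟩ := hex
  have hR0 := RR_g0 ξ hpos g0 hg0 g b hg
  have hprop : ∀ g : Module.End F V, ∀ b, g.charpoly = minpoly F ξ ^ b → Δ g - (Δ g0 / RR ξ V g0) * RR ξ V g = 0 := by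
    intro g b hg
    refine lemmaU _ hirr (prim_lin hP (RR_prim ξ) (Δ g0 / RR ξ V g0)) ?_ g b hg
    intro g hg
    obtain ⟨A, hA⟩ := conj_of_annih _ hirr g g0 hg hg0 rfl
    rw [hP.cls A g g0 hA, (RR_prim ξ).cls A g g0 hA]
    field_simp
    ring
  obtain ⟨hK1, hK2, hK3⟩ := hK V hnt (by omega)
  have hEn : ξ ∈ En F K (Module.finrank F V) := by
    rw [mem_En]
    exact frob_of_dvd _ _ ⟨b, hdeg.symm⟩
  have hRsupp : ∀ g : Module.End F V, RR ξ V g ≠ 0 → ∃ b : ℕ, g.charpoly = minpoly F ξ ^ b := by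
    intro g hg
    exact ⟨_, (En_supp ξ g hg).2⟩
  have hsum : ∑ g, Δ g * RR ξ V g = 0 := by
    have e1 : ∀ g, Δ g * RR ξ V g = nrm F (Module.finrank F V) ^ (k - 1) * (KK ψ L V g * RR ξ V g) - RR ξ V g * VF k ν V g := by
      intro g
      by_cases h : RR ξ V g = 0
      · rw [h]; ring
      · rw [hΔ]
        dsimp only
        rw [if_pos (hRsupp g h), kap, hL]
        ring
    simp only [e1, Finset.sum_sub_distrib]
    rw [← Finset.mul_sum, extraction hK1 hK2 hK3 ψ hψ L ξ hEn h0, sum_VF (RR_prim ξ), sum_RR' hK1 ξ hEn, hL, ← hdeg, hν b hb (by omega), hdeg]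
    obtain ⟨j, rfl⟩ : ∃ j, k = j + 1 := ⟨k - 1, by omega⟩
    have e2 := nrm_cst (F := F) (K := K) (V := V)
    rw [Nat.add_sub_cancel, pow_succ (cst F K V)]
    have e3 : nrm F (Module.finrank F V) ^ j * cst F K V ^ j = (-1) ^ j := by rw [← mul_pow, e2]
    linear_combination (cst F K V * aa F K (Module.finrank F V) * Kf ψ K (Module.finrank F V) L ξ) * e3
  have hsum2 : ∑ g, Δ g * RR ξ V g = (Δ g0 / RR ξ V g0) * ∑ g : Module.End F V, RR ξ V g * RR ξ V g := by
    rw [Finset.mul_sum]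
    refine Finset.sum_congr rfl fun g _ => ?_
    by_cases h : RR ξ V g = 0
    · rw [h]; ring
    · obtain ⟨b, hb⟩ := hRsupp g h
      have := hprop g b hb
      rw [sub_eq_zero] at this
      rw [this]; ring
  rw [hsum] at hsum2
  have hc : Δ g0 / RR ξ V g0 = 0 := by
    rcases mul_eq_zero.1 hsum2.symm with h | h
    · exact h
    · exact absurd h (sum_RR_sq ξ g0 hR0)
  have := hprop g b hg
  rw [hc] at this
  simpa using this

end
end MK

namespace MK
attribute [local instance] Fintype.ofFinite
attribute [local instance] Classical.propDecidable
section
open Polynomial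

variable {F : Type} [Field F] [Finite F]
variable {K : Type} [Field K] [Finite K] [Algebra F K]

lemma splits_irr (h : F[X]) (hi : Irreducible h) (D : ℕ) (hD : Nat.card K = Nat.card F ^ D) (hd : h.natDegree ∣ D) :
    (h.map (algebraMap F K)).Splits := by
  have h1 := (hi.natDegree_dvd_iff_dvd_X_pow_card_pow_sub_X (n := D)).1 hd
  have h2 := Polynomial.map_dvd (algebraMap F K) h1
  rw [← hD] at h2
  simp only [Polynomial.map_sub, Polynomial.map_pow, Polynomial.map_X] at h2
  obtain ⟨p, hp⟩ := CharP.exists K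
  haveI : Fact p.Prime := ⟨CharP.char_is_prime K p⟩
  letI := ZMod.algebra K p
  have h3 := FiniteField.splits_X_pow_nat_card_sub_X (K := K) p
  simp only [Polynomial.map_sub, Polynomial.map_pow, Polynomial.map_X] at h3
  refine h3.of_dvd ?_ h2
  exact FiniteField.X_pow_card_sub_X_ne_zero K Finite.one_lt_card

lemma splits_all (N D : ℕ) (hD : Nat.card K = Nat.card F ^ D) (hd : ∀ m, 1 ≤ m → m ≤ N → m ∣ D) (n : ℕ) :
    ∀ p : F[X], p.natDegree = n → n ≤ N → (p.map (algebraMap F K)).Splits := by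
  induction n using Nat.strong_induction_on with
  | _ n ih =>
  intro p hp hn
  by_cases h0 : p.natDegree = 0
  · rw [Polynomial.natDegree_eq_zero] at h0
    obtain ⟨c, rfl⟩ := h0
    rw [Polynomial.map_C]
    exact Polynomial.Splits.C _
  have hu : ¬ IsUnit p := fun h => h0 (Polynomial.natDegree_eq_zero_of_isUnit h)
  obtain ⟨h, hi, r, rfl⟩ := WfDvdMonoid.exists_irreducible_factor hu (by rintro rfl; simp at h0)
  have hr0 : r ≠ 0 := by rintro rfl; simp at h0
  rw [Polynomial.natDegree_mul hi.ne_zero hr0] at hp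
  have hpos := hi.natDegree_pos
  rw [Polynomial.map_mul]
  exact (splits_irr h hi D hD (hd _ hpos (by omega))).mul (ih _ (by omega) r rfl (by omega))

lemma good_of (N D : ℕ) (hD : Nat.card K = Nat.card F ^ D) (hd : ∀ m, 1 ≤ m → m ≤ N → m ∣ D)
    (hM : (∏ i ∈ Finset.range N, (Nat.card F ^ (i + 1) - 1)) ∣ Nat.card F ^ D - 1) (hC : N.choose 2 ≤ D) :
    Good F K N := by
  intro V _ _ _ hV hn
  refine ⟨fun g => splits_all N D hD hd _ _ rfl (by rwa [LinearMap.charpoly_natDegree]), ?_, ?_⟩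
  · rw [card_aut, hD]
    refine mul_dvd_mul (pow_dvd_pow _ ((Nat.choose_le_choose 2 hn).trans hC)) (dvd_trans ?_ hM)
    exact Finset.prod_dvd_prod_of_subset _ _ _ (by intro i; simp only [Finset.mem_range]; omega)
  · rw [hD]
    obtain ⟨c, hc⟩ := hd _ (Module.finrank_pos (R := F) (M := V)) hn
    rw [hc]
    have := Nat.sub_dvd_pow_sub_pow (Nat.card F ^ Module.finrank F V) 1 c
    rwa [one_pow, ← pow_mul] at this

lemma coprime_M (q N : ℕ) (hq : 1 < q) : Nat.Coprime q (∏ i ∈ Finset.range N, (q ^ (i + 1) - 1)) := by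
  refine Nat.Coprime.prod_right fun i _ => ?_
  have h1 : Nat.Coprime (q ^ (i + 1)) (q ^ (i + 1) - 1) := by
    obtain ⟨m, hm⟩ : ∃ m, q ^ (i + 1) = m + 1 := ⟨q ^ (i + 1) - 1, (Nat.sub_add_cancel (Nat.one_le_pow _ _ (by omega))).symm⟩
    rw [hm]
    simp
  exact Nat.Coprime.coprime_dvd_left (dvd_pow_self q (by omega)) h1

/-- existence of a large extension of `E` which is good for `F`. -/
lemma exists_good (F E : Type) [Field F] [Finite F] [Field E] [Finite E] [Algebra F E] (N : ℕ) :
    ∃ (K : Type) (_ : Field K) (_ : Finite K) (_ : Algebra F K) (_ : Algebra E K) (_ : IsScalarTower F E K),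
      Good F K N ∧ ∀ m, 1 ≤ m → m ≤ N → m ∣ Module.finrank E K := by
  obtain ⟨p, hp⟩ := CharP.exists E
  haveI : Fact p.Prime := ⟨CharP.char_is_prime E p⟩
  obtain ⟨q, hq⟩ : ∃ q, q = Nat.card F := ⟨_, rfl⟩
  have hq1 : 1 < q := hq ▸ Finite.one_lt_card
  obtain ⟨M, hM⟩ : ∃ M, M = ∏ i ∈ Finset.range N, (q ^ (i + 1) - 1) := ⟨_, rfl⟩
  have hcop : Nat.Coprime q M := hM ▸ coprime_M q N hq1
  have hMpos : 0 < M := by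
    rw [hM]
    refine Finset.prod_pos fun i _ => ?_
    have : 1 < q ^ (i + 1) := Nat.one_lt_pow (by omega) hq1
    omega
  obtain ⟨D, hD⟩ : ∃ D, D = M.totient * (N.factorial * (N.choose 2 + 1)) := ⟨_, rfl⟩
  have htot : 0 < M.totient := Nat.totient_pos.2 hMpos
  have hfac := N.factorial_pos
  have hD0 : D ≠ 0 := by
    rw [hD]; positivity
  haveI : NeZero D := ⟨hD0⟩
  have hDN : ∀ m, 1 ≤ m → m ≤ N → m ∣ D := fun m h1 h2 => by
    rw [hD]
    exact dvd_mul_of_dvd_right (dvd_mul_of_dvd_left (Nat.dvd_factorial h1 h2) _) _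
  letI : Algebra F (FiniteField.Extension E p D) :=
    ((algebraMap E (FiniteField.Extension E p D)).comp (algebraMap F E)).toAlgebra
  haveI : IsScalarTower F E (FiniteField.Extension E p D) := IsScalarTower.of_algebraMap_eq fun _ => rfl
  haveI : Finite (FiniteField.Extension E p D) := Module.finite_of_finite E
  refine ⟨FiniteField.Extension E p D, inferInstance, inferInstance, inferInstance, inferInstance, inferInstance, ?_, ?_⟩
  swap
  · rw [FiniteField.finrank_extension]
    exact hDN
  have ha : 0 < Module.finrank F E := Module.finrank_pos
  refine good_of N (Module.finrank F E * D) ?_ (fun m h1 h2 => dvd_mul_of_dvd_right (hDN m h1 h2) _) ?_ ?_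
  · rw [FiniteField.natCard_extension, Module.natCard_eq_pow_finrank (K := F) (V := E), pow_mul]
  · rw [← hq, ← hM, hD]
    have h1 : q ^ M.totient ≡ 1 [MOD M] := Nat.ModEq.pow_totient hcop
    have h2 : q ^ (Module.finrank F E * (M.totient * (N.factorial * (N.choose 2 + 1)))) ≡ 1 [MOD M] := by
      have := h1.pow (Module.finrank F E * (N.factorial * (N.choose 2 + 1)))
      rw [one_pow, ← pow_mul] at this
      convert this using 2
      ring
    exact (Nat.modEq_iff_dvd' (Nat.one_le_pow _ _ (by omega))).1 h2.symm
  · rw [hD]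
    have : N.choose 2 + 1 ≤ Module.finrank F E * (M.totient * (N.factorial * (N.choose 2 + 1))) := by
      refine Nat.le_of_dvd (by positivity) ?_
      exact Dvd.intro_left (Module.finrank F E * M.totient * N.factorial) (by ring)
    omega

end
end MK

namespace MK
attribute [local instance] Fintype.ofFinite
attribute [local instance] Classical.propDecidable
section
open Polynomial

variable {F : Type} [Field F] [Finite F]
variable {K : Type} [Field K] [Finite K] [Algebra F K]

lemma En_image {E : Type} [Field E] [Fintype E] [Algebra F E] (j : E →ₐ[F] K) (n : ℕ) (hn : Module.finrank F E = n) :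
    En F K n = Finset.univ.image j := by
  have hcard : Fintype.card E = Nat.card F ^ n := by
    rw [← Nat.card_eq_fintype_card, Module.natCard_eq_pow_finrank (K := F), hn]
  have hpos : 0 < n := hn ▸ Module.finrank_pos
  symm
  apply Finset.eq_of_subset_of_card_le
  · intro t ht
    obtain ⟨e, _, rfl⟩ := Finset.mem_image.1 ht
    rw [mem_En, ← map_pow, ← hcard, FiniteField.pow_card]
  · rw [Finset.card_image_of_injective _ (show Function.Injective (⇑j) from j.injective), Finset.card_univ, hcard]
    have hne : (Polynomial.X ^ Nat.card F ^ n - Polynomial.X : K[X]) ≠ 0 :=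
      FiniteField.X_pow_card_pow_sub_X_ne_zero K hpos.ne' Finite.one_lt_card
    have hsub : En F K n ⊆ (Polynomial.X ^ Nat.card F ^ n - Polynomial.X : K[X]).roots.toFinset := by
      intro t ht
      rw [Multiset.mem_toFinset, Polynomial.mem_roots hne]
      rw [Polynomial.IsRoot, Polynomial.eval_sub, Polynomial.eval_pow, Polynomial.eval_X, mem_En.1 ht, sub_self]
    refine (Finset.card_le_card hsub).trans ((Multiset.toFinset_card_le _).trans ((Polynomial.card_roots' _).trans ?_))
    rw [FiniteField.X_pow_card_pow_sub_X_natDegree_eq K hpos.ne' Finite.one_lt_card]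

lemma tx_trace {E : Type} [Field E] [Fintype E] [Algebra F E] (j : E →ₐ[F] K) (n : ℕ) (hn : Module.finrank F E = n) (e : E) :
    tx F n (j e) = Algebra.trace F E e := by
  have hpos : 0 < n := hn ▸ Module.finrank_pos
  apply (algebraMap F K).injective
  rw [tx_map hpos (by rw [En_image j n hn]; exact Finset.mem_image_of_mem _ (Finset.mem_univ _)), ← j.commutes,
    FiniteField.algebraMap_trace_eq_sum_pow, map_sum, hn]
  simp only [map_pow]

lemma nx_norm {E : Type} [Field E] [Fintype E] [Algebra F E] (j : E →ₐ[F] K) (n : ℕ) (hn : Module.finrank F E = n) (e : E) :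
    nx F n (j e) = Algebra.norm F e := by
  apply (algebraMap F K).injective
  rw [nx_map (by rw [En_image j n hn]; exact Finset.mem_image_of_mem _ (Finset.mem_univ _)), ← j.commutes,
    FiniteField.algebraMap_norm_eq_prod_pow, map_prod, hn]
  simp only [map_pow]

lemma fieldKloosterman_succ {F : Type} [Field F] [Fintype F] {k : ℕ}
    (α : Fin (k + 1) → Fˣ →* ℂˣ) (ψ : AddChar F ℂ)
    (E : Type) [Field E] [Fintype E] [DecidableEq E] [Algebra F E] (ξ : E) :
    fieldKloosterman α ψ E ξ = ∑ t : Eˣ, (α 0 (Units.map (Algebra.norm F : E →* F) t) : ℂ) * ψ (Algebra.trace F E t) *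
      fieldKloosterman (fun i => α i.succ) ψ E ((t : E)⁻¹ * ξ) := by
  unfold fieldKloosterman
  rw [← Fintype.sum_equiv (Fin.consEquiv fun _ => Eˣ) _ _ (fun _ => rfl), Fintype.sum_prod_type]
  refine Finset.sum_congr rfl fun t _ => ?_
  rw [Finset.mul_sum]
  refine Finset.sum_congr rfl fun s _ => ?_
  have hiff : (((∏ i, s i : Eˣ) : E) = (t : E)⁻¹ * ξ) ↔ ((t : E) * ((∏ i, s i : Eˣ) : E) = ξ) := by
    rw [eq_inv_mul_iff_mul_eq₀ t.ne_zero]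
  simp only [Fin.consEquiv_apply, Fin.prod_univ_succ, Fin.sum_univ_succ, Fin.cons_zero, Fin.cons_succ, Units.val_mul, hiff]
  split_ifs
  · rw [map_add, ψ.map_add_eq_mul]
    ring
  · ring

lemma fieldKloosterman_Kf {F : Type} [Field F] [Fintype F] (K : Type) [Field K] [Finite K] [Algebra F K] {k : ℕ}
    (α : Fin k → Fˣ →* ℂˣ) (ψ : AddChar F ℂ)
    (E : Type) [Field E] [Fintype E] [DecidableEq E] [Algebra F E] (j : E →ₐ[F] K) (n : ℕ) (hn : Module.finrank F E = n) (ξ : E) :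
    fieldKloosterman α ψ E ξ = Kf ψ K n (List.ofFn fun i => MulChar.ofUnitHom (α i)) (j ξ) := by
  induction k generalizing ξ with
  | zero =>
    have hi : (1 = j ξ) ↔ (ξ = 1) := by
      rw [eq_comm]
      exact map_eq_one_iff j j.injective
    simp [fieldKloosterman, Kf, eq_comm, hi]
  | succ k ih =>
    rw [fieldKloosterman_succ, List.ofFn_succ, Kf, En_image j n hn]
    beta_reduce
    rw [Finset.sum_image (g := (⇑j)) (fun a _ b _ h => j.injective h)]
    have hz : (MulChar.ofUnitHom (α 0)) (nx F n (j 0)) = (0 : ℂ) := by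
      rw [nx_norm j n hn, Algebra.norm_zero, MulChar.map_zero]
    rw [← Finset.add_sum_erase _ _ (Finset.mem_univ (0 : E)), hz, zero_mul, zero_mul, zero_add]
    refine Finset.sum_bij (fun t _ => (t : E)) (fun t _ => by simp) (fun a _ b _ h => Units.ext h)
      (fun b hb => ⟨Units.mk0 b (by simpa using hb), Finset.mem_univ _, rfl⟩) (fun t _ => ?_)
    rw [ih, tx_trace j n hn, nx_norm j n hn, map_mul, map_inv₀]
    congr 2
    have : Algebra.norm F (t : E) = ((Units.map (Algebra.norm F : E →* F) t : Fˣ) : F) := rfl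
    rw [this, MulChar.ofUnitHom_coe]

end
end MK

namespace MK
attribute [local instance] Fintype.ofFinite
attribute [local instance] Classical.propDecidable
section
open Polynomial

lemma KK_cons' {F : Type} [Field F] [Finite F] {V : Type} [AddCommGroup V] [Module F V] [Finite V]
    (ψ : AddChar F ℂ) (χ : MulChar F ℂ) (L : List (MulChar F ℂ)) (x : Module.End F V) :
    KK ψ (χ :: L) V x = ∑ u : (Module.End F V)ˣ, Phi ψ χ (u : Module.End F V) * KK ψ L V ((↑u⁻¹ : Module.End F V) * x) := by
  rw [KK]
  beta_reduce
  symm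
  refine Finset.sum_of_injOn (fun u => (u : Module.End F V)) (fun a _ b _ h => Units.ext h) (fun _ _ => by simp) ?_ ?_
  · intro g _ hg
    have : ¬ IsUnit g := by
      rintro ⟨u, rfl⟩
      exact hg ⟨u, by simp, rfl⟩
    simp [Phi_nonunit ψ χ g this]
  · intro u _
    beta_reduce
    rw [Finset.sum_eq_single ((↑u⁻¹ : Module.End F V) * x)]
    · rw [if_pos (by simp)]
    · intro h _ hne
      rw [if_neg]
      rintro rfl
      exact hne (by simp)
    · intro h
      exact absurd (Finset.mem_univ _) h

lemma matrixKloosterman_succ {F : Type} [Field F] [Fintype F] [DecidableEq F]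
    {ι : Type} [Fintype ι] [DecidableEq ι] {k : ℕ}
    (α : Fin (k + 1) → Fˣ →* ℂˣ) (ψ : AddChar F ℂ) (x : Matrix ι ι F) :
    matrixKloosterman α ψ x = ∑ u : (Matrix ι ι F)ˣ,
      (α 0 (Units.map (Matrix.detMonoidHom) u) : ℂ) * ψ (Matrix.trace (u : Matrix ι ι F)) *
      matrixKloosterman (fun i => α i.succ) ψ ((↑u⁻¹ : Matrix ι ι F) * x) := by
  unfold matrixKloosterman
  rw [← Fintype.sum_equiv (Fin.consEquiv fun _ => (Matrix ι ι F)ˣ) _ _ (fun _ => rfl), Fintype.sum_prod_type]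
  refine Finset.sum_congr rfl fun t _ => ?_
  rw [Finset.mul_sum]
  refine Finset.sum_congr rfl fun s _ => ?_
  have hiff : (((List.ofFn s).prod : Matrix ι ι F) = (↑t⁻¹ : Matrix ι ι F) * x) ↔
      ((t : Matrix ι ι F) * ((List.ofFn s).prod : Matrix ι ι F) = x) := by
    rw [Units.eq_inv_mul_iff_mul_eq]
  simp only [Fin.consEquiv_apply, List.ofFn_succ, List.prod_cons, Fin.prod_univ_succ, Fin.sum_univ_succ, Fin.cons_zero,
    Fin.cons_succ, Units.val_mul, hiff]
  split_ifs
  · rw [Matrix.trace_add, ψ.map_add_eq_mul]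
    ring
  · ring

lemma matrixKloosterman_KK {F : Type} [Field F] [Fintype F] [DecidableEq F]
    {ι : Type} [Fintype ι] [DecidableEq ι] {k : ℕ}
    (α : Fin k → Fˣ →* ℂˣ) (ψ : AddChar F ℂ) (x : Matrix ι ι F) :
    matrixKloosterman α ψ x = KK ψ (List.ofFn fun i => MulChar.ofUnitHom (α i)) (ι → F) (Matrix.toLin' x) := by
  induction k generalizing x with
  | zero =>
    have hi : (1 = x) ↔ (Matrix.toLin' x = 1) := by
      have : (1 : Module.End F (ι → F)) = Matrix.toLin' (1 : Matrix ι ι F) := by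
        rw [Matrix.toLin'_one]
        rfl
      rw [this, eq_comm, Matrix.toLin'.injective.eq_iff]
    simp [matrixKloosterman, KK, hi]
  | succ k ih =>
    rw [matrixKloosterman_succ, List.ofFn_succ, KK_cons']
    let e : (Matrix ι ι F)ˣ ≃ (Module.End F (ι → F))ˣ := (Units.mapEquiv (Matrix.toLinAlgEquiv' (R := F) (n := ι)).toMulEquiv).toEquiv
    refine (Fintype.sum_equiv e _ _ fun u => ?_).trans (Finset.sum_congr (by ext; simp) fun _ _ => rfl)
    have h1 : ((e u : (Module.End F (ι → F))ˣ) : Module.End F (ι → F)) = Matrix.toLin' (u : Matrix ι ι F) := rfl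
    have h2 : (((e u)⁻¹ : (Module.End F (ι → F))ˣ) : Module.End F (ι → F)) = Matrix.toLin' (↑u⁻¹ : Matrix ι ι F) := rfl
    have h3 : Matrix.toLin' (↑u⁻¹ : Matrix ι ι F) * Matrix.toLin' x = Matrix.toLin' ((↑u⁻¹ : Matrix ι ι F) * x) :=
      (Matrix.toLin'_mul _ _).symm
    rw [h1, h2, ih, h3, Phi, LinearMap.det_toLin', Matrix.trace_toLin'_eq]
    congr 2
    have : Matrix.det (u : Matrix ι ι F) = ((Units.map (Matrix.detMonoidHom) u : Fˣ) : F) := rfl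
    rw [this, MulChar.ofUnitHom_coe]

end
end MK

namespace MK
attribute [local instance] Fintype.ofFinite
attribute [local instance] Classical.propDecidable
section
open Polynomial

variable {F : Type} [Field F] [Finite F]
variable {V : Type} [AddCommGroup V] [Module F V] [Finite V]

instance finiteSub31 {R M : Type} [Ring R] [AddCommGroup M] [Module R M] [Finite M] : Finite (Submodule R M) :=
  Finite.of_injective (fun p : Submodule R M => (p : Set M)) SetLike.coe_injective

/-- recursive weighted count of stable chains ending in `U` -/
noncomputable def RF (R : Type) {M : Type} [Field R] [AddCommGroup M] [Module R M] [Finite M] (g : M → M) :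
    (k : ℕ) → (Fin k → ℂ) → Submodule R M → ℂ
  | 0, _ => fun U => if Module.finrank R U = 0 then 1 else 0
  | (k + 1), ν => fun U => ∑ U' : Submodule R M, if U' ≤ U ∧ (∀ x ∈ U', g x ∈ U') then
      RF R g k (headPart ν) U' * ν (Fin.last k) ^ (Module.finrank R U - Module.finrank R U') else 0

lemma VF_RF (g : Module.End F V) (k : ℕ) (ν : Fin k → ℂ) (U : Submodule F V) (hU : Stab g U) :
    VF k ν U (g.restrict hU) = RF F g k ν U := by
  induction k generalizing U with
  | zero => simp [VF, triv, RF]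
  | succ k ih =>
    unfold VF star RF
    refine Finset.sum_of_injOn (fun W : Submodule F U => W.map U.subtype)
      (fun a _ b _ h => Submodule.map_injective_of_injective U.subtype_injective h) (fun _ _ => by simp) ?_ ?_
    · intro U' _ hU'
      rw [if_neg]
      rintro ⟨hle, _⟩
      apply hU'
      exact ⟨U'.comap U.subtype, by simp, by simp [Submodule.map_comap_subtype, hle]⟩
    · intro W _
      beta_reduce
      have hle : W.map U.subtype ≤ U := Submodule.map_subtype_le U W
      have hst : Stab (g.restrict hU) W ↔ ∀ x ∈ W.map U.subtype, g x ∈ W.map U.subtype := by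
        constructor
        · rintro h _ ⟨y, hy, rfl⟩
          exact ⟨_, h y hy, rfl⟩
        · intro h y hy
          obtain ⟨z, hz, hz'⟩ := h y ⟨y, hy, rfl⟩
          have : z = g.restrict hU y := Subtype.ext hz'
          rwa [← this]
      unfold term
      by_cases h : Stab (g.restrict hU) W
      · rw [dif_pos h, if_pos ⟨hle, hst.1 h⟩]
        have e : W ≃ₗ[F] W.map U.subtype := Submodule.equivMapOfInjective _ U.subtype_injective W
        have h1 := VF_inv k (headPart ν) _ _ (Submodule.equivMapOfInjective _ U.subtype_injective W)
          ((g.restrict hU).restrict h) (g.restrict (hst.1 h)) (fun x => by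
            apply Subtype.ext
            rfl)
        rw [h1, ih, pw]
        congr 2
        have h2 := W.finrank_quotient_add_finrank
        have h3 := e.finrank_eq
        omega
      · rw [dif_neg h, if_neg]
        rintro ⟨_, h'⟩
        exact h (hst.2 h')

lemma VF_top (g : Module.End F V) (k : ℕ) (ν : Fin k → ℂ) : VF k ν V g = RF F g k ν ⊤ := by
  rw [← VF_RF g k ν ⊤ (fun _ _ => Submodule.mem_top)]
  exact VF_inv k ν _ _ (Submodule.topEquiv (R := F) (M := V)).symm _ _ (fun x => rfl)

variable {E : Type} [Field E] [Finite E] [Algebra F E] [Module E V] [IsScalarTower F E V]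

lemma RF_E (g : V → V) (hg : ∀ U : Submodule F V, (∀ x ∈ U, g x ∈ U) → ∀ (c : E), ∀ x ∈ U, c • x ∈ U)
    (k : ℕ) (ν : Fin k → ℂ) (U : Submodule E V) :
    RF F g k ν (U.restrictScalars F) = RF E g k (fun i => ν i ^ Module.finrank F E) U := by
  have hfr : ∀ U : Submodule E V, Module.finrank F (U.restrictScalars F) = Module.finrank F E * Module.finrank E U :=
    fun U => (Module.finrank_mul_finrank F E U).symm
  have ha : Module.finrank F E ≠ 0 := Module.finrank_pos.ne'
  induction k generalizing U with
  | zero =>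
    unfold RF
    rw [hfr]
    simp [ha]
  | succ k ih =>
    unfold RF
    symm
    refine Finset.sum_of_injOn (fun W : Submodule E V => W.restrictScalars F)
      (fun a _ b _ h => Submodule.restrictScalars_injective F E V h) (fun _ _ => by simp) ?_ ?_
    · intro U' _ hU'
      rw [if_neg]
      rintro ⟨_, hs⟩
      apply hU'
      exact ⟨{ U' with smul_mem' := fun c x hx => hg U' hs c x hx }, by simp, rfl⟩
    · intro W _
      beta_reduce
      have : (W.restrictScalars F ≤ U.restrictScalars F ∧ ∀ x ∈ W.restrictScalars F, g x ∈ W.restrictScalars F) ↔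
        (W ≤ U ∧ ∀ x ∈ W, g x ∈ W) := Iff.rfl
      simp only [this]
      split_ifs
      · rw [ih, hfr, hfr, ← Nat.mul_sub, pow_mul]
      · rfl

end
end MK

namespace MK
attribute [local instance] Fintype.ofFinite
attribute [local instance] Classical.propDecidable
section
open Polynomial

variable {E : Type} [Field E] {V : Type} [AddCommGroup V] [Module E V] [Finite V]

/-- chains `⊥ = C 0 ≤ … ≤ C k = U` of `g`-stable subspaces -/
def Chain (g : V → V) (k : ℕ) (U : Submodule E V) (C : Fin (k + 1) → Submodule E V) : Prop :=
  C 0 = ⊥ ∧ (∀ i : Fin k, C i.castSucc ≤ C i.succ) ∧ (∀ i : Fin k, ∀ x ∈ C i.castSucc, g x ∈ C i.castSucc) ∧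
    C (Fin.last k) = U

lemma RF_chain (g : V → V) (hg0 : g 0 = 0) (k : ℕ) (ω : Fin k → ℂ) (U : Submodule E V) :
    RF E g k ω U = ∑ C : Fin (k + 1) → Submodule E V, if Chain g k U C then
      ∏ i : Fin k, ω i ^ (Module.finrank E (C i.succ) - Module.finrank E (C i.castSucc)) else 0 := by
  induction k generalizing U with
  | zero =>
    unfold RF
    have : ∀ C : Fin 1 → Submodule E V, Chain g 0 U C ↔ (C = fun _ => ⊥) ∧ U = ⊥ := by
      intro C
      unfold Chain
      constructor
      · rintro ⟨h1, _, _, h2⟩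
        refine ⟨funext fun i => by rw [Subsingleton.elim i 0, h1], ?_⟩
        rw [← h2, ← h1]
        rfl
      · rintro ⟨rfl, rfl⟩
        simp
    simp only [this, Submodule.finrank_eq_zero]
    by_cases h : U = ⊥
    · simp [h]
    · simp [h]
  | succ k ih =>
    unfold RF
    rw [← Fintype.sum_equiv (Fin.snocEquiv fun _ => Submodule E V) _ _ (fun _ => rfl), Fintype.sum_prod_type]
    have hch : ∀ (Z : Submodule E V) (C : Fin (k + 1) → Submodule E V),
        Chain g (k + 1) U (Fin.snoc (α := fun _ => Submodule E V) C Z) ↔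
          Z = U ∧ (C (Fin.last k) ≤ U ∧ (∀ x ∈ C (Fin.last k), g x ∈ C (Fin.last k)) ∧ Chain g k (C (Fin.last k)) C) := by
      intro Z C
      unfold Chain
      have e0 : (Fin.snoc (α := fun _ => Submodule E V) C Z) 0 = C 0 := by
        rw [← Fin.castSucc_zero, Fin.snoc_castSucc]
      rw [e0, Fin.forall_fin_succ', Fin.forall_fin_succ']
      simp only [Fin.snoc_castSucc, Fin.snoc_last, Fin.succ_castSucc, Fin.succ_last]
      constructor
      · rintro ⟨h1, ⟨h2, h3⟩, ⟨h4, h5⟩, h6⟩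
        subst h6
        exact ⟨rfl, h3, h5, h1, h2, h4, trivial⟩
      · rintro ⟨rfl, h3, h5, h1, h2, h4, _⟩
        exact ⟨h1, ⟨h2, h3⟩, ⟨h4, h5⟩, rfl⟩
    symm
    rw [Finset.sum_eq_single U]
    rotate_left
    · intro Z _ hZ
      refine Finset.sum_eq_zero fun C _ => ?_
      change (if Chain g (k + 1) U (Fin.snoc (α := fun _ => Submodule E V) C Z) then _ else _) = _
      rw [if_neg]
      rw [hch]
      exact fun h => hZ h.1
    · intro h
      exact absurd (Finset.mem_univ _) h
    have hR : ∀ C : Fin (k + 1) → Submodule E V,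
        (if Chain g (k + 1) U ((Fin.snocEquiv fun _ => Submodule E V) (U, C)) then
          ∏ i : Fin (k + 1), ω i ^ (Module.finrank E (((Fin.snocEquiv fun _ => Submodule E V) (U, C)) i.succ) -
            Module.finrank E (((Fin.snocEquiv fun _ => Submodule E V) (U, C)) i.castSucc)) else 0) =
        ∑ U' : Submodule E V, if U' ≤ U ∧ (∀ x ∈ U', g x ∈ U') then
          (if Chain g k U' C then ∏ i : Fin k, (headPart ω : Fin k → ℂ) i ^ (Module.finrank E (C i.succ) - Module.finrank E (C i.castSucc)) else 0) *
          ω (Fin.last k) ^ (Module.finrank E U - Module.finrank E U') else 0 := by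
      intro C
      have e1 : ((Fin.snocEquiv fun _ => Submodule E V) (U, C)) = Fin.snoc (α := fun _ => Submodule E V) C U := rfl
      have e2 : ∀ i, Module.finrank E ((Fin.snoc (α := fun _ => Submodule E V) C U : Fin (k + 2) → Submodule E V) i.castSucc) =
          Module.finrank E (C i) := fun i => by rw [Fin.snoc_castSucc]
      have e3 : Module.finrank E ((Fin.snoc (α := fun _ => Submodule E V) C U : Fin (k + 2) → Submodule E V) (Fin.last k).succ) =
          Module.finrank E U := by rw [Fin.succ_last, Fin.snoc_last]
      rw [e1, Fin.prod_univ_castSucc, e2, e3]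
      simp only [Fin.succ_castSucc, e2, hch, true_and]
      rw [Finset.sum_eq_single (C (Fin.last k))]
      · by_cases h1 : C (Fin.last k) ≤ U
        · by_cases h2 : ∀ x ∈ C (Fin.last k), g x ∈ C (Fin.last k)
          · by_cases h3 : Chain g k (C (Fin.last k)) C
            · rw [if_pos ⟨h1, h2, h3⟩, if_pos ⟨h1, h2⟩, if_pos h3]
            · rw [if_neg (fun h => h3 h.2.2), if_pos ⟨h1, h2⟩, if_neg h3, zero_mul]
          · rw [if_neg (fun h => h2 h.2.1), if_neg (fun h => h2 h.2)]
        · rw [if_neg (fun h => h1 h.1), if_neg (fun h => h1 h.1)]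
      · intro U' _ hne
        have : ¬ Chain g k U' C := fun h => hne h.2.2.2.symm
        rw [if_neg this, zero_mul, ite_self]
      · intro h
        exact absurd (Finset.mem_univ _) h
    rw [Finset.sum_congr rfl fun C _ => hR C, Finset.sum_comm]
    refine Finset.sum_congr rfl fun U' _ => ?_
    split_ifs
    · rw [ih, Finset.sum_mul]
    · simp

lemma Iic_succ_sum {k : ℕ} (d : Fin k → ℕ) (j : ℕ) (h : j + 1 < k) :
    ∑ i ∈ Finset.Iic (⟨j + 1, h⟩ : Fin k), d i = ∑ i ∈ Finset.Iic (⟨j, by omega⟩ : Fin k), d i + d ⟨j + 1, h⟩ := by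
  have : Finset.Iic (⟨j + 1, h⟩ : Fin k) = insert ⟨j + 1, h⟩ (Finset.Iic (⟨j, by omega⟩ : Fin k)) := by
    ext i
    simp only [Finset.mem_Iic, Finset.mem_insert, Fin.le_def, Fin.ext_iff]
    omega
  rw [this, Finset.sum_insert, add_comm]
  simp [Fin.le_def]

lemma Iic_zero_sum {k : ℕ} (d : Fin k → ℕ) (h : 0 < k) :
    ∑ i ∈ Finset.Iic (⟨0, h⟩ : Fin k), d i = d ⟨0, h⟩ := by
  have : Finset.Iic (⟨0, h⟩ : Fin k) = {⟨0, h⟩} := by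
    ext i
    simp only [Finset.mem_Iic, Finset.mem_singleton, Fin.le_def, Fin.ext_iff]
    omega
  rw [this, Finset.sum_singleton]

lemma sums_iff {k : ℕ} (f : Fin (k + 1) → ℕ) (h0 : f 0 = 0) (hf : ∀ i : Fin k, f i.castSucc ≤ f i.succ) (d : Fin k → ℕ) :
    (∀ j : Fin k, f j.succ = ∑ i ∈ Finset.Iic j, d i) ↔ d = fun i => f i.succ - f i.castSucc := by
  constructor
  · intro h
    funext i
    obtain ⟨i, hi⟩ := i
    rcases i with _ | i
    · have h1 := h ⟨0, hi⟩
      rw [Iic_zero_sum] at h1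
      have : f (Fin.castSucc ⟨0, hi⟩) = 0 := h0
      omega
    · have h1 := h ⟨i + 1, hi⟩
      have h2 := h ⟨i, by omega⟩
      rw [Iic_succ_sum] at h1
      have : f (Fin.castSucc ⟨i + 1, hi⟩) = f (Fin.succ ⟨i, by omega⟩) := rfl
      omega
  · rintro rfl ⟨j, hj⟩
    induction j with
    | zero =>
      rw [Iic_zero_sum]
      have : f (Fin.castSucc ⟨0, hj⟩) = 0 := h0
      omega
    | succ j ih =>
      rw [Iic_succ_sum, ← ih (by omega)]
      have h1 := hf ⟨j + 1, hj⟩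
      have : f (Fin.castSucc ⟨j + 1, hj⟩) = f (Fin.succ ⟨j, by omega⟩) := rfl
      omega

lemma total_sum {k : ℕ} (f : Fin (k + 1) → ℕ) (h0 : f 0 = 0) (hf : ∀ i : Fin k, f i.castSucc ≤ f i.succ) :
    ∑ i : Fin k, (f i.succ - f i.castSucc) = f (Fin.last k) := by
  induction k with
  | zero => simpa using h0.symm
  | succ k ih =>
    rw [Fin.sum_univ_castSucc]
    have := ih (fun i => f i.castSucc) h0 (fun i => hf i.castSucc)
    simp only [Fin.succ_castSucc]
    have e : (Fin.last k).succ = Fin.last (k + 1) := rfl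
    rw [this, e]
    have := hf (Fin.last k)
    rw [e] at this
    omega

lemma flag_chain {k : ℕ} (hk : 1 ≤ k) (T : V →ₗ[E] V) (d : Fin k → ℕ) (W : Fin k → Submodule E V) :
    (Monotone W ∧ (∀ j, Module.finrank E (W j) = ∑ i ∈ Finset.Iic j, d i) ∧
      (∀ j, Submodule.map T (W j) ≤ W j) ∧ (∀ j : Fin k, (j : ℕ) + 1 = k → W j = ⊤)) ↔
    (Chain T k ⊤ (Fin.cons (α := fun _ => Submodule E V) ⊥ W) ∧
      d = fun i => Module.finrank E ((Fin.cons (α := fun _ => Submodule E V) ⊥ W : Fin (k + 1) → Submodule E V) i.succ) -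
        Module.finrank E ((Fin.cons (α := fun _ => Submodule E V) ⊥ W : Fin (k + 1) → Submodule E V) i.castSucc)) := by
  obtain ⟨k, rfl⟩ : ∃ j, k = j + 1 := ⟨k - 1, by omega⟩
  obtain ⟨C, hC⟩ : ∃ C : Fin (k + 2) → Submodule E V, C = Fin.cons (α := fun _ => Submodule E V) ⊥ W := ⟨_, rfl⟩
  have hC0 : C 0 = ⊥ := by rw [hC]; rfl
  have hCs : ∀ i : Fin (k + 1), C i.succ = W i := by intro i; rw [hC]; rfl
  rw [← hC]
  have hmono : Monotone W ↔ ∀ i : Fin (k + 1), C i.castSucc ≤ C i.succ := by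
    rw [Fin.monotone_iff_le_succ]
    rw [Fin.forall_fin_succ (n := k) (P := fun i => C i.castSucc ≤ C i.succ), Fin.castSucc_zero, hC0]
    simp only [bot_le, true_and]
    refine forall_congr' fun i => ?_
    rw [Fin.castSucc_succ, hCs, hCs]
  have hlast : (∀ j : Fin (k + 1), (j : ℕ) + 1 = k + 1 → W j = ⊤) ↔ C (Fin.last (k + 1)) = ⊤ := by
    rw [← Fin.succ_last, hCs]
    constructor
    · intro h
      exact h _ rfl
    · intro h j hj
      have : j = Fin.last k := Fin.ext (by simp at hj ⊢; omega)
      rw [this, h]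
  unfold Chain
  rw [hmono, hlast]
  have key : (∀ i : Fin (k + 1), C i.castSucc ≤ C i.succ) → ((∀ j, Module.finrank E (W j) = ∑ i ∈ Finset.Iic j, d i) ↔
      d = fun i => Module.finrank E (C i.succ) - Module.finrank E (C i.castSucc)) := by
    intro h
    rw [← sums_iff (fun i => Module.finrank E (C i)) (by rw [hC0]; simp) (fun i => Submodule.finrank_mono (h i)) d]
    refine forall_congr' fun j => ?_
    rw [hCs]
  constructor
  · rintro ⟨h1, h2, h3, h4⟩
    refine ⟨⟨hC0, h1, ?_, h4⟩, (key h1).1 h2⟩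
    intro i
    refine Fin.cases ?_ (fun i => ?_) i
    · rw [Fin.castSucc_zero, hC0]
      intro x hx
      rw [Submodule.mem_bot] at hx ⊢
      rw [hx, map_zero]
    · rw [Fin.castSucc_succ, hCs]
      intro x hx
      exact h3 _ ⟨x, hx, rfl⟩
  · rintro ⟨⟨_, h1, h3, h4⟩, h2⟩
    refine ⟨h1, (key h1).2 h2, ?_, h4⟩
    intro j
    rintro _ ⟨x, hx, rfl⟩
    rcases Fin.eq_castSucc_or_eq_last j with ⟨i, rfl⟩ | rfl
    · have := h3 i.succ x
      rw [Fin.castSucc_succ, hCs] at this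
      exact this hx
    · rw [← hCs, Fin.succ_last, h4]
      trivial

lemma RF_flag {k : ℕ} (hk : 1 ≤ k) (T : V →ₗ[E] V) (ω : Fin k → ℂ) (b : ℕ) (hb : Module.finrank E V = b) :
    RF E T k ω ⊤ = ∑ d ∈ Finset.Nat.antidiagonalTuple k b, (flagCount T d : ℂ) * ∏ i, ω i ^ d i := by
  rw [RF_chain T (map_zero T)]
  have hfc : ∀ d : Fin k → ℕ, (flagCount T d : ℂ) = ∑ W : Fin k → Submodule E V,
      if (Chain T k ⊤ (Fin.cons (α := fun _ => Submodule E V) ⊥ W) ∧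
      d = fun i => Module.finrank E ((Fin.cons (α := fun _ => Submodule E V) ⊥ W : Fin (k + 1) → Submodule E V) i.succ) -
        Module.finrank E ((Fin.cons (α := fun _ => Submodule E V) ⊥ W : Fin (k + 1) → Submodule E V) i.castSucc))
      then (1 : ℂ) else 0 := by
    intro d
    unfold flagCount
    simp only [flag_chain hk]
    rw [Finset.sum_boole, Nat.card_eq_fintype_card, Fintype.card_subtype]
  simp only [hfc, Finset.sum_mul]
  rw [Finset.sum_comm, ← Fintype.sum_equiv (Fin.consEquiv fun _ => Submodule E V) _ _ (fun _ => rfl), Fintype.sum_prod_type,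
    Finset.sum_eq_single (⊥ : Submodule E V)]
  · refine Finset.sum_congr rfl fun W _ => ?_
    have e1 : ((Fin.consEquiv fun _ => Submodule E V) (⊥, W)) = Fin.cons (α := fun _ => Submodule E V) ⊥ W := rfl
    rw [e1]
    generalize Fin.cons (α := fun _ => Submodule E V) ⊥ W = C
    by_cases h : Chain T k ⊤ C
    · rw [if_pos h]
      rw [Finset.sum_eq_single (fun i => Module.finrank E (C i.succ) - Module.finrank E (C i.castSucc))]
      · rw [if_pos ⟨h, rfl⟩, one_mul]
      · intro d _ hd
        rw [if_neg (fun h => hd h.2), zero_mul]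
      · intro hn
        exfalso
        apply hn
        rw [Finset.Nat.mem_antidiagonalTuple]
        rw [total_sum (fun i => Module.finrank E (C i)) (by rw [h.1]; simp) (fun i => Submodule.finrank_mono (h.2.1 i)), h.2.2.2,
          finrank_top, hb]
    · rw [if_neg h]
      symm
      refine Finset.sum_eq_zero fun d _ => ?_
      rw [if_neg (fun h' => h h'.1), zero_mul]
  · intro Z _ hZ
    refine Finset.sum_eq_zero fun C _ => ?_
    rw [if_neg]
    intro h
    exact hZ h.1
  · intro h
    exact absurd (Finset.mem_univ _) h

end
end MK

namespace MK
attribute [local instance] Fintype.ofFinite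
attribute [local instance] Classical.propDecidable
section
open Polynomial

section
variable {F : Type} [Field F] {V : Type} [AddCommGroup V] [Module F V] [Finite V]

lemma charpoly_of_pow (f : F[X]) (hf : Irreducible f) (hfm : f.Monic) (g : Module.End F V) (Q : ℕ)
    (h : aeval g (f ^ Q) = 0) : ∃ b, g.charpoly = f ^ b := by
  have hm := g.charpoly_monic
  obtain ⟨b, k, hk, hbk⟩ := WfDvdMonoid.max_power_factor (hm.ne_zero) hf
  refine ⟨b, ?_⟩
  have hu : IsUnit k := by
    by_contra hu
    have hk0 : k ≠ 0 := by
      rintro rfl; exact hk (dvd_zero _)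
    obtain ⟨h', hh, hhk⟩ := WfDvdMonoid.exists_irreducible_factor hu hk0
    haveI := Fact.mk hh
    have e : aeval (AdjoinRoot.root h') g.charpoly = 0 := by
      rw [AdjoinRoot.aeval_eq, AdjoinRoot.mk_eq_zero, hbk]
      exact hhk.mul_left _
    have e2 := root_annih g _ h _ e
    rw [AdjoinRoot.aeval_eq, AdjoinRoot.mk_eq_zero] at e2
    have e3 := hh.prime.dvd_of_dvd_pow e2
    exact hk ((hh.dvd_symm hf e3).trans hhk)
  have hkm : k.Monic := (hfm.pow b).of_mul_monic_left (hbk ▸ hm)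
  rw [hbk, hkm.eq_one_of_isUnit hu, mul_one]

lemma pow_expand [Finite F] (f : F[X]) (m : ℕ) : f ^ (Nat.card F) ^ m = expand F ((Nat.card F) ^ m) f := by
  induction m with
  | zero => simp
  | succ m ih =>
    rw [pow_succ, pow_mul, ih, expand_mul, ← map_pow, Nat.card_eq_fintype_card, FiniteField.expand_card]

end

section
variable {F : Type} [Field F] [Finite F] {E : Type} [Field E] [Finite E] [Algebra F E]
  {V : Type} [AddCommGroup V] [Module E V] [Module F V] [IsScalarTower F E V] [Finite V]

lemma exists_pow_scalar (T : Module.End E V) (ξ : E) (hN : IsNilpotent (T - algebraMap E _ ξ)) :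
    ∃ m : ℕ, T ^ (Nat.card F) ^ m = algebraMap E (Module.End E V) ξ := by
  rcases subsingleton_or_nontrivial V with h | h
  · exact ⟨0, Subsingleton.elim _ _⟩
  obtain ⟨s, hs⟩ := hN
  obtain ⟨p, hp⟩ := CharP.exists E
  haveI := hp
  haveI : Fact p.Prime := ⟨CharP.char_is_prime E p⟩
  haveI : CharP (Module.End E V) p := charP_of_injective_algebraMap (algebraMap E (Module.End E V)).injective p
  haveI : CharP F p := (RingHom.charP_iff (algebraMap F E) (algebraMap F E).injective p).2 hp
  obtain ⟨e, _, he⟩ := FiniteField.card F p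
  rw [← Nat.card_eq_fintype_card] at he
  refine ⟨Module.finrank F E * s, ?_⟩
  have hq : Nat.card F ^ (Module.finrank F E * s) = p ^ ((e : ℕ) * (Module.finrank F E * s)) := by
    rw [he, ← pow_mul]
  have hle : s ≤ p ^ ((e : ℕ) * (Module.finrank F E * s)) := by
    have h1 : s ≤ (e : ℕ) * (Module.finrank F E * s) := by
      have := e.pos
      have := Module.finrank_pos (R := F) (M := E)
      nlinarith [Nat.le_mul_of_pos_left s this, Nat.le_mul_of_pos_left (Module.finrank F E * s) e.pos]
    exact h1.trans (Nat.lt_pow_self (Fact.out : p.Prime).one_lt).le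
  have hc : Commute T (algebraMap E (Module.End E V) ξ) := (Algebra.commutes ξ T).symm
  have h1 := sub_pow_char_pow_of_commute (p := p) (n := (e : ℕ) * (Module.finrank F E * s)) hc
  rw [pow_eq_zero_of_le hle hs, ← hq, eq_comm, sub_eq_zero, ← map_pow] at h1
  rw [h1, pow_mul, ← Module.natCard_eq_pow_finrank (K := F) (V := E), Nat.card_eq_fintype_card, FiniteField.pow_card_pow]

lemma smul_stab (T : Module.End E V) (ξ : E) (hN : IsNilpotent (T - algebraMap E _ ξ))
    (hξ : (minpoly F ξ).natDegree = Module.finrank F E)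
    (U : Submodule F V) (hU : ∀ x ∈ U, T x ∈ U) (c : E) : ∀ x ∈ U, c • x ∈ U := by
  obtain ⟨m, hm⟩ := exists_pow_scalar (F := F) T ξ hN
  have hpow : ∀ (j : ℕ), ∀ x ∈ U, (T ^ j) x ∈ U := by
    intro j
    induction j with
    | zero => intro x hx; simpa using hx
    | succ j ih => intro x hx; rw [pow_succ', Module.End.mul_apply]; exact hU _ (ih x hx)
  have hs : ∀ x ∈ U, ξ • x ∈ U := by
    intro x hx
    have := hpow (Nat.card F ^ m) x hx
    rw [hm] at this
    simpa using this
  have htop : IntermediateField.adjoin F {ξ} = ⊤ := by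
    have hIntg : IsIntegral F ξ := Algebra.IsIntegral.isIntegral ξ
    apply IntermediateField.eq_of_le_of_finrank_eq le_top
    rw [IntermediateField.adjoin.finrank hIntg, hξ, IntermediateField.finrank_top']
  have hc : c ∈ Algebra.adjoin F {ξ} := by
    have hIntg : IsIntegral F ξ := Algebra.IsIntegral.isIntegral ξ
    rw [← IntermediateField.adjoin_simple_toSubalgebra_of_isAlgebraic hIntg.isAlgebraic, htop]
    trivial
  induction hc using Algebra.adjoin_induction with
  | mem y hy => rw [Set.mem_singleton_iff.1 hy]; exact hs
  | algebraMap r => intro x hx; rw [algebraMap_smul]; exact U.smul_mem _ hx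
  | add y z _ _ hy hz => intro x hx; rw [add_smul]; exact U.add_mem (hy x hx) (hz x hx)
  | mul y z _ _ hy hz => intro x hx; rw [mul_smul]; exact hy _ (hz x hx)

lemma charpoly_restr (T : Module.End E V) (ξ : E) (hN : IsNilpotent (T - algebraMap E _ ξ)) :
    ∃ b, (T.restrictScalars F : Module.End F V).charpoly = minpoly F ξ ^ b := by
  obtain ⟨m, hm⟩ := exists_pow_scalar (F := F) T ξ hN
  have hIntg : IsIntegral F ξ := Algebra.IsIntegral.isIntegral ξ
  refine charpoly_of_pow _ (minpoly.irreducible hIntg) (minpoly.monic hIntg) _ ((Nat.card F) ^ m) ?_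
  rw [pow_expand, expand_aeval]
  have h1 : (T.restrictScalars F : Module.End F V) ^ (Nat.card F) ^ m = Algebra.lsmul F F V ξ := by
    ext x
    have h2 : ∀ j : ℕ, ((T.restrictScalars F : Module.End F V) ^ j) x = (T ^ j) x := by
      intro j
      induction j with
      | zero => simp
      | succ j ih => rw [pow_succ', pow_succ', Module.End.mul_apply, Module.End.mul_apply, ih]; rfl
    rw [h2, hm]; simp
  rw [h1, aeval_algHom_apply, minpoly.aeval, map_zero]

end

end
end MK

namespace MK
attribute [local instance] Fintype.ofFinite
attribute [local instance] Classical.propDecidable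
section
open Polynomial

lemma sum_sigma_block {r : ℕ} {β : Fin r → Type} [∀ j, Fintype (β j)] {R : Type} [Semiring R]
    (M : ∀ j, Matrix (β j) (β j) R) (v : (Σ j, β j) → R) (j : Fin r) (i : β j) :
    (Matrix.blockDiagonal' M).mulVec v ⟨j, i⟩ = ∑ i', M j i i' * v ⟨j, i'⟩ := by
  rw [Matrix.mulVec, dotProduct]
  have : (Finset.univ : Finset (Σ j, β j)) = Finset.univ.sigma fun _ => Finset.univ := by ext; simp
  rw [this, Finset.sum_sigma, Finset.sum_eq_single j]
  · refine Finset.sum_congr rfl fun i' _ => ?_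
    rw [Matrix.blockDiagonal'_apply_eq]
  · intro j' _ hj
    refine Finset.sum_eq_zero fun i' _ => ?_
    rw [Matrix.blockDiagonal'_apply_ne _ _ _ hj.symm, zero_mul]
  · simp

lemma scalar_apply {E : Type} [Field E] {r : ℕ} (ξ : E) (μ : Fin r → ℕ) (v : (Σ j : Fin r, Fin (μ j)) → E)
    (j : Fin r) (i : Fin (μ j)) :
    Matrix.mulVecLin (jordanPartitionScalar ξ μ) v ⟨j, i⟩ =
      ξ * v ⟨j, i⟩ + if h : (i : ℕ) + 1 < μ j then v ⟨j, ⟨(i : ℕ) + 1, h⟩⟩ else 0 := by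
  rw [Matrix.mulVecLin_apply, jordanPartitionScalar]
  have := sum_sigma_block (fun j => jordanBlockScalar ξ (μ j)) v j i
  refine Eq.trans ?_ (this.trans ?_)
  · congr!
  have h1 : ∀ i' : Fin (μ j), jordanBlockScalar ξ (μ j) i i' * v ⟨j, i'⟩ =
      (if i' = i then ξ * v ⟨j, i⟩ else 0) + (if (i : ℕ) + 1 = i' then v ⟨j, i'⟩ else 0) := by
    intro i'
    rw [jordanBlockScalar]
    by_cases h : i = i'
    · subst h; simp
    · by_cases h2 : (i : ℕ) + 1 = i'
      · simp [h, h2, Ne.symm h]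
      · simp [h, h2, Ne.symm h]
  simp only [h1]
  rw [Finset.sum_add_distrib, Finset.sum_ite_eq' Finset.univ i, if_pos (Finset.mem_univ _)]
  congr 1
  split_ifs with h
  · rw [Finset.sum_eq_single ⟨(i : ℕ) + 1, h⟩]
    · simp
    · intro i' _ hi
      rw [if_neg]
      intro h'; exact hi (Fin.ext h'.symm)
    · simp
  · refine Finset.sum_eq_zero fun i' _ => ?_
    rw [if_neg]
    intro h'; exact h (h' ▸ i'.2)

lemma scalar_nil {E : Type} [Field E] {r : ℕ} (ξ : E) (μ : Fin r → ℕ) :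
    IsNilpotent ((Matrix.mulVecLin (jordanPartitionScalar ξ μ) : Module.End E ((Σ j : Fin r, Fin (μ j)) → E))
      - algebraMap E _ ξ) := by
  set N := (Matrix.mulVecLin (jordanPartitionScalar ξ μ) : Module.End E ((Σ j : Fin r, Fin (μ j)) → E))
      - algebraMap E _ ξ with hN
  have h : ∀ (s : ℕ) (v : (Σ j : Fin r, Fin (μ j)) → E) (j : Fin r) (i : Fin (μ j)), μ j ≤ (i : ℕ) + s → (N ^ s) v ⟨j, i⟩ = 0 := by
    intro s v
    induction s with
    | zero => intro j i h; have := i.2; omega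
    | succ s ih =>
      intro j i h
      rw [pow_succ', Module.End.mul_apply, hN, LinearMap.sub_apply, Pi.sub_apply, scalar_apply]
      rw [Module.algebraMap_end_apply, Pi.smul_apply, smul_eq_mul, add_sub_cancel_left]
      split_ifs with h1
      · rw [← hN]; apply ih; simp only; omega
      · rfl
  refine ⟨∑ j, μ j, ?_⟩
  ext v p
  obtain ⟨j, i⟩ := p
  rw [LinearMap.comp_apply, h]
  · simp
  · have := Finset.single_le_sum (f := μ) (fun _ _ => Nat.zero_le _) (Finset.mem_univ j)
    omega

lemma block_apply {F : Type} [Field F] {r a : ℕ} (y : Matrix (Fin a) (Fin a) F) (μ : Fin r → ℕ)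
    (v : (Σ j : Fin r, Fin (μ j) × Fin a) → F)
    (j : Fin r) (i : Fin (μ j)) (c : Fin a) :
    Matrix.mulVec (jordanPartition y μ) v ⟨j, i, c⟩ =
      y.mulVec (fun c => v ⟨j, i, c⟩) c + if h : (i : ℕ) + 1 < μ j then v ⟨j, ⟨(i : ℕ) + 1, h⟩, c⟩ else 0 := by
  rw [jordanPartition]
  have := sum_sigma_block (fun j => jordanBlock y (μ j)) v j (i, c)
  refine Eq.trans ?_ (this.trans ?_)
  · congr!
  rw [Fintype.sum_prod_type]
  have h1 : ∀ (i' : Fin (μ j)) (c' : Fin a), jordanBlock y (μ j) (i, c) (i', c') * v ⟨j, i', c'⟩ =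
      (if i' = i then y c c' * v ⟨j, i, c'⟩ else 0) + (if (i : ℕ) + 1 = i' then (if c' = c then v ⟨j, i', c⟩ else 0) else 0) := by
    intro i' c'
    rw [jordanBlock]
    by_cases h : i = i'
    · subst h; simp
    · by_cases h2 : (i : ℕ) + 1 = i'
      · by_cases h3 : c = c'
        · subst h3
          simp [h, h2, Ne.symm h]
        · simp [h, h2, Ne.symm h, h3, Ne.symm h3]
      · simp [h, h2, Ne.symm h]
  simp only [h1, Finset.sum_add_distrib]
  congr 1
  · rw [Finset.sum_eq_single i]
    · simp [Matrix.mulVec, dotProduct]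
    · intro i' _ hi; simp [hi]
    · simp
  split_ifs with h
  · rw [Finset.sum_eq_single ⟨(i : ℕ) + 1, h⟩]
    · simp
    · intro i' _ hi
      refine Finset.sum_eq_zero fun c' _ => ?_
      rw [if_neg]
      intro h'; exact hi (Fin.ext h'.symm)
    · simp
  · refine Finset.sum_eq_zero fun i' _ => Finset.sum_eq_zero fun c' _ => ?_
    rw [if_neg]
    intro h'; exact h (h' ▸ i'.2)

lemma jordan_conj {F : Type} [Field F] {r a : ℕ} (y : Matrix (Fin a) (Fin a) F) (μ : Fin r → ℕ)
    {E : Type} [Field E] [Algebra F E] (ξ : E) (A : (Fin a → F) ≃ₗ[F] E)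
    (hA : ∀ w, A (y.mulVec w) = ξ * A w) :
    ∃ e : ((Σ j : Fin r, Fin (μ j) × Fin a) → F) ≃ₗ[F] ((Σ j : Fin r, Fin (μ j)) → E),
      ∀ v, e (Matrix.mulVec (jordanPartition y μ) v) = Matrix.mulVecLin (jordanPartitionScalar ξ μ) (e v) := by
  let e : ((Σ j : Fin r, Fin (μ j) × Fin a) → F) ≃ₗ[F] ((Σ j : Fin r, Fin (μ j)) → E) :=
    { toFun := fun v p => A fun c => v ⟨p.1, p.2, c⟩
      map_add' := fun v w => by ext p; exact map_add A (fun c => v ⟨p.1, p.2, c⟩) (fun c => w ⟨p.1, p.2, c⟩)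
      map_smul' := fun t v => by ext p; exact map_smul A t (fun c => v ⟨p.1, p.2, c⟩)
      invFun := fun w p => A.symm (w ⟨p.1, p.2.1⟩) p.2.2
      left_inv := fun v => by ext p; simp
      right_inv := fun w => by ext p; simp }
  have he : ∀ v j i, e v ⟨j, i⟩ = A fun c => v ⟨j, i, c⟩ := fun _ _ _ => rfl
  refine ⟨e, fun v => ?_⟩
  ext ⟨j, i⟩
  rw [scalar_apply, he, he, ← hA]
  have : (fun c => Matrix.mulVec (jordanPartition y μ) v ⟨j, i, c⟩) = y.mulVec (fun c => v ⟨j, i, c⟩) +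
      if h : (i : ℕ) + 1 < μ j then (fun c => v ⟨j, ⟨(i : ℕ) + 1, h⟩, c⟩) else 0 := by
    ext c
    rw [block_apply, Pi.add_apply]
    split_ifs <;> rfl
  rw [this, map_add]
  congr 1
  split_ifs with h
  · rw [he]
  · exact map_zero A

end
end MK

/-- for `n = ab`, a regular elliptic `x ∈ GL_a(F)` with root `ξ` of its
characteristic polynomial in a degree-`a` extension `E`, a partition `μ ⊢ b`, and
`ω₁,…,ω_k` the roots of the twisted Kloosterman sheaf at `ξ` (characterized by
`Σ ωᵢ^m = (-1)^(k-1) K_{E_m}(α,ψ,ξ_m)` for all `m ≥ 1`), we have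
`K(α,ψ,J_μ(x)) = (-1)^((k-1)n) q^((k-1)n(n-1)/2) Σ_{d₁+⋯+d_k=b} N_d(J_μ(ξ)) ω₁^{d₁}⋯ω_k^{d_k}`. -/
theorem matrix_kloosterman_jordan_hall_littlewood
    {F : Type} [Field F] [Fintype F] [DecidableEq F]
    (ψ : AddChar F ℂ) (hψ : ∃ a : F, ψ a ≠ 1)
    {k : ℕ} (hk : 1 ≤ k) (α : Fin k → Fˣ →* ℂˣ)
    {n a b : ℕ} (hn : n = a * b)
    (x : (Matrix (Fin a) (Fin a) F)ˣ)
    (hx : Irreducible (Matrix.charpoly (x : Matrix (Fin a) (Fin a) F)))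
    (E : Type) [Field E] [Fintype E] [DecidableEq E] [Algebra F E]
    (hE : Module.finrank F E = a)
    (ξ : E)
    (hξ : Polynomial.aeval ξ (Matrix.charpoly (x : Matrix (Fin a) (Fin a) F)) = 0)
    {r : ℕ} (μ : Fin r → ℕ) (hμpos : ∀ j, 0 < μ j) (hμanti : Antitone μ)
    (hμsum : ∑ j, μ j = b)
    (Em : ℕ → Type) [∀ m, Field (Em m)] [∀ m, Fintype (Em m)] [∀ m, DecidableEq (Em m)]
    [∀ m, Algebra F (Em m)] [∀ m, Algebra E (Em m)] [∀ m, IsScalarTower F E (Em m)]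
    (hEm : ∀ m, 1 ≤ m → Module.finrank E (Em m) = m)
    (ω : Fin k → ℂ)
    (hω : ∀ m, 1 ≤ m →
      (∑ i, ω i ^ m) = (-1 : ℂ) ^ (k - 1) *
        fieldKloosterman α ψ (Em m) (algebraMap E (Em m) ξ)) :
    matrixKloosterman α ψ (jordanPartition (x : Matrix (Fin a) (Fin a) F) μ)
    = (-1 : ℂ) ^ ((k - 1) * n) *
        (Fintype.card F : ℂ) ^ ((k - 1) * (n * (n - 1) / 2)) *
        ∑ d ∈ Finset.Nat.antidiagonalTuple k b,
          (flagCount (Matrix.mulVecLin (jordanPartitionScalar ξ μ)) d : ℂ) *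
            ∏ i, ω i ^ d i := by

  classical
  have hfm : (Matrix.charpoly (x : Matrix (Fin a) (Fin a) F)).Monic := Matrix.charpoly_monic _
  have hfmin : Matrix.charpoly (x : Matrix (Fin a) (Fin a) F) = minpoly F ξ :=
    minpoly.eq_of_irreducible_of_monic hx hξ hfm
  have hdeg : (minpoly F ξ).natDegree = a := by
    rw [← hfmin, Matrix.charpoly_natDegree_eq_dim, Fintype.card_fin]
  have ha : 0 < a := by rw [← hE]; exact Module.finrank_pos
  have h0 : ξ ≠ 0 := by
    rintro rfl
    have h1 : (Matrix.charpoly (x : Matrix (Fin a) (Fin a) F)).coeff 0 = 0 := by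
      rw [← Polynomial.coeff_zero_eq_aeval_zero'] at hξ
      exact (map_eq_zero_iff _ (algebraMap F E).injective).1 hξ
    have h2 := Matrix.det_eq_sign_charpoly_coeff (x : Matrix (Fin a) (Fin a) F)
    rw [h1, mul_zero] at h2
    have h3 : IsUnit (x : Matrix (Fin a) (Fin a) F).det := (Matrix.isUnit_iff_isUnit_det _).1 x.isUnit
    rw [h2] at h3
    exact not_isUnit_zero h3
  -- the conjugation between the matrix `x` and multiplication by `ξ`
  obtain ⟨A, hA⟩ := MK.conj_of_annih _ hx (Matrix.toLin' (x : Matrix (Fin a) (Fin a) F)) (Algebra.lmul F E ξ)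
    (by
      rw [← Matrix.charpoly_toLin']
      exact LinearMap.aeval_self_charpoly _)
    (by rw [Polynomial.aeval_algHom_apply, hξ, map_zero])
    (by rw [Module.finrank_fintype_fun_eq_card, Fintype.card_fin, hE])
  obtain ⟨e, he⟩ := MK.jordan_conj (x : Matrix (Fin a) (Fin a) F) μ ξ A (fun w => by
    have := hA w
    rw [Matrix.toLin'_apply] at this
    exact this)
  obtain ⟨T, hT⟩ : ∃ T, T = Matrix.mulVecLin (jordanPartitionScalar ξ μ) := ⟨_, rfl⟩
  have he' : ∀ v, e (Matrix.toLin' (jordanPartition (x : Matrix (Fin a) (Fin a) F) μ) v) = T (e v) := by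
    intro v
    rw [Matrix.toLin'_apply, hT]
    convert he v
  have hN : IsNilpotent ((T : Module.End E ((Σ j : Fin r, Fin (μ j)) → E)) - algebraMap E _ ξ) := by
    rw [hT]
    convert MK.scalar_nil ξ μ
  rw [← hT]
  set L : List (MulChar F ℂ) := List.ofFn fun i => MulChar.ofUnitHom (α i) with hL
  have hLl : L.length = k := List.length_ofFn
  let g : Module.End F ((Σ j : Fin r, Fin (μ j)) → E) := T.restrictScalars F
  have hKK : matrixKloosterman α ψ (jordanPartition (x : Matrix (Fin a) (Fin a) F) μ) = MK.KK ψ L _ g := by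
    rw [MK.matrixKloosterman_KK]
    exact MK.KK_inv ψ L _ _ e _ g he'
  have hfrE : Module.finrank E ((Σ j : Fin r, Fin (μ j)) → E) = b := by
    rw [Module.finrank_fintype_fun_eq_card, Fintype.card_sigma]
    simp [hμsum]
  have hfrF : Module.finrank F ((Σ j : Fin r, Fin (μ j)) → E) = n := by
    rw [← Module.finrank_mul_finrank F E, hfrE, hE, hn]
  obtain ⟨c, hc⟩ := MK.charpoly_restr (F := F) T ξ hN
  obtain ⟨K, iK1, iK2, iK3, iK4, iK5, hgood, hdvd⟩ := MK.exists_good F E n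
  have hminK : minpoly F (algebraMap E K ξ) = minpoly F ξ :=
    minpoly.algebraMap_eq (algebraMap E K).injective ξ
  choose ν hν using fun i => IsAlgClosed.exists_pow_nat_eq (ω i) ha
  have hkap : MK.kap ψ L _ g = MK.VF k ν _ g := by
    refine MK.main_abs (algebraMap E K ξ) ?_ n hgood ψ hψ L k hk hLl ν ?_ n _ hfrF le_rfl g c ?_
    · exact (map_ne_zero_iff _ (algebraMap E K).injective).2 h0
    · intro m hm hmn
      rw [hminK, hdeg] at hmn ⊢
      have h1 : m ∣ Module.finrank E K := hdvd m hm (le_trans (Nat.le_mul_of_pos_left m ha) hmn)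
      obtain ⟨j⟩ := FiniteField.nonempty_algHom_of_finrank_dvd (F := E) (K := Em m) (L := K) (by rw [hEm m hm]; exact h1)
      have h2 := MK.fieldKloosterman_Kf K α ψ (Em m) (j.restrictScalars F) (a * m)
        (by rw [← Module.finrank_mul_finrank F E, hE, hEm m hm]) (algebraMap E (Em m) ξ)
      have h3 : (j.restrictScalars F) (algebraMap E (Em m) ξ) = algebraMap E K ξ := j.commutes ξ
      rw [h3] at h2
      rw [hL, ← h2, ← hω m hm]
      refine Finset.sum_congr rfl fun i _ => ?_
      rw [pow_mul, hν]
    · rw [hminK]; exact hc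
  have hVF : MK.VF k ν _ g = ∑ d ∈ Finset.Nat.antidiagonalTuple k b, (flagCount T d : ℂ) * ∏ i, ω i ^ d i := by
    rw [MK.VF_top]
    have h1 := MK.RF_E (F := F) (E := E) (T : ((Σ j : Fin r, Fin (μ j)) → E) → ((Σ j : Fin r, Fin (μ j)) → E))
      (fun U hU => MK.smul_stab T ξ hN (hdeg.trans hE.symm) U hU) k ν ⊤
    rw [hE] at h1
    simp only [hν] at h1
    rw [← MK.RF_flag hk T ω b hfrE, ← h1]
    rfl
  rw [← hVF, ← hkap, hKK, MK.kap, hfrF, hLl, MK.nrm, ← Nat.choose_two_right, Nat.card_eq_fintype_card]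
  have hq : (Fintype.card F : ℂ) ≠ 0 := Nat.cast_ne_zero.2 Fintype.card_ne_zero
  rw [mul_comm (k - 1) n, mul_comm (k - 1) (n.choose 2), pow_mul, pow_mul, ← mul_assoc, ← mul_pow, ← mul_pow]
  have h1 : (-1 : ℂ) ^ n * (Fintype.card F : ℂ) ^ n.choose 2 * ((-1) ^ n / (Fintype.card F : ℂ) ^ n.choose 2) = 1 := by
    have h5 : ((-1 : ℂ) ^ n) * (-1) ^ n = 1 := by rw [← mul_pow]; simp
    field_simp
    rw [sq]
    exact h5
  rw [h1, one_pow, one_mul]
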